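/- Fix d ∈ ℕ+. There exist D ∈ ℕ and real constants C, κ, η > 0 (depending only on d) such that for every n ∈ ℕ+, all a, b ∈ ℕ+ with gcd(n, ab) = 1, and every smooth compactly supported function F : 𝕋 × X → ℂ, one has | φ(n)⁻¹ · Σ_{k ∈ (ℤ/nℤ)ˣ} F( a k^d / n mod ℤ , SL₂(ℤ) u_{b k^d / n} a_{√n}⁻¹ ) − ∫_{𝕋×X} F d(m ⊗ μ_X) | ≤ C (ab)^η n^{−κ} S_D(F). Here the summand is evaluated at any integer representative of k (it is independent of the choice), and the average over k ∈ (ℤ/nℤ)ˣ equals the average over the finite point set 𝒫^{×d}(n;a,b) = {(a k^d/n mod ℤ, SL₂(ℤ) u_{b k^d/n} a_{√n}⁻¹) : gcd(k,n) = 1}, because all fibres of k ↦ k^d on (ℤ/nℤ)ˣ have the same cardinality. -/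

import Mathlib

/-!
Effective equidistribution of the points `SL₂(ℤ) u_{b k^d / n} a_{√n}⁻¹`, `k ∈ (ℤ/nℤ)ˣ`,
in the modular surface `X = SL₂(ℤ)\SL₂(ℝ)` (Corollary 1.2 of
"Primitive rational points on expanding horocycles ...").
-/

noncomputable section
open MeasureTheory Matrix

abbrev SL2R := Matrix.SpecialLinearGroup (Fin 2) ℝ

instance : TopologicalSpace SL2R :=
  inferInstanceAs (TopologicalSpace {A : Matrix (Fin 2) (Fin 2) ℝ // A.det = 1})

instance : MeasurableSpace (Matrix (Fin 2) (Fin 2) ℝ) :=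
  inferInstanceAs (MeasurableSpace ((Fin 2) → (Fin 2) → ℝ))

instance : MeasurableSpace SL2R :=
  inferInstanceAs (MeasurableSpace {A : Matrix (Fin 2) (Fin 2) ℝ // A.det = 1})

/-- The upper-triangular unipotent `u t = [[1, t], [0, 1]]`. -/
def uElt (t : ℝ) : SL2R := ⟨!![1, t; 0, 1], by simp [Matrix.det_fin_two_of]⟩

/-- The lower-triangular unipotent `v t = [[1, 0], [t, 1]]`. -/
def vElt (t : ℝ) : SL2R := ⟨!![1, 0; t, 1], by simp [Matrix.det_fin_two_of]⟩

/-- The diagonal element `a y = [[y, 0], [0, y⁻¹]]` (junk value `1` for `y = 0`). -/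
def aElt (y : ℝ) : SL2R :=
  if h : y = 0 then 1 else ⟨!![y, 0; 0, y⁻¹], by simp [Matrix.det_fin_two_of, mul_inv_cancel₀ h]⟩

/-- The one-parameter subgroup `exp (s H₀) = [[e^{-s}, 0], [0, e^s]]` for `H₀ = [[-1,0],[0,1]]`. -/
def hElt (s : ℝ) : SL2R :=
  ⟨!![Real.exp (-s), 0; 0, Real.exp s], by simp [Matrix.det_fin_two_of, ← Real.exp_add]⟩

/-- The one-parameter subgroups generated by the basis `H₀, E₀, F₀` of `𝔰𝔩₂(ℝ)`. -/
def oneParam : Fin 3 → ℝ → SL2R := ![hElt, uElt, vElt]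

/-- The space of right cosets `Γ g` of a subgroup `Γ ≤ SL₂(ℝ)`. -/
abbrev XQuot (Γ : Subgroup SL2R) := Quotient (QuotientGroup.rightRel Γ)

/-- The projection `SL₂(ℝ) → Γ\SL₂(ℝ)`. -/
def XProj (Γ : Subgroup SL2R) (g : SL2R) : XQuot Γ := Quotient.mk _ g

/-- Right translation by `g` on the space of right cosets. -/
def rightT (Γ : Subgroup SL2R) (g : SL2R) : XQuot Γ → XQuot Γ :=
  Quotient.map (· * g) (by
    intro a b hab
    have h := QuotientGroup.rightRel_apply.mp hab
    exact QuotientGroup.rightRel_apply.mpr (by simpa [mul_assoc] using h))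

/-- Maximum of the absolute values of the entries of a real `2×2` matrix. -/
def matSup (A : Matrix (Fin 2) (Fin 2) ℝ) : ℝ :=
  max (max |A 0 0| |A 0 1|) (max |A 1 0| |A 1 1|)

/-- The height function `ht (Γ g) = sup {‖g⁻¹ w g‖⁻¹ : w ∈ M₂(ℤ), tr w = 0, w ≠ 0}`. -/
def htX (Γ : Subgroup SL2R) (x : XQuot Γ) : ℝ :=
  sSup {r : ℝ | ∃ w : Matrix (Fin 2) (Fin 2) ℤ, w ≠ 0 ∧ w.trace = 0 ∧
    r = (matSup (((x.out⁻¹ : SL2R) : Matrix (Fin 2) (Fin 2) ℝ) *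
      (w.map (Int.cast : ℤ → ℝ)) * ((x.out : SL2R) : Matrix (Fin 2) (Fin 2) ℝ)))⁻¹}

/-- The Lie derivative of `f` in the direction of the `i`-th basis element:
`(D_Z f) g = (d/ds)|₀ f (g · exp (s Z))`. -/
def lieDeriv (i : Fin 3) (f : SL2R → ℂ) : SL2R → ℂ :=
  fun g => deriv (fun s : ℝ => f (g * oneParam i s)) 0

/-- Iterated Lie derivatives along a word in the basis directions. -/
def wordDeriv : List (Fin 3) → (SL2R → ℂ) → SL2R → ℂ
  | [], f => f
  | i :: w, f => lieDeriv i (wordDeriv w f)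

/-- A (left-`Γ`-invariant) function on `SL₂(ℝ)` is smooth if all its iterated Lie
derivatives exist and are continuous. -/
def IsSmoothSL (f : SL2R → ℂ) : Prop :=
  ∀ w : List (Fin 3),
    Continuous (wordDeriv w f) ∧
    ∀ i : Fin 3, ∀ g : SL2R,
      DifferentiableAt ℝ (fun s : ℝ => wordDeriv w f (g * oneParam i s)) 0

/-- The lift to `SL₂(ℝ)` of a function on `Γ\SL₂(ℝ)`. -/
def liftX (Γ : Subgroup SL2R) (f : XQuot Γ → ℂ) : SL2R → ℂ := fun g => f (XProj Γ g)

/-- The degree-`D` `L²`-Sobolev norm of a function on `Γ\SL₂(ℝ)` with respect to the basis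
`H₀, E₀, F₀`, summing over all monomials of degree at most `D`. -/
def sobX (Γ : Subgroup SL2R) (μ : Measure (XQuot Γ)) (D : ℕ) (f : XQuot Γ → ℂ) : ℝ :=
  Real.sqrt (∑ l ∈ Finset.range (D + 1), ∑ w : Fin l → Fin 3,
    ∫ x : XQuot Γ, (1 + htX Γ x) ^ (2 * D) *
      ‖wordDeriv (List.ofFn w) (liftX Γ f) x.out‖ ^ 2 ∂μ)

/-- `SL₂(ℤ)`, embedded entrywise as a subgroup of `SL₂(ℝ)`. -/
def Γℤ : Subgroup SL2R := (Matrix.SpecialLinearGroup.map (Int.castRingHom ℝ)).range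


/-- The unit circle `𝕋 = ℝ/ℤ`. -/
abbrev T1 := AddCircle (1 : ℝ)

/-- The canonical representative in `[0,1)` of a point of `𝕋 = ℝ/ℤ`. -/
def torusRep (t : T1) : ℝ := ((AddCircle.equivIco 1 0) t : ℝ)

/-- The lift to `ℝ × SL₂(ℝ)` of a function on `𝕋 × Γ\SL₂(ℝ)`. -/
def liftTX (Γ : Subgroup SL2R) (F : T1 × XQuot Γ → ℂ) : ℝ × SL2R → ℂ :=
  fun p => F ((p.1 : T1), XProj Γ p.2)

/-- The four basic differential operators on functions on `ℝ × SL₂(ℝ)`: the derivative in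
the torus variable, and the Lie derivatives `D_{H₀}, D_{E₀}, D_{F₀}` in the group variable. -/
def pOp (i : Fin 4) (G : ℝ × SL2R → ℂ) : ℝ × SL2R → ℂ :=
  if i = 0 then fun p => deriv (fun s : ℝ => G (s, p.2)) p.1
  else if i = 1 then fun p => deriv (fun s : ℝ => G (p.1, p.2 * hElt s)) 0
  else if i = 2 then fun p => deriv (fun s : ℝ => G (p.1, p.2 * uElt s)) 0
  else fun p => deriv (fun s : ℝ => G (p.1, p.2 * vElt s)) 0

/-- Iterated application of the four basic operators along a word. -/
def wordOp : List (Fin 4) → (ℝ × SL2R → ℂ) → ℝ × SL2R → ℂ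
  | [], G => G
  | i :: w, G => pOp i (wordOp w G)

/-- A (`ℤ`-periodic, left-`Γ`-invariant) function on `ℝ × SL₂(ℝ)` is smooth if all its
iterated derivatives by the four basic operators exist and are continuous. -/
def IsSmoothTX (G : ℝ × SL2R → ℂ) : Prop :=
  ∀ w : List (Fin 4),
    Continuous (wordOp w G) ∧
    (∀ p : ℝ × SL2R, DifferentiableAt ℝ (fun s : ℝ => wordOp w G (s, p.2)) p.1) ∧
    (∀ i : Fin 3, ∀ p : ℝ × SL2R,
      DifferentiableAt ℝ (fun s : ℝ => wordOp w G (p.1, p.2 * oneParam i s)) 0)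

/-- The degree-`D` `L²`-Sobolev norm of a function on `𝕋 × Γ\SL₂(ℝ)`:
`S_D(F)² = ∑_W ∫ (1+ht(x))^{2D} |W F(t,x)|² dm(t) dμ(x)`, the sum running over all
monomials `W` of degree at most `D` in the four basic operators. -/
def sobTX (Γ : Subgroup SL2R) (μ : Measure (XQuot Γ)) (D : ℕ) (F : T1 × XQuot Γ → ℂ) : ℝ :=
  Real.sqrt (∑ l ∈ Finset.range (D + 1), ∑ w : Fin l → Fin 4,
    ∫ q : T1 × XQuot Γ,
      (1 + htX Γ q.2) ^ (2 * D) *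
        ‖wordOp (List.ofFn w) (liftTX Γ F) (torusRep q.1, q.2.out)‖ ^ 2
      ∂((volume : Measure T1).prod μ))

/-! ### Kloosterman sums to composite moduli -/

lemma card_annihilator_le (c : ℕ) [NeZero c] (m : ℤ) :
    (Finset.univ.filter fun v : ZMod c => (m : ZMod c) * v = 0).card ≤ Int.gcd m c := by
  have hpos : 0 < Int.gcd m c :=
    Int.gcd_pos_of_ne_zero_right _ (by exact_mod_cast NeZero.ne c)
  refine le_trans (Finset.card_le_card ?_)
    (IsAddCyclic.card_nsmul_eq_zero_le (α := ZMod c) hpos)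
  intro v hv
  simp only [Finset.mem_filter, Finset.mem_univ, true_and] at hv ⊢
  have h := Int.gcd_eq_gcd_ab m c
  have h2 : ((Int.gcd m c : ℤ) : ZMod c) = (m : ZMod c) * (Int.gcdA m c : ZMod c) := by
    rw [h]; push_cast; simp
  rw [nsmul_eq_mul]
  have : ((Int.gcd m c : ℕ) : ZMod c) = ((Int.gcd m c : ℤ) : ZMod c) := by norm_cast
  rw [this, h2, mul_right_comm, hv, zero_mul]

lemma sum_gcd_le (c : ℕ) [NeZero c] :
    (Finset.univ.filter fun p : ZMod c × ZMod c => p.1 * p.2 = 0).card ≤ c * c.divisors.card := by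
  have hc : c ≠ 0 := NeZero.ne c
  have h1 : (Finset.univ.filter fun p : ZMod c × ZMod c => p.1 * p.2 = 0).card
      = ∑ u : ZMod c, (Finset.univ.filter fun v : ZMod c => u * v = 0).card := by
    rw [Finset.card_filter, ← Finset.univ_product_univ, Finset.sum_product]
    simp only [Finset.card_filter]
  rw [h1]
  have h2 : ∀ u : ZMod c, (Finset.univ.filter fun v : ZMod c => u * v = 0).card
      ≤ ∑ δ ∈ c.divisors, if δ ∣ u.val then δ else 0 := by
    intro u
    have := card_annihilator_le c (u.val : ℤ)
    rw [show ((u.val : ℤ) : ZMod c) = u by simp] at this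
    refine this.trans ?_
    have hg : Int.gcd (u.val : ℤ) c = Nat.gcd u.val c := rfl
    rw [hg]
    refine le_trans (le_of_eq ?_) (Finset.single_le_sum
      (f := fun δ => if δ ∣ u.val then δ else 0) (fun _ _ => Nat.zero_le _)
      (Nat.mem_divisors.mpr ⟨Nat.gcd_dvd_right u.val c, hc⟩))
    simp [Nat.gcd_dvd_left]
  refine (Finset.sum_le_sum fun u _ => h2 u).trans ?_
  rw [Finset.sum_comm]
  have h3 : ∀ δ ∈ c.divisors, (∑ u : ZMod c, if δ ∣ u.val then δ else 0) ≤ c := by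
    intro δ hδ
    obtain ⟨hd, -⟩ := Nat.mem_divisors.mp hδ
    obtain ⟨e, rfl⟩ := hd
    have hδ0 : 0 < δ := Nat.pos_of_ne_zero (by rintro rfl; simp at hc)
    rw [← Finset.sum_filter, Finset.sum_const, smul_eq_mul, mul_comm]
    refine Nat.mul_le_mul_left _ ?_
    have : (Finset.univ.filter fun u : ZMod (δ * e) => δ ∣ u.val).card
        ≤ (Finset.range e).card := by
      refine Finset.card_le_card_of_injOn (fun u => u.val / δ) ?_ ?_
      · intro u _
        simp only [Finset.coe_range, Set.mem_Iio]
        exact Nat.div_lt_of_lt_mul (ZMod.val_lt u)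
      · intro u hu v hv huv
        simp only [Finset.coe_filter, Finset.mem_univ, true_and, Set.mem_ofPred_eq] at hu hv
        have : u.val = v.val := by
          rw [← Nat.div_mul_cancel hu, ← Nat.div_mul_cancel hv]
          exact congrArg (· * δ) huv
        exact ZMod.val_injective _ this
    simpa using this
  refine (Finset.sum_le_sum h3).trans ?_
  simp [mul_comm]

lemma card_triple_zero_le (c : ℕ) [NeZero c] :
    (Finset.univ.filter fun p : ZMod c × ZMod c × ZMod c => p.1 * p.2.1 * p.2.2 = 0).card
      ≤ (c * c.divisors.card) ^ 2 := by
  classical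
  have key : ∀ s u : ZMod c, (Finset.univ.filter fun v : ZMod c => s * u * v = 0).card
      ≤ (Finset.univ.filter fun v : ZMod c => s * v = 0).card *
        (Finset.univ.filter fun v : ZMod c => u * v = 0).card := by
    intro s u
    rw [mul_comm (Finset.card _)]
    refine Finset.card_le_mul_card_image_of_maps_to (f := fun v => u * v) ?_ _ ?_
    · intro v hv
      simp only [Finset.mem_filter, Finset.mem_univ, true_and] at hv ⊢
      rw [← mul_assoc]; exact hv
    · intro w _
      by_cases hne : ((Finset.univ.filter fun v : ZMod c => s * u * v = 0).filter
          fun v => u * v = w).Nonempty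
      · obtain ⟨v0, hv0⟩ := hne
        simp only [Finset.mem_filter, Finset.mem_univ, true_and] at hv0
        refine Finset.card_le_card_of_injOn (fun v => v - v0) ?_ ?_
        · intro v hv
          simp only [Finset.coe_filter, Finset.mem_filter, Finset.mem_univ, true_and,
            Set.mem_ofPred_eq] at hv ⊢
          rw [mul_sub, hv.2, hv0.2, sub_self]
        · intro a _ b _ hab; simpa using hab
      · rw [Finset.not_nonempty_iff_eq_empty.mp hne]; simp
  have e1 : (Finset.univ.filter fun p : ZMod c × ZMod c × ZMod c => p.1 * p.2.1 * p.2.2 = 0).card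
      = ∑ s : ZMod c, ∑ u : ZMod c,
        (Finset.univ.filter fun v : ZMod c => s * u * v = 0).card := by
    rw [Finset.card_filter, ← Finset.univ_product_univ, Finset.sum_product]
    refine Finset.sum_congr rfl fun s _ => ?_
    rw [← Finset.univ_product_univ, Finset.sum_product]
    simp only [Finset.card_filter]
  have e2 : (Finset.univ.filter fun p : ZMod c × ZMod c => p.1 * p.2 = 0).card
      = ∑ u : ZMod c, (Finset.univ.filter fun v : ZMod c => u * v = 0).card := by
    rw [Finset.card_filter, ← Finset.univ_product_univ, Finset.sum_product]
    simp only [Finset.card_filter]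
  rw [e1]
  calc _ ≤ ∑ s : ZMod c, ∑ u : ZMod c,
        (Finset.univ.filter fun v : ZMod c => s * v = 0).card *
        (Finset.univ.filter fun v : ZMod c => u * v = 0).card :=
        Finset.sum_le_sum fun s _ => Finset.sum_le_sum fun u _ => key s u
    _ = ((Finset.univ.filter fun p : ZMod c × ZMod c => p.1 * p.2 = 0).card) ^ 2 := by
        rw [e2, sq, Finset.sum_mul_sum]
    _ ≤ _ := Nat.pow_le_pow_left (sum_gcd_le c) 2

/-- The quadruples of units counted by the fourth moment of Kloosterman sums. -/
def klQuads (c : ℕ) [NeZero c] : Finset ((ZMod c)ˣ × (ZMod c)ˣ × (ZMod c)ˣ × (ZMod c)ˣ) :=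
  Finset.univ.filter fun x =>
    (x.1 : ZMod c) + x.2.1 - x.2.2.1 - x.2.2.2 = 0 ∧
    ((x.1⁻¹ : (ZMod c)ˣ) : ZMod c) + (x.2.1⁻¹ : (ZMod c)ˣ) - (x.2.2.1⁻¹ : (ZMod c)ˣ)
      - (x.2.2.2⁻¹ : (ZMod c)ˣ) = 0

lemma card_klQuads_le (c : ℕ) [NeZero c] :
    (klQuads c).card ≤ 2 * (c * c.divisors.card) ^ 2 := by
  classical
  refine le_trans ?_ (Nat.mul_le_mul_left 2 (card_triple_zero_le c))
  refine Finset.card_le_mul_card_image_of_maps_to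
    (f := fun x => ((x.1 : ZMod c) + x.2.1, (x.2.2.1 : ZMod c) - x.1, (x.2.1 : ZMod c) - x.2.2.1))
    ?_ 2 ?_
  · rintro ⟨x1, x2, x3, x4⟩ h
    simp only [klQuads, Finset.mem_filter, Finset.mem_univ, true_and] at h ⊢
    obtain ⟨h1, h2⟩ := h
    have a1 : (x1 : ZMod c) * (x1⁻¹ : (ZMod c)ˣ) = 1 := x1.mul_inv
    have a2 : (x2 : ZMod c) * (x2⁻¹ : (ZMod c)ˣ) = 1 := x2.mul_inv
    have a3 : (x3 : ZMod c) * (x3⁻¹ : (ZMod c)ˣ) = 1 := x3.mul_inv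
    have a4 : (x4 : ZMod c) * (x4⁻¹ : (ZMod c)ˣ) = 1 := x4.mul_inv
    generalize ((x1⁻¹ : (ZMod c)ˣ) : ZMod c) = y1 at *
    generalize ((x2⁻¹ : (ZMod c)ˣ) : ZMod c) = y2 at *
    generalize ((x3⁻¹ : (ZMod c)ˣ) : ZMod c) = y3 at *
    generalize ((x4⁻¹ : (ZMod c)ˣ) : ZMod c) = y4 at *
    generalize (x1 : ZMod c) = z1 at *
    generalize (x2 : ZMod c) = z2 at *
    generalize (x3 : ZMod c) = z3 at *
    generalize (x4 : ZMod c) = z4 at *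
    have e4 : z4 = z1 + z2 - z3 := by linear_combination -h1
    have h3 : z2 * z3 * z4 + z1 * z3 * z4 - z1 * z2 * z4 - z1 * z2 * z3 = 0 := by
      linear_combination z1 * z2 * z3 * z4 * h2 - z2 * z3 * z4 * a1 - z1 * z3 * z4 * a2
        + z1 * z2 * z4 * a3 + z1 * z2 * z3 * a4
    subst e4
    linear_combination h3
  · rintro ⟨s, u, v⟩ _
    by_cases hne : ((klQuads c).filter fun x => ((x.1 : ZMod c) + x.2.1,
        (x.2.2.1 : ZMod c) - x.1, (x.2.1 : ZMod c) - x.2.2.1) = (s, u, v)).Nonempty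
    · obtain ⟨x0, hx0⟩ := hne
      have h2 : (Finset.univ.filter fun v : ZMod c => (2 : ℕ) • v = 0).card ≤ 2 :=
        IsAddCyclic.card_nsmul_eq_zero_le (α := ZMod c) two_pos
      refine le_trans (Finset.card_le_card_of_injOn
        (fun x => (x.1 : ZMod c) - x0.1) ?_ ?_) h2
      · intro x hx
        simp only [Finset.coe_filter, Set.mem_ofPred_eq, Prod.mk.injEq, Finset.mem_filter,
          klQuads, Finset.mem_univ, true_and] at hx hx0 ⊢
        obtain ⟨-, b1, b2, b3⟩ := hx
        obtain ⟨-, d1, d2, d3⟩ := hx0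
        rw [nsmul_eq_mul]; push_cast
        linear_combination b1 - b2 - b3 - d1 + d2 + d3
      · intro x hx y hy hxy
        simp only [Finset.coe_filter, Set.mem_ofPred_eq, Prod.mk.injEq, Finset.mem_filter,
          klQuads, Finset.mem_univ, true_and] at hx hy hxy
        have e1 : (x.1 : ZMod c) = y.1 := by simpa using hxy
        obtain ⟨⟨b0, -⟩, b1, b2, b3⟩ := hx
        obtain ⟨⟨d0, -⟩, d1, d2, d3⟩ := hy
        have e2 : (x.2.1 : ZMod c) = y.2.1 := by linear_combination b1 - d1 - e1
        have e3 : (x.2.2.1 : ZMod c) = y.2.2.1 := by linear_combination b2 - d2 + e1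
        have e4 : (x.2.2.2 : ZMod c) = y.2.2.2 := by
          linear_combination -b0 + d0 + e1 + e2 - e3
        exact Prod.ext (Units.ext e1) (Prod.ext (Units.ext e2)
          (Prod.ext (Units.ext e3) (Units.ext e4)))
    · rw [Finset.not_nonempty_iff_eq_empty.mp hne]; simp

/-- The Kloosterman sum modulo `c`. -/
def kloos (c : ℕ) [NeZero c] (a b : ZMod c) : ℂ :=
  ∑ x : (ZMod c)ˣ, ZMod.stdAddChar (a * (x : ZMod c) + b * ((x⁻¹ : (ZMod c)ˣ) : ZMod c))

lemma kloos_symm (c : ℕ) [NeZero c] (a b : ZMod c) : kloos c a b = kloos c b a := by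
  unfold kloos
  rw [← Equiv.sum_comp (Equiv.inv (ZMod c)ˣ)]
  refine Finset.sum_congr rfl fun x _ => ?_
  simp [add_comm]

lemma kloos_mul (c : ℕ) [NeZero c] (a b : ZMod c) (u : (ZMod c)ˣ) :
    kloos c (u * a) ((u⁻¹ : (ZMod c)ˣ) * b) = kloos c a b := by
  unfold kloos
  rw [← Equiv.sum_comp (Equiv.mulLeft u) (fun x : (ZMod c)ˣ =>
    (ZMod.stdAddChar (a * (x : ZMod c) + b * ((x⁻¹ : (ZMod c)ˣ) : ZMod c)) : ℂ))]
  refine Finset.sum_congr rfl fun x _ => ?_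
  congr 1
  simp only [Equiv.coe_mulLeft, Units.val_mul, mul_inv]
  ring

lemma sum_stdAddChar_mul (c : ℕ) [NeZero c] (t : ZMod c) :
    ∑ a : ZMod c, (ZMod.stdAddChar (a * t) : ℂ) = if t = 0 then (c : ℂ) else 0 := by
  have := AddChar.sum_mulShift t (ZMod.isPrimitive_stdAddChar c)
  rw [this]; simp

lemma conj_stdAddChar (c : ℕ) [NeZero c] (t : ZMod c) :
    (starRingEnd ℂ) (ZMod.stdAddChar t) = ZMod.stdAddChar (-t) := by
  rw [AddChar.map_neg_eq_conj]

lemma norm_stdAddChar (c : ℕ) [NeZero c] (t : ZMod c) :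
    ‖(ZMod.stdAddChar t : ℂ)‖ = 1 := by
  rw [ZMod.stdAddChar_apply]; exact Circle.norm_coe _

lemma kloos_pow_four (c : ℕ) [NeZero c] (a b : ZMod c) :
    ((‖kloos c a b‖ ^ 4 : ℝ) : ℂ) = ∑ x : (ZMod c)ˣ × (ZMod c)ˣ × (ZMod c)ˣ × (ZMod c)ˣ,
      (ZMod.stdAddChar (a * ((x.1 : ZMod c) + (x.2.1 : ZMod c) - (x.2.2.1 : ZMod c) - (x.2.2.2 : ZMod c))) : ℂ) *
      ZMod.stdAddChar (b * (((x.1⁻¹ : (ZMod c)ˣ) : ZMod c) + ((x.2.1⁻¹ : (ZMod c)ˣ) : ZMod c)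
        - ((x.2.2.1⁻¹ : (ZMod c)ˣ) : ZMod c) - ((x.2.2.2⁻¹ : (ZMod c)ˣ) : ZMod c))) := by
  have h : ((‖kloos c a b‖ ^ 4 : ℝ) : ℂ) = (starRingEnd ℂ) (kloos c a b) *
      ((starRingEnd ℂ) (kloos c a b) * (kloos c a b * kloos c a b)) := by
    have := Complex.mul_conj' (kloos c a b)
    push_cast
    linear_combination (-(kloos c a b * (starRingEnd ℂ) (kloos c a b))
      - (‖kloos c a b‖ : ℂ) ^ 2) * this
  rw [h]
  have hc : (starRingEnd ℂ) (kloos c a b) =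
      ∑ x : (ZMod c)ˣ, (ZMod.stdAddChar (-(a * (x : ZMod c) + b * ((x⁻¹ : (ZMod c)ˣ) : ZMod c))) : ℂ) := by
    simp only [kloos, map_sum, conj_stdAddChar]
  rw [hc]
  unfold kloos
  simp only [Fintype.sum_prod_type, ← AddChar.map_add_eq_mul, Finset.mul_sum,
    Finset.sum_mul]
  refine Finset.sum_congr rfl fun x1 _ => ?_
  refine Finset.sum_congr rfl fun x2 _ => ?_
  refine Finset.sum_congr rfl fun x3 _ => ?_
  refine Finset.sum_congr rfl fun x4 _ => ?_
  congr 1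
  ring

lemma sum_kloos_pow_four (c : ℕ) [NeZero c] :
    ∑ p : ZMod c × ZMod c, ‖kloos c p.1 p.2‖ ^ 4 = (c : ℝ) ^ 2 * (klQuads c).card := by
  have h : ((∑ p : ZMod c × ZMod c, ‖kloos c p.1 p.2‖ ^ 4 : ℝ) : ℂ)
      = (((c : ℝ) ^ 2 * (klQuads c).card : ℝ) : ℂ) := by
    rw [Complex.ofReal_sum]
    simp_rw [kloos_pow_four]
    rw [Finset.sum_comm, klQuads, Finset.card_filter]
    push_cast
    rw [Finset.mul_sum]
    refine Finset.sum_congr rfl fun x _ => ?_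
    rw [Fintype.sum_prod_type]
    simp only []
    rw [← Finset.sum_mul_sum, sum_stdAddChar_mul, sum_stdAddChar_mul]
    split_ifs <;> simp_all [sq]
  exact_mod_cast h

lemma totient_mul_kloos_le (c : ℕ) [NeZero c] (a : ZMod c) (b : ℤ) :
    (Nat.totient c : ℝ) * ‖kloos c a b‖ ^ 4 ≤
      Int.gcd b c * ((c : ℝ) ^ 2 * (2 * (c * c.divisors.card) ^ 2)) := by
  classical
  have h1 : (Nat.totient c : ℝ) * ‖kloos c a b‖ ^ 4 =
      ∑ u : (ZMod c)ˣ, ‖kloos c (u * a) ((u⁻¹ : (ZMod c)ˣ) * b)‖ ^ 4 := by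
    simp_rw [kloos_mul]
    rw [Finset.sum_const, Finset.card_univ, ZMod.card_units_eq_totient, nsmul_eq_mul]
  rw [h1]
  have h2 : ∑ u : (ZMod c)ˣ, ‖kloos c (u * a) ((u⁻¹ : (ZMod c)ˣ) * b)‖ ^ 4 =
      ∑ p : ZMod c × ZMod c, ((Finset.univ.filter fun u : (ZMod c)ˣ =>
        ((u : ZMod c) * a, ((u⁻¹ : (ZMod c)ˣ) : ZMod c) * b) = p).card : ℝ)
        * ‖kloos c p.1 p.2‖ ^ 4 := by
    rw [← Finset.sum_fiberwise (s := Finset.univ) (g := fun u : (ZMod c)ˣ =>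
        ((u : ZMod c) * a, ((u⁻¹ : (ZMod c)ˣ) : ZMod c) * (b : ZMod c)))]
    refine Finset.sum_congr rfl fun p _ => ?_
    rw [← nsmul_eq_mul, ← Finset.sum_const]
    refine Finset.sum_congr rfl fun u hu => ?_
    rw [← (Finset.mem_filter.mp hu).2]
  rw [h2]
  have h3 : ∀ p : ZMod c × ZMod c, (Finset.univ.filter fun u : (ZMod c)ˣ =>
        ((u : ZMod c) * a, ((u⁻¹ : (ZMod c)ˣ) : ZMod c) * b) = p).card ≤ Int.gcd b c := by
    intro p
    by_cases hne : (Finset.univ.filter fun u : (ZMod c)ˣ =>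
        ((u : ZMod c) * a, ((u⁻¹ : (ZMod c)ˣ) : ZMod c) * b) = p).Nonempty
    · obtain ⟨u0, hu0⟩ := hne
      refine le_trans (Finset.card_le_card_of_injOn
        (fun u => ((u⁻¹ : (ZMod c)ˣ) : ZMod c) - (u0⁻¹ : (ZMod c)ˣ)) ?_ ?_)
        (card_annihilator_le c b)
      · intro u hu
        simp only [Finset.coe_filter, Set.mem_ofPred_eq, Finset.mem_filter,
          Finset.mem_univ, true_and, Prod.ext_iff] at hu hu0 ⊢
        linear_combination hu.2 - hu0.2
      · intro u _ v _ huv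
        have : ((u⁻¹ : (ZMod c)ˣ) : ZMod c) = (v⁻¹ : (ZMod c)ˣ) := by simpa using huv
        exact inv_injective (Units.ext this)
    · rw [Finset.not_nonempty_iff_eq_empty.mp hne]; simp
  calc _ ≤ ∑ p : ZMod c × ZMod c, (Int.gcd b c : ℝ) * ‖kloos c p.1 p.2‖ ^ 4 := by
        refine Finset.sum_le_sum fun p _ => ?_
        refine mul_le_mul_of_nonneg_right ?_ (by positivity)
        exact_mod_cast h3 p
    _ = (Int.gcd b c : ℝ) * ((c : ℝ) ^ 2 * (klQuads c).card) := by
        rw [← Finset.mul_sum, sum_kloos_pow_four]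
    _ ≤ _ := by
        refine mul_le_mul_of_nonneg_left (mul_le_mul_of_nonneg_left ?_ (by positivity))
          (by positivity)
        exact_mod_cast card_klQuads_le c

lemma le_card_divisors_mul_totient (c : ℕ) : c ≤ c.divisors.card * Nat.totient c := by
  rcases Nat.eq_zero_or_pos c with rfl | hc
  · simp
  conv_lhs => rw [← Nat.sum_totient c]
  refine (Finset.sum_le_card_nsmul _ _ (Nat.totient c) fun δ hδ => ?_)
  exact Nat.le_of_dvd (Nat.totient_pos.mpr hc) (Nat.totient_dvd_of_dvd (Nat.dvd_of_mem_divisors hδ))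

lemma kloos_pow_four_le (c : ℕ) [NeZero c] (a : ZMod c) (b : ℤ) :
    ‖kloos c a b‖ ^ 4 ≤ 2 * Int.gcd b c * (c.divisors.card : ℝ) ^ 3 * (c : ℝ) ^ 3 := by
  have h1 := totient_mul_kloos_le c a b
  have hc : (0 : ℝ) < c := by exact_mod_cast Nat.pos_of_ne_zero (NeZero.ne c)
  have h2 : (c : ℝ) ≤ c.divisors.card * Nat.totient c := by
    exact_mod_cast le_card_divisors_mul_totient c
  have h3 : (c : ℝ) * ‖kloos c a b‖ ^ 4 ≤ c *
      (2 * Int.gcd b c * (c.divisors.card : ℝ) ^ 3 * (c : ℝ) ^ 3) := by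
    calc _ ≤ (c.divisors.card * Nat.totient c) * ‖kloos c a b‖ ^ 4 := by gcongr
      _ = c.divisors.card * (Nat.totient c * ‖kloos c a b‖ ^ 4) := by ring
      _ ≤ c.divisors.card * (Int.gcd b c * ((c : ℝ) ^ 2 * (2 * (c * c.divisors.card) ^ 2))) := by
          gcongr
      _ = _ := by ring
  exact le_of_mul_le_mul_left h3 hc

/-- A convenient weak form of Kloosterman's bound. -/
lemma kloos_le (c : ℕ) [NeZero c] (a : ZMod c) (b : ℤ) :
    ‖kloos c a b‖ ≤ 2 * Int.gcd b c * c.divisors.card * (c : ℝ) ^ (3 / 4 : ℝ) := by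
  have h := kloos_pow_four_le c a b
  have hc : (0 : ℝ) < c := by exact_mod_cast Nat.pos_of_ne_zero (NeZero.ne c)
  have hg : (1 : ℝ) ≤ Int.gcd b c := by
    exact_mod_cast Int.gcd_pos_of_ne_zero_right _ (by exact_mod_cast NeZero.ne c)
  have hd : (1 : ℝ) ≤ c.divisors.card := by
    exact_mod_cast Finset.card_pos.mpr ⟨1, Nat.one_mem_divisors.mpr (NeZero.ne c)⟩
  have hp : ((c : ℝ) ^ (3 / 4 : ℝ)) ^ 4 = (c : ℝ) ^ 3 := by
    rw [← Real.rpow_natCast, ← Real.rpow_mul hc.le]; norm_num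
  refine le_of_pow_le_pow_left₀ (n := 4) (by norm_num) (by positivity) (h.trans ?_)
  rw [mul_pow, hp, mul_pow, mul_pow]
  gcongr ?_ * ?_ * ?_ * _
  · norm_num
  · exact le_self_pow₀ hg (by norm_num)
  · exact pow_le_pow_right₀ hd (by norm_num)

lemma kloos_le' (c : ℕ) [NeZero c] (a : ℤ) (b : ZMod c) :
    ‖kloos c a b‖ ≤ 2 * Int.gcd a c * c.divisors.card * (c : ℝ) ^ (3 / 4 : ℝ) := by
  rw [kloos_symm]; exact kloos_le c b a

/-! ### Divisor bounds, roots of unity modulo `n`, primes in short windows -/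

lemma succ_le_mul_prime_pow {ε : ℝ} (hε : 0 < ε) (p a : ℕ) (hp : 2 ≤ p) :
    ((a : ℝ) + 1) ≤ (if (p : ℝ) < 2 ^ (1 / ε) then max 1 (1 / (ε * Real.log 2)) else 1)
      * ((p : ℝ) ^ a) ^ ε := by
  have hp' : (2 : ℝ) ≤ p := by exact_mod_cast hp
  have hl : 0 < Real.log 2 := Real.log_pos (by norm_num)
  have e : ((p : ℝ) ^ a) ^ ε = ((p : ℝ) ^ ε) ^ a := by
    rw [← Real.rpow_natCast, ← Real.rpow_natCast, ← Real.rpow_mul (by positivity),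
      ← Real.rpow_mul (by positivity), mul_comm]
  split_ifs with h
  · have h1 : (1 : ℝ) + a * (ε * Real.log 2) ≤ ((p : ℝ) ^ ε) ^ a := by
      have h2 : (2 : ℝ) ^ ε ≤ (p : ℝ) ^ ε := Real.rpow_le_rpow (by norm_num) hp' hε.le
      have h3 : (1 : ℝ) + a * (ε * Real.log 2) ≤ Real.exp (a * (ε * Real.log 2)) := by
        linarith [Real.add_one_le_exp (a * (ε * Real.log 2))]
      refine h3.trans (le_trans (le_of_eq ?_) (pow_le_pow_left₀ (by positivity) h2 a))
      rw [Real.rpow_def_of_pos (by norm_num), ← Real.exp_nat_mul]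
      congr 1; ring
    rw [e]
    refine le_trans ?_ (mul_le_mul_of_nonneg_left h1 (by positivity))
    have h4 : (1 : ℝ) ≤ max 1 (1 / (ε * Real.log 2)) := le_max_left _ _
    have h5 : (1 : ℝ) ≤ max 1 (1 / (ε * Real.log 2)) * (ε * Real.log 2) := by
      rw [← div_le_iff₀ (by positivity)]; exact le_max_right _ _
    have h6 : (0 : ℝ) ≤ a := by positivity
    nlinarith
  · rw [one_mul, e]
    have h2 : (2 : ℝ) ≤ (p : ℝ) ^ ε := by
      have := Real.rpow_le_rpow (by positivity) (not_lt.mp h) hε.le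
      rwa [← Real.rpow_mul (by norm_num), one_div_mul_cancel hε.ne', Real.rpow_one] at this
    refine le_trans ?_ (pow_le_pow_left₀ (by norm_num) h2 a)
    exact_mod_cast Nat.lt_two_pow_self

/-- The divisor bound `τ(n) ≪ n^ε`. -/
lemma exists_divisor_bound {ε : ℝ} (hε : 0 < ε) :
    ∃ C : ℝ, 1 ≤ C ∧ ∀ n : ℕ, n ≠ 0 → (n.divisors.card : ℝ) ≤ C * (n : ℝ) ^ ε := by
  set K := max 1 (1 / (ε * Real.log 2)) with hK
  have hK1 : 1 ≤ K := le_max_left _ _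
  set P := ⌈(2 : ℝ) ^ (1 / ε)⌉₊ with hP
  refine ⟨K ^ P, one_le_pow₀ hK1, fun n hn => ?_⟩
  rw [Nat.card_divisors hn]
  have hfac : (n : ℝ) ^ ε = ∏ p ∈ n.primeFactors, ((p : ℝ) ^ n.factorization p) ^ ε := by
    rw [Real.finsetProd_rpow _ _ (fun p _ => by positivity)]
    congr 1
    exact_mod_cast (Nat.prod_factorization_pow_eq_self hn).symm
  rw [hfac]
  push_cast
  calc ∏ p ∈ n.primeFactors, ((n.factorization p : ℝ) + 1)
      ≤ ∏ p ∈ n.primeFactors, ((if (p : ℝ) < 2 ^ (1 / ε) then K else 1)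
        * ((p : ℝ) ^ n.factorization p) ^ ε) :=
        Finset.prod_le_prod (fun p _ => by positivity) fun p hp =>
          succ_le_mul_prime_pow hε p _ (Nat.prime_of_mem_primeFactors hp).two_le
    _ = (∏ p ∈ n.primeFactors, (if (p : ℝ) < 2 ^ (1 / ε) then K else 1)) *
        ∏ p ∈ n.primeFactors, ((p : ℝ) ^ n.factorization p) ^ ε := Finset.prod_mul_distrib
    _ ≤ _ := by
        refine mul_le_mul_of_nonneg_right ?_ (Finset.prod_nonneg fun p _ => by positivity)
        rw [← Finset.prod_filter, Finset.prod_const]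
        refine pow_le_pow_right₀ hK1 ?_
        refine le_trans (Finset.card_le_card (t := Finset.range P) fun p hp => ?_) (by simp)
        rw [Finset.mem_range, hP, Nat.lt_ceil]
        exact (Finset.mem_filter.mp hp).2

lemma sum_int_gcd_le (ν : ℤ) (hν : ν ≠ 0) (P : ℕ) :
    ∑ c ∈ Finset.Icc 1 P, Int.gcd ν c ≤ P * ν.natAbs.divisors.card := by
  have h2 : ∀ c ∈ Finset.Icc 1 P, Int.gcd ν c
      ≤ ∑ δ ∈ ν.natAbs.divisors, if δ ∣ c then δ else 0 := by
    intro c _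
    refine le_trans (le_of_eq ?_) (Finset.single_le_sum
      (f := fun δ => if δ ∣ c then δ else 0) (fun _ _ => Nat.zero_le _)
      (Nat.mem_divisors.mpr ⟨Nat.gcd_dvd_left ν.natAbs c, Int.natAbs_ne_zero.mpr hν⟩))
    simp only [Nat.gcd_dvd_right, if_true]
    rfl
  refine (Finset.sum_le_sum h2).trans ?_
  rw [Finset.sum_comm]
  have h3 : ∀ δ ∈ ν.natAbs.divisors, (∑ c ∈ Finset.Icc 1 P, if δ ∣ c then δ else 0) ≤ P := by
    intro δ _
    rw [← Finset.sum_filter, Finset.sum_const, smul_eq_mul]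
    have : (Finset.filter (fun c => δ ∣ c) (Finset.Icc 1 P)).card = P / δ :=
      Nat.Ioc_filter_dvd_card_eq_div P δ
    rw [this]
    exact Nat.div_mul_le_self P δ
  refine (Finset.sum_le_sum h3).trans ?_
  simp [mul_comm]

lemma card_pow_eq_one_le_of_cyclic_subgroup {G : Type*} [CommGroup G] [Fintype G] [DecidableEq G]
    (K : Subgroup G) [IsCyclic K] (d : ℕ) (hd : 0 < d) :
    (Finset.univ.filter fun x : G => x ^ d = 1).card ≤ d * K.index := by
  classical
  have : Fintype (G ⧸ K) := Fintype.ofFinite _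
  have hidx : K.index = (Finset.univ : Finset (G ⧸ K)).card := by
    rw [Finset.card_univ, Subgroup.index_eq_card, Nat.card_eq_fintype_card]
  rw [hidx]
  refine Finset.card_le_mul_card_image_of_maps_to (f := fun x : G => (x : G ⧸ K))
    (fun _ _ => Finset.mem_univ _) d ?_
  intro q _
  by_cases hne : ((Finset.univ.filter fun x : G => x ^ d = 1).filter
      fun x : G => (QuotientGroup.mk x : G ⧸ K) = q).Nonempty
  · obtain ⟨x0, hx0⟩ := hne
    simp only [Finset.mem_filter, Finset.mem_univ, true_and] at hx0
    have h := IsCyclic.card_pow_eq_one_le (α := K) hd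
    refine le_trans ?_ h
    rw [← Finset.card_map (Function.Embedding.subtype (fun x => x ∈ K))]
    refine Finset.card_le_card_of_injOn (fun x => x0⁻¹ * x) ?_ ?_
    · intro x hx
      simp only [Finset.coe_filter, Finset.mem_filter, Finset.mem_univ, true_and,
        Set.mem_ofPred_eq] at hx
      have hm : x0⁻¹ * x ∈ K := QuotientGroup.eq.mp (hx0.2.trans hx.2.symm)
      simp only [Finset.coe_map, Function.Embedding.subtype_apply, Set.mem_image,
        Finset.coe_filter, Finset.mem_univ, true_and, Set.mem_ofPred_eq]
      refine ⟨⟨_, hm⟩, ?_, rfl⟩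
      ext
      simp [mul_pow, hx.1, hx0.1]
    · intro x _ y _ hxy; simpa using hxy
  · rw [Finset.not_nonempty_iff_eq_empty.mp hne]; simp

/-- The number of `d`-th roots of unity modulo `n`. -/
def rootCount (d n : ℕ) : ℕ := Nat.card {x : (ZMod n)ˣ // x ^ d = 1}

lemma rootCount_mul (d m n : ℕ) (h : m.Coprime n) :
    rootCount d (m * n) = rootCount d m * rootCount d n := by
  unfold rootCount
  rw [← Nat.card_prod]
  let e : (ZMod (m * n))ˣ ≃* (ZMod m)ˣ × (ZMod n)ˣ :=
    (Units.mapEquiv (ZMod.chineseRemainder h).toMulEquiv).trans MulEquiv.prodUnits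
  refine Nat.card_congr ((Equiv.subtypeEquiv e.toEquiv (q := fun p => p.1 ^ d = 1 ∧ p.2 ^ d = 1)
    fun x => ?_).trans (Equiv.subtypeProdEquivProd (p := fun x : (ZMod m)ˣ => x ^ d = 1)
    (q := fun x : (ZMod n)ˣ => x ^ d = 1)))
  have : x ^ d = 1 ↔ (e x) ^ d = 1 := by
    rw [← map_pow, MulEquiv.map_eq_one_iff]
  rw [this, Prod.ext_iff]; rfl

lemma rootCount_prime_pow_le (d p k : ℕ) (hd : 0 < d) (hp : p.Prime) :
    rootCount d (p ^ k) ≤ d * 2 := by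
  classical
  have : NeZero (p ^ k) := ⟨pow_ne_zero _ hp.ne_zero⟩
  have hr : rootCount d (p ^ k) = (Finset.univ.filter fun x : (ZMod (p ^ k))ˣ => x ^ d = 1).card := by
    rw [rootCount, Nat.card_eq_fintype_card, Fintype.card_subtype]
  rw [hr]
  by_cases hc : IsCyclic (ZMod (p ^ k))ˣ
  · exact (IsCyclic.card_pow_eq_one_le hd).trans (by omega)
  · have h2 : p = 2 := by
      by_contra h; exact hc (ZMod.isCyclic_units_of_prime_pow p hp h k)
    subst h2
    rw [ZMod.isCyclic_units_two_pow_iff] at hc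
    obtain ⟨j, rfl⟩ : ∃ j, k = j + 2 := ⟨k - 2, by omega⟩
    have ho := ZMod.orderOf_five j
    have hu : IsUnit (5 : ZMod (2 ^ (j + 2))) := by
      have := (ZMod.isUnit_iff_coprime 5 (2 ^ (j + 2))).mpr
        (Nat.Coprime.pow_right _ (by norm_num))
      exact_mod_cast this
    obtain ⟨u, hu⟩ := hu
    rw [← hu, orderOf_units] at ho
    refine (card_pow_eq_one_le_of_cyclic_subgroup (Subgroup.zpowers u) d hd).trans ?_
    have hcard := (Subgroup.zpowers u).card_mul_index
    rw [Nat.card_zpowers, ho, Nat.card_eq_fintype_card, ZMod.card_units_eq_totient,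
      Nat.totient_prime_pow_succ Nat.prime_two] at hcard
    have : (Subgroup.zpowers u).index = 2 := by
      have h0 : 0 < 2 ^ j := by positivity
      apply Nat.eq_of_mul_eq_mul_left h0
      rw [hcard, pow_succ]; norm_num
    rw [this]

lemma rootCount_le (d : ℕ) (hd : 0 < d) (n : ℕ) (hn : n ≠ 0) :
    rootCount d n ≤ n.divisors.card ^ (d + 1) := by
  induction n using Nat.recOnPosPrimePosCoprime with
  | prime_pow p k hp hk =>
    refine (rootCount_prime_pow_le d p k hd hp).trans ?_
    rw [Nat.divisors_prime_pow hp, Finset.card_map, Finset.card_range]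
    calc d * 2 ≤ 2 ^ d * 2 := Nat.mul_le_mul_right _ Nat.lt_two_pow_self.le
      _ = 2 ^ (d + 1) := (pow_succ _ _).symm
      _ ≤ _ := Nat.pow_le_pow_left (by omega) _
  | zero => exact absurd rfl hn
  | one =>
    have : Subsingleton {x : (ZMod 1)ˣ // x ^ d = 1} := inferInstance
    simp only [rootCount, Nat.divisors_one, Finset.card_singleton, one_pow]
    exact Finite.card_le_one_iff_subsingleton.mpr this
  | coprime a b ha hb hab iha ihb =>
    rw [rootCount_mul d a b hab, Nat.Coprime.card_divisors_mul hab, mul_pow]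
    exact Nat.mul_le_mul (iha (by omega)) (ihb (by omega))

lemma card_pow_eq_le (d n : ℕ) [NeZero n] (hd : 0 < d) (j : (ZMod n)ˣ) :
    (Finset.univ.filter fun x : (ZMod n)ˣ => x ^ d = j).card ≤ n.divisors.card ^ (d + 1) := by
  classical
  refine le_trans ?_ (rootCount_le d hd n (NeZero.ne n))
  rw [rootCount, Nat.card_eq_fintype_card, Fintype.card_subtype]
  by_cases hne : (Finset.univ.filter fun x : (ZMod n)ˣ => x ^ d = j).Nonempty
  · obtain ⟨x0, hx0⟩ := hne
    simp only [Finset.mem_filter, Finset.mem_univ, true_and] at hx0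
    refine Finset.card_le_card_of_injOn (fun x => x0⁻¹ * x) ?_ ?_
    · intro x hx
      simp only [Finset.coe_filter, Finset.mem_univ, true_and, Set.mem_ofPred_eq] at hx ⊢
      simp [mul_pow, hx, hx0]
    · intro x _ y _ hxy; simpa using hxy
  · rw [Finset.not_nonempty_iff_eq_empty.mp hne]; simp

/-- There are many primes in `(Q, 8Q]`. -/
lemma exists_many_primes : ∃ Q₀ : ℕ, ∀ Q : ℕ, Q₀ ≤ Q →
    Real.sqrt Q ≤ ((Finset.Ioc Q (8 * Q)).filter Nat.Prime).card := by
  refine ⟨10 ^ 7, fun Q hQ => ?_⟩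
  have hQ' : (10 : ℝ) ^ 7 ≤ Q := by exact_mod_cast hQ
  set y : ℝ := 8 * Q with hy
  have h1 := Chebyshev.theta_ge (8 * Q)
  have h2 := Chebyshev.theta_le_log4_mul_x (x := (Q : ℝ)) (by positivity)
  push_cast at h1
  rw [← hy] at h1
  have h3 : Chebyshev.theta y - Chebyshev.theta Q ≤
      ((Finset.Ioc Q (8 * Q)).filter Nat.Prime).card * Real.log y := by
    have e1 : Chebyshev.theta y = ∑ p ∈ (Finset.Ioc 0 (8 * Q)).filter Nat.Prime, Real.log p := by
      have : y = ((8 * Q : ℕ) : ℝ) := by push_cast; rfl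
      rw [this, Chebyshev.theta, Nat.floor_natCast]
    have e2 : Chebyshev.theta Q = ∑ p ∈ (Finset.Ioc 0 Q).filter Nat.Prime, Real.log p := by
      rw [Chebyshev.theta, Nat.floor_natCast]
    have e3 : (Finset.Ioc 0 (8 * Q)).filter Nat.Prime = (Finset.Ioc 0 Q).filter Nat.Prime ∪
        (Finset.Ioc Q (8 * Q)).filter Nat.Prime := by
      ext p
      simp only [Finset.mem_filter, Finset.mem_Ioc, Finset.mem_union, ← or_and_right]
      refine and_congr_left fun _ => ?_
      omega
    rw [e1, e2, e3, Finset.sum_union]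
    · rw [add_sub_cancel_left, ← nsmul_eq_mul]
      refine Finset.sum_le_card_nsmul _ _ _ fun p hp => ?_
      simp only [Finset.mem_filter, Finset.mem_Ioc] at hp
      refine Real.log_le_log (by exact_mod_cast hp.2.pos) ?_
      rw [hy]; exact_mod_cast hp.1.2
    · rw [Finset.disjoint_left]; intro p hp hp'
      simp only [Finset.mem_filter, Finset.mem_Ioc] at hp hp'; omega
  have hl4 : Real.log 4 = 2 * Real.log 2 := by
    rw [show (4 : ℝ) = 2 ^ 2 by norm_num, Real.log_pow]; norm_num
  have hl2 : 0.69 < Real.log 2 := by linarith [Real.log_two_gt_d9]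
  have hy0 : 0 < y := by positivity
  set z : ℝ := y ^ (1 / 4 : ℝ) with hz
  have hz0 : 0 < z := by positivity
  have hz4 : z ^ 4 = y := by
    rw [hz, ← Real.rpow_natCast, ← Real.rpow_mul hy0.le]; norm_num
  have hz2 : Real.sqrt y = z ^ 2 := by
    rw [← hz4, show z ^ 4 = (z ^ 2) ^ 2 by ring, Real.sqrt_sq (by positivity)]
  have hlog : Real.log y ≤ 4 * z := by
    rw [← hz4, Real.log_pow]; push_cast
    linarith [Real.log_le_sub_one_of_pos hz0]
  have hz90 : 90 ≤ z := by
    by_contra hlt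
    push Not at hlt
    have : z ^ 4 < 90 ^ 4 := by gcongr
    rw [hz4, hy] at this; norm_num at this; linarith
  have hlog1 : Real.log (y + 1) ≤ 4 * z + 1 := by
    have : Real.log (y + 1) ≤ Real.log (y * Real.exp 1) :=
      Real.log_le_log (by positivity) (by
        have := Real.exp_one_gt_d9
        nlinarith)
    rw [Real.log_mul hy0.ne' (Real.exp_pos _).ne', Real.log_exp] at this
    linarith
  have hly : 0 < Real.log y := Real.log_pos (by rw [hy]; linarith)
  have hkey : Real.sqrt Q * Real.log y ≤
      ((Finset.Ioc Q (8 * Q)).filter Nat.Prime).card * Real.log y := by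
    refine le_trans ?_ h3
    have a1 : Real.sqrt Q ≤ z ^ 2 := by
      rw [← hz2]; exact Real.sqrt_le_sqrt (by rw [hy]; linarith)
    have a2 : Real.sqrt Q * Real.log y ≤ z ^ 2 * (4 * z) := by gcongr
    rw [hz2] at h1
    have a3 : 2 * z ^ 2 * Real.log y ≤ 2 * z ^ 2 * (4 * z) := by gcongr
    have a4 : (Q : ℝ) = z ^ 4 / 8 := by rw [hz4, hy]; ring
    have a5 : (90 : ℝ) * z ^ 3 ≤ z ^ 4 := by nlinarith [pow_pos hz0 3]
    have a6 : (90 : ℝ) ^ 2 * z ≤ z ^ 3 := by nlinarith [mul_pos hz0 hz0]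
    have a7 : 0.69 * z ^ 4 ≤ Real.log 2 * z ^ 4 := by gcongr
    have a8 : (z ^ 4 / 8 : ℝ) * 8 = z ^ 4 := by ring
    rw [hl4, a4] at h2
    rw [← a4] at h2
    have a9 : 2 * Real.log 2 * (Q : ℝ) = Real.log 2 * z ^ 4 / 4 := by rw [a4]; ring
    have a10 : y * Real.log 2 = Real.log 2 * z ^ 4 := by rw [hz4]; ring
    rw [a4, ← a4, a9] at h2
    rw [a10] at h1
    have a11 : 2 * z ^ 2 * (4 * z) = 8 * z ^ 3 := by ring
    have a12 : z ^ 2 * (4 * z) = 4 * z ^ 3 := by ring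
    rw [a11] at a3
    rw [a12] at a2
    linarith
  exact le_of_mul_le_mul_right hkey hly

/-! ### Fejér approximation on the circle and the 2-torus -/

/-- `eR t = exp(2πit)`. -/
def eR (t : ℝ) : ℂ := Complex.exp ((2 * Real.pi * t : ℝ) * Complex.I)

lemma eR_add (s t : ℝ) : eR (s + t) = eR s * eR t := by
  rw [eR, eR, eR, ← Complex.exp_add]; congr 1; push_cast; ring

lemma norm_eR (t : ℝ) : ‖eR t‖ = 1 := Complex.norm_exp_ofReal_mul_I _

@[simp] lemma eR_zero : eR 0 = 1 := by simp [eR]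

lemma eR_neg (t : ℝ) : eR (-t) = (starRingEnd ℂ) (eR t) := by
  rw [eR, eR, ← Complex.exp_conj, map_mul, Complex.conj_ofReal, Complex.conj_I]
  congr 1; push_cast; ring

lemma eR_int (k : ℤ) : eR k = 1 := by
  rw [eR, Complex.exp_eq_one_iff]; exact ⟨k, by push_cast; ring⟩

lemma eR_add_int (t : ℝ) (k : ℤ) : eR (t + k) = eR t := by rw [eR_add, eR_int, mul_one]

lemma eR_sub (s t : ℝ) : eR (s - t) = eR s * (starRingEnd ℂ) (eR t) := by
  rw [sub_eq_add_neg, eR_add, eR_neg]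

lemma eR_nat_mul (k : ℕ) (t : ℝ) : eR (k * t) = eR t ^ k := by
  rw [eR, eR, ← Complex.exp_nat_mul]; congr 1; push_cast; ring

@[fun_prop] lemma continuous_eR : Continuous eR := by unfold eR; fun_prop

lemma norm_eR_sub_le (s t : ℝ) : ‖eR s - eR t‖ ≤ 2 * Real.pi * |s - t| := by
  have h : eR s - eR t = eR t * (eR (s - t) - 1) := by
    rw [mul_sub, ← eR_add]; ring_nf
  rw [h, norm_mul, norm_eR, one_mul, eR]
  have := Real.norm_exp_I_mul_ofReal_sub_one_le (x := 2 * Real.pi * (s - t))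
  rw [mul_comm] at this
  refine this.trans ?_
  rw [Real.norm_eq_abs, abs_mul, abs_of_pos (by positivity)]

lemma eR_eq_stdAddChar (c : ℕ) [NeZero c] (j : ℤ) :
    eR ((j : ℝ) / c) = ZMod.stdAddChar (j : ZMod c) := by
  rw [ZMod.stdAddChar_coe, eR]
  congr 1; push_cast; ring

lemma integral_eR_int (k : ℤ) : ∫ t in (0 : ℝ)..1, eR (k * t) = if k = 0 then 1 else 0 := by
  split_ifs with h
  · simp [h]
  · have hc : (2 * Real.pi * k * Complex.I : ℂ) ≠ 0 := by
      simp [Real.pi_ne_zero, h]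
    have : ∀ t : ℝ, eR (k * t) = Complex.exp ((2 * Real.pi * k * Complex.I) * t) := by
      intro t; rw [eR]; congr 1; push_cast; ring
    simp_rw [this]
    rw [integral_exp_mul_complex hc]
    have h1 : Complex.exp (2 * Real.pi * k * Complex.I * (1 : ℝ)) = 1 := by
      rw [Complex.exp_eq_one_iff]; exact ⟨k, by push_cast; ring⟩
    rw [h1]; simp

lemma norm_fourier_le {f : ℝ → ℂ} {C : ℝ} (hf : ∀ t, ‖f t‖ ≤ C) (m : ℤ) :
    ‖∫ t in (0 : ℝ)..1, f t * eR (-(m * t))‖ ≤ C := by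
  simpa using intervalIntegral.norm_integral_le_of_norm_le_const (a := (0 : ℝ)) (b := 1) (C := C)
    (f := fun t => f t * eR (-(m * t))) fun t _ => by rw [norm_mul, norm_eR, mul_one]; exact hf t

/-- The square of pairs of indices below `H`. -/
abbrev box (H : ℕ) : Finset (ℕ × ℕ) := Finset.range H ×ˢ Finset.range H

/-- The frequency attached to a pair of indices. -/
abbrev freq (p : ℕ × ℕ) : ℤ := p.1 - p.2

/-- The Fejér kernel. -/
def fejer (H : ℕ) (t : ℝ) : ℝ := (H : ℝ)⁻¹ * ‖∑ k ∈ Finset.range H, eR (k * t)‖ ^ 2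

lemma fejer_nonneg (H : ℕ) (t : ℝ) : 0 ≤ fejer H t := by unfold fejer; positivity

@[fun_prop] lemma continuous_fejer (H : ℕ) : Continuous (fejer H) := by unfold fejer; fun_prop

lemma fejer_eq (H : ℕ) (t : ℝ) : (fejer H t : ℂ) =
    (H : ℂ)⁻¹ * ∑ p ∈ box H, eR (freq p * t) := by
  unfold fejer
  push_cast
  congr 1
  rw [← Complex.mul_conj', map_sum, Finset.sum_mul_sum, Finset.sum_product]
  refine Finset.sum_congr rfl fun k _ => Finset.sum_congr rfl fun k' _ => ?_
  rw [← eR_sub]; congr 1; ring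

lemma fejer_periodic (H : ℕ) : Function.Periodic (fejer H) 1 := by
  intro t
  unfold fejer
  have : ∀ k : ℕ, eR (k * (t + 1)) = eR (k * t) := fun k => by
    have := eR_add_int (k * t) k
    rw [mul_add, mul_one]; exact_mod_cast this
  simp_rw [this]

lemma integral_fejer (H : ℕ) (hH : 0 < H) : ∫ t in (0 : ℝ)..1, fejer H t = 1 := by
  have h : ((∫ t in (0 : ℝ)..1, fejer H t : ℝ) : ℂ) = 1 := by
    rw [← intervalIntegral.integral_ofReal]
    simp_rw [fejer_eq]
    rw [intervalIntegral.integral_const_mul, intervalIntegral.integral_finsetSum]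
    · simp_rw [integral_eR_int]
      rw [Finset.sum_product]
      have : ∀ x ∈ Finset.range H, (∑ y ∈ Finset.range H,
          if (x : ℤ) - y = 0 then (1 : ℂ) else 0) = 1 := by
        intro x hx
        rw [Finset.sum_eq_single x]
        · simp
        · intro y _ hy; rw [if_neg]; omega
        · intro h; exact absurd hx h
      rw [Finset.sum_congr rfl this]
      simp [hH.ne']
    · intro i _
      exact Continuous.intervalIntegrable (by fun_prop) _ _
  exact_mod_cast h

lemma fejer_mul_sq (H : ℕ) (t : ℝ) :
    fejer H t * ‖1 - eR t‖ ^ 2 = (H : ℝ)⁻¹ * ‖1 - eR (H * t)‖ ^ 2 := by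
  unfold fejer
  rw [mul_assoc, ← mul_pow, ← norm_mul]
  congr 3
  simp_rw [eR_nat_mul]
  exact geom_sum_mul_neg _ _

lemma norm_one_sub_eR_sq (t : ℝ) : ((‖1 - eR t‖ ^ 2 : ℝ) : ℂ) = 2 - eR t - eR (-t) := by
  push_cast
  rw [← Complex.mul_conj', map_sub, map_one, ← eR_neg]
  have : eR t * eR (-t) = 1 := by rw [← eR_add, add_neg_cancel, eR_zero]
  linear_combination this

lemma integral_fejer_mul_sq (H : ℕ) (hH : 0 < H) :
    ∫ t in (0 : ℝ)..1, fejer H t * ‖1 - eR t‖ ^ 2 = 2 / H := by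
  simp_rw [fejer_mul_sq]
  rw [intervalIntegral.integral_const_mul]
  have h : ((∫ t in (0 : ℝ)..1, ‖1 - eR (H * t)‖ ^ 2 : ℝ) : ℂ) = 2 := by
    rw [← intervalIntegral.integral_ofReal]
    simp_rw [norm_one_sub_eR_sq]
    have a1 := integral_eR_int H
    have a2 := integral_eR_int (-H)
    rw [if_neg (by omega)] at a1 a2
    push_cast at a1 a2
    simp_rw [neg_mul] at a2
    rw [intervalIntegral.integral_sub, intervalIntegral.integral_sub, a1, a2]
    · simp
    all_goals exact Continuous.intervalIntegrable (by fun_prop) _ _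
  have h' : (∫ t in (0 : ℝ)..1, ‖1 - eR (H * t)‖ ^ 2 : ℝ) = 2 := by exact_mod_cast h
  rw [h']; ring

lemma four_mul_abs_le (t : ℝ) (ht : |t| ≤ 1 / 2) : 4 * |t| ≤ ‖1 - eR t‖ := by
  have h : ‖1 - eR t‖ = 2 * |Real.sin (Real.pi * t)| := by
    rw [norm_sub_rev, eR, mul_comm, Complex.norm_exp_I_mul_ofReal_sub_one]
    rw [norm_mul, Real.norm_eq_abs, Real.norm_eq_abs, abs_two]
    congr 3; ring
  rw [h]
  have := Real.mul_abs_le_abs_sin (x := Real.pi * t) (by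
    rw [abs_mul, abs_of_pos Real.pi_pos]; nlinarith [Real.pi_pos])
  rw [abs_mul, abs_of_pos Real.pi_pos] at this
  have e : 2 / Real.pi * (Real.pi * |t|) = 2 * |t| := by
    field_simp
  linarith

lemma integral_abs_mul_fejer_le (H : ℕ) (hH : 0 < H) :
    ∫ t in (-(1 / 2) : ℝ)..(1 / 2), |t| * fejer H t ≤ 1 / Real.sqrt H := by
  have hH' : (0 : ℝ) < H := by exact_mod_cast hH
  set ε := 1 / Real.sqrt H with hε
  have hε0 : 0 < ε := by positivity
  have hper : ∀ f : ℝ → ℝ, Function.Periodic f 1 →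
      ∫ t in (-(1 / 2) : ℝ)..(1 / 2), f t = ∫ t in (0 : ℝ)..1, f t := by
    intro f hf
    have := hf.intervalIntegral_add_eq (-(1 / 2)) 0
    norm_num at this ⊢; exact this
  have i1 : ∫ t in (-(1 / 2) : ℝ)..(1 / 2), fejer H t = 1 := by
    rw [hper _ (fejer_periodic H), integral_fejer H hH]
  have i2 : ∫ t in (-(1 / 2) : ℝ)..(1 / 2), fejer H t * ‖1 - eR t‖ ^ 2 = 2 / H := by
    rw [hper, integral_fejer_mul_sq H hH]
    intro t
    simp only [fejer_periodic H t]
    have := eR_add_int t 1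
    push_cast at this; rw [this]
  calc ∫ t in (-(1 / 2) : ℝ)..(1 / 2), |t| * fejer H t
      ≤ ∫ t in (-(1 / 2) : ℝ)..(1 / 2), (ε / 2 * fejer H t +
          (1 / (32 * ε)) * (fejer H t * ‖1 - eR t‖ ^ 2)) := by
        refine intervalIntegral.integral_mono_on (by norm_num)
          (Continuous.intervalIntegrable (by fun_prop) _ _)
          (Continuous.intervalIntegrable (by fun_prop) _ _) fun t ht => ?_
        have h1 := four_mul_abs_le t (abs_le.mpr ht)
        have h2 := fejer_nonneg H t
        have h3 : |t| ≤ ε / 2 + (1 / (32 * ε)) * ‖1 - eR t‖ ^ 2 := by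
          have h4 : (4 * |t|) ^ 2 ≤ ‖1 - eR t‖ ^ 2 := by gcongr
          have h5 : |t| ≤ ε / 2 + (1 / (32 * ε)) * (4 * |t|) ^ 2 := by
            have : ε / 2 + (1 / (32 * ε)) * (4 * |t|) ^ 2 - |t| = (ε - |t|) ^ 2 / (2 * ε) := by
              field_simp; ring
            have h6 : 0 ≤ (ε - |t|) ^ 2 / (2 * ε) := by positivity
            linarith
          refine h5.trans ?_
          gcongr
        nlinarith
    _ = ε / 2 + (1 / (32 * ε)) * (2 / H) := by
        rw [intervalIntegral.integral_add, intervalIntegral.integral_const_mul,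
          intervalIntegral.integral_const_mul, i1, i2, mul_one]
        all_goals exact Continuous.intervalIntegrable (by fun_prop) _ _
    _ ≤ ε := by
        have : ε ^ 2 = 1 / H := by rw [hε, div_pow, Real.sq_sqrt hH'.le]; norm_num
        have e : (1 / (32 * ε)) * (2 / (H : ℝ)) = ε / 16 := by
          rw [show (2 : ℝ) / H = 2 * (1 / H) by ring, ← this]; field_simp; norm_num
        rw [e]; linarith

/-- Fejér means approximate Lipschitz periodic functions. -/
lemma norm_sub_fejer_le (H : ℕ) (hH : 0 < H) (P : ℝ → ℂ) (L : ℝ) (hper : Function.Periodic P 1)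
    (hL : ∀ s t, ‖P s - P t‖ ≤ L * |s - t|) (hP : Continuous P) (θ : ℝ) :
    ‖P θ - ∫ τ in (0 : ℝ)..1, P τ * fejer H (θ - τ)‖ ≤ L / Real.sqrt H := by
  have h1 : ∫ τ in (0 : ℝ)..1, P τ * fejer H (θ - τ) =
      ∫ v in (-(1 / 2) : ℝ)..(1 / 2), P (θ - v) * fejer H v := by
    have hp : Function.Periodic (fun τ => P τ * (fejer H (θ - τ) : ℂ)) 1 := by
      intro τ
      simp only [hper τ]
      have := fejer_periodic H (θ - (τ + 1))
      rw [show θ - (τ + 1) + 1 = θ - τ by ring] at this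
      rw [this]
    have h2 := hp.intervalIntegral_add_eq 0 (θ - 1 / 2)
    rw [zero_add] at h2
    rw [h2]
    have h3 := intervalIntegral.integral_comp_sub_left
      (fun τ => P τ * (fejer H (θ - τ) : ℂ)) θ (a := -(1 / 2)) (b := 1 / 2)
    simp only [sub_sub_cancel] at h3
    rw [h3]; congr 1; ring
  have h4 : P θ = ∫ v in (-(1 / 2) : ℝ)..(1 / 2), P θ * fejer H v := by
    rw [intervalIntegral.integral_const_mul, intervalIntegral.integral_ofReal]
    have := (fejer_periodic H).intervalIntegral_add_eq (-(1 / 2)) 0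
    rw [zero_add, integral_fejer H hH] at this
    rw [show (-(1 / 2) + 1 : ℝ) = 1 / 2 by norm_num] at this
    rw [this]; simp
  have c1 : Continuous fun v => P θ * (fejer H v : ℂ) := by fun_prop
  have c2 : Continuous fun v => P (θ - v) * (fejer H v : ℂ) := by fun_prop
  rw [h1]
  conv_lhs => rw [h4]
  rw [← intervalIntegral.integral_sub (c1.intervalIntegrable _ _) (c2.intervalIntegrable _ _)]
  calc _ ≤ ∫ v in (-(1 / 2) : ℝ)..(1 / 2), L * (|v| * fejer H v) := by
        refine intervalIntegral.norm_integral_le_of_norm_le (by norm_num) ?_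
          (Continuous.intervalIntegrable (by fun_prop) _ _)
        refine Filter.Eventually.of_forall fun v _ => ?_
        rw [← sub_mul, norm_mul, Complex.norm_real, Real.norm_of_nonneg (fejer_nonneg H v),
          ← mul_assoc]
        refine mul_le_mul_of_nonneg_right ?_ (fejer_nonneg H v)
        have := hL θ (θ - v)
        rwa [sub_sub_cancel] at this
    _ ≤ L * (1 / Real.sqrt H) := by
        rw [intervalIntegral.integral_const_mul]
        have hL0 : 0 ≤ L := by
          have := (norm_nonneg _).trans (hL 1 0); simpa using this
        exact mul_le_mul_of_nonneg_left (integral_abs_mul_fejer_le H hH) hL0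
    _ = _ := by ring

lemma fejer_mean_eq (H : ℕ) (P : ℝ → ℂ) (hP : Continuous P) (θ : ℝ) :
    ∫ τ in (0 : ℝ)..1, P τ * fejer H (θ - τ) =
      (H : ℂ)⁻¹ * ∑ p ∈ box H, eR (freq p * θ) *
        ∫ τ in (0 : ℝ)..1, P τ * eR (-(freq p * τ)) := by
  have h : ∀ τ : ℝ, P τ * (fejer H (θ - τ) : ℂ) =
      ∑ p ∈ box H, ((H : ℂ)⁻¹ * eR (freq p * θ)) * (P τ * eR (-(freq p * τ))) := by
    intro τ
    rw [fejer_eq, mul_left_comm, Finset.mul_sum, Finset.mul_sum]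
    refine Finset.sum_congr rfl fun p _ => ?_
    rw [mul_sub, sub_eq_add_neg, eR_add]; ring
  simp_rw [h]
  rw [intervalIntegral.integral_finsetSum, Finset.mul_sum]
  · refine Finset.sum_congr rfl fun p _ => ?_
    rw [intervalIntegral.integral_const_mul, mul_assoc]
  · intro i _
    exact Continuous.intervalIntegrable (by fun_prop) _ _

lemma norm_fejer_mean_le (H : ℕ) (hH : 0 < H) (P : ℝ → ℂ) (K : ℝ)
    (hK : ∀ s, ‖P s‖ ≤ K) (θ : ℝ) :
    ‖∫ τ in (0 : ℝ)..1, P τ * fejer H (θ - τ)‖ ≤ K := by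
  have h1 : ∫ τ in (0 : ℝ)..1, fejer H (θ - τ) = 1 := by
    rw [intervalIntegral.integral_comp_sub_left (fejer H) θ]
    have := (fejer_periodic H).intervalIntegral_add_eq (θ - 1) 0
    rw [zero_add, integral_fejer H hH, sub_add_cancel] at this
    rw [sub_zero]; exact this
  calc _ ≤ ∫ τ in (0 : ℝ)..1, K * fejer H (θ - τ) := by
        refine intervalIntegral.norm_integral_le_of_norm_le (by norm_num) ?_
          (Continuous.intervalIntegrable (by fun_prop) _ _)
        refine Filter.Eventually.of_forall fun v _ => ?_
        rw [norm_mul, Complex.norm_real, Real.norm_of_nonneg (fejer_nonneg H _)]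
        exact mul_le_mul_of_nonneg_right (hK v) (fejer_nonneg H _)
    _ = K := by rw [intervalIntegral.integral_const_mul, h1, mul_one]

/-- Exponential sums control averages of Lipschitz functions on the 2-torus. -/
lemma torus_average_le {ι : Type*} (s : Finset ι) (ph : ι → ℂ) (hph : ∀ i ∈ s, ‖ph i‖ ≤ 1)
    (θ y : ι → ℝ) (P : ℝ → ℝ → ℂ) (M L : ℝ) (H : ℕ) (hH : 0 < H)
    (hp1 : ∀ t u, P (t + 1) u = P t u) (hp2 : ∀ t u, P t (u + 1) = P t u)
    (hM : ∀ t u, ‖P t u‖ ≤ M)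
    (hL1 : ∀ t t' u, ‖P t u - P t' u‖ ≤ L * |t - t'|)
    (hL2 : ∀ t u u', ‖P t u - P t u'‖ ≤ L * |u - u'|) :
    ‖∑ i ∈ s, ph i * P (θ i) (y i) -
        (∑ i ∈ s, ph i) * ∫ u in (0 : ℝ)..1, ∫ t in (0 : ℝ)..1, P t u‖ ≤
      s.card * (2 * L / Real.sqrt H) + M / (H : ℝ) ^ 2 *
        ∑ p ∈ (box H ×ˢ box H).filter
            (fun p => ¬ (p.1.1 = p.1.2 ∧ p.2.1 = p.2.2)),
          ‖∑ i ∈ s, ph i * (eR (freq p.1 * θ i) * eR (freq p.2 * y i))‖ := by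
  have hL0 : 0 ≤ L := by simpa using (norm_nonneg _).trans (hL1 1 0 0)
  have hM0 : 0 ≤ M := (norm_nonneg _).trans (hM 0 0)
  have lip : ∀ (f : ℝ → ℂ), (∀ a b, ‖f a - f b‖ ≤ L * |a - b|) → Continuous f := by
    intro f hf
    refine (LipschitzWith.of_dist_le_mul (K := ⟨L, hL0⟩) fun a b => ?_).continuous
    rw [dist_eq_norm, Real.dist_eq]; exact hf a b
  have c1 : ∀ u, Continuous fun t => P t u := fun u => lip _ fun a b => hL1 a b u
  have c2 : ∀ t, Continuous fun u => P t u := fun t => lip _ fun a b => hL2 t a b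
  set A : ℝ → ℝ → ℂ := fun t u => ∫ τ in (0 : ℝ)..1, P τ u * fejer H (t - τ) with hA
  have AL : ∀ t u u', ‖A t u - A t u'‖ ≤ L * |u - u'| := by
    intro t u u'
    have i1 : ∀ u, IntervalIntegrable (fun τ => P τ u * (fejer H (t - τ) : ℂ)) volume 0 1 :=
      fun u => Continuous.intervalIntegrable (by have := c1 u; fun_prop) _ _
    rw [hA]; simp only
    rw [← intervalIntegral.integral_sub (i1 u) (i1 u')]
    simp_rw [← sub_mul]
    exact norm_fejer_mean_le H hH (fun τ => P τ u - P τ u') _ (fun τ => hL2 τ u u') t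
  have Ac : ∀ t, Continuous (A t) := fun t => lip _ (AL t)
  have Ap : ∀ t, Function.Periodic (A t) 1 := by
    intro t u; simp only [hA, hp2]
  set R := box H with hR
  set Q : ℕ × ℕ → ℝ → ℂ := fun p u =>
    ∫ τ in (0 : ℝ)..1, P τ u * eR (-(freq p * τ)) with hQ
  have QL : ∀ p u u', ‖Q p u - Q p u'‖ ≤ L * |u - u'| := by
    intro p u u'
    have i1 : ∀ u, IntervalIntegrable (fun τ => P τ u * eR (-(freq p * τ))) volume 0 1 :=
      fun u => Continuous.intervalIntegrable (by have := c1 u; fun_prop) _ _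
    rw [hQ]; simp only
    rw [← intervalIntegral.integral_sub (i1 u) (i1 u')]
    simp_rw [← sub_mul]
    exact norm_fourier_le (fun τ => hL2 τ u u') _
  have Qc : ∀ p, Continuous (Q p) := fun p => lip _ (QL p)
  have QM : ∀ p u, ‖Q p u‖ ≤ M := fun p u => norm_fourier_le (fun τ => hM τ u) _
  set cf : ℕ × ℕ → ℕ × ℕ → ℂ := fun p q =>
    ∫ u in (0 : ℝ)..1, Q p u * eR (-(freq q * u)) with hcf
  have cM : ∀ p q, ‖cf p q‖ ≤ M := fun p q => norm_fourier_le (QM p) _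
  set e : (ℕ × ℕ) × (ℕ × ℕ) → ι → ℂ := fun p i =>
    eR (freq p.1 * θ i) * eR (freq p.2 * y i) with he
  set B : ι → ℂ := fun i => ((H : ℂ) ^ 2)⁻¹ * ∑ p ∈ R ×ˢ R, e p i * cf p.1 p.2 with hB
  have hPB : ∀ i, ‖P (θ i) (y i) - B i‖ ≤ 2 * L / Real.sqrt H := by
    intro i
    have e1 := norm_sub_fejer_le H hH (fun t => P t (y i)) L (fun t => hp1 t _)
      (fun a b => hL1 a b _) (c1 _) (θ i)
    have e2 := norm_sub_fejer_le H hH (A (θ i)) L (Ap _) (AL _) (Ac _) (y i)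
    have e3 : ∫ τ in (0 : ℝ)..1, A (θ i) τ * fejer H (y i - τ) = B i := by
      rw [fejer_mean_eq H _ (Ac _)]
      have : ∀ u, A (θ i) u = ∑ p ∈ R, ((H : ℂ)⁻¹ * eR (freq p * θ i)) * Q p u := by
        intro u; simp only [hA]
        rw [fejer_mean_eq H (fun t => P t u) (c1 u), Finset.mul_sum]
        exact Finset.sum_congr rfl fun p _ => (mul_assoc _ _ _).symm
      simp_rw [this, Finset.sum_mul]
      have h2 : ∀ q : ℕ × ℕ, (∫ u in (0 : ℝ)..1,
          ∑ p ∈ R, ((H : ℂ)⁻¹ * eR (freq p * θ i)) * Q p u * eR (-(freq q * u))) =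
          ∑ p ∈ R, ((H : ℂ)⁻¹ * eR (freq p * θ i)) * cf p q := by
        intro q
        rw [intervalIntegral.integral_finsetSum]
        · refine Finset.sum_congr rfl fun p _ => ?_
          simp_rw [mul_assoc]
          rw [intervalIntegral.integral_const_mul, intervalIntegral.integral_const_mul]
        · intro p _
          exact Continuous.intervalIntegrable (by have := Qc p; fun_prop) _ _
      simp_rw [h2]
      simp only [hB]
      rw [← hR, Finset.sum_product_right (s := R) (t := R), Finset.mul_sum, Finset.mul_sum]
      refine Finset.sum_congr rfl fun q _ => ?_
      rw [Finset.mul_sum, Finset.mul_sum, Finset.mul_sum]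
      refine Finset.sum_congr rfl fun p _ => ?_
      simp only [he]; ring
    rw [e3] at e2
    calc ‖P (θ i) (y i) - B i‖ = ‖(P (θ i) (y i) - A (θ i) (y i)) + (A (θ i) (y i) - B i)‖ := by
          rw [sub_add_sub_cancel]
      _ ≤ L / Real.sqrt H + L / Real.sqrt H := (norm_add_le _ _).trans (add_le_add e1 e2)
      _ = _ := by ring
  set S := (R ×ˢ R).filter (fun p => ¬ (p.1.1 = p.1.2 ∧ p.2.1 = p.2.2)) with hS
  set D := (R ×ˢ R).filter (fun p => (p.1.1 = p.1.2 ∧ p.2.1 = p.2.2)) with hD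
  set I := ∫ u in (0 : ℝ)..1, ∫ t in (0 : ℝ)..1, P t u with hI
  have hDe : ∀ i, ∑ p ∈ D, e p i * cf p.1 p.2 = (H : ℂ) ^ 2 * I := by
    intro i
    have h1 : ∀ p ∈ D, e p i * cf p.1 p.2 = I := by
      intro p hp
      obtain ⟨h1, h2⟩ := (Finset.mem_filter.mp hp).2
      simp [he, hcf, hQ, hI, h1, h2]
    rw [Finset.sum_congr rfl h1, Finset.sum_const]
    have : D.card = H ^ 2 := by
      have : D = (box H).image
          (fun p => ((p.1, p.1), (p.2, p.2))) := by
        ext ⟨⟨a, b⟩, c, d⟩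
        simp only [hD, hR, Finset.mem_filter, Finset.mem_product, Finset.mem_image, Prod.mk.injEq,
          Prod.exists]
        constructor
        · rintro ⟨⟨⟨h1, -⟩, h2, -⟩, rfl, rfl⟩; exact ⟨a, c, ⟨h1, h2⟩, ⟨rfl, rfl⟩, rfl, rfl⟩
        · rintro ⟨a, c, ⟨h1, h2⟩, ⟨rfl, rfl⟩, rfl, rfl⟩; exact ⟨⟨⟨h1, h1⟩, h2, h2⟩, rfl, rfl⟩
      rw [this, Finset.card_image_of_injective]
      · simp [sq]
      · rintro ⟨a, b⟩ ⟨c, d⟩ h; simp at h; simp [h]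
    rw [this]; simp
  have hH0 : (H : ℂ) ≠ 0 := by exact_mod_cast hH.ne'
  have hBs : ∑ i ∈ s, ph i * B i = (∑ i ∈ s, ph i) * I +
      ((H : ℂ) ^ 2)⁻¹ * ∑ p ∈ S, cf p.1 p.2 * ∑ i ∈ s, ph i * e p i := by
    have h1 : ∀ i, B i = I + ((H : ℂ) ^ 2)⁻¹ * ∑ p ∈ S, e p i * cf p.1 p.2 := by
      intro i
      simp only [hB]
      rw [← Finset.sum_filter_add_sum_filter_not (R ×ˢ R)
        (fun p => p.1.1 = p.1.2 ∧ p.2.1 = p.2.2), hDe, mul_add, ← mul_assoc,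
        inv_mul_cancel₀ (pow_ne_zero 2 hH0), one_mul]
    simp_rw [h1, mul_add, Finset.sum_add_distrib, ← Finset.sum_mul]
    congr 1
    simp_rw [Finset.mul_sum]
    rw [Finset.sum_comm]
    refine Finset.sum_congr rfl fun p _ => Finset.sum_congr rfl fun i _ => ?_
    ring
  have hsplit : ∑ i ∈ s, ph i * P (θ i) (y i) - (∑ i ∈ s, ph i) * I =
      ∑ i ∈ s, ph i * (P (θ i) (y i) - B i) +
        ((H : ℂ) ^ 2)⁻¹ * ∑ p ∈ S, cf p.1 p.2 * ∑ i ∈ s, ph i * e p i := by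
    simp_rw [mul_sub, Finset.sum_sub_distrib]
    rw [hBs]; ring
  rw [hsplit]
  refine (norm_add_le _ _).trans (add_le_add ?_ ?_)
  · calc _ ≤ ∑ i ∈ s, ‖ph i * (P (θ i) (y i) - B i)‖ := norm_sum_le _ _
      _ ≤ ∑ i ∈ s, (2 * L / Real.sqrt H) := Finset.sum_le_sum fun i hi => by
          rw [norm_mul]
          calc _ ≤ 1 * (2 * L / Real.sqrt H) := by
                gcongr
                · exact hph i hi
                · exact hPB i
            _ = _ := one_mul _
      _ = _ := by simp
  · rw [norm_mul, norm_inv, norm_pow, Complex.norm_natCast, div_eq_inv_mul, mul_assoc]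
    gcongr
    rw [Finset.mul_sum]
    refine (norm_sum_le _ _).trans (Finset.sum_le_sum fun p _ => ?_)
    rw [norm_mul]
    gcongr
    exact cM _ _

/-! ### Elementary facts about `SL₂(ℝ)` -/

/-- The matrix `[[a, b], [c, d]]` of determinant one. -/
def mk2 (a b c d : ℝ) (h : a * d - b * c = 1) : SL2R :=
  ⟨!![a, b; c, d], by rw [Matrix.det_fin_two_of]; exact h⟩

/-- The embedding of `SL₂(ℤ)`. -/
def zSL (γ : Matrix.SpecialLinearGroup (Fin 2) ℤ) : SL2R :=
  Matrix.SpecialLinearGroup.map (Int.castRingHom ℝ) γ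

lemma zSL_mem (γ : Matrix.SpecialLinearGroup (Fin 2) ℤ) : zSL γ ∈ Γℤ := ⟨γ, rfl⟩

lemma zSL_apply (γ : Matrix.SpecialLinearGroup (Fin 2) ℤ) (i j : Fin 2) :
    (zSL γ).1 i j = (γ.1 i j : ℝ) := rfl

lemma zSL_mul (γ δ : Matrix.SpecialLinearGroup (Fin 2) ℤ) : zSL (γ * δ) = zSL γ * zSL δ :=
  map_mul _ _ _

lemma zSL_inv (γ : Matrix.SpecialLinearGroup (Fin 2) ℤ) : zSL γ⁻¹ = (zSL γ)⁻¹ :=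
  map_inv _ _

lemma SL2R_ext {g h : SL2R} (h00 : g.1 0 0 = h.1 0 0) (h01 : g.1 0 1 = h.1 0 1)
    (h10 : g.1 1 0 = h.1 1 0) (h11 : g.1 1 1 = h.1 1 1) : g = h := by
  apply Subtype.ext
  ext i j
  fin_cases i <;> fin_cases j <;> assumption

lemma SL2R_det (g : SL2R) : g.1 0 0 * g.1 1 1 - g.1 0 1 * g.1 1 0 = 1 := by
  rw [← Matrix.det_fin_two]; exact g.2

lemma mul_apply2 (g h : SL2R) (i j : Fin 2) :
    (g * h).1 i j = g.1 i 0 * h.1 0 j + g.1 i 1 * h.1 1 j := by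
  change (g.1 * h.1) i j = _
  rw [Matrix.mul_apply, Fin.sum_univ_two]

lemma inv_apply2 (g : SL2R) : (g⁻¹).1 = !![g.1 1 1, -g.1 0 1; -g.1 1 0, g.1 0 0] :=
  congrArg Subtype.val (Matrix.SpecialLinearGroup.SL2_inv_expl g)

lemma inv_00 (g : SL2R) : (g⁻¹).1 0 0 = g.1 1 1 := by rw [inv_apply2]; rfl
lemma inv_01 (g : SL2R) : (g⁻¹).1 0 1 = -g.1 0 1 := by rw [inv_apply2]; rfl
lemma inv_10 (g : SL2R) : (g⁻¹).1 1 0 = -g.1 1 0 := by rw [inv_apply2]; rfl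
lemma inv_11 (g : SL2R) : (g⁻¹).1 1 1 = g.1 0 0 := by rw [inv_apply2]; rfl

lemma matSup_le_iff {A : Matrix (Fin 2) (Fin 2) ℝ} {x : ℝ} :
    matSup A ≤ x ↔ |A 0 0| ≤ x ∧ |A 0 1| ≤ x ∧ |A 1 0| ≤ x ∧ |A 1 1| ≤ x := by
  simp [matSup, and_assoc]

lemma abs_le_matSup (A : Matrix (Fin 2) (Fin 2) ℝ) (i j : Fin 2) : |A i j| ≤ matSup A := by
  have h := (matSup_le_iff (A := A)).mp le_rfl
  fin_cases i <;> fin_cases j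
  · exact h.1
  · exact h.2.1
  · exact h.2.2.1
  · exact h.2.2.2

lemma matSup_nonneg (A : Matrix (Fin 2) (Fin 2) ℝ) : 0 ≤ matSup A :=
  (abs_nonneg _).trans (abs_le_matSup A 0 0)

lemma matSup_mul_le (A B : Matrix (Fin 2) (Fin 2) ℝ) : matSup (A * B) ≤ 2 * matSup A * matSup B := by
  have key : ∀ i j, |(A * B) i j| ≤ 2 * matSup A * matSup B := by
    intro i j
    rw [Matrix.mul_apply, Fin.sum_univ_two]
    have h : ∀ k, |A i k * B k j| ≤ matSup A * matSup B := fun k => by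
      rw [abs_mul]
      exact mul_le_mul (abs_le_matSup _ _ _) (abs_le_matSup _ _ _) (abs_nonneg _) (matSup_nonneg _)
    refine (abs_add_le _ _).trans ?_
    linarith [h 0, h 1]
  exact matSup_le_iff.mpr ⟨key _ _, key _ _, key _ _, key _ _⟩

lemma matSup_inv (g : SL2R) : matSup (g⁻¹).1 = matSup g.1 := by
  have key : ∀ h : SL2R, matSup (h⁻¹).1 ≤ matSup h.1 := fun h => by
    rw [matSup_le_iff, inv_00, inv_01, inv_10, inv_11, abs_neg, abs_neg]
    exact ⟨abs_le_matSup _ _ _, abs_le_matSup _ _ _, abs_le_matSup _ _ _, abs_le_matSup _ _ _⟩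
  refine le_antisymm (key g) ?_
  conv_lhs => rw [← inv_inv g]
  exact key _

lemma matSup_pos (g : SL2R) : 1 ≤ 2 * matSup g.1 ^ 2 := by
  have h := SL2R_det g
  have h1 : |g.1 0 0 * g.1 1 1| ≤ matSup g.1 ^ 2 := by
    rw [abs_mul, sq]
    exact mul_le_mul (abs_le_matSup _ _ _) (abs_le_matSup _ _ _) (abs_nonneg _) (matSup_nonneg _)
  have h2 : |g.1 0 1 * g.1 1 0| ≤ matSup g.1 ^ 2 := by
    rw [abs_mul, sq]
    exact mul_le_mul (abs_le_matSup _ _ _) (abs_le_matSup _ _ _) (abs_nonneg _) (matSup_nonneg _)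
  have := abs_le.mp h1; have := abs_le.mp h2
  linarith

lemma half_le_matSup (g : SL2R) : 1 / 2 ≤ matSup g.1 := by
  nlinarith [matSup_pos g, matSup_nonneg g.1]

lemma matSup_add_le (A B : Matrix (Fin 2) (Fin 2) ℝ) : matSup (A + B) ≤ matSup A + matSup B := by
  have key : ∀ i j, |(A + B) i j| ≤ matSup A + matSup B := fun i j =>
    (abs_add_le _ _).trans (add_le_add (abs_le_matSup _ _ _) (abs_le_matSup _ _ _))
  exact matSup_le_iff.mpr ⟨key _ _, key _ _, key _ _, key _ _⟩

lemma matSup_one : matSup (1 : Matrix (Fin 2) (Fin 2) ℝ) = 1 := by simp [matSup]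

/-- Conjugation: `h⁻¹ k h - 1 = h⁻¹ (k - 1) h`. -/
lemma matSup_conj_sub_one_le (h k : SL2R) :
    matSup ((h⁻¹ * k * h).1 - 1) ≤ 4 * matSup h.1 ^ 2 * matSup (k.1 - 1) := by
  have e : (h⁻¹ * k * h).1 - 1 = (h⁻¹).1 * (k.1 - 1) * h.1 := by
    have : (h⁻¹).1 * h.1 = 1 := by
      have := congrArg Subtype.val (inv_mul_cancel h); exact this
    rw [mul_sub, sub_mul, mul_one, this]; rfl
  rw [e]
  calc _ ≤ 2 * matSup ((h⁻¹).1 * (k.1 - 1)) * matSup h.1 := matSup_mul_le _ _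
    _ ≤ 2 * (2 * matSup (h⁻¹).1 * matSup (k.1 - 1)) * matSup h.1 := by
        have := matSup_nonneg h.1
        gcongr
        exact matSup_mul_le _ _
    _ = _ := by rw [matSup_inv]; ring

/-! ### The lattice-sum partition of unity -/

/-- The bump function on the plane. -/
def bump (x y : ℝ) : ℝ := max 0 (3 - max |x| |y|)

lemma bump_nonneg (x y : ℝ) : 0 ≤ bump x y := le_max_left _ _

lemma bump_eq_zero_iff (x y : ℝ) : bump x y = 0 ↔ 3 ≤ max |x| |y| := by
  unfold bump; rw [max_eq_left_iff]; constructor <;> intro h <;> linarith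

lemma bump_neg (x y : ℝ) : bump (-x) (-y) = bump x y := by simp [bump]

lemma abs_bump_sub_le (x y x' y' : ℝ) : |bump x y - bump x' y'| ≤ max |x - x'| |y - y'| := by
  unfold bump
  calc _ ≤ max |(0 : ℝ) - 0| |(3 - max |x| |y|) - (3 - max |x'| |y'|)| := abs_max_sub_max_le_max _ _ _ _
    _ ≤ max |x - x'| |y - y'| := by
        rw [sub_self, abs_zero]
        refine max_le ((abs_nonneg _).trans (le_max_left _ _)) ?_
        rw [sub_sub_sub_cancel_left, abs_sub_comm]
        refine (abs_max_sub_max_le_max _ _ _ _).trans (max_le_max ?_ ?_) <;>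
        exact abs_abs_sub_abs_le _ _

/-- The first coordinate of `v g`. -/
def row0 (v : ℤ × ℤ) (g : SL2R) : ℝ := v.1 * g.1 0 0 + v.2 * g.1 1 0
/-- The second coordinate of `v g`. -/
def row1 (v : ℤ × ℤ) (g : SL2R) : ℝ := v.1 * g.1 0 1 + v.2 * g.1 1 1

lemma row_bound (v : ℤ × ℤ) (g : SL2R) (K : ℝ) (h0 : |row0 v g| ≤ K) (h1 : |row1 v g| ≤ K) :
    |(v.1 : ℝ)| ≤ 2 * K * matSup g.1 ∧ |(v.2 : ℝ)| ≤ 2 * K * matSup g.1 := by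
  have hd := SL2R_det g
  have hK : 0 ≤ K := (abs_nonneg _).trans h0
  have key : ∀ x y i j k l, |x| ≤ K → |y| ≤ K → |x * g.1 i j - y * g.1 k l| ≤ 2 * K * matSup g.1 := by
    intro x y i j k l hx hy
    calc _ ≤ |x * g.1 i j| + |y * g.1 k l| := abs_sub _ _
      _ ≤ K * matSup g.1 + K * matSup g.1 := by
          rw [abs_mul, abs_mul]
          gcongr <;> exact abs_le_matSup _ _ _
      _ = _ := by ring
  constructor
  · have e : (v.1 : ℝ) = row0 v g * g.1 1 1 - row1 v g * g.1 1 0 := by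
      unfold row0 row1; linear_combination (-(v.1 : ℝ)) * hd
    rw [e]; exact key _ _ _ _ _ _ h0 h1
  · have e : (v.2 : ℝ) = row1 v g * g.1 0 0 - row0 v g * g.1 0 1 := by
      unfold row0 row1; linear_combination (-(v.2 : ℝ)) * hd
    rw [e]; exact key _ _ _ _ _ _ h1 h0

/-- The term of the lattice sum. -/
def latTerm (g : SL2R) (v : ℤ × ℤ) : ℝ :=
  if IsCoprime v.1 v.2 then bump (row0 v g) (row1 v g) else 0

lemma latTerm_nonneg (g : SL2R) (v : ℤ × ℤ) : 0 ≤ latTerm g v := by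
  unfold latTerm; split_ifs; exacts [bump_nonneg _ _, le_rfl]

/-- The box of integer vectors `v` with `|vᵢ| ≤ Z`. -/
def zBox (Z : ℕ) : Finset (ℤ × ℤ) := Finset.Icc (-Z : ℤ) Z ×ˢ Finset.Icc (-Z : ℤ) Z

lemma card_zBox (Z : ℕ) : (zBox Z).card = (2 * Z + 1) ^ 2 := by
  simp only [zBox, Finset.card_product, Int.card_Icc, sq]; congr 1 <;> omega

lemma mem_zBox {v : ℤ × ℤ} {Z : ℕ} (h : |(v.1 : ℝ)| ≤ Z ∧ |(v.2 : ℝ)| ≤ Z) : v ∈ zBox Z := by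
  simp only [zBox, Finset.mem_product, Finset.mem_Icc]
  have h1 := abs_le.mp h.1; have h2 := abs_le.mp h.2
  exact ⟨⟨by exact_mod_cast h1.1, by exact_mod_cast h1.2⟩,
    by exact_mod_cast h2.1, by exact_mod_cast h2.2⟩

lemma latTerm_eq_zero (g : SL2R) (Z : ℕ) (hZ : 6 * matSup g.1 ≤ Z) (v : ℤ × ℤ) (hv : v ∉ zBox Z) :
    latTerm g v = 0 := by
  unfold latTerm; split_ifs with hc
  · rw [bump_eq_zero_iff]
    by_contra! hlt
    obtain ⟨h0, h1⟩ := max_lt_iff.mp hlt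
    obtain ⟨a, b⟩ := row_bound v g 3 h0.le h1.le
    exact hv (mem_zBox ⟨by linarith, by linarith⟩)
  · rfl

/-- The lattice sum over primitive vectors. -/
def latSum (g : SL2R) : ℝ := ∑' v : ℤ × ℤ, latTerm g v

lemma latSum_eq (g : SL2R) (Z : ℕ) (hZ : 6 * matSup g.1 ≤ Z) :
    latSum g = ∑ v ∈ zBox Z, latTerm g v :=
  tsum_eq_sum fun v hv => latTerm_eq_zero g Z hZ v hv

lemma summable_latTerm (g : SL2R) : Summable (latTerm g) := by
  obtain ⟨Z, hZ⟩ := exists_nat_ge (6 * matSup g.1)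
  exact summable_of_ne_finset_zero fun v hv => latTerm_eq_zero g Z hZ v hv

lemma latTerm_le_latSum (g : SL2R) (v : ℤ × ℤ) : latTerm g v ≤ latSum g :=
  (summable_latTerm g).le_tsum v fun w _ => latTerm_nonneg g w

/-- Right multiplication by an element of `SL₂(ℤ)` on integer row vectors. -/
def rowEquiv (γ : Matrix.SpecialLinearGroup (Fin 2) ℤ) : ℤ × ℤ ≃ ℤ × ℤ where
  toFun v := (v.1 * γ.1 0 0 + v.2 * γ.1 1 0, v.1 * γ.1 0 1 + v.2 * γ.1 1 1)
  invFun v := (v.1 * γ.1 1 1 - v.2 * γ.1 1 0, - v.1 * γ.1 0 1 + v.2 * γ.1 0 0)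
  left_inv v := by
    have h := γ.2; rw [Matrix.det_fin_two] at h
    ext
    · simp only; linear_combination v.1 * h
    · simp only; linear_combination v.2 * h
  right_inv v := by
    have h := γ.2; rw [Matrix.det_fin_two] at h
    ext
    · simp only; linear_combination v.1 * h
    · simp only; linear_combination v.2 * h

lemma isCoprime_rowEquiv_of (γ : Matrix.SpecialLinearGroup (Fin 2) ℤ) (v : ℤ × ℤ)
    (hv : IsCoprime v.1 v.2) : IsCoprime (rowEquiv γ v).1 (rowEquiv γ v).2 := by
  have h := γ.2; rw [Matrix.det_fin_two] at h
  obtain ⟨x, y, hxy⟩ := hv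
  refine ⟨x * γ.1 1 1 - y * γ.1 0 1, -x * γ.1 1 0 + y * γ.1 0 0, ?_⟩
  simp only [rowEquiv, Equiv.coe_fn_mk]
  linear_combination (x * v.1 + y * v.2) * h + hxy

lemma rowEquiv_symm (γ : Matrix.SpecialLinearGroup (Fin 2) ℤ) (v : ℤ × ℤ) :
    (rowEquiv γ).symm v = rowEquiv γ⁻¹ v := by
  have e : (γ⁻¹).1 = !![γ.1 1 1, -γ.1 0 1; -γ.1 1 0, γ.1 0 0] :=
    congrArg Subtype.val (Matrix.SpecialLinearGroup.SL2_inv_expl γ)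
  ext
  · simp [rowEquiv, e]; ring
  · simp [rowEquiv, e]

lemma isCoprime_rowEquiv (γ : Matrix.SpecialLinearGroup (Fin 2) ℤ) (v : ℤ × ℤ) :
    IsCoprime (rowEquiv γ v).1 (rowEquiv γ v).2 ↔ IsCoprime v.1 v.2 := by
  refine ⟨fun h => ?_, isCoprime_rowEquiv_of γ v⟩
  have := isCoprime_rowEquiv_of γ⁻¹ _ h
  rwa [← rowEquiv_symm, Equiv.symm_apply_apply] at this

lemma latTerm_mul (γ : Matrix.SpecialLinearGroup (Fin 2) ℤ) (g : SL2R) (v : ℤ × ℤ) :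
    latTerm (zSL γ * g) v = latTerm g (rowEquiv γ v) := by
  unfold latTerm
  simp only [isCoprime_rowEquiv]
  congr 2
  · simp only [row0, mul_apply2, zSL_apply, rowEquiv, Equiv.coe_fn_mk]; push_cast; ring
  · simp only [row1, mul_apply2, zSL_apply, rowEquiv, Equiv.coe_fn_mk]; push_cast; ring

lemma latSum_mul (γ : Matrix.SpecialLinearGroup (Fin 2) ℤ) (g : SL2R) :
    latSum (zSL γ * g) = latSum g := by
  unfold latSum
  simp_rw [latTerm_mul]
  exact (rowEquiv γ).tsum_eq (latTerm g)

/-- Reduction theory: every `g` has a representative with short and almost orthogonal rows. -/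
lemma exists_reduced (g : SL2R) : ∃ γ : Matrix.SpecialLinearGroup (Fin 2) ℤ,
    (zSL γ * g).1 1 0 ^ 2 + (zSL γ * g).1 1 1 ^ 2 ≤ 4 / 3 ∧
    |(zSL γ * g).1 0 0 * (zSL γ * g).1 1 0 + (zSL γ * g).1 0 1 * (zSL γ * g).1 1 1| ≤
      1 / 2 * ((zSL γ * g).1 1 0 ^ 2 + (zSL γ * g).1 1 1 ^ 2) := by
  obtain ⟨γ, hγ⟩ := ModularGroup.exists_smul_mem_fd (g • UpperHalfPlane.I)
  refine ⟨γ, ?_⟩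
  set h := zSL γ * g with hh
  have e0 : γ • g • UpperHalfPlane.I = h • UpperHalfPlane.I := by
    rw [hh, mul_smul]; rfl
  rw [e0] at hγ
  have hd := SL2R_det h
  have e : ((h • UpperHalfPlane.I : UpperHalfPlane) : ℂ) =
      (h.1 0 0 * Complex.I + h.1 0 1) / (h.1 1 0 * Complex.I + h.1 1 1) := by
    rw [UpperHalfPlane.coe_specialLinearGroup_apply]; simp
  set N := h.1 1 0 ^ 2 + h.1 1 1 ^ 2 with hN
  have hN0 : 0 < N := by
    by_contra hc
    have h1 : h.1 1 0 = 0 := by nlinarith [sq_nonneg (h.1 1 0), sq_nonneg (h.1 1 1)]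
    have h2 : h.1 1 1 = 0 := by nlinarith [sq_nonneg (h.1 1 0), sq_nonneg (h.1 1 1)]
    rw [h1, h2] at hd; simp at hd
  have him : (h • UpperHalfPlane.I).im = 1 / N := by
    rw [← UpperHalfPlane.coe_im, e, Complex.div_im, Complex.normSq_apply]
    simp
    rw [show h.1 1 1 * h.1 1 1 + h.1 1 0 * h.1 1 0 = N by rw [hN]; ring, ← sub_div]
    exact (congrArg (· / N) hd).trans (one_div N)
  have hre : (h • UpperHalfPlane.I).re = (h.1 0 0 * h.1 1 0 + h.1 0 1 * h.1 1 1) / N := by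
    rw [← UpperHalfPlane.coe_re, e, Complex.div_re, Complex.normSq_apply]
    simp
    rw [show h.1 1 1 * h.1 1 1 + h.1 1 0 * h.1 1 0 = N by rw [hN]; ring]
    ring
  have h3 := ModularGroup.three_le_four_mul_im_sq_of_mem_fd hγ
  have h4 := hγ.2
  rw [him] at h3
  rw [hre, abs_div, abs_of_pos hN0, div_le_iff₀ hN0] at h4
  refine ⟨?_, h4⟩
  rw [div_pow, one_pow, mul_one_div, le_div_iff₀ (by positivity)] at h3
  nlinarith

lemma bump_ge_one {x y : ℝ} (h : x ^ 2 + y ^ 2 ≤ 4) : 1 ≤ bump x y := by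
  have hx : |x| ≤ 2 := abs_le_of_sq_le_sq (by nlinarith [sq_nonneg y]) (by norm_num)
  have hy : |y| ≤ 2 := abs_le_of_sq_le_sq (by nlinarith [sq_nonneg x]) (by norm_num)
  unfold bump
  exact le_max_of_le_right (by linarith [max_le hx hy])

lemma one_le_latSum (g : SL2R) : 1 ≤ latSum g := by
  obtain ⟨γ, h, -⟩ := exists_reduced g
  rw [← latSum_mul γ g]
  refine le_trans ?_ (latTerm_le_latSum _ (0, 1))
  have : IsCoprime (0 : ℤ) 1 := ⟨0, 1, by norm_num⟩
  simp only [latTerm, row0, row1, this, if_true]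
  simp only [Int.cast_zero, Int.cast_one, zero_mul, one_mul, zero_add]
  exact bump_ge_one (by linarith)

lemma abs_latTerm_sub_le (g k : SL2R) (hk : matSup (k.1 - 1) ≤ 1) (v : ℤ × ℤ) :
    |latTerm (g * k) v - latTerm g v| ≤ 24 * matSup (k.1 - 1) := by
  have hk0 := matSup_nonneg (k.1 - 1)
  unfold latTerm
  split_ifs with hc
  swap
  · simp; exact hk0
  have en : ∀ i j, |k.1 i j - (1 : Matrix (Fin 2) (Fin 2) ℝ) i j| ≤ matSup (k.1 - 1) := fun i j =>
    abs_le_matSup (k.1 - 1) i j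
  have n00 := en 0 0
  have n01 := en 0 1
  have n10 := en 1 0
  have n11 := en 1 1
  simp at n00 n01 n10 n11
  set ε := matSup (k.1 - 1)
  by_cases hz : bump (row0 v (g * k)) (row1 v (g * k)) = 0 ∧ bump (row0 v g) (row1 v g) = 0
  · rw [hz.1, hz.2]; simp; exact hk0
  have e0 : row0 v (g * k) = row0 v g * k.1 0 0 + row1 v g * k.1 1 0 := by
    simp only [row0, row1, mul_apply2]; ring
  have e1 : row1 v (g * k) = row0 v g * k.1 0 1 + row1 v g * k.1 1 1 := by
    simp only [row0, row1, mul_apply2]; ring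
  have hd := SL2R_det k
  have hK : |row0 v g| ≤ 12 ∧ |row1 v g| ≤ 12 := by
    by_cases hb : bump (row0 v g) (row1 v g) = 0
    · have hb' : bump (row0 v (g * k)) (row1 v (g * k)) ≠ 0 := fun h => hz ⟨h, hb⟩
      rw [Ne, bump_eq_zero_iff, not_le, max_lt_iff] at hb'
      obtain ⟨q0, q1⟩ := hb'
      have f0 : row0 v g = row0 v (g * k) * k.1 1 1 - row1 v (g * k) * k.1 1 0 := by
        rw [e0, e1]; linear_combination (-(row0 v g)) * hd
      have f1 : row1 v g = row1 v (g * k) * k.1 0 0 - row0 v (g * k) * k.1 0 1 := by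
        rw [e0, e1]; linear_combination (-(row1 v g)) * hd
      have k2 : ∀ x y z w : ℝ, |x| < 3 → |y| < 3 → |z| ≤ 2 → |w| ≤ 2 → |x * z - y * w| ≤ 12 := by
        intro x y z w hx hy hz hw
        calc _ ≤ |x * z| + |y * w| := abs_sub _ _
          _ ≤ 3 * 2 + 3 * 2 := by rw [abs_mul, abs_mul]; gcongr
          _ = 12 := by norm_num
      have b00 : |k.1 0 0| ≤ 2 := by
        have := abs_le.mp n00; rw [abs_le]; constructor <;> linarith
      have b11 : |k.1 1 1| ≤ 2 := by
        have := abs_le.mp n11; rw [abs_le]; constructor <;> linarith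
      rw [f0, f1]
      exact ⟨k2 _ _ _ _ q0 q1 b11 (by linarith), k2 _ _ _ _ q1 q0 b00 (by linarith)⟩
    · rw [bump_eq_zero_iff, not_le, max_lt_iff] at hb
      exact ⟨by linarith [hb.1], by linarith [hb.2]⟩
  refine (abs_bump_sub_le _ _ _ _).trans ?_
  have k3 : ∀ z w : ℝ, |z| ≤ ε → |w| ≤ ε → |row0 v g * z + row1 v g * w| ≤ 24 * ε := by
    intro z w hz hw
    calc _ ≤ |row0 v g * z| + |row1 v g * w| := abs_add_le _ _
      _ ≤ 12 * ε + 12 * ε := by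
        rw [abs_mul, abs_mul]
        have := hK.1; have := hK.2
        gcongr
      _ = 24 * ε := by ring
  refine max_le ?_ ?_
  · rw [show row0 v (g * k) - row0 v g = row0 v g * (k.1 0 0 - 1) + row1 v g * k.1 1 0 by
      rw [e0]; ring]
    exact k3 _ _ n00 n10
  · rw [show row1 v (g * k) - row1 v g = row0 v g * k.1 0 1 + row1 v g * (k.1 1 1 - 1) by
      rw [e1]; ring]
    exact k3 _ _ n01 n11

lemma matSup_le_of_sub_one (k : SL2R) (hk : matSup (k.1 - 1) ≤ 1) : matSup k.1 ≤ 2 := by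
  have := matSup_add_le (k.1 - 1) 1
  rw [sub_add_cancel, matSup_one] at this
  linarith

lemma abs_latSum_sub_le (g k : SL2R) (hk : matSup (k.1 - 1) ≤ 1) :
    |latSum (g * k) - latSum g| ≤ 24 * (60 * matSup g.1) ^ 2 * matSup (k.1 - 1) := by
  have hg := half_le_matSup g
  have hk0 := matSup_nonneg (k.1 - 1)
  have hgk : matSup (g * k).1 ≤ 4 * matSup g.1 := by
    have h1 := matSup_mul_le g.1 k.1
    have h2 := matSup_le_of_sub_one k hk
    calc _ ≤ 2 * matSup g.1 * matSup k.1 := h1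
      _ ≤ 2 * matSup g.1 * 2 := by gcongr
      _ = _ := by ring
  set Z := ⌈24 * matSup g.1⌉₊ with hZ
  have hZ1 : 24 * matSup g.1 ≤ Z := Nat.le_ceil _
  have hZ2 : (Z : ℝ) < 24 * matSup g.1 + 1 := Nat.ceil_lt_add_one (by linarith)
  rw [latSum_eq (g * k) Z (by linarith), latSum_eq g Z (by linarith), ← Finset.sum_sub_distrib]
  calc _ ≤ ∑ v ∈ zBox Z, |latTerm (g * k) v - latTerm g v| := Finset.abs_sum_le_sum_abs _ _
    _ ≤ ∑ v ∈ zBox Z, 24 * matSup (k.1 - 1) :=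
        Finset.sum_le_sum fun v _ => abs_latTerm_sub_le g k hk v
    _ = ((2 * Z + 1 : ℕ) : ℝ) ^ 2 * (24 * matSup (k.1 - 1)) := by
        rw [Finset.sum_const, card_zBox, nsmul_eq_mul]; push_cast; ring
    _ ≤ (60 * matSup g.1) ^ 2 * (24 * matSup (k.1 - 1)) := by
        gcongr
        push_cast; linarith
    _ = _ := by ring

/-- The weight of the bottom row in the partition of unity. -/
def rho (g : SL2R) : ℝ := bump (g.1 1 0) (g.1 1 1) / latSum g

lemma rho_nonneg (g : SL2R) : 0 ≤ rho g :=
  div_nonneg (bump_nonneg _ _) (zero_le_one.trans (one_le_latSum g))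

lemma bump_eq_latTerm (g : SL2R) : bump (g.1 1 0) (g.1 1 1) = latTerm g (0, 1) := by
  have : IsCoprime (0 : ℤ) 1 := ⟨0, 1, by norm_num⟩
  simp [latTerm, row0, row1, this]

lemma rho_le_one (g : SL2R) : rho g ≤ 1 := by
  unfold rho
  rw [div_le_one (by linarith [one_le_latSum g]), bump_eq_latTerm]
  exact latTerm_le_latSum _ _

lemma rho_eq_zero (g : SL2R) (h : 3 ≤ max |g.1 1 0| |g.1 1 1|) : rho g = 0 := by
  unfold rho; rw [(bump_eq_zero_iff _ _).mpr h, zero_div]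

lemma abs_rho_sub_le (g k : SL2R) :
    |rho (g * k) - rho g| ≤ 10 ^ 6 * matSup g.1 ^ 2 * matSup (k.1 - 1) := by
  have hg := matSup_pos g
  have hk0 := matSup_nonneg (k.1 - 1)
  rcases le_or_gt (matSup (k.1 - 1)) 1 with hk | hk
  · have h1 := abs_latSum_sub_le g k hk
    have h2 := abs_latTerm_sub_le g k hk (0, 1)
    rw [← bump_eq_latTerm, ← bump_eq_latTerm] at h2
    have a1 := one_le_latSum g
    have a2 := one_le_latSum (g * k)
    have b1 := rho_nonneg g
    have b2 := rho_le_one g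
    unfold rho at b1 b2 ⊢
    set x := bump (g.1 1 0) (g.1 1 1)
    set x' := bump ((g * k).1 1 0) ((g * k).1 1 1)
    set Y := latSum g
    set Y' := latSum (g * k)
    have e : x' / Y' - x / Y = ((x' - x) - (x / Y) * (Y' - Y)) / Y' := by
      have : Y ≠ 0 := by linarith
      have : Y' ≠ 0 := by linarith
      field_simp; ring
    rw [e, abs_div, abs_of_pos (a := Y') (by linarith)]
    refine (div_le_self (abs_nonneg _) a2).trans ((abs_sub _ _).trans ?_)
    rw [abs_mul, abs_of_nonneg b1]
    have : x / Y * |Y' - Y| ≤ 1 * |Y' - Y| := by gcongr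
    nlinarith
  · have a1 := rho_nonneg g; have a2 := rho_le_one g
    have a3 := rho_nonneg (g * k); have a4 := rho_le_one (g * k)
    have : |rho (g * k) - rho g| ≤ 1 := by rw [abs_le]; constructor <;> linarith
    nlinarith

/-- The partition of unity. -/
lemma tsum_latTerm_div (g : SL2R) : ∑' v, latTerm g v / latSum g = 1 := by
  rw [tsum_div_const]
  exact div_self (zero_lt_one.trans_le (one_le_latSum g)).ne'

lemma rho_mul_eq (γ : Matrix.SpecialLinearGroup (Fin 2) ℤ) (g : SL2R) :
    rho (zSL γ * g) = latTerm g (γ.1 1 0, γ.1 1 1) / latSum g := by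
  unfold rho
  rw [latSum_mul, bump_eq_latTerm, latTerm_mul]
  simp [rowEquiv]

/-! ### The chart -/

/-- The element of `SL₂(ℝ)` with bottom row `(w₁, w₂)` and quotient `Y` of the first column
(junk value `1` if `w₁ = 0`). -/
def gp (w₁ w₂ Y : ℝ) : SL2R :=
  if h : w₁ = 0 then 1 else mk2 (Y * w₁) (Y * w₂ - w₁⁻¹) w₁ w₂ (by field_simp; ring)

section gp
variable {w₁ w₂ Y : ℝ} (h : w₁ ≠ 0)
include h
lemma gp_00 : (gp w₁ w₂ Y).1 0 0 = Y * w₁ := by rw [gp, dif_neg h]; rfl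
lemma gp_01 : (gp w₁ w₂ Y).1 0 1 = Y * w₂ - w₁⁻¹ := by rw [gp, dif_neg h]; rfl
lemma gp_10 : (gp w₁ w₂ Y).1 1 0 = w₁ := by rw [gp, dif_neg h]; rfl
lemma gp_11 : (gp w₁ w₂ Y).1 1 1 = w₂ := by rw [gp, dif_neg h]; rfl
end gp

lemma u_00 (t : ℝ) : (uElt t).1 0 0 = 1 := rfl
lemma u_01 (t : ℝ) : (uElt t).1 0 1 = t := rfl
lemma u_10 (t : ℝ) : (uElt t).1 1 0 = 0 := rfl
lemma u_11 (t : ℝ) : (uElt t).1 1 1 = 1 := rfl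
lemma v_00 (t : ℝ) : (vElt t).1 0 0 = 1 := rfl
lemma v_01 (t : ℝ) : (vElt t).1 0 1 = 0 := rfl
lemma v_10 (t : ℝ) : (vElt t).1 1 0 = t := rfl
lemma v_11 (t : ℝ) : (vElt t).1 1 1 = 1 := rfl
lemma h_00 (s : ℝ) : (hElt s).1 0 0 = Real.exp (-s) := rfl
lemma h_01 (s : ℝ) : (hElt s).1 0 1 = 0 := rfl
lemma h_10 (s : ℝ) : (hElt s).1 1 0 = 0 := rfl
lemma h_11 (s : ℝ) : (hElt s).1 1 1 = Real.exp s := rfl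

lemma u_mul_gp {w₁ : ℝ} (h : w₁ ≠ 0) (w₂ Y t : ℝ) : uElt t * gp w₁ w₂ Y = gp w₁ w₂ (Y + t) := by
  apply SL2R_ext <;>
    simp only [mul_apply2, u_00, u_01, u_10, u_11, gp_00 h, gp_01 h, gp_10 h, gp_11 h] <;> ring

lemma eq_gp (g : SL2R) (h : g.1 1 0 ≠ 0) : g = gp (g.1 1 0) (g.1 1 1) (g.1 0 0 / g.1 1 0) := by
  have hd := SL2R_det g
  apply SL2R_ext
  · rw [gp_00 h]; field_simp
  · rw [gp_01 h]; field_simp; linarith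
  · rw [gp_10 h]
  · rw [gp_11 h]

/-- The translation by an integer unipotent. -/
def zU (k : ℤ) : Matrix.SpecialLinearGroup (Fin 2) ℤ :=
  ⟨!![1, k; 0, 1], by simp [Matrix.det_fin_two_of]⟩

lemma zSL_zU (k : ℤ) : zSL (zU k) = uElt k := by
  apply SL2R_ext <;> rw [zSL_apply] <;> simp [zU, u_00, u_01, u_10, u_11]

lemma rho_u_mul (k : ℤ) (g : SL2R) : rho (uElt k * g) = rho g := by
  rw [← zSL_zU]
  unfold rho
  rw [latSum_mul, zSL_zU]
  simp [mul_apply2, u_10, u_11]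

lemma rho_neg (g : SL2R) : rho (-g) = rho g := by
  have : -g = zSL (-1) * g := by
    apply SL2R_ext <;> simp [mul_apply2, zSL_apply]
  rw [this]
  unfold rho
  rw [latSum_mul, ← this]
  simp [bump_neg]

/-! ### Periodization -/

/-- The periodization of a function on the line. -/
def perz (h : ℝ → ℂ) (θ : ℝ) : ℂ := ∑' i : ℤ, h (θ + i)

lemma perz_box (θ S : ℝ) (i : ℤ) (hi : |θ + i| < S) : i ∈ Finset.Ioo ⌊-S - θ⌋ ⌈S - θ⌉ := by
  rw [abs_lt] at hi
  rw [Finset.mem_Ioo, Int.floor_lt, Int.lt_ceil]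
  constructor <;> linarith

lemma card_perz_box (θ S : ℝ) (hS : 0 ≤ S) :
    ((Finset.Ioo ⌊-S - θ⌋ ⌈S - θ⌉).card : ℝ) ≤ 2 * S + 1 := by
  rw [Int.card_Ioo]
  have h1 := Int.lt_floor_add_one (-S - θ)
  have h2 := Int.ceil_lt_add_one (S - θ)
  rcases le_or_gt (⌈S - θ⌉ - ⌊-S - θ⌋ - 1) 0 with h | h
  · rw [Int.toNat_of_nonpos h]; push_cast; linarith
  · have : (((⌈S - θ⌉ - ⌊-S - θ⌋ - 1).toNat : ℤ) : ℝ) = ((⌈S - θ⌉ - ⌊-S - θ⌋ - 1 : ℤ) : ℝ) := by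
      rw [Int.toNat_of_nonneg h.le]
    rw [Int.cast_natCast] at this
    rw [this]; push_cast; linarith

section perz
variable {h : ℝ → ℂ} {S : ℝ} (hS : 0 ≤ S) (hsupp : ∀ τ, S ≤ |τ| → h τ = 0)
include hsupp

lemma perz_eq_sum (θ : ℝ) : perz h θ = ∑ i ∈ Finset.Ioo ⌊-S - θ⌋ ⌈S - θ⌉, h (θ + i) :=
  tsum_eq_sum fun i hi => hsupp _ (by by_contra! hc; exact hi (perz_box _ _ _ hc))

include hS in
lemma norm_perz_le {δ : ℝ} (hδ : ∀ τ, ‖h τ‖ ≤ δ) (θ : ℝ) : ‖perz h θ‖ ≤ (2 * S + 1) * δ := by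
  rw [perz_eq_sum hsupp]
  have hδ0 := (norm_nonneg _).trans (hδ 0)
  calc _ ≤ ∑ i ∈ Finset.Ioo ⌊-S - θ⌋ ⌈S - θ⌉, ‖h (θ + i)‖ := norm_sum_le _ _
    _ ≤ ∑ i ∈ Finset.Ioo ⌊-S - θ⌋ ⌈S - θ⌉, δ := Finset.sum_le_sum fun i _ => hδ _
    _ = ((Finset.Ioo ⌊-S - θ⌋ ⌈S - θ⌉).card : ℝ) * δ := by simp
    _ ≤ _ := by gcongr; exact card_perz_box θ S hS

lemma summable_perz (θ : ℝ) : Summable fun i : ℤ => h (θ + i) :=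
  summable_of_ne_finset_zero (s := Finset.Ioo ⌊-S - θ⌋ ⌈S - θ⌉) fun i hi =>
    hsupp _ (by by_contra! hc; exact hi (perz_box _ _ _ hc))

end perz

lemma perz_add_one (h : ℝ → ℂ) (θ : ℝ) : perz h (θ + 1) = perz h θ := by
  unfold perz
  rw [← (Equiv.addRight (1 : ℤ)).tsum_eq fun i : ℤ => h (θ + i)]
  refine tsum_congr fun i => ?_
  congr 1; simp; ring

lemma perz_sub {h h' : ℝ → ℂ} {S : ℝ} (hsupp : ∀ τ, S ≤ |τ| → h τ = 0)
    (hsupp' : ∀ τ, S ≤ |τ| → h' τ = 0) (θ : ℝ) :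
    perz h θ - perz h' θ = perz (fun τ => h τ - h' τ) θ :=
  ((summable_perz hsupp θ).tsum_sub (summable_perz hsupp' θ)).symm

lemma norm_perz_sub_le {h : ℝ → ℂ} {S ℓ : ℝ} (hS : 0 ≤ S) (hsupp : ∀ τ, S ≤ |τ| → h τ = 0)
    (h1 : ∀ τ, ‖h τ‖ ≤ 1) (hL : ∀ τ τ', ‖h τ - h τ'‖ ≤ ℓ * |τ - τ'|) (θ θ' : ℝ) :
    ‖perz h θ - perz h θ'‖ ≤ (2 * S + 3) * (ℓ + 2) * |θ - θ'| := by
  have hℓ : 0 ≤ ℓ := by simpa using (norm_nonneg _).trans (hL 1 0)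
  rcases le_or_gt |θ - θ'| 1 with hc | hc
  · have e : perz h θ' = perz (fun τ => h (τ + (θ' - θ))) θ := by
      unfold perz; refine tsum_congr fun i => ?_
      congr 1; ring
    rw [e, perz_sub (S := S + 1)]
    · have := norm_perz_le (h := fun τ => h τ - h (τ + (θ' - θ))) (S := S + 1) (by linarith)
        (fun τ hτ => ?_) (δ := ℓ * |θ - θ'|) (fun τ => ?_) θ
      · refine this.trans ?_
        have := abs_nonneg (θ - θ')
        nlinarith [mul_nonneg hS this, mul_nonneg hℓ this]
      · rw [hsupp _ (by linarith), hsupp, sub_zero]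
        have := abs_sub_abs_le_abs_sub τ (-(θ' - θ))
        rw [sub_neg_eq_add, abs_neg, abs_sub_comm θ' θ] at this
        linarith
      · refine (hL _ _).trans (le_of_eq ?_)
        congr 2; ring
    · intro τ hτ; exact hsupp _ (by linarith)
    · intro τ hτ
      apply hsupp
      have := abs_sub_abs_le_abs_sub τ (-(θ' - θ))
      rw [sub_neg_eq_add, abs_neg, abs_sub_comm θ' θ] at this
      linarith
  · have a := norm_perz_le hS hsupp h1 θ
    have b := norm_perz_le hS hsupp h1 θ'
    refine (norm_sub_le _ _).trans ?_
    nlinarith [mul_nonneg hS hℓ]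

lemma integral_perz {h : ℝ → ℂ} {S : ℝ} (hsupp : ∀ τ, S ≤ |τ| → h τ = 0) (hc : Continuous h) :
    ∫ θ in (0 : ℝ)..1, perz h θ = ∫ τ, h τ := by
  have hcs : HasCompactSupport h := by
    refine HasCompactSupport.of_support_subset_isCompact (isCompact_Icc (a := -S) (b := S)) ?_
    intro τ hτ
    by_contra hn
    apply hτ; apply hsupp
    by_contra! hlt
    exact hn ⟨(abs_lt.mp hlt).1.le, (abs_lt.mp hlt).2.le⟩
  have hi : Integrable h volume := hc.integrable_of_hasCompactSupport hcs
  have h1 := hi.hasSum_intervalIntegral_comp_add_int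
  set F := Finset.Ioo (⌊-S - 1⌋) ⌈S⌉ with hF
  have hz : ∀ i ∉ F, ∀ θ ∈ Set.Icc (0 : ℝ) 1, h (θ + i) = 0 := by
    intro i hi θ hθ
    apply hsupp
    by_contra! hlt
    apply hi
    rw [abs_lt] at hlt
    rw [hF, Finset.mem_Ioo, Int.floor_lt, Int.lt_ceil]
    constructor <;> linarith [hθ.1, hθ.2]
  rw [← h1.tsum_eq, tsum_eq_sum (s := F)]
  · rw [← intervalIntegral.integral_finsetSum]
    · refine intervalIntegral.integral_congr fun θ hθ => ?_
      rw [Set.uIcc_of_le zero_le_one] at hθ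
      exact tsum_eq_sum fun i hi => hz i hi θ hθ
    · intro i _
      exact Continuous.intervalIntegrable (by fun_prop) _ _
  · intro i hi
    rw [intervalIntegral.integral_congr (g := fun _ => (0 : ℂ))]
    · simp
    · intro θ hθ
      rw [Set.uIcc_of_le zero_le_one] at hθ
      exact hz i hi θ hθ

lemma tsum_int_mod (c : ℕ) [NeZero c] (g : ℤ → ℂ) (hg : Summable g) :
    ∑' s, g s = ∑ x ∈ Finset.range c, ∑' k : ℤ, g (x + c * k) := by
  rw [← (Int.divModEquiv c).symm.tsum_eq]
  have hs : Summable fun p => g ((Int.divModEquiv c).symm p) :=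
    (Int.divModEquiv c).symm.summable_iff.mpr hg
  rw [← (Equiv.prodComm (Fin c) ℤ).tsum_eq]
  have hs' : Summable fun p : Fin c × ℤ => g ((Int.divModEquiv c).symm (Equiv.prodComm _ _ p)) :=
    (Equiv.prodComm (Fin c) ℤ).summable_iff.mpr hs
  rw [hs'.tsum_prod, tsum_fintype, Finset.sum_range]
  refine Finset.sum_congr rfl fun x _ => tsum_congr fun k => ?_
  congr 1
  simp [Int.divModEquiv]; ring

/-- Two fundamental domains for the action of `(n, -c)` on `ℤ²`. -/
lemma unfold_sum (n c : ℕ) [NeZero n] [NeZero c] (f : ℤ → ℤ → ℂ)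
    (h1 : ∀ i, Summable (f i)) (h2 : ∀ s, Summable fun i => f i s)
    (hf : ∀ i s, f (i + n) (s - c) = f i s) :
    ∑ i ∈ Finset.range n, ∑' s, f i s = ∑ x ∈ Finset.range c, ∑' i, f i x := by
  have hk : ∀ (k : ℕ) (i s : ℤ), f (i + n * k) s = f i (s + c * k) := by
    intro k
    induction k with
    | zero => intro i s; simp
    | succ k ih =>
      intro i s
      rw [show i + (n : ℤ) * ((k + 1 : ℕ) : ℤ) = (i + n) + n * k by push_cast; ring, ih,
        ← hf i (s + c * ((k + 1 : ℕ) : ℤ))]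
      congr 1; push_cast; ring
  have hkz : ∀ (k i s : ℤ), f (i + n * k) s = f i (s + c * k) := by
    intro k i s
    obtain ⟨m, rfl | rfl⟩ := k.eq_nat_or_neg
    · exact hk m i s
    · have := hk m (i + n * -m) (s + c * -m)
      rw [show i + (n : ℤ) * -m + n * m = i by ring,
        show s + (c : ℤ) * -m + c * m = s by ring] at this
      exact this.symm
  have e1 : ∀ i : ℤ, ∑' s, f i s = ∑ x ∈ Finset.range c, ∑' k : ℤ, f i (x + c * k) :=
    fun i => tsum_int_mod c _ (h1 i)
  have e2 : ∀ x : ℤ, ∑' i, f i x = ∑ i ∈ Finset.range n, ∑' k : ℤ, f (i + n * k) x :=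
    fun x => tsum_int_mod n _ (h2 x)
  simp_rw [e1, e2, hkz]
  exact Finset.sum_comm

lemma sum_coprime_eq_units (c : ℕ) [NeZero c] (F : ZMod c → ℂ) :
    ∑ x ∈ (Finset.range c).filter (fun x => Nat.gcd x c = 1), F (x : ZMod c) =
      ∑ u : (ZMod c)ˣ, F u := by
  symm
  refine Finset.sum_bij (fun u _ => (u : ZMod c).val) ?_ ?_ ?_ ?_
  · intro u _
    rw [Finset.mem_filter, Finset.mem_range]
    exact ⟨ZMod.val_lt _, ZMod.val_coe_unit_coprime u⟩
  · intro u _ v _ h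
    exact Units.ext (ZMod.val_injective c h)
  · intro x hx
    rw [Finset.mem_filter, Finset.mem_range] at hx
    refine ⟨ZMod.unitOfCoprime x hx.2, Finset.mem_univ _, ?_⟩
    simp [ZMod.val_cast_of_lt hx.1]
  · intro u _
    simp

/-! ### The unfolded function -/

/-- Bounded by one and right Lipschitz with constant `L`. -/
def LipG (L : ℝ) (f : SL2R → ℂ) : Prop :=
  (∀ g, ‖f g‖ ≤ 1) ∧ ∀ g k, ‖f (g * k) - f g‖ ≤ L * matSup (k.1 - 1)

/-- The Weyl element. -/
def Wst : SL2R := mk2 0 (-1) 1 0 (by norm_num)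

/-- The function integrated after unfolding. -/
def Phi (Ψ : SL2R → ℂ) (w₁ w₂ Y : ℝ) : ℂ := Ψ (Wst * gp w₁ w₂ Y) * rho (gp w₁ w₂ Y)

section Phi
variable {Ψ : SL2R → ℂ} {T : ℝ} (hT : 1 ≤ T) (hΨ : LipG T Ψ)
include hΨ

lemma norm_Phi_le (w₁ w₂ Y : ℝ) : ‖Phi Ψ w₁ w₂ Y‖ ≤ 1 := by
  rw [Phi, norm_mul, Complex.norm_real, Real.norm_of_nonneg (rho_nonneg _)]
  exact mul_le_one₀ (hΨ.1 _) (rho_nonneg _) (rho_le_one _)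

omit hΨ in
lemma Phi_eq_zero {w₁ w₂ : ℝ} (Y : ℝ) (h0 : w₁ ≠ 0) (h : 3 ≤ |w₁| ∨ 3 ≤ |w₂|) :
    Phi Ψ w₁ w₂ Y = 0 := by
  rw [Phi, rho_eq_zero, Complex.ofReal_zero, mul_zero]
  rw [gp_10 h0, gp_11 h0]
  exact le_max_iff.mpr h

omit hΨ in
include hT in
lemma matSup_gp_le {w₁ w₂ Y : ℝ} (h1 : 1 / T ≤ w₁) (h1' : w₁ ≤ 3) (h2 : |w₂| ≤ 3)
    (hY : |Y| ≤ 1) : matSup (gp w₁ w₂ Y).1 ≤ 4 * T := by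
  have hT0 : 0 < T := by linarith
  have hw : 0 < w₁ := lt_of_lt_of_le (by positivity) h1
  have hi : w₁⁻¹ ≤ T := by
    rw [inv_le_comm₀ hw hT0, ← one_div]; exact h1
  have hi0 : 0 < w₁⁻¹ := by positivity
  rw [matSup_le_iff, gp_00 hw.ne', gp_01 hw.ne', gp_10 hw.ne', gp_11 hw.ne']
  refine ⟨?_, ?_, ?_, by linarith⟩
  · rw [abs_mul, abs_of_pos hw]
    nlinarith [abs_nonneg Y]
  · refine (abs_sub _ _).trans ?_
    rw [abs_mul, abs_of_pos hi0]
    nlinarith [abs_nonneg Y, abs_nonneg w₂]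
  · rw [abs_of_pos hw]; linarith

include hT in
lemma norm_Phi_sub_le_aux {w₁ w₂ Y w₁' w₂' Y' : ℝ} (h1 : 1 / T ≤ w₁) (h1' : w₁ ≤ 3)
    (h2 : |w₂| ≤ 3) :
    ‖Phi Ψ w₁' w₂' Y' - Phi Ψ w₁ w₂ Y‖ ≤
      2 * 10 ^ 7 * T ^ 2 * matSup (((gp w₁ w₂ Y)⁻¹ * gp w₁' w₂' Y').1 - 1) := by
  have hT0 : 0 < T := by linarith
  have hw : 0 < w₁ := lt_of_lt_of_le (by positivity) h1
  set g := gp w₁ w₂ Y with hg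
  set g' := gp w₁' w₂' Y'
  set k := g⁻¹ * g' with hk
  have hgk : g' = g * k := by rw [hk]; group
  set m := matSup (k.1 - 1)
  have hm : 0 ≤ m := matSup_nonneg _
  have r1 : |rho (g * k) - rho g| ≤ 10 ^ 6 * (4 * T) ^ 2 * m := by
    have e : ∀ x, rho (uElt ((-⌊Y⌋ : ℤ)) * x) = rho x := fun x => rho_u_mul _ x
    rw [← e g, ← e (g * k), ← mul_assoc]
    refine (abs_rho_sub_le _ k).trans ?_
    have : matSup (uElt ((-⌊Y⌋ : ℤ)) * g).1 ≤ 4 * T := by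
      rw [hg, u_mul_gp hw.ne']
      refine matSup_gp_le hT h1 h1' h2 ?_
      push_cast
      rw [← sub_eq_add_neg, Int.self_sub_floor, abs_of_nonneg (Int.fract_nonneg _)]
      exact (Int.fract_lt_one _).le
    have h0 := matSup_nonneg (uElt ((-⌊Y⌋ : ℤ)) * g).1
    gcongr
  have r2 := hΨ.2 (Wst * g) k
  have e : Phi Ψ w₁' w₂' Y' - Phi Ψ w₁ w₂ Y =
      (Ψ (Wst * g * k) - Ψ (Wst * g)) * (rho (g * k) : ℂ) +
        Ψ (Wst * g) * ((rho (g * k) - rho g : ℝ) : ℂ) := by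
    rw [Phi, Phi, show gp w₁' w₂' Y' = g * k from hgk, mul_assoc]
    push_cast; ring
  rw [e]
  refine (norm_add_le _ _).trans ?_
  rw [norm_mul, norm_mul, Complex.norm_real, Complex.norm_real, Real.norm_of_nonneg (rho_nonneg _),
    Real.norm_eq_abs]
  have a1 : ‖Ψ (Wst * g * k) - Ψ (Wst * g)‖ * rho (g * k) ≤ T * m * 1 :=
    mul_le_mul r2 (rho_le_one _) (rho_nonneg _) (by positivity)
  have a2 : ‖Ψ (Wst * g)‖ * |rho (g * k) - rho g| ≤ 1 * (10 ^ 6 * (4 * T) ^ 2 * m) := by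
    gcongr
    exact hΨ.1 _
  have : T * m ≤ T ^ 2 * m := by gcongr; nlinarith
  nlinarith [mul_nonneg (sq_nonneg T) hm]

omit hΨ in
lemma gp_inv_mul {w₁ w₁' : ℝ} (h : w₁ ≠ 0) (h' : w₁' ≠ 0) (w₂ w₂' Y : ℝ) :
    (gp w₁ w₂ Y)⁻¹ * gp w₁' w₂' Y =
      mk2 (w₁' / w₁) (w₂' / w₁ - w₂ / w₁') 0 (w₁ / w₁') (by field_simp; simp) := by
  apply SL2R_ext <;>
    simp only [mul_apply2, inv_00, inv_01, inv_10, inv_11, gp_00 h, gp_01 h, gp_10 h, gp_11 h,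
      gp_00 h', gp_01 h', gp_10 h', gp_11 h', mk2] <;> simp <;> field_simp <;> ring

omit hΨ in
lemma matSup_mk2_sub_one (a b c d : ℝ) (h : a * d - b * c = 1) {x : ℝ}
    (h1 : |a - 1| ≤ x) (h2 : |b| ≤ x) (h3 : |c| ≤ x) (h4 : |d - 1| ≤ x) :
    matSup ((mk2 a b c d h).1 - 1) ≤ x := by
  rw [matSup_le_iff]
  simp only [mk2, Matrix.sub_apply, Matrix.one_apply]
  simpa using ⟨h1, h2, h3, h4⟩

include hT in
lemma norm_Phi_sub_Y_le {w₁ w₂ Y Y' : ℝ} (h1 : 1 / T ≤ w₁) :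
    ‖Phi Ψ w₁ w₂ Y' - Phi Ψ w₁ w₂ Y‖ ≤ 2 * 10 ^ 8 * T ^ 4 * |Y' - Y| := by
  have hT0 : 0 < T := by linarith
  have hw : 0 < w₁ := lt_of_lt_of_le (by positivity) h1
  by_cases hc : 3 ≤ |w₁| ∨ 3 ≤ |w₂|
  · rw [Phi_eq_zero _ hw.ne' hc, Phi_eq_zero _ hw.ne' hc]; simp; positivity
  push Not at hc
  rw [abs_of_pos hw] at hc
  refine (norm_Phi_sub_le_aux hT hΨ h1 hc.1.le hc.2.le).trans ?_
  have : matSup (((gp w₁ w₂ Y)⁻¹ * gp w₁ w₂ Y').1 - 1) ≤ 9 * |Y' - Y| := by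
    have e : (gp w₁ w₂ Y)⁻¹ * gp w₁ w₂ Y' = mk2 (1 + (Y' - Y) * (w₁ * w₂)) ((Y' - Y) * (w₂ * w₂))
        (-((Y' - Y) * (w₁ * w₁))) (1 - (Y' - Y) * (w₁ * w₂)) (by ring) := by
      apply SL2R_ext <;>
      simp only [mul_apply2, inv_00, inv_01, inv_10, inv_11, gp_00 hw.ne', gp_01 hw.ne',
        gp_10 hw.ne', gp_11 hw.ne', mk2] <;> simp <;> field_simp <;> ring
    have h3 : |w₁| ≤ 3 := by rw [abs_of_pos hw]; exact hc.1.le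
    have key : ∀ a b : ℝ, |a| ≤ 3 → |b| ≤ 3 → |(Y' - Y) * (a * b)| ≤ 9 * |Y' - Y| := by
      intro a b ha hb
      rw [abs_mul, abs_mul, mul_comm]
      gcongr
      nlinarith [abs_nonneg a, abs_nonneg b]
    rw [e]
    refine matSup_mk2_sub_one _ _ _ _ _ ?_ ?_ ?_ ?_
    · rw [add_sub_cancel_left]; exact key _ _ h3 hc.2.le
    · exact key _ _ hc.2.le hc.2.le
    · rw [abs_neg]; exact key _ _ h3 h3
    · rw [sub_sub_cancel_left, abs_neg]; exact key _ _ h3 hc.2.le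
  calc _ ≤ 2 * 10 ^ 7 * T ^ 2 * (9 * |Y' - Y|) := by gcongr
    _ ≤ 2 * 10 ^ 8 * T ^ 2 * |Y' - Y| := by nlinarith [mul_nonneg (sq_nonneg T) (abs_nonneg (Y' - Y))]
    _ ≤ _ := by gcongr <;> norm_num [hT]

include hT in
lemma norm_Phi_sub_w₂_le {w₁ w₂ w₂' Y : ℝ} (h1 : 1 / T ≤ w₁) :
    ‖Phi Ψ w₁ w₂' Y - Phi Ψ w₁ w₂ Y‖ ≤ 2 * 10 ^ 8 * T ^ 4 * |w₂' - w₂| := by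
  have hT0 : 0 < T := by linarith
  have hw : 0 < w₁ := lt_of_lt_of_le (by positivity) h1
  have key : ∀ w₂ w₂' : ℝ, |w₂| ≤ 3 → w₁ ≤ 3 →
      ‖Phi Ψ w₁ w₂' Y - Phi Ψ w₁ w₂ Y‖ ≤ 2 * 10 ^ 8 * T ^ 4 * |w₂' - w₂| := by
    intro w₂ w₂' h2 h3
    refine (norm_Phi_sub_le_aux hT hΨ h1 h3 h2).trans ?_
    have : matSup (((gp w₁ w₂ Y)⁻¹ * gp w₁ w₂' Y).1 - 1) ≤ T * |w₂' - w₂| := by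
      rw [gp_inv_mul hw.ne' hw.ne']
      have hp : 0 ≤ T * |w₂' - w₂| := by positivity
      refine matSup_mk2_sub_one _ _ _ _ _ ?_ ?_ ?_ ?_
      · rw [div_self hw.ne']; simpa using hp
      · rw [← sub_div, abs_div, abs_of_pos hw, div_le_iff₀ hw]
        rw [div_le_iff₀ hT0] at h1
        nlinarith [abs_nonneg (w₂' - w₂)]
      · simpa using hp
      · rw [div_self hw.ne']; simpa using hp
    calc _ ≤ 2 * 10 ^ 7 * T ^ 2 * (T * |w₂' - w₂|) := by gcongr
      _ = 2 * 10 ^ 7 * T ^ 3 * |w₂' - w₂| := by ring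
      _ ≤ _ := by gcongr <;> norm_num [hT]
  rcases le_or_gt w₁ 3 with h3 | h3
  · rcases le_or_gt |w₂| 3 with h2 | h2
    · exact key _ _ h2 h3
    rcases le_or_gt |w₂'| 3 with h2' | h2'
    · rw [norm_sub_rev, abs_sub_comm]; exact key _ _ h2' h3
    · rw [Phi_eq_zero _ hw.ne' (Or.inr h2.le), Phi_eq_zero _ hw.ne' (Or.inr h2'.le)]
      simp; positivity
  · have : 3 ≤ |w₁| := by rw [abs_of_pos hw]; exact h3.le
    rw [Phi_eq_zero _ hw.ne' (Or.inl this), Phi_eq_zero _ hw.ne' (Or.inl this)]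
    simp; positivity

include hT in
lemma norm_Phi_sub_w₁_le {w₁ w₁' w₂ Y : ℝ} (h1 : 1 / T ≤ w₁) (h1' : 1 / T ≤ w₁') :
    ‖Phi Ψ w₁' w₂ Y - Phi Ψ w₁ w₂ Y‖ ≤ 2 * 10 ^ 8 * T ^ 4 * |w₁' - w₁| := by
  have hT0 : 0 < T := by linarith
  have hw : 0 < w₁ := lt_of_lt_of_le (by positivity) h1
  have hw' : 0 < w₁' := lt_of_lt_of_le (by positivity) h1'
  have key : ∀ w₁ w₁' : ℝ, |w₂| ≤ 3 → w₁ ≤ 3 → 1 / T ≤ w₁ → 1 / T ≤ w₁' →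
      ‖Phi Ψ w₁' w₂ Y - Phi Ψ w₁ w₂ Y‖ ≤ 2 * 10 ^ 8 * T ^ 4 * |w₁' - w₁| := by
    intro w₁ w₁' h2 h3 h1 h1'
    have hw : 0 < w₁ := lt_of_lt_of_le (by positivity) h1
    have hw' : 0 < w₁' := lt_of_lt_of_le (by positivity) h1'
    have hi : w₁⁻¹ ≤ T := by rw [inv_le_comm₀ hw hT0, ← one_div]; exact h1
    have hi' : w₁'⁻¹ ≤ T := by rw [inv_le_comm₀ hw' hT0, ← one_div]; exact h1'
    have i0 : 0 < w₁⁻¹ := by positivity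
    have i0' : 0 < w₁'⁻¹ := by positivity
    refine (norm_Phi_sub_le_aux hT hΨ h1 h3 h2).trans ?_
    have hd := abs_nonneg (w₁' - w₁)
    have hTT : T * |w₁' - w₁| ≤ 3 * T ^ 2 * |w₁' - w₁| := by gcongr; nlinarith
    have : matSup (((gp w₁ w₂ Y)⁻¹ * gp w₁' w₂ Y).1 - 1) ≤ 3 * T ^ 2 * |w₁' - w₁| := by
      rw [gp_inv_mul hw.ne' hw'.ne']
      refine matSup_mk2_sub_one _ _ _ _ _ ?_ ?_ ?_ ?_
      · rw [div_sub_one hw.ne', abs_div, abs_of_pos hw, div_eq_mul_inv]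
        nlinarith
      · rw [show w₂ / w₁ - w₂ / w₁' = w₂ * ((w₁⁻¹ * w₁'⁻¹) * (w₁' - w₁)) by field_simp, abs_mul,
          abs_mul, abs_of_pos (mul_pos i0 i0')]
        have : w₁⁻¹ * w₁'⁻¹ ≤ T ^ 2 := by rw [sq]; gcongr
        calc _ ≤ 3 * (T ^ 2 * |w₁' - w₁|) := by gcongr
          _ = _ := by ring
      · rw [abs_zero]; positivity
      · rw [div_sub_one hw'.ne', abs_div, abs_of_pos hw', div_eq_mul_inv, abs_sub_comm]
        nlinarith
    calc _ ≤ 2 * 10 ^ 7 * T ^ 2 * (3 * T ^ 2 * |w₁' - w₁|) := by gcongr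
      _ = 6 * 10 ^ 7 * (T ^ 4 * |w₁' - w₁|) := by ring
      _ ≤ 2 * 10 ^ 8 * (T ^ 4 * |w₁' - w₁|) :=
        mul_le_mul_of_nonneg_right (by norm_num) (by positivity)
      _ = _ := by ring
  rcases le_or_gt |w₂| 3 with h2 | h2
  · rcases le_or_gt w₁ 3 with h3 | h3
    · exact key _ _ h2 h3 h1 h1'
    rcases le_or_gt w₁' 3 with h3' | h3'
    · rw [norm_sub_rev, abs_sub_comm]; exact key _ _ h2 h3' h1' h1
    · rw [Phi_eq_zero _ hw.ne' (Or.inl (by rw [abs_of_pos hw]; exact h3.le)),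
        Phi_eq_zero _ hw'.ne' (Or.inl (by rw [abs_of_pos hw']; exact h3'.le))]
      simp; positivity
  · rw [Phi_eq_zero _ hw.ne' (Or.inr h2.le), Phi_eq_zero _ hw'.ne' (Or.inr h2.le)]
    simp; positivity

end Phi

/-! ### Unfolding the sum over rational points -/

/-- The rational point `u_{i/n} a_R⁻¹`. -/
def ptg (R : ℝ) (n : ℕ) (i : ℤ) : SL2R := uElt ((i : ℝ) / n) * (aElt R)⁻¹

section ptg
variable {R : ℝ} (hR : R ≠ 0) (n : ℕ) (i : ℤ)
include hR

lemma aElt_eq : aElt R = mk2 R 0 0 R⁻¹ (by simp [hR]) := dif_neg hR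
lemma aElt_00 : (aElt R).1 0 0 = R := by rw [aElt_eq hR]; rfl
lemma aElt_01 : (aElt R).1 0 1 = 0 := by rw [aElt_eq hR]; rfl
lemma aElt_10 : (aElt R).1 1 0 = 0 := by rw [aElt_eq hR]; rfl
lemma aElt_11 : (aElt R).1 1 1 = R⁻¹ := by rw [aElt_eq hR]; rfl

lemma ptg_00 : (ptg R n i).1 0 0 = R⁻¹ := by
  simp [ptg, mul_apply2, u_00, u_01, inv_00, inv_10, aElt_11 hR, aElt_10 hR]
lemma ptg_01 : (ptg R n i).1 0 1 = i * R / n := by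
  simp [ptg, mul_apply2, u_00, u_01, inv_01, inv_11, aElt_00 hR, aElt_01 hR]; ring
lemma ptg_10 : (ptg R n i).1 1 0 = 0 := by
  simp [ptg, mul_apply2, u_10, u_11, inv_00, inv_10, aElt_10 hR]
lemma ptg_11 : (ptg R n i).1 1 1 = R := by
  simp [ptg, mul_apply2, u_10, u_11, inv_01, inv_11, aElt_00 hR]

lemma row0_ptg (c s : ℤ) : row0 (c, s) (ptg R n i) = c / R := by
  simp [row0, ptg_00 hR, ptg_10 hR]; ring
lemma row1_ptg [NeZero n] (c s : ℤ) : row1 (c, s) (ptg R n i) = R / n * (c * i + s * n) := by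
  have : (n : ℝ) ≠ 0 := NeZero.ne _
  simp [row1, ptg_01 hR, ptg_11 hR]; field_simp

end ptg

lemma ptg_add (R : ℝ) (n : ℕ) [NeZero n] (i : ℤ) : ptg R n (i + n) = zSL (zU 1) * ptg R n i := by
  have : (n : ℝ) ≠ 0 := NeZero.ne _
  have e : uElt (((i + n : ℤ) : ℝ) / n) = uElt ((1 : ℤ) : ℝ) * uElt ((i : ℝ) / n) := by
    apply SL2R_ext <;> simp only [mul_apply2, u_00, u_01, u_10, u_11] <;> push_cast <;>
      field_simp <;> ring
  rw [ptg, ptg, e, zSL_zU, mul_assoc]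

/-- The weights of the partition of unity. -/
def wt (g : SL2R) (c s : ℤ) : ℝ := latTerm g (c, s) / latSum g

lemma wt_nonneg (g : SL2R) (c s : ℤ) : 0 ≤ wt g c s :=
  div_nonneg (latTerm_nonneg _ _) (zero_le_one.trans (one_le_latSum g))

lemma wt_le_one (g : SL2R) (c s : ℤ) : wt g c s ≤ 1 := by
  rw [wt, div_le_one (by linarith [one_le_latSum g])]
  exact latTerm_le_latSum _ _

lemma summable_wt (g : SL2R) : Summable fun v : ℤ × ℤ => wt g v.1 v.2 :=
  (summable_latTerm g).div_const _

lemma latTerm_neg (g : SL2R) (c s : ℤ) : latTerm g (-c, -s) = latTerm g (c, s) := by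
  unfold latTerm row0 row1
  simp only [IsCoprime.neg_neg_iff]
  have e : ∀ x y : ℝ, ((-c : ℤ) : ℝ) * x + ((-s : ℤ) : ℝ) * y = -(c * x + s * y) := by
    intro x y; push_cast; ring
  rw [e, e, bump_neg]

lemma wt_eq_zero {g : SL2R} {c s : ℤ} (h : 3 ≤ |row0 (c, s) g| ∨ 3 ≤ |row1 (c, s) g|) :
    wt g c s = 0 := by
  rw [wt, latTerm, (bump_eq_zero_iff _ _).mpr (le_max_iff.mpr h), ite_self, zero_div]

lemma wt_eq_zero' {g : SL2R} {c s : ℤ} (h : ¬ IsCoprime c s) : wt g c s = 0 := by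
  rw [wt, latTerm, if_neg h, zero_div]

section unfold
variable {R : ℝ} (hR : 4 ≤ R) (n : ℕ) [NeZero n]
include hR

omit [NeZero n] in
lemma wt_ptg_eq_zero {c s i : ℤ} (h : 3 * R ≤ |(c : ℝ)|) : wt (ptg R n i) c s = 0 := by
  have h0 : 0 < R := by linarith
  apply wt_eq_zero; left
  rw [row0_ptg h0.ne', abs_div, abs_of_pos h0, le_div_iff₀ h0]; exact h

lemma wt_ptg_eq_zero' {c s i : ℤ} (h : 3 * n / R ≤ |(c : ℝ) * i + s * n|) :
    wt (ptg R n i) c s = 0 := by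
  have h0 : 0 < R := by linarith
  have hn : 0 < (n : ℝ) := Nat.cast_pos.mpr (NeZero.pos n)
  apply wt_eq_zero; right
  rw [row1_ptg h0.ne', abs_mul, abs_of_pos (by positivity)]
  calc 3 = R / n * (3 * n / R) := by field_simp
    _ ≤ _ := by gcongr

lemma wt_zero_left (s i : ℤ) : wt (ptg R n i) 0 s = 0 := by
  have h0 : 0 < R := by linarith
  have hn : 0 < (n : ℝ) := Nat.cast_pos.mpr (NeZero.pos n)
  by_cases h : IsCoprime (0 : ℤ) s
  · apply wt_ptg_eq_zero' hR
    have hs : 1 ≤ |(s : ℝ)| := by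
      have : s ≠ 0 := by rintro rfl; exact not_isCoprime_zero_zero h
      exact_mod_cast Int.one_le_abs this
    rw [div_le_iff₀ h0]
    simp only [Int.cast_zero, zero_mul, zero_add, abs_mul, Nat.abs_cast]
    nlinarith [mul_le_mul_of_nonneg_right hs hn.le, mul_nonneg (sub_nonneg.mpr hs) hn.le]
  · exact wt_eq_zero' h

lemma two_mul_sum_wt (i : ℤ) :
    (1 : ℝ) = 2 * ∑ c ∈ Finset.Icc 1 ⌊3 * R⌋₊, ∑' s : ℤ, wt (ptg R n i) c s := by
  set g := ptg R n i
  have h1 : ∑' v : ℤ × ℤ, wt g v.1 v.2 = 1 := tsum_latTerm_div g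
  rw [(summable_wt g).tsum_prod] at h1
  have hz : ∀ c : ℕ, c ∉ Finset.Icc 1 ⌊3 * R⌋₊ → ∑' s : ℤ, wt g c s = 0 := by
    intro c hc
    rw [Finset.mem_Icc, not_and_or] at hc
    rcases hc with hc | hc
    · obtain rfl : c = 0 := by omega
      simp only [Nat.cast_zero]
      simp_rw [show ∀ s, wt g 0 s = 0 from fun s => wt_zero_left hR n s i, tsum_zero]
    · have : 3 * R ≤ |((c : ℤ) : ℝ)| := by
        rw [Int.cast_natCast, Nat.abs_cast]
        exact (Nat.lt_of_floor_lt (not_le.mp hc)).le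
      simp_rw [show ∀ s, wt g c s = 0 from fun s => wt_ptg_eq_zero hR n this, tsum_zero]
  have hneg : ∀ c : ℤ, ∑' s : ℤ, wt g (-c) s = ∑' s : ℤ, wt g c s := by
    intro c
    rw [← (Equiv.neg ℤ).tsum_eq]
    refine tsum_congr fun s => ?_
    rw [Equiv.neg_apply, wt, latTerm_neg]; rfl
  have hs : Summable fun c : ℕ => ∑' s : ℤ, wt g c s :=
    summable_of_ne_finset_zero hz
  have := Summable.tsum_of_nat_of_neg (f := fun c : ℤ => ∑' s : ℤ, wt g c s) hs
    (by simp_rw [hneg]; exact hs)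
  rw [h1] at this
  simp_rw [hneg] at this
  rw [tsum_eq_sum (s := Finset.Icc 1 ⌊3 * R⌋₊) hz, show ∑' s : ℤ, wt g 0 s = 0 from hz 0 (by simp)] at this
  linarith

end unfold

/-- The summand after inserting the partition of unity. -/
def tf (Ψ : SL2R → ℂ) (R : ℝ) (n : ℕ) (B : ℤ) (c i s : ℤ) : ℂ :=
  eR ((B : ℝ) * i / n) * Ψ (ptg R n i) * wt (ptg R n i) c s

/-- The contribution of the lower-left entry `c`. -/
def Dc (Ψ : SL2R → ℂ) (R : ℝ) (n : ℕ) (B : ℤ) (c : ℕ) : ℂ :=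
  ∑ i ∈ Finset.range n, ∑' s : ℤ, tf Ψ R n B c i s

section unfold
variable {R : ℝ} (hR : 4 ≤ R) (n : ℕ) [NeZero n] (Ψ : SL2R → ℂ) (B : ℤ)
include hR

lemma sum_eq_Dc : ∑ i ∈ Finset.range n, eR ((B : ℝ) * i / n) * Ψ (ptg R n i) =
    2 * ∑ c ∈ Finset.Icc 1 ⌊3 * R⌋₊, Dc Ψ R n B c := by
  unfold Dc
  rw [Finset.sum_comm, Finset.mul_sum]
  refine Finset.sum_congr rfl fun i _ => ?_
  unfold tf
  simp_rw [tsum_mul_left, ← Finset.mul_sum, ← Complex.ofReal_tsum, ← Complex.ofReal_sum]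
  have h2 := congrArg (fun x : ℝ => (x : ℂ)) (two_mul_sum_wt hR n i)
  simp only [Complex.ofReal_mul, Complex.ofReal_one, Complex.ofReal_ofNat] at h2
  rw [mul_left_comm, ← h2, mul_one, Int.cast_natCast]

lemma norm_Dc_le (hΨ : ∀ g, ‖Ψ g‖ ≤ 1) (c : ℕ) (hc : 0 < c) :
    ‖Dc Ψ R n B c‖ ≤ Nat.gcd c n * (6 * n / R + 1) := by
  have h0 : 0 < R := by linarith
  have hn : 0 < (n : ℝ) := Nat.cast_pos.mpr (NeZero.pos n)
  have hn' : 0 < n := NeZero.pos n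
  set A := (Finset.range n ×ˢ Finset.Icc (-(c : ℤ)) c).filter
    (fun p => |(c : ℝ) * p.1 + p.2 * n| < 3 * n / R) with hA
  have h1 : ‖Dc Ψ R n B c‖ ≤ A.card := by
    have e : Dc Ψ R n B c = ∑ p ∈ A, tf Ψ R n B c p.1 p.2 := by
      rw [hA, Finset.sum_filter, Finset.sum_product]
      refine Finset.sum_congr rfl fun i hi => ?_
      rw [tsum_eq_sum (s := Finset.Icc (-(c : ℤ)) c)]
      · refine Finset.sum_congr rfl fun s _ => ?_
        split_ifs with h
        · rfl
        · rw [tf, wt_ptg_eq_zero' hR, Complex.ofReal_zero, mul_zero]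
          push_cast; exact not_lt.mp h
      · intro s hs
        rw [tf, wt_ptg_eq_zero' hR, Complex.ofReal_zero, mul_zero]
        by_contra! h
        apply hs
        push_cast at h
        have hi' : (i : ℝ) < n := by exact_mod_cast Finset.mem_range.mp hi
        have hq : 3 * n / R < n := by rw [div_lt_iff₀ h0]; nlinarith
        have hlt := h.trans hq
        rw [abs_lt] at hlt
        have hi0 : (0 : ℝ) ≤ i := Nat.cast_nonneg i
        have hc0 : (0 : ℝ) < c := Nat.cast_pos.mpr hc
        have l1 : (-(c : ℝ) - 1) < s := by
          by_contra! hh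
          nlinarith
        have l2 : (s : ℝ) < c + 1 := by
          by_contra! hh
          nlinarith
        have l1' : -(c : ℤ) - 1 < s := by exact_mod_cast l1
        have l2' : s < (c : ℤ) + 1 := by exact_mod_cast l2
        rw [Finset.mem_Icc]; omega
    rw [e]
    refine (norm_sum_le _ _).trans ?_
    calc _ ≤ ∑ p ∈ A, (1 : ℝ) := Finset.sum_le_sum fun p _ => by
          rw [tf, norm_mul, norm_mul, norm_eR, one_mul, Complex.norm_real,
            Real.norm_of_nonneg (wt_nonneg _ _ _)]
          exact mul_le_one₀ (hΨ _) (wt_nonneg _ _ _) (wt_le_one _ _ _)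
      _ = _ := by simp
  set g := Nat.gcd n c
  have hg : 0 < g := Nat.gcd_pos_of_pos_left _ hn'
  have hgn : g ∣ n := Nat.gcd_dvd_left _ _
  have hq : 0 < n / g := Nat.div_pos (Nat.le_of_dvd hn' hgn) hg
  have h2 : A.card ≤ (Finset.Ioo ⌊-(3 * n / R) - 0⌋ ⌈3 * n / R - 0⌉ ×ˢ Finset.range g).card := by
    refine Finset.card_le_card_of_injOn
      (fun p => ((c : ℤ) * p.1 + p.2 * n, p.1 / (n / g))) ?_ ?_
    · intro p hp
      rw [Finset.mem_coe, hA, Finset.mem_filter, Finset.mem_product, Finset.mem_range] at hp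
      rw [Finset.mem_coe, Finset.mem_product, Finset.mem_range]
      refine ⟨perz_box 0 _ _ ?_, ?_⟩
      · push_cast; rw [zero_add]; exact hp.2
      · simp only
        rw [Nat.div_lt_iff_lt_mul hq, Nat.mul_div_cancel' hgn]; exact hp.1.1
    · intro p hp q hpq' h
      simp only [Prod.mk.injEq] at h
      have hm : c * p.1 ≡ c * q.1 [MOD n] := by
        rw [← Int.natCast_modEq_iff, Int.modEq_iff_dvd]
        exact ⟨p.2 - q.2, by push_cast; linarith [h.1]⟩
      have hm' := hm.cancel_left_div_gcd hn'
      have e1 : p.1 = q.1 := by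
        rw [← Nat.div_add_mod p.1 (n / g), ← Nat.div_add_mod q.1 (n / g), h.2, hm']
      have e2 : p.2 = q.2 := by
        have := h.1
        rw [e1] at this
        have hn0 : (n : ℤ) ≠ 0 := by exact_mod_cast hn'.ne'
        exact mul_right_cancel₀ hn0 (by linarith)
      exact Prod.ext e1 e2
  rw [Finset.card_product, Finset.card_range] at h2
  have h3 := card_perz_box 0 (3 * n / R) (by positivity)
  calc _ ≤ (A.card : ℝ) := h1
    _ ≤ ((Finset.Ioo ⌊-(3 * n / R) - 0⌋ ⌈3 * n / R - 0⌉).card : ℝ) * g := by exact_mod_cast h2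
    _ ≤ (2 * (3 * n / R) + 1) * g := by gcongr
    _ = _ := by rw [Nat.gcd_comm]; ring

end unfold

/-- Left invariance under the integer matrices with lower-left entry divisible by `N`. -/
def InvN (N : ℕ) (Ψ : SL2R → ℂ) : Prop :=
  ∀ γ : Matrix.SpecialLinearGroup (Fin 2) ℤ, (N : ℤ) ∣ γ.1 1 0 → ∀ g, Ψ (zSL γ * g) = Ψ g

/-- The test function on the line attached to the lower-left entry `c`. -/
def Hc (Ψ : SL2R → ℂ) (R : ℝ) (n : ℕ) (B : ℤ) (c : ℕ) (Y τ : ℝ) : ℂ :=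
  eR (B * τ / n) * Phi Ψ (c / R) (R * c * τ / n) Y

section Dc
variable {Ψ : SL2R → ℂ} {N : ℕ} (hinv : InvN N Ψ) {R : ℝ} (hR : 4 ≤ R) (n : ℕ) [NeZero n] (B : ℤ)
  (c : ℕ) [NeZero c]
include hinv hR

lemma tf_eq (i x p q : ℤ) (h : N * p * x - q * c = 1) :
    tf Ψ R n B c i x = eR (-(B * x / c)) * Hc Ψ R n B c (N * (p / c)) (n * x / c + i) := by
  have h0 : 0 < R := by linarith
  have hn : (n : ℝ) ≠ 0 := NeZero.ne _
  have hc : (c : ℝ) ≠ 0 := NeZero.ne _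
  set γ : Matrix.SpecialLinearGroup (Fin 2) ℤ :=
    ⟨!![N * p, q; c, x], by rw [Matrix.det_fin_two_of]; exact h⟩ with hγ
  set δ : Matrix.SpecialLinearGroup (Fin 2) ℤ :=
    ⟨!![-c, -x; N * p, q], by rw [Matrix.det_fin_two_of]; linarith⟩ with hδ
  have e1 : Wst * zSL γ = zSL δ := by
    apply SL2R_ext <;> simp only [mul_apply2, zSL_apply] <;> simp [Wst, mk2, hγ, hδ]
  have e2 : zSL γ * ptg R n i = gp (c / R) (R * c * (n * x / c + i) / n) (N * (p / c)) := by
    have a10 : (zSL γ * ptg R n i).1 1 0 = c / R := by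
      simp only [mul_apply2, zSL_apply, ptg_00 h0.ne', ptg_10 h0.ne']; simp [hγ]; ring
    have a11 : (zSL γ * ptg R n i).1 1 1 = R * c * (n * x / c + i) / n := by
      simp only [mul_apply2, zSL_apply, ptg_01 h0.ne', ptg_11 h0.ne']; simp [hγ]; field_simp; ring
    have a00 : (zSL γ * ptg R n i).1 0 0 = N * p / R := by
      simp only [mul_apply2, zSL_apply, ptg_00 h0.ne', ptg_10 h0.ne']; simp [hγ]; ring
    have := eq_gp (zSL γ * ptg R n i) (by rw [a10]; positivity)
    rw [this, a10, a11, a00]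
    congr 1; field_simp
  have e3 : rho (gp (c / R) (R * c * (n * x / c + i) / n) (N * (p / c))) = wt (ptg R n i) c x := by
    rw [← e2, rho_mul_eq]; rfl
  have e4 : Ψ (Wst * gp (c / R) (R * c * (n * x / c + i) / n) (N * (p / c))) = Ψ (ptg R n i) := by
    rw [← e2, ← mul_assoc, e1]
    exact hinv δ ⟨p, rfl⟩ _
  rw [tf, Hc, Phi, e3, e4, ← mul_assoc, ← mul_assoc, ← eR_add]
  congr 3
  field_simp; ring

lemma Dc_eq (hc : Nat.Coprime N c) :
    Dc Ψ R n B c = ∑ u : (ZMod c)ˣ, eR (-(B * ((u : ZMod c).val : ℤ) / c)) *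
      perz (Hc Ψ R n B c (N * (((((ZMod.unitOfCoprime N hc * u)⁻¹ : (ZMod c)ˣ) : ZMod c).val : ℤ) / c)))
        (n * ((u : ZMod c).val : ℤ) / c) := by
  have h0 : 0 < R := by linarith
  have hn : 0 < (n : ℝ) := Nat.cast_pos.mpr (NeZero.pos n)
  have hc0 : 0 < (c : ℝ) := Nat.cast_pos.mpr (NeZero.pos c)
  have hsum := unfold_sum n c (fun i s => tf Ψ R n B c i s) ?_ ?_ ?_
  · unfold Dc
    rw [hsum, ← Finset.sum_filter_add_sum_filter_not _ (fun x => Nat.gcd x c = 1)]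
    rw [Finset.sum_eq_zero (s := (Finset.range c).filter (fun x => ¬ Nat.gcd x c = 1)), add_zero]
    · have key := sum_coprime_eq_units c (fun z => ∑' i : ℤ, tf Ψ R n B c i (z.val : ℕ))
      have e : ∀ x ∈ (Finset.range c).filter (fun x => Nat.gcd x c = 1),
          ∑' i : ℤ, tf Ψ R n B c i x = ∑' i : ℤ, tf Ψ R n B c i (((x : ZMod c).val : ℕ) : ℤ) := by
        intro x hx
        rw [ZMod.val_cast_of_lt (Finset.mem_range.mp (Finset.mem_filter.mp hx).1)]
      rw [Finset.sum_congr rfl e, key]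
      refine Finset.sum_congr rfl fun u _ => ?_
      set p : ℤ := ((((ZMod.unitOfCoprime N hc * u)⁻¹ : (ZMod c)ˣ) : ZMod c).val : ℤ) with hp
      have hq : ∃ q : ℤ, (N : ℤ) * p * ((u : ZMod c).val : ℤ) - q * c = 1 := by
        have : ((1 : ℤ) : ZMod c) = (((N : ℤ) * p * ((u : ZMod c).val : ℤ) : ℤ) : ZMod c) := by
          have h1 := (ZMod.unitOfCoprime N hc * u).inv_mul
          rw [Units.val_mul, ZMod.coe_unitOfCoprime] at h1
          rw [hp]; push_cast
          rw [ZMod.natCast_zmod_val, ZMod.natCast_zmod_val, ← h1]; ring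
        rw [ZMod.intCast_eq_intCast_iff_dvd_sub] at this
        obtain ⟨q, hq⟩ := this
        exact ⟨q, by linarith⟩
      obtain ⟨q, hq⟩ := hq
      rw [perz, ← tsum_mul_left]
      exact tsum_congr fun i => tf_eq hinv hR n B c i _ p q hq
    · intro x hx
      rw [Finset.mem_filter] at hx
      have hcop : ¬ IsCoprime (c : ℤ) (x : ℤ) := by
        rw [Nat.isCoprime_iff_coprime, Nat.coprime_comm]; exact hx.2
      simp_rw [tf, wt_eq_zero' hcop]
      simp
  · intro i
    unfold tf
    have h1 : Summable fun s : ℤ => wt (ptg R n i) c s :=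
      (summable_wt (ptg R n i)).comp_injective (i := fun s : ℤ => ((c : ℤ), s))
        (fun a b h => (Prod.mk.inj h).2)
    exact (Complex.ofRealCLM.summable h1).mul_left _
  · intro s
    refine summable_of_ne_finset_zero
      (s := Finset.Ioo ⌊-(3 * n / (R * c)) - (s * n / c : ℝ)⌋ ⌈3 * n / (R * c) - (s * n / c : ℝ)⌉) ?_
    intro i hi
    rw [tf, wt_ptg_eq_zero' hR, Complex.ofReal_zero, mul_zero]
    by_contra! hlt
    apply hi
    apply perz_box
    rw [show (s : ℝ) * n / c + i = ((c : ℤ) * i + s * n) / c by push_cast; field_simp; ring,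
      abs_div, abs_of_pos hc0, div_lt_iff₀ hc0]
    refine hlt.trans_le (le_of_eq ?_)
    field_simp
  · intro i s
    unfold tf
    rw [ptg_add, hinv _ (by simp [zU])]
    congr 1
    · congr 1
      rw [show (B : ℝ) * ((i + n : ℤ) : ℝ) / n = B * i / n + (B : ℤ) by push_cast; field_simp,
        eR_add_int]
    · rw [wt, latTerm_mul, latSum_mul]
      have : rowEquiv (zU 1) ((c : ℤ), s - c) = ((c : ℤ), s) := by
        simp [rowEquiv, zU]
      rw [this]; rfl

end Dc

/-! ### Equidistribution along the unfolded sum -/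

lemma Phi_add_N {Ψ : SL2R → ℂ} {N : ℕ} (hinv : InvN N Ψ) {w₁ : ℝ} (h : w₁ ≠ 0) (w₂ Y : ℝ) :
    Phi Ψ w₁ w₂ (Y + N) = Phi Ψ w₁ w₂ Y := by
  set δ : Matrix.SpecialLinearGroup (Fin 2) ℤ :=
    ⟨!![1, 0; -N, 1], by rw [Matrix.det_fin_two_of]; ring⟩ with hδ
  have e : Wst * uElt N = zSL δ * Wst := by
    apply SL2R_ext <;> simp only [mul_apply2, zSL_apply] <;> simp [Wst, mk2, hδ, uElt]
  have e2 : uElt (N : ℝ) = uElt ((N : ℤ) : ℝ) := by rw [Int.cast_natCast]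
  rw [Phi, Phi, ← u_mul_gp h, ← mul_assoc, e, mul_assoc, hinv δ (by simp [hδ]), e2, rho_u_mul]

section good
variable {Ψ : SL2R → ℂ} {T : ℝ} (hT : 1 ≤ T) (hΨ : LipG T Ψ) {N : ℕ} (hinv : InvN N Ψ)
  (hN : (N : ℝ) ≤ T) {R : ℝ} (hR : 4 ≤ R) (n : ℕ) [NeZero n] (hn1 : (n : ℝ) ≤ R ^ 2)
  (hn2 : R ^ 2 ≤ T * n) (B : ℤ) (hB : |(B : ℝ)| ≤ n) (c : ℕ) [NeZero c] (hc1 : R / T ≤ c)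
  (hc2 : (c : ℝ) ≤ 3 * R)
include hR

lemma norm_Hc_le (hΨ : LipG T Ψ) (Y τ : ℝ) : ‖Hc Ψ R n B c Y τ‖ ≤ 1 := by
  rw [Hc, norm_mul, norm_eR, one_mul]; exact norm_Phi_le hΨ _ _ _

include hT hn1 hc1 in
lemma Hc_eq_zero (Y τ : ℝ) (hτ : 3 * T ≤ |τ|) : Hc Ψ R n B c Y τ = 0 := by
  have h0 : 0 < R := by linarith
  have hT0 : 0 < T := by linarith
  have hn : 0 < (n : ℝ) := Nat.cast_pos.mpr (NeZero.pos n)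
  have hc : 0 < (c : ℝ) := Nat.cast_pos.mpr (NeZero.pos c)
  rw [Hc, Phi_eq_zero, mul_zero]
  · positivity
  · right
    rw [div_le_iff₀ hT0] at hc1
    rw [abs_div, abs_mul, abs_of_pos (mul_pos h0 hc), abs_of_pos hn, le_div_iff₀ hn]
    calc 3 * (n : ℝ) ≤ 3 * (R * (c * T)) := by nlinarith
      _ = R * c * (3 * T) := by ring
      _ ≤ _ := by gcongr

include hT hΨ hn2 hB hc1 hc2 in
lemma norm_Hc_sub_le (Y τ τ' : ℝ) :
    ‖Hc Ψ R n B c Y τ - Hc Ψ R n B c Y τ'‖ ≤ 7 * 10 ^ 8 * T ^ 5 * |τ - τ'| := by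
  have h0 : 0 < R := by linarith
  have hT0 : 0 < T := by linarith
  have hn : 0 < (n : ℝ) := Nat.cast_pos.mpr (NeZero.pos n)
  have hc : 0 < (c : ℝ) := Nat.cast_pos.mpr (NeZero.pos c)
  have hw : 1 / T ≤ (c : ℝ) / R := by
    rw [div_le_div_iff₀ hT0 h0]; rw [div_le_iff₀ hT0] at hc1; linarith
  set x := Phi Ψ (c / R) (R * c * τ / n) Y
  set x' := Phi Ψ (c / R) (R * c * τ' / n) Y
  have h1 : ‖x - x'‖ ≤ 6 * 10 ^ 8 * T ^ 5 * |τ - τ'| := by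
    refine (norm_Phi_sub_w₂_le hT hΨ hw).trans ?_
    rw [← sub_div, ← mul_sub, abs_div, abs_mul, abs_of_pos (mul_pos h0 hc), abs_of_pos hn]
    have : R * c / n ≤ 3 * T := by
      rw [div_le_iff₀ hn]; nlinarith
    calc _ = 2 * 10 ^ 8 * T ^ 4 * (R * c / n) * |τ - τ'| := by ring
      _ ≤ 2 * 10 ^ 8 * T ^ 4 * (3 * T) * |τ - τ'| := by gcongr
      _ = _ := by ring
  have h2 : ‖eR (B * τ / n) - eR (B * τ' / n)‖ ≤ 7 * |τ - τ'| := by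
    refine (norm_eR_sub_le _ _).trans ?_
    rw [← sub_div, ← mul_sub, abs_div, abs_mul, abs_of_pos hn]
    have : |(B : ℝ)| / n ≤ 1 := by rw [div_le_one hn]; exact hB
    have hp : 2 * Real.pi ≤ 7 := by linarith [Real.pi_lt_d2]
    calc _ = 2 * Real.pi * (|(B : ℝ)| / n) * |τ - τ'| := by ring
      _ ≤ 7 * 1 * |τ - τ'| := by gcongr
      _ = _ := by ring
  have e : Hc Ψ R n B c Y τ - Hc Ψ R n B c Y τ' =
      eR (B * τ / n) * (x - x') + (eR (B * τ / n) - eR (B * τ' / n)) * x' := by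
    rw [Hc, Hc]; ring
  rw [e]
  refine (norm_add_le _ _).trans ?_
  rw [norm_mul, norm_mul, norm_eR, one_mul]
  have h3 : ‖x'‖ ≤ 1 := norm_Phi_le hΨ _ _ _
  have h4 : ‖eR (B * τ / n) - eR (B * τ' / n)‖ * ‖x'‖ ≤ 7 * |τ - τ'| * 1 := by gcongr
  have h5 : 1 ≤ T ^ 5 := one_le_pow₀ hT
  nlinarith [mul_nonneg (sub_nonneg.mpr h5) (abs_nonneg (τ - τ')), abs_nonneg (τ - τ')]

include hT hΨ hc1 in
lemma norm_Hc_sub_Y_le (Y Y' τ : ℝ) :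
    ‖Hc Ψ R n B c Y τ - Hc Ψ R n B c Y' τ‖ ≤ 2 * 10 ^ 8 * T ^ 4 * |Y - Y'| := by
  have h0 : 0 < R := by linarith
  have hT0 : 0 < T := by linarith
  have hw : 1 / T ≤ (c : ℝ) / R := by
    rw [div_le_div_iff₀ hT0 h0]; rw [div_le_iff₀ hT0] at hc1; linarith
  rw [Hc, Hc, ← mul_sub, norm_mul, norm_eR, one_mul]
  exact norm_Phi_sub_Y_le hT hΨ hw

/-- The average of the unfolded function. -/
def Ic (Ψ : SL2R → ℂ) (R : ℝ) (n : ℕ) (B : ℤ) (N c : ℕ) : ℂ :=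
  ∫ u in (0 : ℝ)..1, ∫ t in (0 : ℝ)..1, perz (Hc Ψ R n B c (N * u)) t

include hT hΨ hn1 hc1 in
lemma norm_perz_Hc_le (Y t : ℝ) : ‖perz (Hc Ψ R n B c Y) t‖ ≤ 7 * T := by
  refine (norm_perz_le (S := 3 * T) (by linarith) (fun τ => Hc_eq_zero hT hR n hn1 B c hc1 Y τ)
    (norm_Hc_le hR n B c hΨ Y) t).trans (by linarith)

include hT hΨ hn1 hc1 in
lemma norm_Ic_le : ‖Ic Ψ R n B N c‖ ≤ 7 * T := by
  have h := intervalIntegral.norm_integral_le_of_norm_le_const (a := (0 : ℝ)) (b := 1)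
    (f := fun u => ∫ t in (0 : ℝ)..1, perz (Hc Ψ R n B c (N * u)) t) (C := 7 * T) ?_
  · rw [sub_zero, abs_one, mul_one] at h; exact h
  · intro u _
    have h := intervalIntegral.norm_integral_le_of_norm_le_const (a := (0 : ℝ)) (b := 1)
      (f := fun t => perz (Hc Ψ R n B c (N * u)) t) (C := 7 * T)
      (fun t _ => norm_perz_Hc_le hT hΨ hR n hn1 B c hc1 _ t)
    simpa using h

include hT hΨ hinv hN hn1 hn2 hB hc1 hc2 in
lemma norm_Dc_sub_le (hc : Nat.Coprime N c) (H : ℕ) (hH : 0 < H) :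
    ‖Dc Ψ R n B c - (∑ u : (ZMod c)ˣ, eR (-(B * ((u : ZMod c).val : ℤ) / c))) * Ic Ψ R n B N c‖ ≤
      c * (2 * (10 ^ 10 * T ^ 6) / Real.sqrt H) + 7 * T / (H : ℝ) ^ 2 *
        ∑ p ∈ ((Finset.range H ×ˢ Finset.range H) ×ˢ (Finset.range H ×ˢ Finset.range H)).filter
            (fun p => ¬ (p.1.1 = p.1.2 ∧ p.2.1 = p.2.2)),
          ‖kloos c ((freq p.1 * n - B : ℤ) : ZMod c)
            ((((ZMod.unitOfCoprime N hc)⁻¹ : (ZMod c)ˣ) : ZMod c) *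
              (freq p.2 : ZMod c))‖ := by
  have h0 : 0 < R := by linarith
  have hT0 : 0 < T := by linarith
  have hc0 : 0 < (c : ℝ) := Nat.cast_pos.mpr (NeZero.pos c)
  rw [Dc_eq hinv hR n B c hc]
  have key := torus_average_le (Finset.univ : Finset (ZMod c)ˣ)
    (fun u => eR (-(B * ((u : ZMod c).val : ℤ) / c))) (fun u _ => (norm_eR _).le)
    (fun u => (n * ((u : ZMod c).val : ℤ) / c : ℝ))
    (fun u => (((((ZMod.unitOfCoprime N hc * u)⁻¹ : (ZMod c)ˣ) : ZMod c).val : ℤ) / c : ℝ))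
    (fun t u => perz (Hc Ψ R n B c (N * u)) t) (7 * T) (10 ^ 10 * T ^ 6) H hH ?_ ?_ ?_ ?_ ?_
  · refine key.trans ?_
    have hcard : ((Finset.univ : Finset (ZMod c)ˣ).card : ℝ) ≤ c := by
      rw [Finset.card_univ, ZMod.card_units_eq_totient]
      exact_mod_cast Nat.totient_le c
    gcongr with p hp
    refine le_of_eq (congrArg _ ?_)
    unfold kloos
    refine Finset.sum_congr rfl fun u _ => ?_
    rw [← eR_add, ← eR_add]
    set v : ℤ := ((((ZMod.unitOfCoprime N hc * u)⁻¹ : (ZMod c)ˣ) : ZMod c).val : ℤ) with hv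
    set w : ℤ := ((u : ZMod c).val : ℤ) with hw
    have hv' : ((v : ℤ) : ZMod c) = (((ZMod.unitOfCoprime N hc)⁻¹ : (ZMod c)ˣ) : ZMod c) *
        ((u⁻¹ : (ZMod c)ˣ) : ZMod c) := by
      rw [hv]; push_cast
      rw [ZMod.natCast_zmod_val, mul_inv, Units.val_mul]
    have hw' : ((w : ℤ) : ZMod c) = u := by rw [hw]; push_cast; rw [ZMod.natCast_zmod_val]
    have e : (-(B * w / c) + ((freq p.1 : ℤ) * (n * w / c) +
        (freq p.2 : ℤ) * (v / c)) : ℝ) =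
        ((((freq p.1 * n - B) * w + freq p.2 * v : ℤ)) : ℝ) / c := by
      push_cast; field_simp; ring
    rw [e, eR_eq_stdAddChar]
    congr 1
    rw [Int.cast_add, Int.cast_mul, Int.cast_mul _ v, hv', hw']
    ring
  · intro t u; exact perz_add_one _ _
  · intro t u
    have : Hc Ψ R n B c (N * (u + 1)) = Hc Ψ R n B c (N * u) := by
      funext τ
      rw [Hc, Hc, mul_add, mul_one, Phi_add_N hinv (by positivity)]
    simp only [this]
  · intro t u; exact norm_perz_Hc_le hT hΨ hR n hn1 B c hc1 _ _
  · intro t t' u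
    refine (norm_perz_sub_le (S := 3 * T) (by linarith)
      (fun τ => Hc_eq_zero hT hR n hn1 B c hc1 _ τ) (norm_Hc_le hR n B c hΨ _)
      (norm_Hc_sub_le hT hΨ hR n hn2 B hB c hc1 hc2 _) t t').trans ?_
    have h5 : 1 ≤ T ^ 5 := one_le_pow₀ hT
    have : (2 * (3 * T) + 3) * (7 * 10 ^ 8 * T ^ 5 + 2) ≤ 10 ^ 10 * T ^ 6 := by
      calc _ ≤ (9 * T) * (8 * 10 ^ 8 * T ^ 5) := by gcongr <;> linarith
        _ = 72 * 10 ^ 8 * T ^ 6 := by ring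
        _ ≤ _ := by have : 0 ≤ T ^ 6 := by positivity
                    nlinarith
    gcongr
  · intro t u u'
    rw [perz_sub (S := 3 * T) (fun τ => Hc_eq_zero hT hR n hn1 B c hc1 _ τ)
      (fun τ => Hc_eq_zero hT hR n hn1 B c hc1 _ τ)]
    refine (norm_perz_le (S := 3 * T) (by linarith) (fun τ hτ => ?_)
      (norm_Hc_sub_Y_le hT hΨ hR n B c hc1 _ _) t).trans ?_
    · rw [Hc_eq_zero hT hR n hn1 B c hc1 _ τ hτ, Hc_eq_zero hT hR n hn1 B c hc1 _ τ hτ, sub_zero]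
    · rw [← mul_sub, abs_mul, Nat.abs_cast]
      calc _ ≤ (7 * T) * (2 * 10 ^ 8 * T ^ 4 * (T * |u - u'|)) := by gcongr; linarith
        _ = 14 * 10 ^ 8 * (T ^ 6 * |u - u'|) := by ring
        _ ≤ 10 ^ 10 * (T ^ 6 * |u - u'|) :=
          mul_le_mul_of_nonneg_right (by norm_num) (by positivity)
        _ = _ := by ring

end good

/-! ### Cancellation in the unfolded sum -/

/-- The majorant of Kloosterman sums modulo `c` with a coefficient `ν`. -/
abbrev kloosMajorant (ν : ℤ) (c : ℕ) : ℝ :=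
  2 * (Int.gcd ν c : ℝ) * (c.divisors.card : ℝ) * (c : ℝ) ^ (3 / 4 : ℝ)

/-- Summing `kloosMajorant` over moduli, with constant `C`. -/
def KloosSumBound (C : ℝ) : Prop := ∀ (ν : ℤ) (P : ℕ), ν ≠ 0 → ∑ c ∈ Finset.Icc 1 P, kloosMajorant ν c ≤
  C * (P : ℝ) ^ (1 + 3 / 4 + 1 / 60 : ℝ) * (ν.natAbs : ℝ) ^ (1 / 60 : ℝ)

lemma sum_kloos_bound : ∃ C : ℝ, 1 ≤ C ∧ KloosSumBound C := by
  obtain ⟨C, hC1, hC⟩ := exists_divisor_bound (ε := 1 / 60) (by norm_num)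
  refine ⟨2 * C ^ 2, by nlinarith, fun ν P hν => ?_⟩
  rcases Nat.eq_zero_or_pos P with rfl | hP
  · simp; positivity
  have hP0 : (0 : ℝ) < P := by exact_mod_cast hP
  have h1 : ∀ c ∈ Finset.Icc 1 P, kloosMajorant ν c ≤
      (Int.gcd ν c : ℝ) * (2 * (C * (P : ℝ) ^ (1 / 60 : ℝ)) * (P : ℝ) ^ (3 / 4 : ℝ)) := by
    intro c hc
    rw [Finset.mem_Icc] at hc
    have hcP : (c : ℝ) ≤ P := by exact_mod_cast hc.2
    have hd : (c.divisors.card : ℝ) ≤ C * (P : ℝ) ^ (1 / 60 : ℝ) :=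
      (hC c (by omega)).trans (by gcongr)
    calc _ = 2 * (Int.gcd ν c : ℝ) * (c.divisors.card : ℝ) * (c : ℝ) ^ (3 / 4 : ℝ) := rfl
      _ ≤ 2 * (Int.gcd ν c : ℝ) * (C * (P : ℝ) ^ (1 / 60 : ℝ)) * (P : ℝ) ^ (3 / 4 : ℝ) := by
            gcongr
      _ = _ := by ring
  refine (Finset.sum_le_sum h1).trans ?_
  rw [← Finset.sum_mul, ← Nat.cast_sum]
  have h2 : ((∑ c ∈ Finset.Icc 1 P, Int.gcd ν c : ℕ) : ℝ) ≤ P * (C * (ν.natAbs : ℝ) ^ (1 / 60 : ℝ)) := by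
    calc _ ≤ ((P * ν.natAbs.divisors.card : ℕ) : ℝ) := by exact_mod_cast sum_int_gcd_le ν hν P
      _ = P * (ν.natAbs.divisors.card : ℝ) := by push_cast; ring
      _ ≤ _ := by gcongr; exact hC _ (by simpa using hν)
  refine (mul_le_mul_of_nonneg_right h2 (by positivity)).trans (le_of_eq ?_)
  rw [Real.rpow_add hP0, Real.rpow_add hP0, Real.rpow_one]; ring

section good
variable {Ψ : SL2R → ℂ} {T : ℝ} (hT : 1 ≤ T) (hΨ : LipG T Ψ) {N : ℕ} (hinv : InvN N Ψ)
  (hN : (N : ℝ) ≤ T) {R : ℝ} (hR : 4 ≤ R) (n : ℕ) [NeZero n] (hn1 : (n : ℝ) ≤ R ^ 2)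
  (hn2 : R ^ 2 ≤ T * n) (B : ℤ) (hB : |B| < n)

/-- The lower-left entries with an unfolded main term. -/
def goodC (T R : ℝ) (N : ℕ) : Finset ℕ :=
  (Finset.Icc 1 ⌊3 * R⌋₊).filter (fun c => R / T ≤ c ∧ Nat.Coprime N c)

/-- The exceptional lower-left entries. -/
def badC (T R : ℝ) (N : ℕ) : Finset ℕ :=
  (Finset.Icc 1 ⌊3 * R⌋₊).filter (fun c => ¬ (R / T ≤ c ∧ Nat.Coprime N c))

include hB in
lemma exists_kloos_majorant (H : ℕ) (p : (ℕ × ℕ) × (ℕ × ℕ))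
    (hp : p ∈ (Finset.range H ×ˢ Finset.range H) ×ˢ (Finset.range H ×ˢ Finset.range H))
    (hne : ¬ (p.1.1 = p.1.2 ∧ p.2.1 = p.2.2)) :
    ∃ ν : ℤ, ν ≠ 0 ∧ ν.natAbs ≤ 2 * H * n ∧ ∀ (c : ℕ) [NeZero c] (w : (ZMod c)ˣ),
      ‖kloos c ((freq p.1 * n - B : ℤ) : ZMod c)
            (((w⁻¹ : (ZMod c)ˣ) : ZMod c) *
              (freq p.2 : ZMod c))‖ ≤ kloosMajorant ν c := by
  have hn := NeZero.pos n
  simp only [Finset.mem_product, Finset.mem_range] at hp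
  obtain ⟨⟨h1, h2⟩, h3, h4⟩ := hp
  by_cases h : p.2.1 = p.2.2
  · refine ⟨freq p.1 * n - B, ?_, ?_, fun c _ w => kloos_le' c _ _⟩
    · have hd : freq p.1 ≠ 0 := fun h' => hne ⟨by unfold freq at h'; omega, h⟩
      have h1 : (n : ℤ) ≤ |freq p.1 * n| := by
        rw [abs_mul, Nat.abs_cast]
        nlinarith [Int.one_le_abs hd]
      intro h'
      have h0 : freq p.1 * n = B := by omega
      rw [h0] at h1; omega
    · zify
      have hd : |freq p.1| ≤ H - 1 := by rw [abs_le]; unfold freq; omega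
      have hd' : |freq p.1 * n| ≤ (H - 1) * n := by
        rw [abs_mul, Nat.abs_cast]; gcongr
      have := abs_sub (freq p.1 * n) B
      nlinarith
  · refine ⟨freq p.2, by unfold freq; omega, ?_, fun c _ w => ?_⟩
    · have : (freq p.2).natAbs ≤ H := by unfold freq; omega
      nlinarith
    · have e := kloos_mul c (((w⁻¹ : (ZMod c)ˣ) : ZMod c) * ((freq p.1 * n - B : ℤ) : ZMod c))
        (freq p.2 : ZMod c) w
      rw [Units.mul_inv_cancel_left] at e
      rw [e]
      exact kloos_le c _ _

lemma sum_eR_neg_le (c : ℕ) [NeZero c] :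
    ‖∑ u : (ZMod c)ˣ, eR (-(B * ((u : ZMod c).val : ℤ) / c))‖ ≤ kloosMajorant (-B) c := by
  refine le_trans (le_of_eq (congrArg _ ?_)) (kloos_le' c (-B) 0)
  unfold kloos
  refine Finset.sum_congr rfl fun u _ => ?_
  have : (-(B * ((u : ZMod c).val : ℤ) / c) : ℝ) = (((-B * ((u : ZMod c).val : ℤ) : ℤ)) : ℝ) / c := by
    push_cast; ring
  rw [this, eR_eq_stdAddChar]
  congr 1
  push_cast
  rw [ZMod.natCast_zmod_val]; ring

lemma sum_eR_zero (c : ℕ) [NeZero c] :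
    ∑ u : (ZMod c)ˣ, eR (-(((0 : ℤ) : ℝ) * ((u : ZMod c).val : ℤ) / c)) = Nat.totient c := by
  simp [eR_zero, ZMod.card_units_eq_totient]

include hT hΨ hinv hN hR hn1 hn2 hB in
lemma norm_sum_Dc_good_le {C : ℝ} (hC1 : 1 ≤ C) (hC : KloosSumBound C) (H : ℕ) (hH : 0 < H) :
    ‖∑ c ∈ goodC T R N, Dc Ψ R n B c -
      (if B = 0 then ∑ c ∈ goodC T R N, (Nat.totient c : ℂ) * Ic Ψ R n 0 N c else 0)‖ ≤
      (⌊3 * R⌋₊ : ℝ) ^ 2 * (2 * (10 ^ 10 * T ^ 6) / Real.sqrt H) +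
        (7 * T / (H : ℝ) ^ 2 * (H : ℝ) ^ 4 + 7 * T) *
        (C * (⌊3 * R⌋₊ : ℝ) ^ (1 + 3 / 4 + 1 / 60 : ℝ) * (2 * H * n : ℝ) ^ (1 / 60 : ℝ)) := by
  have h0 : 0 < R := by linarith
  have hT0 : 0 < T := by linarith
  have hn : 0 < (n : ℝ) := Nat.cast_pos.mpr (NeZero.pos n)
  have hn0 := NeZero.pos n
  have hB' : |(B : ℝ)| ≤ n := by exact_mod_cast hB.le
  set P := ⌊3 * R⌋₊ with hP
  set K := C * (P : ℝ) ^ (1 + 3 / 4 + 1 / 60 : ℝ) * (2 * H * n : ℝ) ^ (1 / 60 : ℝ) with hK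
  have hK0 : 0 ≤ K := by positivity
  set S := ((Finset.range H ×ˢ Finset.range H) ×ˢ (Finset.range H ×ˢ Finset.range H)).filter
            (fun p => ¬ (p.1.1 = p.1.2 ∧ p.2.1 = p.2.2)) with hS
  have hSc : (S.card : ℝ) ≤ (H : ℝ) ^ 4 := by
    have : S.card ≤ H ^ 4 := by
      refine (Finset.card_filter_le _ _).trans ?_
      simp [Finset.card_product]; apply le_of_eq; ring
    exact_mod_cast this
  have hbound : ∀ ν : ℤ, ν ≠ 0 → ν.natAbs ≤ 2 * H * n → ∑ c ∈ goodC T R N,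
      kloosMajorant ν c ≤ K := by
    intro ν hν hν2
    refine (Finset.sum_le_sum_of_subset_of_nonneg (Finset.filter_subset _ _)
      (fun _ _ _ => by positivity)).trans ((hC ν P hν).trans ?_)
    rw [hK]
    have : (ν.natAbs : ℝ) ≤ 2 * H * n := by exact_mod_cast hν2
    gcongr
  choose! ν hν using fun p (hp : p ∈ S) =>
    exists_kloos_majorant n B hB H p (Finset.mem_filter.mp hp).1 (Finset.mem_filter.mp hp).2
  have hmain : ∀ c ∈ goodC T R N, ‖Dc Ψ R n B c - (if B = 0 then (Nat.totient c : ℂ) * Ic Ψ R n 0 N c else 0)‖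
      ≤ (c * (2 * (10 ^ 10 * T ^ 6) / Real.sqrt H) + 7 * T / (H : ℝ) ^ 2 *
        ∑ p ∈ S, kloosMajorant (ν p) c) +
        (if B = 0 then 0 else
          7 * T * (kloosMajorant (-B) c)) := by
    intro c hc
    rw [goodC, Finset.mem_filter, Finset.mem_Icc] at hc
    obtain ⟨⟨hc1, hc2⟩, hc3, hc4⟩ := hc
    have : NeZero c := ⟨by omega⟩
    have hc5 : (c : ℝ) ≤ 3 * R := (Nat.le_floor_iff (by linarith)).mp hc2
    have key := norm_Dc_sub_le hT hΨ hinv hN hR n hn1 hn2 B hB' c hc3 hc5 hc4 H hH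
    have key2 : ‖Dc Ψ R n B c - (∑ u : (ZMod c)ˣ, eR (-(B * ((u : ZMod c).val : ℤ) / c))) * Ic Ψ R n B N c‖ ≤
        c * (2 * (10 ^ 10 * T ^ 6) / Real.sqrt H) + 7 * T / (H : ℝ) ^ 2 *
        ∑ p ∈ S, kloosMajorant (ν p) c := by
      refine key.trans ?_
      gcongr with p hp
      exact (hν p hp).2.2 c _
    by_cases hB0 : B = 0
    · subst hB0
      rw [sum_eR_zero] at key2
      simpa using key2
    · rw [if_neg hB0, if_neg hB0, sub_zero]
      have h3 := norm_Ic_le (N := N) hT hΨ hR n hn1 B c hc3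
      have h4 := sum_eR_neg_le B c
      refine (norm_le_norm_sub_add _ _).trans (add_le_add key2 ?_)
      rw [norm_mul, mul_comm]
      gcongr
  have e : ∑ c ∈ goodC T R N, Dc Ψ R n B c -
      (if B = 0 then ∑ c ∈ goodC T R N, (Nat.totient c : ℂ) * Ic Ψ R n 0 N c else 0) =
      ∑ c ∈ goodC T R N, (Dc Ψ R n B c - (if B = 0 then (Nat.totient c : ℂ) * Ic Ψ R n 0 N c else 0)) := by
    rw [Finset.sum_sub_distrib]; split_ifs <;> simp
  rw [e]
  refine (norm_sum_le _ _).trans ((Finset.sum_le_sum hmain).trans ?_)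
  rw [Finset.sum_add_distrib, Finset.sum_add_distrib, ← Finset.sum_mul, ← Finset.mul_sum,
    Finset.sum_comm]
  have g1 : ∑ c ∈ goodC T R N, (c : ℝ) ≤ (P : ℝ) ^ 2 := by
    calc _ ≤ ∑ c ∈ Finset.Icc 1 P, (c : ℝ) :=
          Finset.sum_le_sum_of_subset_of_nonneg (Finset.filter_subset _ _) (fun _ _ _ => by positivity)
      _ ≤ ∑ c ∈ Finset.Icc 1 P, (P : ℝ) :=
          Finset.sum_le_sum fun c hc => by exact_mod_cast (Finset.mem_Icc.mp hc).2
      _ = _ := by simp; ring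
  have g2 : ∑ p ∈ S, ∑ c ∈ goodC T R N,
      kloosMajorant (ν p) c ≤ (H : ℝ) ^ 4 * K := by
    refine (Finset.sum_le_card_nsmul _ _ K fun p hp => hbound _ (hν p hp).1 (hν p hp).2.1).trans ?_
    rw [nsmul_eq_mul]; gcongr
  have g3 : ∑ c ∈ goodC T R N, (if B = 0 then 0 else
          7 * T * (kloosMajorant (-B) c)) ≤ 7 * T * K := by
    by_cases hB0 : B = 0
    · simp [hB0]; positivity
    · simp only [if_neg hB0]
      rw [← Finset.mul_sum]
      gcongr
      refine hbound _ (by omega) ?_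
      have : (-B).natAbs ≤ n := by have := abs_lt.mp hB; omega
      nlinarith
  calc _ ≤ (P : ℝ) ^ 2 * (2 * (10 ^ 10 * T ^ 6) / Real.sqrt H) + 7 * T / (H : ℝ) ^ 2 * ((H : ℝ) ^ 4 * K) +
        7 * T * K := by gcongr
    _ = _ := by ring

end good

/-- Cancellation in the exponential sum along the points `ptg R n i`. -/
theorem exists_expSum_bound : ∃ C : ℝ, 1 ≤ C ∧ ∀ (Ψ : SL2R → ℂ) (T : ℝ) (N : ℕ) (R : ℝ) (n : ℕ) (B : ℤ),
    1 ≤ T → LipG T Ψ → InvN N Ψ → (N : ℝ) ≤ T → 4 ≤ R → 0 < n → (n : ℝ) ≤ R ^ 2 → R ^ 2 ≤ T * n →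
    |B| < n →
    ‖∑ i ∈ Finset.range n, eR ((B : ℝ) * i / n) * Ψ (ptg R n i) -
      (if B = 0 then 2 * ∑ c ∈ goodC T R N, (Nat.totient c : ℂ) * Ic Ψ R n 0 N c else 0)‖ ≤
      2 * ∑ c ∈ badC T R N, (Nat.gcd c n : ℝ) * (6 * n / R + 1) +
      C * T ^ 7 * (n : ℝ) ^ (1 - 1 / 80 : ℝ) := by
  obtain ⟨C, hC1, hC⟩ := sum_kloos_bound
  refine ⟨2 * (9 * (2 * 10 ^ 10)) + 2 * (1008 * C + 252 * C), by linarith, ?_⟩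
  intro Ψ T N R n B hT hΨ hinv hN hR hn0 hn1 hn2 hB
  have : NeZero n := ⟨hn0.ne'⟩
  have h0 : 0 < R := by linarith
  have hT0 : 0 < T := by linarith
  have hn : 1 ≤ (n : ℝ) := by exact_mod_cast hn0
  have hn' : 0 < (n : ℝ) := by linarith
  set H := ⌈(n : ℝ) ^ (1 / 40 : ℝ)⌉₊ with hHd
  have hH1 : 1 ≤ (n : ℝ) ^ (1 / 40 : ℝ) := Real.one_le_rpow hn (by norm_num)
  have hHl : (n : ℝ) ^ (1 / 40 : ℝ) ≤ H := Nat.le_ceil _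
  have hHu : (H : ℝ) ≤ 2 * (n : ℝ) ^ (1 / 40 : ℝ) := by
    have := (Nat.ceil_lt_add_one (by linarith : 0 ≤ (n : ℝ) ^ (1 / 40 : ℝ))).le
    linarith
  have hH : 0 < H := by have : (0:ℝ) < H := by linarith
                        exact_mod_cast this
  have hHr : (0 : ℝ) < H := by exact_mod_cast hH
  have key := norm_sum_Dc_good_le hT hΨ hinv hN hR n hn1 hn2 B hB hC1 hC H hH
  set P := ⌊3 * R⌋₊ with hP
  have hP2 : (P : ℝ) ^ 2 ≤ 9 * T * n := by
    have : (P : ℝ) ≤ 3 * R := Nat.floor_le (by linarith)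
    calc (P : ℝ) ^ 2 ≤ (3 * R) ^ 2 := by gcongr
      _ = 9 * R ^ 2 := by ring
      _ ≤ 9 * (T * n) := by gcongr
      _ = _ := by ring
  have hsq : (n : ℝ) ^ (1 / 80 : ℝ) ≤ Real.sqrt H := by
    refine Real.le_sqrt_of_sq_le ?_
    rw [← Real.rpow_natCast, ← Real.rpow_mul hn'.le]
    refine le_trans (le_of_eq ?_) hHl
    norm_num
  have t1 : (P : ℝ) ^ 2 * (2 * (10 ^ 10 * T ^ 6) / Real.sqrt H) ≤
      9 * (2 * 10 ^ 10) * T ^ 7 * (n : ℝ) ^ (1 - 1 / 80 : ℝ) := by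
    calc _ ≤ 9 * T * n * (2 * (10 ^ 10 * T ^ 6) / (n : ℝ) ^ (1 / 80 : ℝ)) := by gcongr
      _ = 9 * (2 * 10 ^ 10) * T ^ 7 * ((n : ℝ) / (n : ℝ) ^ (1 / 80 : ℝ)) := by ring
      _ = _ := by rw [Real.rpow_sub hn', Real.rpow_one]
  have t2 : (P : ℝ) ^ (1 + 3 / 4 + 1 / 60 : ℝ) ≤ 9 * T * (n : ℝ) ^ (7 / 8 + 1 / 120 : ℝ) := by
    have e : (P : ℝ) ^ (1 + 3 / 4 + 1 / 60 : ℝ) = ((P : ℝ) ^ 2) ^ (7 / 8 + 1 / 120 : ℝ) := by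
      rw [← Real.rpow_natCast, ← Real.rpow_mul (by positivity)]; norm_num
    rw [e]
    calc _ ≤ (9 * T * n) ^ (7 / 8 + 1 / 120 : ℝ) := by gcongr
      _ = (9 * T) ^ (7 / 8 + 1 / 120 : ℝ) * (n : ℝ) ^ (7 / 8 + 1 / 120 : ℝ) :=
          Real.mul_rpow (by positivity) hn'.le
      _ ≤ (9 * T) ^ (1 : ℝ) * (n : ℝ) ^ (7 / 8 + 1 / 120 : ℝ) := by
          gcongr ?_ * _
          exact Real.rpow_le_rpow_of_exponent_le (by linarith) (by norm_num)
      _ = _ := by rw [Real.rpow_one]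
  have t3 : (2 * H * n : ℝ) ^ (1 / 60 : ℝ) ≤ 4 * (n : ℝ) ^ (41 / 2400 : ℝ) := by
    calc _ ≤ (4 * (n : ℝ) ^ (41 / 40 : ℝ)) ^ (1 / 60 : ℝ) := by
          refine Real.rpow_le_rpow (by positivity) ?_ (by norm_num)
          calc (2 * H * n : ℝ) ≤ 2 * (2 * (n : ℝ) ^ (1 / 40 : ℝ)) * n := by gcongr
            _ = 4 * ((n : ℝ) ^ (1 / 40 : ℝ) * (n : ℝ) ^ (1 : ℝ)) := by rw [Real.rpow_one]; ring
            _ = _ := by rw [← Real.rpow_add hn']; norm_num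
      _ = (4 : ℝ) ^ (1 / 60 : ℝ) * (n : ℝ) ^ (41 / 2400 : ℝ) := by
          rw [Real.mul_rpow (by norm_num) (by positivity), ← Real.rpow_mul hn'.le]; norm_num
      _ ≤ (4 : ℝ) ^ (1 : ℝ) * (n : ℝ) ^ (41 / 2400 : ℝ) := by
          gcongr ?_ * _
          exact Real.rpow_le_rpow_of_exponent_le (by norm_num) (by norm_num)
      _ = _ := by rw [Real.rpow_one]
  have t4 : (7 * T / (H : ℝ) ^ 2 * (H : ℝ) ^ 4 + 7 * T) ≤ 35 * T * (n : ℝ) ^ (1 / 20 : ℝ) := by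
    have e : 7 * T / (H : ℝ) ^ 2 * (H : ℝ) ^ 4 = 7 * T * (H : ℝ) ^ 2 := by field_simp
    have e2 : (H : ℝ) ^ 2 ≤ 4 * (n : ℝ) ^ (1 / 20 : ℝ) := by
      calc (H : ℝ) ^ 2 ≤ (2 * (n : ℝ) ^ (1 / 40 : ℝ)) ^ 2 := by gcongr
        _ = 4 * ((n : ℝ) ^ (1 / 40 : ℝ)) ^ 2 := by ring
        _ = _ := by rw [← Real.rpow_natCast, ← Real.rpow_mul hn'.le]; norm_num
    have e3 : 1 ≤ (n : ℝ) ^ (1 / 20 : ℝ) := Real.one_le_rpow hn (by norm_num)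
    rw [e]
    nlinarith
  have t5 : (7 * T / (H : ℝ) ^ 2 * (H : ℝ) ^ 4 + 7 * T) *
        (C * (P : ℝ) ^ (1 + 3 / 4 + 1 / 60 : ℝ) * (2 * H * n : ℝ) ^ (1 / 60 : ℝ)) ≤
        1260 * C * T ^ 7 * (n : ℝ) ^ (1 - 1 / 80 : ℝ) := by
    calc _ ≤ 35 * T * (n : ℝ) ^ (1 / 20 : ℝ) * (C * (9 * T * (n : ℝ) ^ (7 / 8 + 1 / 120 : ℝ)) *
          (4 * (n : ℝ) ^ (41 / 2400 : ℝ))) := by gcongr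
      _ = 1260 * C * T ^ 2 * ((n : ℝ) ^ (1 / 20 : ℝ) * (n : ℝ) ^ (7 / 8 + 1 / 120 : ℝ) *
          (n : ℝ) ^ (41 / 2400 : ℝ)) := by ring
      _ = 1260 * C * T ^ 2 * (n : ℝ) ^ (1 / 20 + (7 / 8 + 1 / 120) + 41 / 2400 : ℝ) := by
          rw [← Real.rpow_add hn', ← Real.rpow_add hn']
      _ ≤ _ := by
          have hT7 : T ^ 2 ≤ T ^ 7 := pow_le_pow_right₀ hT (by norm_num)
          have hx : (n : ℝ) ^ (1 / 20 + (7 / 8 + 1 / 120) + 41 / 2400 : ℝ) ≤ (n : ℝ) ^ (1 - 1 / 80 : ℝ) :=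
            Real.rpow_le_rpow_of_exponent_le hn (by norm_num)
          gcongr
  rw [sum_eq_Dc hR n Ψ B]
  have hsplit : ∑ c ∈ Finset.Icc 1 P, Dc Ψ R n B c =
      ∑ c ∈ goodC T R N, Dc Ψ R n B c + ∑ c ∈ badC T R N, Dc Ψ R n B c :=
    (Finset.sum_filter_add_sum_filter_not _ _ _).symm
  have hbad : ‖∑ c ∈ badC T R N, Dc Ψ R n B c‖ ≤ ∑ c ∈ badC T R N, (Nat.gcd c n : ℝ) * (6 * n / R + 1) := by
    refine (norm_sum_le _ _).trans (Finset.sum_le_sum fun c hc => ?_)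
    rw [badC, Finset.mem_filter, Finset.mem_Icc] at hc
    exact norm_Dc_le hR n Ψ B hΨ.1 c (by omega)
  rw [hsplit]
  have e : 2 * (∑ c ∈ goodC T R N, Dc Ψ R n B c + ∑ c ∈ badC T R N, Dc Ψ R n B c) -
      (if B = 0 then 2 * ∑ c ∈ goodC T R N, (Nat.totient c : ℂ) * Ic Ψ R n 0 N c else 0) =
      2 * ∑ c ∈ badC T R N, Dc Ψ R n B c + 2 * (∑ c ∈ goodC T R N, Dc Ψ R n B c -
      (if B = 0 then ∑ c ∈ goodC T R N, (Nat.totient c : ℂ) * Ic Ψ R n 0 N c else 0)) := by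
    split_ifs <;> ring
  rw [e]
  refine (norm_add_le _ _).trans ?_
  rw [norm_mul, norm_mul, Complex.norm_ofNat]
  linarith

/-! ### Riemann sums weighted by the totient function -/

lemma totient_div_eq_sum (c : ℕ) (hc : 0 < c) :
    (Nat.totient c : ℝ) / c = ∑ δ ∈ c.divisors, (ArithmeticFunction.moebius δ : ℝ) / δ := by
  have h := (ArithmeticFunction.sum_eq_iff_sum_mul_moebius_eq (R := ℝ)
    (f := fun n => (Nat.totient n : ℝ)) (g := fun n => (n : ℝ))).mp
    (fun n _ => by exact_mod_cast Nat.sum_totient n) c hc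
  have hc' : (c : ℝ) ≠ 0 := by positivity
  rw [← h, Nat.sum_divisorsAntidiagonal (fun a b => (ArithmeticFunction.moebius a : ℝ) * (b : ℝ)),
    Finset.sum_div]
  refine Finset.sum_congr rfl fun δ hδ => ?_
  have hd := Nat.dvd_of_mem_divisors hδ
  have hδ0 : (δ : ℝ) ≠ 0 := by
    have := Nat.pos_of_mem_divisors hδ; positivity
  rw [Nat.cast_div hd hδ0]
  field_simp

lemma sum_Icc_sum_divisors {M : Type*} [AddCommMonoid M] (P : ℕ) (F : ℕ → ℕ → M) :
    ∑ c ∈ Finset.Icc 1 P, ∑ δ ∈ c.divisors, F δ c =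
      ∑ δ ∈ Finset.Icc 1 P, ∑ m ∈ Finset.Icc 1 (P / δ), F δ (δ * m) := by
  rw [Finset.sum_sigma', Finset.sum_sigma']
  refine Finset.sum_bij' (fun x _ => ⟨x.2, x.1 / x.2⟩) (fun y _ => ⟨y.1 * y.2, y.1⟩) ?_ ?_ ?_ ?_ ?_
  · rintro ⟨c, δ⟩ h
    simp only [Finset.mem_sigma, Finset.mem_Icc, Nat.mem_divisors] at h ⊢
    obtain ⟨⟨h1, h2⟩, h3, h4⟩ := h
    have := Nat.pos_of_dvd_of_pos h3 h1
    exact ⟨⟨this, (Nat.le_of_dvd h1 h3).trans h2⟩, Nat.div_pos (Nat.le_of_dvd h1 h3) this,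
      Nat.div_le_div_right h2⟩
  · rintro ⟨δ, m⟩ h
    simp only [Finset.mem_sigma, Finset.mem_Icc, Nat.mem_divisors] at h ⊢
    obtain ⟨⟨h1, h2⟩, h3, h4⟩ := h
    exact ⟨⟨Nat.mul_pos h1 h3, (Nat.mul_le_mul_left _ h4).trans (Nat.mul_div_le _ _)⟩,
      dvd_mul_right _ _, (Nat.mul_pos h1 h3).ne'⟩
  · rintro ⟨c, δ⟩ h
    simp only [Finset.mem_sigma, Finset.mem_Icc, Nat.mem_divisors] at h
    simp [Nat.mul_div_cancel' h.2.1]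
  · rintro ⟨δ, m⟩ h
    simp only [Finset.mem_sigma, Finset.mem_Icc] at h
    simp [Nat.mul_div_cancel_left _ h.1.1]
  · rintro ⟨c, δ⟩ h
    simp only [Finset.mem_sigma, Finset.mem_Icc, Nat.mem_divisors] at h
    simp [Nat.mul_div_cancel' h.2.1]

section riemann
variable {g : ℝ → ℂ} {L A : ℝ} (hL : 0 ≤ L) (hlip : ∀ x y, ‖g x - g y‖ ≤ L * |x - y|)
  (hA : ∀ x, ‖g x‖ ≤ A)
include hL hlip

lemma continuous_of_lip : Continuous g := by
  have : LipschitzWith ⟨L, hL⟩ g := LipschitzWith.of_dist_le_mul fun x y => by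
    rw [dist_eq_norm, Real.dist_eq]; exact hlip x y
  exact this.continuous

include hA
lemma riemann_sum_le {h : ℝ} (hh : 0 < h) :
    ‖∑ m ∈ Finset.Icc 1 ⌊3 / h⌋₊, g (h * m) - (1 / h : ℝ) * ∫ x in (0 : ℝ)..3, g x‖ ≤ 3 * L + A := by
  have hcont := continuous_of_lip hL hlip
  have hint : ∀ a b, IntervalIntegrable g volume a b := fun a b => hcont.intervalIntegrable a b
  set K := ⌊3 / h⌋₊ with hK
  have hA0 : 0 ≤ A := (norm_nonneg _).trans (hA 0)
  have hKle : (K : ℝ) * h ≤ 3 := by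
    rw [← le_div_iff₀ hh]; exact Nat.floor_le (by positivity)
  have hKlt : 3 < (K + 1) * h := by
    rw [← div_lt_iff₀ hh]; exact Nat.lt_floor_add_one _
  have e1 : ∑ m ∈ Finset.Icc 1 K, g (h * m) = ∑ k ∈ Finset.range K, g (h * (k + 1 : ℕ)) := by
    rw [Finset.range_eq_Ico, Finset.sum_Ico_add' (fun m : ℕ => g (h * m)) 0 K 1]
    rfl
  have e2 : ∫ x in (0 : ℝ)..3, g x =
      ∑ k ∈ Finset.range K, (∫ x in (h * k)..(h * (k + 1 : ℕ)), g x) + ∫ x in (h * K)..3, g x := by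
    rw [intervalIntegral.sum_integral_adjacent_intervals (a := fun k : ℕ => h * k) (fun k _ => hint _ _),
      intervalIntegral.integral_add_adjacent_intervals (hint _ _) (hint _ _)]
    simp
  have h3 : ∀ k : ℕ, ‖g (h * (k + 1 : ℕ)) - (1 / h : ℝ) * ∫ x in (h * k)..(h * (k + 1 : ℕ)), g x‖ ≤ L * h := by
    intro k
    have e : g (h * (k + 1 : ℕ)) - (1 / h : ℝ) * ∫ x in (h * k)..(h * (k + 1 : ℕ)), g x =
        (1 / h : ℝ) * ∫ x in (h * k)..(h * (k + 1 : ℕ)), (g (h * (k + 1 : ℕ)) - g x) := by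
      rw [intervalIntegral.integral_sub intervalIntegrable_const (hint _ _),
        intervalIntegral.integral_const]
      have : h * (k + 1 : ℕ) - h * k = h := by push_cast; ring
      rw [this, mul_sub, Complex.real_smul, ← mul_assoc, ← Complex.ofReal_mul, one_div_mul_cancel hh.ne']
      simp
    have hb := intervalIntegral.norm_integral_le_of_norm_le_const (a := h * k) (b := h * (k + 1 : ℕ))
      (f := fun x => g (h * (k + 1 : ℕ)) - g x) (C := L * h) ?_
    · rw [e, norm_mul, Complex.norm_real, Real.norm_of_nonneg (by positivity)]
      have : |h * (k + 1 : ℕ) - h * k| = h := by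
        rw [show h * (k + 1 : ℕ) - h * k = h by push_cast; ring, abs_of_pos hh]
      rw [this] at hb
      calc _ ≤ 1 / h * (L * h * h) := by gcongr
        _ = _ := by field_simp
    · intro x hx
      rw [Set.uIoc_of_le (by gcongr; simp)] at hx
      refine (hlip _ _).trans ?_
      gcongr
      have := hx.2; have := hx.1
      rw [abs_of_nonneg (by linarith)]
      push_cast; linarith
  have h4 : ‖(1 / h : ℝ) * ∫ x in (h * K)..3, g x‖ ≤ A := by
    have hb := intervalIntegral.norm_integral_le_of_norm_le_const (a := h * K) (b := 3)
      (f := g) (C := A) (fun x _ => hA x)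
    rw [norm_mul, Complex.norm_real, Real.norm_of_nonneg (by positivity)]
    have : |3 - h * K| ≤ h := by rw [abs_of_nonneg (by linarith)]; linarith
    calc _ ≤ 1 / h * (A * h) := by
          gcongr; exact hb.trans (by gcongr)
      _ = _ := by field_simp
  have e3 : ∑ m ∈ Finset.Icc 1 K, g (h * m) - (1 / h : ℝ) * ∫ x in (0 : ℝ)..3, g x =
      ∑ k ∈ Finset.range K, (g (h * (k + 1 : ℕ)) - (1 / h : ℝ) * ∫ x in (h * k)..(h * (k + 1 : ℕ)), g x) -
        (1 / h : ℝ) * ∫ x in (h * K)..3, g x := by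
    rw [e1, e2, Finset.sum_sub_distrib, ← Finset.mul_sum]; ring
  rw [e3]
  refine (norm_sub_le _ _).trans (add_le_add ((norm_sum_le _ _).trans ?_) h4)
  refine (Finset.sum_le_sum fun k _ => h3 k).trans ?_
  rw [Finset.sum_const, Finset.card_range, nsmul_eq_mul]
  nlinarith

omit hL hlip hA in
lemma sum_inv_sq_le (P : ℕ) : ∑ δ ∈ Finset.Icc 1 P, (1 / (δ : ℝ) ^ 2) ≤ 2 := by
  suffices h : ∀ P : ℕ, ∑ δ ∈ Finset.Icc 1 (P + 1), (1 / (δ : ℝ) ^ 2) ≤ 2 - 1 / (P + 1 : ℝ) by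
    rcases P with _ | P
    · simp
    · have := h P
      have : 0 < 1 / (P + 1 : ℝ) := by positivity
      linarith
  intro P
  induction P with
  | zero => norm_num
  | succ P ih =>
    rw [Finset.sum_Icc_succ_top (by omega)]
    have : (1 : ℝ) / ((P + 1 + 1 : ℕ) : ℝ) ^ 2 ≤ 1 / (P + 1 : ℝ) - 1 / ((P : ℝ) + 1 + 1) := by
      push_cast
      rw [div_sub_div _ _ (by positivity) (by positivity), div_le_div_iff₀ (by positivity) (by positivity)]
      have : (0 : ℝ) ≤ P := by positivity
      nlinarith
    push_cast at *
    linarith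

lemma totient_riemann_sum_le {R : ℝ} (hR : 1 ≤ R) :
    ‖∑ c ∈ Finset.Icc 1 ⌊3 * R⌋₊, ((Nat.totient c / c : ℝ) : ℂ) * g (c / R)‖ ≤
      2 * R * ‖∫ x in (0 : ℝ)..3, g x‖ + (3 * L + A) * (1 + Real.log (3 * R)) := by
  have h0 : 0 < R := by linarith
  have hA0 : 0 ≤ A := (norm_nonneg _).trans (hA 0)
  set P := ⌊3 * R⌋₊ with hP
  have hP1 : 1 ≤ P := by rw [hP, Nat.one_le_floor_iff]; linarith
  set I := ∫ x in (0 : ℝ)..3, g x with hI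
  have e1 : ∑ c ∈ Finset.Icc 1 P, ((Nat.totient c / c : ℝ) : ℂ) * g (c / R) =
      ∑ δ ∈ Finset.Icc 1 P, (((ArithmeticFunction.moebius δ : ℝ) / δ : ℝ) : ℂ) *
        ∑ m ∈ Finset.Icc 1 (P / δ), g (δ / R * m) := by
    have := sum_Icc_sum_divisors P (fun δ c => (((ArithmeticFunction.moebius δ : ℝ) / δ : ℝ) : ℂ) * g (c / R))
    rw [← Finset.sum_congr rfl fun c hc => ?_] at this
    · rw [this]
      refine Finset.sum_congr rfl fun δ _ => ?_
      rw [Finset.mul_sum]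
      refine Finset.sum_congr rfl fun m _ => ?_
      congr 2; push_cast; ring
    · rw [totient_div_eq_sum c (Finset.mem_Icc.mp hc).1, ← Finset.sum_mul, Complex.ofReal_sum]
  have h2 : ∀ δ ∈ Finset.Icc 1 P, ‖(((ArithmeticFunction.moebius δ : ℝ) / δ : ℝ) : ℂ) *
        ∑ m ∈ Finset.Icc 1 (P / δ), g (δ / R * m)‖ ≤
      R * ‖I‖ * (1 / (δ : ℝ) ^ 2) + (3 * L + A) * ((δ : ℝ)⁻¹) := by
    intro δ hδ
    have hδ0 : 0 < (δ : ℝ) := by exact_mod_cast (Finset.mem_Icc.mp hδ).1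
    have key := riemann_sum_le hL hlip hA (h := δ / R) (by positivity)
    have e : ⌊3 / (δ / R)⌋₊ = P / δ := by
      rw [hP, ← Nat.floor_div_natCast]; congr 1; field_simp
    rw [e] at key
    have h3 : ‖∑ m ∈ Finset.Icc 1 (P / δ), g (δ / R * m)‖ ≤ R / δ * ‖I‖ + (3 * L + A) := by
      refine (norm_le_norm_sub_add _ (((1 / (δ / R) : ℝ) : ℂ) * I)).trans ?_
      rw [add_comm]
      refine add_le_add ?_ key
      rw [norm_mul, Complex.norm_real, Real.norm_of_nonneg (by positivity)]
      apply le_of_eq; rw [hI]; field_simp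
    have h4 : |((ArithmeticFunction.moebius δ : ℝ) / δ : ℝ)| ≤ 1 / δ := by
      rw [abs_div, abs_of_pos hδ0]
      gcongr
      exact_mod_cast ArithmeticFunction.abs_moebius_le_one
    rw [norm_mul, Complex.norm_real, Real.norm_eq_abs]
    calc _ ≤ 1 / δ * (R / δ * ‖I‖ + (3 * L + A)) := by gcongr
      _ = _ := by field_simp
  rw [e1]
  refine (norm_sum_le _ _).trans ((Finset.sum_le_sum h2).trans ?_)
  rw [Finset.sum_add_distrib, ← Finset.mul_sum, ← Finset.mul_sum]
  have h5 : ∑ δ ∈ Finset.Icc 1 P, ((δ : ℝ)⁻¹) ≤ 1 + Real.log (3 * R) := by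
    have := harmonic_le_one_add_log P
    rw [harmonic_eq_sum_Icc] at this
    push_cast at this
    refine this.trans ?_
    exact (add_le_add_iff_left _).mpr
      (Real.log_le_log (by exact_mod_cast hP1) (Nat.floor_le (by linarith)))
  have h6 := sum_inv_sq_le P
  calc _ ≤ R * ‖I‖ * 2 + (3 * L + A) * (1 + Real.log (3 * R)) := by gcongr
    _ = _ := by ring

end riemann

/-! ### The main term and equidistribution of the full orbit -/

lemma norm_integral_le_of_supp {h : ℝ → ℂ} {K : ℝ} (hb : ∀ w, ‖h w‖ ≤ K)
    (hs : ∀ w, 3 ≤ |w| → h w = 0) : ‖∫ w, h w‖ ≤ 6 * K := by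
  have h1 := norm_integral_le_of_norm_le (μ := volume) (f := h)
    (g := (Set.Icc (-3 : ℝ) 3).indicator fun _ => K)
    ((integrable_indicator_iff measurableSet_Icc).mpr (by simp)) (Filter.Eventually.of_forall fun w => ?_)
  · rw [integral_indicator measurableSet_Icc] at h1
    refine h1.trans (le_of_eq ?_)
    simp; norm_num
  · by_cases hw : w ∈ Set.Icc (-3 : ℝ) 3
    · rw [Set.indicator_of_mem hw]; exact hb w
    · rw [Set.indicator_of_notMem hw, hs w, norm_zero]
      by_contra! hlt
      exact hw (abs_le.mp hlt.le)

lemma LipG.mono {L L' : ℝ} (h : L ≤ L') {f : SL2R → ℂ} (hf : LipG L f) : LipG L' f :=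
  ⟨hf.1, fun g k => (hf.2 g k).trans (mul_le_mul_of_nonneg_right h (matSup_nonneg _))⟩

/-- The main term attached to the lower-left entry `x`. -/
def Mn (Ψ : SL2R → ℂ) (N : ℕ) (x : ℝ) : ℂ := ∫ u in (0 : ℝ)..1, ∫ w, Phi Ψ x w (N * u)

lemma norm_integral_Phi_le {Ψ : SL2R → ℂ} (hΨ : ∀ g, ‖Ψ g‖ ≤ 1) {x : ℝ} (hx : x ≠ 0) (Y : ℝ) :
    ‖∫ w, Phi Ψ x w Y‖ ≤ 6 := by
  have := norm_integral_le_of_supp (h := fun w => Phi Ψ x w Y) (K := 1) (fun w => ?_)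
    (fun w hw => Phi_eq_zero Y hx (Or.inr hw))
  · simpa using this
  · rw [Phi, norm_mul, Complex.norm_real, Real.norm_of_nonneg (rho_nonneg _)]
    exact mul_le_one₀ (hΨ _) (rho_nonneg _) (rho_le_one _)

lemma norm_Mn_le {Ψ : SL2R → ℂ} (hΨ : ∀ g, ‖Ψ g‖ ≤ 1) (N : ℕ) {x : ℝ} (hx : x ≠ 0) :
    ‖Mn Ψ N x‖ ≤ 6 := by
  have h := intervalIntegral.norm_integral_le_of_norm_le_const (a := (0 : ℝ)) (b := 1)
    (f := fun u => ∫ w, Phi Ψ x w (N * u)) (C := 6) (fun u _ => norm_integral_Phi_le hΨ hx _)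
  simpa [Mn] using h

lemma Mn_eq_zero (Ψ : SL2R → ℂ) (N : ℕ) {x : ℝ} (hx : 3 ≤ x) : Mn Ψ N x = 0 := by
  unfold Mn
  have : ∀ u w, Phi Ψ x w (N * u) = 0 := fun u w =>
    Phi_eq_zero _ (by linarith) (Or.inl (hx.trans (le_abs_self x)))
  simp [this]

section lip
variable {Ψ : SL2R → ℂ} {T : ℝ} (hT : 1 ≤ T) (hΨ : LipG T Ψ)
include hT hΨ

lemma integrable_Phi {x : ℝ} (hx : 1 / T ≤ x) (Y : ℝ) : Integrable fun w => Phi Ψ x w Y := by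
  have hT0 : 0 < T := by linarith
  have hx0 : 0 < x := lt_of_lt_of_le (by positivity) hx
  have hc : Continuous fun w => Phi Ψ x w Y :=
    continuous_of_lip (L := 2 * 10 ^ 8 * T ^ 4) (by positivity)
      fun a b => norm_Phi_sub_w₂_le hT hΨ hx
  refine hc.integrable_of_hasCompactSupport ?_
  refine HasCompactSupport.of_support_subset_isCompact (isCompact_Icc (a := (-3 : ℝ)) (b := 3)) ?_
  intro w hw
  by_contra hn
  apply hw
  refine Phi_eq_zero Y hx0.ne' (Or.inr ?_)
  by_contra! hlt
  exact hn (abs_le.mp hlt.le)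

lemma continuous_integral_Phi {x : ℝ} (hx : 1 / T ≤ x) : Continuous fun Y => ∫ w, Phi Ψ x w Y := by
  have hT0 : 0 < T := by linarith
  have hx0 : 0 < x := lt_of_lt_of_le (by positivity) hx
  refine continuous_of_lip (L := 6 * (2 * 10 ^ 8 * T ^ 4)) (by positivity) fun Y Y' => ?_
  rw [← integral_sub (integrable_Phi hT hΨ hx _) (integrable_Phi hT hΨ hx _), mul_assoc]
  refine norm_integral_le_of_supp (fun w => norm_Phi_sub_Y_le hT hΨ hx) fun w hw => ?_
  rw [Phi_eq_zero _ hx0.ne' (Or.inr hw), Phi_eq_zero _ hx0.ne' (Or.inr hw), sub_zero]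

lemma norm_Mn_sub_le (N : ℕ) {x x' : ℝ} (hx : 1 / T ≤ x) (hx' : 1 / T ≤ x') :
    ‖Mn Ψ N x - Mn Ψ N x'‖ ≤ 12 * 10 ^ 8 * T ^ 4 * |x - x'| := by
  have hT0 : 0 < T := by linarith
  have hx0 : 0 < x := lt_of_lt_of_le (by positivity) hx
  have hx0' : 0 < x' := lt_of_lt_of_le (by positivity) hx'
  have hi : ∀ {y : ℝ}, 1 / T ≤ y → IntervalIntegrable (fun u : ℝ => ∫ w, Phi Ψ y w (N * u)) volume 0 1 :=
    fun hy => ((continuous_integral_Phi hT hΨ hy).comp (continuous_const.mul continuous_id)).intervalIntegrable _ _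
  unfold Mn
  rw [← intervalIntegral.integral_sub (hi hx) (hi hx')]
  have h := intervalIntegral.norm_integral_le_of_norm_le_const (a := (0 : ℝ)) (b := 1)
    (f := fun u => (∫ w, Phi Ψ x w (N * u)) - ∫ w, Phi Ψ x' w (N * u))
    (C := 6 * (2 * 10 ^ 8 * T ^ 4 * |x - x'|)) (fun u _ => ?_)
  · refine h.trans (le_of_eq ?_); simp; ring
  · rw [← integral_sub (integrable_Phi hT hΨ hx _) (integrable_Phi hT hΨ hx' _)]
    refine norm_integral_le_of_supp (fun w => norm_Phi_sub_w₁_le hT hΨ hx' hx) fun w hw => ?_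
    rw [Phi_eq_zero _ hx0.ne' (Or.inr hw), Phi_eq_zero _ hx0'.ne' (Or.inr hw), sub_zero]

lemma Ic_zero_eq {R : ℝ} (hR : 4 ≤ R) (n : ℕ) [NeZero n] (hn1 : (n : ℝ) ≤ R ^ 2)
    (hn2 : R ^ 2 ≤ T * n) (N c : ℕ) [NeZero c] (hc1 : R / T ≤ c) (hc2 : (c : ℝ) ≤ 3 * R) :
    Ic Ψ R n 0 N c = ((n / (R * c) : ℝ) : ℂ) * Mn Ψ N (c / R) := by
  have h0 : 0 < R := by linarith
  have hn : 0 < (n : ℝ) := Nat.cast_pos.mpr (NeZero.pos n)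
  have hc0 : 0 < (c : ℝ) := Nat.cast_pos.mpr (NeZero.pos c)
  have hcont : ∀ Y, Continuous (Hc Ψ R n 0 c Y) := fun Y => by
    refine continuous_of_lip (L := 7 * 10 ^ 8 * T ^ 5) (by positivity) fun a b => ?_
    have := norm_Hc_sub_le hT hΨ hR n hn2 0 (by simp) c hc1 hc2 Y b a
    rw [norm_sub_rev, abs_sub_comm]; exact this
  unfold Ic Mn
  rw [← intervalIntegral.integral_const_mul]
  congr 1; funext u
  rw [integral_perz (fun τ => Hc_eq_zero hT hR n hn1 0 c hc1 _ τ) (hcont _)]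
  have e : ∀ τ, Hc Ψ R n 0 c (N * u) τ = Phi Ψ (c / R) (R * c / n * τ) (N * u) := by
    intro τ
    rw [Hc]; simp only [Int.cast_zero, zero_mul, zero_div, eR_zero, one_mul]
    congr 1; ring
  simp_rw [e]
  rw [Measure.integral_comp_mul_left (fun w => Phi Ψ (c / R) w (N * u)), abs_of_pos (by positivity),
    inv_div, Complex.real_smul]

end lip

lemma intervalIntegrable_Mn {Ψ : SL2R → ℂ} {T : ℝ} (hT : 1 ≤ T) (hΨ : LipG T Ψ) (N : ℕ) {a b : ℝ}
    (ha : 0 ≤ a) (hab : a ≤ b) : IntervalIntegrable (Mn Ψ N) volume a b := by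
  have hc : ContinuousOn (Mn Ψ N) (Set.Ioi 0) := by
    intro x hx
    have hx : 0 < x := hx
    set T' := max T (2 / x) with hT'
    have hT1 : 1 ≤ T' := hT.trans (le_max_left _ _)
    have hT2 : 1 / T' ≤ x / 2 := by
      rw [div_le_iff₀ (by linarith)]
      have : 2 / x ≤ T' := le_max_right _ _
      rw [div_le_iff₀ hx] at this; linarith
    have hΨ' := hΨ.mono (le_max_left T (2 / x))
    have hlip : LipschitzOnWith ⟨12 * 10 ^ 8 * T' ^ 4, by positivity⟩ (Mn Ψ N) (Set.Ioi (x / 2)) :=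
      LipschitzOnWith.of_dist_le_mul fun y hy z hz => by
        rw [dist_eq_norm, Real.dist_eq]
        exact norm_Mn_sub_le hT1 hΨ' N (hT2.trans (le_of_lt hy)) (hT2.trans (le_of_lt hz))
    exact (hlip.continuousOn.continuousAt (Ioi_mem_nhds (by linarith))).continuousWithinAt
  rw [intervalIntegrable_iff_integrableOn_Ioc_of_le hab]
  have hm : AEStronglyMeasurable (Mn Ψ N) (volume.restrict (Set.Ioc a b)) :=
    (hc.mono fun x hx => lt_of_le_of_lt ha hx.1).aestronglyMeasurable measurableSet_Ioc
  refine Integrable.mono' (g := fun _ => (6 : ℝ)) (by simp) hm ?_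
  rw [ae_restrict_iff' measurableSet_Ioc]
  exact Filter.Eventually.of_forall fun x hx => norm_Mn_le hΨ.1 N (lt_of_le_of_lt ha hx.1).ne'

lemma sum_gcd_le_of_le (n : ℕ) (hn : 0 < n) {X : ℝ} (hX : 0 ≤ X) (S : Finset ℕ)
    (hS : ∀ c ∈ S, 1 ≤ c ∧ (c : ℝ) ≤ X) :
    ∑ c ∈ S, (Nat.gcd c n : ℝ) ≤ X * n.divisors.card := by
  have h := sum_int_gcd_le n (by omega) ⌊X⌋₊
  have h1 : ∑ c ∈ S, (Nat.gcd c n : ℝ) ≤ ∑ c ∈ Finset.Icc 1 ⌊X⌋₊, (Nat.gcd c n : ℝ) :=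
    Finset.sum_le_sum_of_subset_of_nonneg (fun c hc => Finset.mem_Icc.mpr
      ⟨(hS c hc).1, Nat.le_floor (hS c hc).2⟩) (fun _ _ _ => by positivity)
  refine h1.trans ?_
  have h2 : ∑ c ∈ Finset.Icc 1 ⌊X⌋₊, (Nat.gcd c n : ℝ) ≤ (⌊X⌋₊ : ℝ) * n.divisors.card := by
    have e : ∀ c : ℕ, Int.gcd (n : ℤ) (c : ℤ) = Nat.gcd c n := fun c => by
      rw [Int.gcd_natCast_natCast, Nat.gcd_comm]
    simp only [e, Int.natAbs_natCast] at h
    exact_mod_cast h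
  refine h2.trans ?_
  gcongr
  exact Nat.floor_le hX

lemma bounds_of_mem_badC {T R : ℝ} {c : ℕ} (hc : c ∈ badC T R 1) : 1 ≤ c ∧ (c : ℝ) ≤ R / T := by
  rw [badC, Finset.mem_filter, Finset.mem_Icc] at hc
  have := hc.2
  simp only [Nat.coprime_one_left_eq_true, and_true, not_le] at this
  exact ⟨hc.1.1, this.le⟩

section full
variable {f : SL2R → ℂ} {T : ℝ} (hT : 1 ≤ T) (hf : LipG T f)
include hT hf

lemma norm_goodC_main_le {R : ℝ} (hR : 4 ≤ R) (h0 : ∫ x in (0 : ℝ)..3, Mn f 1 x = 0) :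
    ‖∑ c ∈ goodC T R 1, ((Nat.totient c / c : ℝ) : ℂ) * Mn f 1 (c / R)‖ ≤
      30 * (R / T) + (36 * 10 ^ 8 * T ^ 4 + 6) * (1 + Real.log (3 * R)) := by
  have hT0 : 0 < T := by linarith
  have hR0 : 0 < R := by linarith
  set g : ℝ → ℂ := fun x => Mn f 1 (max x (1 / T)) with hg
  have hpos : ∀ x : ℝ, 0 < max x (1 / T) := fun x => lt_of_lt_of_le (by positivity) (le_max_right _ _)
  have hA : ∀ x, ‖g x‖ ≤ 6 := fun x => norm_Mn_le hf.1 1 (hpos x).ne'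
  have hlip : ∀ x y, ‖g x - g y‖ ≤ 12 * 10 ^ 8 * T ^ 4 * |x - y| := fun x y => by
    refine (norm_Mn_sub_le hT hf 1 (le_max_right _ _) (le_max_right _ _)).trans ?_
    exact mul_le_mul_of_nonneg_left (abs_max_sub_max_le_abs x y (1 / T)) (by positivity)
  have hL : 0 ≤ 12 * 10 ^ 8 * T ^ 4 := by positivity
  have key := totient_riemann_sum_le hL hlip hA (R := R) (by linarith)
  have hgc := continuous_of_lip hL hlip
  have hI : ‖∫ x in (0 : ℝ)..3, g x‖ ≤ 12 / T := by
    have hT3 : 1 / T ≤ 3 := by rw [div_le_iff₀ hT0]; linarith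
    have i1 := intervalIntegrable_Mn hT hf 1 (le_refl (0:ℝ)) (by positivity : (0:ℝ) ≤ 1 / T)
    have i2 := intervalIntegrable_Mn hT hf 1 (by positivity : (0:ℝ) ≤ 1 / T) hT3
    have e1 : ∫ x in (0 : ℝ)..3, g x = ∫ x in (0 : ℝ)..(1 / T), (g x - Mn f 1 x) := by
      rw [intervalIntegral.integral_sub (hgc.intervalIntegrable _ _) i1]
      rw [← intervalIntegral.integral_add_adjacent_intervals i1 i2] at h0
      rw [← intervalIntegral.integral_add_adjacent_intervals (hgc.intervalIntegrable 0 (1 / T))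
        (hgc.intervalIntegrable _ 3)]
      have : ∫ x in (1 / T)..3, g x = ∫ x in (1 / T)..3, Mn f 1 x := by
        refine intervalIntegral.integral_congr fun x hx => ?_
        rw [Set.uIcc_of_le hT3] at hx
        simp only [hg, max_eq_left hx.1]
      rw [this, eq_neg_of_add_eq_zero_right h0]; ring
    rw [e1]
    have h := intervalIntegral.norm_integral_le_of_norm_le_const (a := (0 : ℝ)) (b := 1 / T)
      (f := fun x => g x - Mn f 1 x) (C := 12) (fun x hx => ?_)
    · rw [sub_zero, abs_of_pos (by positivity)] at h
      refine h.trans (le_of_eq (by ring))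
    · rw [Set.uIoc_of_le (by positivity)] at hx
      refine (norm_sub_le _ _).trans ?_
      have := hA x
      have := norm_Mn_le hf.1 1 hx.1.ne'
      linarith
  have esplit : ∑ c ∈ Finset.Icc 1 ⌊3 * R⌋₊, ((Nat.totient c / c : ℝ) : ℂ) * g (c / R) =
      ∑ c ∈ goodC T R 1, ((Nat.totient c / c : ℝ) : ℂ) * g (c / R) +
      ∑ c ∈ badC T R 1, ((Nat.totient c / c : ℝ) : ℂ) * g (c / R) :=
    (Finset.sum_filter_add_sum_filter_not _ _ _).symm
  have egood : ∑ c ∈ goodC T R 1, ((Nat.totient c / c : ℝ) : ℂ) * g (c / R) =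
      ∑ c ∈ goodC T R 1, ((Nat.totient c / c : ℝ) : ℂ) * Mn f 1 (c / R) := by
    refine Finset.sum_congr rfl fun c hc => ?_
    have h1 := (Finset.mem_filter.mp hc).2.1
    have : 1 / T ≤ c / R := by rw [le_div_iff₀ hR0]; linarith [show 1 / T * R = R / T by ring]
    simp only [hg, max_eq_left this]
  have hbad : ‖∑ c ∈ badC T R 1, ((Nat.totient c / c : ℝ) : ℂ) * g (c / R)‖ ≤ R / T * 6 := by
    have h1 : ∀ c ∈ badC T R 1, ‖((Nat.totient c / c : ℝ) : ℂ) * g (c / R)‖ ≤ 6 := by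
      intro c hc
      rw [norm_mul, Complex.norm_real, Real.norm_of_nonneg (by positivity)]
      have : (Nat.totient c / c : ℝ) ≤ 1 :=
        div_le_one_of_le₀ (by exact_mod_cast Nat.totient_le c) (by positivity)
      nlinarith [hA (c / R), norm_nonneg (g (c / R))]
    refine (norm_sum_le _ _).trans ((Finset.sum_le_card_nsmul _ _ 6 h1).trans ?_)
    rw [nsmul_eq_mul]
    gcongr
    have h2 : badC T R 1 ⊆ Finset.Icc 1 ⌊R / T⌋₊ := by
      intro c hc
      exact Finset.mem_Icc.mpr ⟨(bounds_of_mem_badC hc).1, Nat.le_floor (bounds_of_mem_badC hc).2⟩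
    have h3 := Finset.card_le_card h2
    rw [Nat.card_Icc] at h3
    calc ((badC T R 1).card : ℝ) ≤ (⌊R / T⌋₊ : ℝ) := by exact_mod_cast (by omega)
      _ ≤ _ := Nat.floor_le (by positivity)
  rw [← egood, eq_sub_of_add_eq esplit.symm]
  refine (norm_sub_le _ _).trans ?_
  have : 2 * R * ‖∫ x in (0 : ℝ)..3, g x‖ ≤ 2 * R * (12 / T) := by gcongr
  have e : 2 * R * (12 / T) = 24 * (R / T) := by ring
  have e2 : (3 * (12 * 10 ^ 8 * T ^ 4) + 6) * (1 + Real.log (3 * R)) =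
    (36 * 10 ^ 8 * T ^ 4 + 6) * (1 + Real.log (3 * R)) := by ring
  linarith

end full

/-- Equidistribution of the full orbits `ptg √n n j`, `0 ≤ j < n`, with constant `C`. -/
def FullOrbitBound (C : ℝ) : Prop := ∀ (f : SL2R → ℂ) (n : ℕ), InvN 1 f → LipG 1 f →
  (∫ x in (0 : ℝ)..3, Mn f 1 x = 0) → 0 < n →
  ‖∑ j ∈ Finset.range n, f (ptg (Real.sqrt n) n j)‖ ≤ C * (n : ℝ) ^ (1 - 1 / 2000 : ℝ)

theorem exists_fullOrbit_bound : ∃ C : ℝ, 1 ≤ C ∧ FullOrbitBound C := by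
  obtain ⟨C, hC1, hC⟩ := exists_expSum_bound
  obtain ⟨Cd, hCd1, hCd⟩ := exists_divisor_bound (ε := 1 / 2000) (by norm_num)
  refine ⟨16 + 60 + 10 ^ 12 + 14 * Cd + C, by linarith, ?_⟩
  intro f n hinv hf h0 hn0
  have : NeZero n := ⟨hn0.ne'⟩
  have hn : 1 ≤ (n : ℝ) := by exact_mod_cast hn0
  have hn' : 0 < (n : ℝ) := by linarith
  have hpow : 0 < (n : ℝ) ^ (1 - 1 / 2000 : ℝ) := by positivity
  have hp1 : 1 ≤ (n : ℝ) ^ (1 - 1 / 2000 : ℝ) := Real.one_le_rpow hn (by norm_num)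
  by_cases hn16 : n < 16
  · have h1 : ‖∑ j ∈ Finset.range n, f (ptg (Real.sqrt n) n j)‖ ≤ n := by
      refine (norm_sum_le_of_le _ fun j _ => hf.1 _).trans ?_
      simp
    have h2 : (n : ℝ) ≤ 16 := by exact_mod_cast hn16.le
    nlinarith
  have hn16' : (16 : ℝ) ≤ n := by exact_mod_cast not_lt.mp hn16
  set R := Real.sqrt n with hRd
  have hR2 : R ^ 2 = n := Real.sq_sqrt hn'.le
  have hR : 4 ≤ R := Real.le_sqrt_of_sq_le (by linarith)
  have hR0 : 0 < R := by linarith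
  set T := (n : ℝ) ^ (1 / 1000 : ℝ) with hTd
  have hT : 1 ≤ T := Real.one_le_rpow hn (by norm_num)
  have hT0 : 0 < T := by linarith
  have hfT := hf.mono hT
  have key := hC f T 1 R n 0 hT hfT hinv (by simpa using hT) hR hn0 hR2.ge (by nlinarith) (by simpa using hn0)
  have hnR : (n : ℝ) / R = R := by rw [← hR2]; field_simp
  have emain : (2 : ℂ) * ∑ c ∈ goodC T R 1, (Nat.totient c : ℂ) * Ic f R n 0 1 c =
      2 * (R : ℂ) * ∑ c ∈ goodC T R 1, ((Nat.totient c / c : ℝ) : ℂ) * Mn f 1 (c / R) := by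
    rw [mul_assoc, Finset.mul_sum _ _ (R : ℂ)]
    congr 1
    refine Finset.sum_congr rfl fun c hc => ?_
    rw [goodC, Finset.mem_filter, Finset.mem_Icc] at hc
    have : NeZero c := ⟨by omega⟩
    have hc0 : (c : ℂ) ≠ 0 := NeZero.ne _
    rw [Ic_zero_eq hT hfT hR n hR2.ge (by nlinarith) 1 c hc.2.1
      ((Nat.le_floor_iff (by linarith)).mp hc.1.2), ← div_div, hnR]
    push_cast; field_simp
  rw [if_pos rfl, emain] at key
  simp only [Int.cast_zero, zero_mul, zero_div, eR_zero, one_mul] at key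
  have hmain := norm_goodC_main_le hT hfT hR h0
  have hbad : ∑ c ∈ badC T R 1, (Nat.gcd c n : ℝ) * (6 * n / R + 1) ≤ 7 * Cd * (n : ℝ) ^ (1 - 1 / 2000 : ℝ) := by
    rw [← Finset.sum_mul]
    have h1 := sum_gcd_le_of_le n hn0 (X := R / T) (by positivity) _ fun c hc => bounds_of_mem_badC hc
    have h2 : 6 * n / R + 1 ≤ 7 * R := by rw [mul_div_assoc, hnR]; linarith
    calc _ ≤ R / T * (Cd * (n : ℝ) ^ (1 / 2000 : ℝ)) * (7 * R) := by
          gcongr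
          exact h1.trans (by gcongr; exact hCd n hn0.ne')
      _ = 7 * Cd * ((n : ℝ) ^ (1 : ℝ) / T * (n : ℝ) ^ (1 / 2000 : ℝ)) := by
          rw [Real.rpow_one, ← hR2]; ring
      _ = _ := by
          rw [hTd, ← Real.rpow_sub hn', ← Real.rpow_add hn']; norm_num
  have hlog : 1 + Real.log (3 * R) ≤ 17 * (n : ℝ) ^ (1 / 8 : ℝ) := by
    have h1 := Real.log_le_rpow_div (x := 3 * R) (ε := 1 / 4) (by positivity) (by norm_num)
    have h2 : (3 * R) ^ (1 / 4 : ℝ) ≤ 4 * (n : ℝ) ^ (1 / 8 : ℝ) := by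
      rw [Real.mul_rpow (by norm_num) hR0.le, hRd, Real.sqrt_eq_rpow, ← Real.rpow_mul hn'.le]
      norm_num
      have : (3 : ℝ) ^ (1 / 4 : ℝ) ≤ 3 ^ (1 : ℝ) :=
        Real.rpow_le_rpow_of_exponent_le (by norm_num) (by norm_num)
      rw [Real.rpow_one] at this
      gcongr; linarith
    have h3 : 1 ≤ (n : ℝ) ^ (1 / 8 : ℝ) := Real.one_le_rpow hn (by norm_num)
    have : (3 * R) ^ (1 / 4 : ℝ) / (1 / 4) = 4 * (3 * R) ^ (1 / 4 : ℝ) := by ring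
    linarith
  have hm1 : 2 * R * (30 * (R / T)) ≤ 60 * (n : ℝ) ^ (1 - 1 / 2000 : ℝ) := by
    calc _ = 60 * ((n : ℝ) ^ (1 : ℝ) / T) := by rw [Real.rpow_one, ← hR2]; ring
      _ = 60 * (n : ℝ) ^ (1 - 1 / 1000 : ℝ) := by rw [hTd, ← Real.rpow_sub hn']
      _ ≤ _ := by gcongr 60 * ?_; exact Real.rpow_le_rpow_of_exponent_le hn (by norm_num)
  have hm2 : 2 * R * ((36 * 10 ^ 8 * T ^ 4 + 6) * (1 + Real.log (3 * R))) ≤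
      10 ^ 12 * (n : ℝ) ^ (1 - 1 / 2000 : ℝ) := by
    have hT4 : 1 ≤ T ^ 4 := one_le_pow₀ hT
    have hT4' : T ^ 4 = (n : ℝ) ^ (4 / 1000 : ℝ) := by
      rw [hTd, ← Real.rpow_natCast, ← Real.rpow_mul hn'.le]; norm_num
    calc _ ≤ 2 * R * ((10 ^ 10 * T ^ 4) * (17 * (n : ℝ) ^ (1 / 8 : ℝ))) := by
          gcongr
          · have := Real.log_nonneg (by linarith : 1 ≤ 3 * R); linarith
          · linarith
      _ = 34 * 10 ^ 10 * ((n : ℝ) ^ (1 / 2 : ℝ) * (n : ℝ) ^ (4 / 1000 : ℝ) * (n : ℝ) ^ (1 / 8 : ℝ)) := by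
          rw [hT4', hRd, Real.sqrt_eq_rpow]; ring
      _ = 34 * 10 ^ 10 * (n : ℝ) ^ (1 / 2 + 4 / 1000 + 1 / 8 : ℝ) := by
          rw [← Real.rpow_add hn', ← Real.rpow_add hn']
      _ ≤ 34 * 10 ^ 10 * (n : ℝ) ^ (1 - 1 / 2000 : ℝ) :=
          mul_le_mul_of_nonneg_left (Real.rpow_le_rpow_of_exponent_le hn (by norm_num)) (by norm_num)
      _ ≤ _ := mul_le_mul_of_nonneg_right (by norm_num) hpow.le
  have hlast : C * T ^ 7 * (n : ℝ) ^ (1 - 1 / 80 : ℝ) ≤ C * (n : ℝ) ^ (1 - 1 / 2000 : ℝ) := by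
    have hT7 : T ^ 7 = (n : ℝ) ^ (7 / 1000 : ℝ) := by
      rw [hTd, ← Real.rpow_natCast, ← Real.rpow_mul hn'.le]; norm_num
    rw [hT7, mul_assoc, ← Real.rpow_add hn']
    exact mul_le_mul_of_nonneg_left (Real.rpow_le_rpow_of_exponent_le hn (by norm_num)) (by linarith)
  refine (norm_le_norm_sub_add _ (2 * (R : ℂ) * ∑ c ∈ goodC T R 1, ((Nat.totient c / c : ℝ) : ℂ) * Mn f 1 (c / R))).trans ?_
  have hM : ‖2 * (R : ℂ) * ∑ c ∈ goodC T R 1, ((Nat.totient c / c : ℝ) : ℂ) * Mn f 1 (c / R)‖ ≤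
      2 * R * (30 * (R / T) + (36 * 10 ^ 8 * T ^ 4 + 6) * (1 + Real.log (3 * R))) := by
    rw [norm_mul, norm_mul, Complex.norm_ofNat, Complex.norm_real, Real.norm_of_nonneg hR0.le]
    gcongr
  rw [mul_add] at hM
  have key' := key.trans (add_le_add (mul_le_mul_of_nonneg_left hbad (by norm_num)) hlast)
  have := add_le_add key' hM
  have h16 : 0 ≤ 16 * (n : ℝ) ^ (1 - 1 / 2000 : ℝ) := by positivity
  linarith

/-- Left translates by the diagonal, twisted by a second copy of the function. -/
def pairF (f : SL2R → ℂ) (α β : ℕ) (g : SL2R) : ℂ :=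
  f (aElt (Real.sqrt α) * g) * starRingEnd ℂ (f (aElt (Real.sqrt β) * g *
    (aElt (Real.sqrt α) * (aElt (Real.sqrt β))⁻¹)))

lemma sqrt_natCast_ne_zero {α : ℕ} (h : 0 < α) : Real.sqrt α ≠ 0 :=
  (Real.sqrt_pos.2 (by exact_mod_cast h)).ne'

lemma aElt_mul_uElt {R : ℝ} (hR : R ≠ 0) (t : ℝ) : aElt R * uElt t = uElt (R ^ 2 * t) * aElt R := by
  apply SL2R_ext <;>
    simp only [mul_apply2, aElt_00 hR, aElt_01 hR, aElt_10 hR, aElt_11 hR, u_00, u_01, u_10, u_11]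
  · ring
  · field_simp; ring
  · ring
  · ring

lemma aElt_mul_aElt {R S : ℝ} (hR : R ≠ 0) (hS : S ≠ 0) : aElt R * aElt S = aElt (R * S) := by
  have h := mul_ne_zero hR hS
  apply SL2R_ext <;>
    simp only [mul_apply2, aElt_00 hR, aElt_01 hR, aElt_10 hR, aElt_11 hR,
      aElt_00 hS, aElt_01 hS, aElt_10 hS, aElt_11 hS, aElt_00 h, aElt_01 h, aElt_10 h, aElt_11 h,
      mul_inv] <;> ring

lemma aElt_sqrt_mul {n α : ℕ} (hn : 0 < n) (hα : 0 < α) :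
    aElt (Real.sqrt (n * α)) = aElt (Real.sqrt n) * aElt (Real.sqrt α) := by
  rw [aElt_mul_aElt (sqrt_natCast_ne_zero hn) (sqrt_natCast_ne_zero hα), Real.sqrt_mul (by positivity)]

lemma aElt_mul_ptg {α n : ℕ} (hα : 0 < α) (hn : 0 < n) (i : ℤ) :
    aElt (Real.sqrt α) * ptg (Real.sqrt (n * α)) n i = ptg (Real.sqrt n) n (α * i) := by
  have h1 := sqrt_natCast_ne_zero hα
  have h2 := sqrt_natCast_ne_zero hn
  have e := aElt_sqrt_mul hn hα
  unfold ptg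
  rw [e, ← mul_assoc, aElt_mul_uElt h1, Real.sq_sqrt (by positivity), mul_assoc, _root_.mul_inv_rev,
    mul_inv_cancel_left]
  congr 2
  push_cast; ring

lemma aElt_comm {R S : ℝ} (hR : R ≠ 0) (hS : S ≠ 0) : Commute (aElt R) (aElt S) := by
  unfold Commute SemiconjBy
  rw [aElt_mul_aElt hR hS, aElt_mul_aElt hS hR, mul_comm]

lemma pairF_ptg (f : SL2R → ℂ) {α β n : ℕ} (hα : 0 < α) (hβ : 0 < β) (hn : 0 < n) (i : ℤ) :
    pairF f α β (ptg (Real.sqrt (n * α)) n i) = f (ptg (Real.sqrt n) n (α * i)) *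
      starRingEnd ℂ (f (ptg (Real.sqrt n) n (β * i))) := by
  unfold pairF
  rw [aElt_mul_ptg hα hn]
  congr 3
  have h1 := sqrt_natCast_ne_zero hα
  have h2 := sqrt_natCast_ne_zero hn
  have h3 := sqrt_natCast_ne_zero hβ
  have e := aElt_sqrt_mul hn hα
  have c1 := aElt_comm h1 h2
  have c2 := aElt_comm h2 h3
  unfold ptg
  have e2 : (aElt (Real.sqrt n) * aElt (Real.sqrt α))⁻¹ = (aElt (Real.sqrt α))⁻¹ * (aElt (Real.sqrt n))⁻¹ :=
    _root_.mul_inv_rev _ _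
  have e3 : aElt (Real.sqrt β) * uElt ((i : ℝ) / n) = uElt (((β * i : ℤ) : ℝ) / n) * aElt (Real.sqrt β) := by
    rw [aElt_mul_uElt h3, Real.sq_sqrt (by positivity)]
    congr 2; push_cast; ring
  rw [e, e2]
  calc _ = (aElt (Real.sqrt β) * uElt ((i : ℝ) / n)) * ((aElt (Real.sqrt α))⁻¹ *
        ((aElt (Real.sqrt n))⁻¹ * aElt (Real.sqrt α))) * (aElt (Real.sqrt β))⁻¹ := by
        simp only [mul_assoc]
    _ = uElt (((β * i : ℤ) : ℝ) / n) * (aElt (Real.sqrt β) * (aElt (Real.sqrt n))⁻¹) *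
        (aElt (Real.sqrt β))⁻¹ := by
        rw [e3, ← c1.inv_right.eq, inv_mul_cancel_left]
        simp only [mul_assoc]
    _ = _ := by
        rw [← c2.inv_left.eq]
        simp only [mul_assoc, mul_inv_cancel, mul_one]

lemma exists_zSL (p q r s : ℤ) (h : p * s - q * r = 1) :
    ∃ γ : Matrix.SpecialLinearGroup (Fin 2) ℤ, (zSL γ).1 0 0 = p ∧ (zSL γ).1 0 1 = q ∧
      (zSL γ).1 1 0 = r ∧ (zSL γ).1 1 1 = s :=
  ⟨⟨!![p, q; r, s], by rw [Matrix.det_fin_two_of]; exact h⟩, rfl, rfl, rfl, rfl⟩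

lemma invN_aElt {f : SL2R → ℂ} (hf : InvN 1 f) {α : ℕ} (hα : 0 < α)
    (γ : Matrix.SpecialLinearGroup (Fin 2) ℤ) (h : (α : ℤ) ∣ γ.1 1 0) (g : SL2R) :
    f (aElt (Real.sqrt α) * (zSL γ * g)) = f (aElt (Real.sqrt α) * g) := by
  obtain ⟨c, hc⟩ := h
  have h1 := sqrt_natCast_ne_zero hα
  have hd := γ.2
  rw [Matrix.det_fin_two, hc] at hd
  have h2 : (α : ℝ) = Real.sqrt α * Real.sqrt α := (Real.mul_self_sqrt (by positivity)).symm
  obtain ⟨δ, d00, d01, d10, d11⟩ := exists_zSL (γ.1 0 0) (α * γ.1 0 1) c (γ.1 1 1)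
    (by linear_combination hd)
  have e : aElt (Real.sqrt α) * zSL γ = zSL δ * aElt (Real.sqrt α) := by
    have hc' : ((γ.1 1 0 : ℤ) : ℝ) = α * c := by rw [hc]; push_cast; ring
    apply SL2R_ext <;>
      simp only [mul_apply2, aElt_00 h1, aElt_01 h1, aElt_10 h1, aElt_11 h1, d00, d01, d10, d11] <;>
      simp only [zSL_apply, hc'] <;> push_cast
    · ring
    · field_simp; linear_combination (-((γ.1 0 1 : ℤ) : ℝ)) * h2
    · field_simp; linear_combination (c : ℝ) * h2
    · ring
  rw [← mul_assoc, e, mul_assoc]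
  exact hf _ (by simp) _

lemma invN_pairF {f : SL2R → ℂ} (hf : InvN 1 f) {α β : ℕ} (hα : 0 < α) (hβ : 0 < β) :
    InvN (α * β) (pairF f α β) := by
  intro γ hγ g
  push_cast at hγ
  unfold pairF
  rw [invN_aElt hf hα γ ((dvd_mul_right _ _).trans hγ)]
  congr 2
  rw [mul_assoc, mul_assoc, invN_aElt hf hβ γ ((dvd_mul_left _ _).trans hγ), mul_assoc]

lemma matSup_aElt_mul_inv_sq {α β : ℕ} (hα : 0 < α) (hβ : 0 < β) {H : ℝ} (h1 : (α : ℝ) ≤ H * β)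
    (h2 : (β : ℝ) ≤ H * α) :
    matSup (aElt (Real.sqrt α) * (aElt (Real.sqrt β))⁻¹).1 ^ 2 ≤ H := by
  have a1 := sqrt_natCast_ne_zero hα
  have b1 := sqrt_natCast_ne_zero hβ
  have hα' : (0 : ℝ) < α := by exact_mod_cast hα
  have hβ' : (0 : ℝ) < β := by exact_mod_cast hβ
  have hH : 0 ≤ H := by
    by_contra h; push Not at h; nlinarith [mul_neg_of_neg_of_pos h hβ']
  have : matSup (aElt (Real.sqrt α) * (aElt (Real.sqrt β))⁻¹).1 ≤ Real.sqrt H := by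
    rw [matSup_le_iff]
    simp only [mul_apply2, aElt_00 a1, aElt_01 a1, aElt_10 a1, aElt_11 a1, inv_00, inv_01, inv_10,
      inv_11, aElt_00 b1, aElt_01 b1, aElt_10 b1, aElt_11 b1]
    have p := Real.sqrt_nonneg (α : ℝ)
    have q := Real.sqrt_nonneg (β : ℝ)
    refine ⟨?_, ?_, ?_, ?_⟩
    · simp only [mul_zero, neg_zero, add_zero, zero_mul]
      rw [abs_of_nonneg (by positivity), ← div_eq_mul_inv, ← Real.sqrt_div hα'.le]
      exact Real.sqrt_le_sqrt ((div_le_iff₀ hβ').2 h1)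
    · simp
    · simp
    · simp only [mul_zero, neg_zero, zero_add, zero_mul]
      rw [abs_of_nonneg (by positivity), mul_comm, ← div_eq_mul_inv, ← Real.sqrt_div hβ'.le]
      exact Real.sqrt_le_sqrt ((div_le_iff₀ hα').2 h2)
  calc _ ≤ Real.sqrt H ^ 2 := pow_le_pow_left₀ (matSup_nonneg _) this 2
    _ = H := Real.sq_sqrt hH

lemma norm_mul_conj_sub_le {a b c d : ℂ} {x y : ℝ} (ha : ‖a‖ ≤ 1) (hd : ‖d‖ ≤ 1) (h1 : ‖a - c‖ ≤ x)
    (h2 : ‖b - d‖ ≤ y) : ‖a * starRingEnd ℂ b - c * starRingEnd ℂ d‖ ≤ x + y := by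
  have e : a * starRingEnd ℂ b - c * starRingEnd ℂ d =
      (a - c) * starRingEnd ℂ d + a * starRingEnd ℂ (b - d) := by rw [map_sub]; ring
  rw [e]
  refine (norm_add_le _ _).trans ?_
  rw [norm_mul, norm_mul, RCLike.norm_conj, RCLike.norm_conj]
  nlinarith [norm_nonneg (a - c), norm_nonneg (b - d), norm_nonneg a, norm_nonneg d]

lemma lipG_pairF {f : SL2R → ℂ} (hf : LipG 1 f) {α β : ℕ} (hα : 0 < α) (hβ : 0 < β) {H : ℝ}
    (h1 : (α : ℝ) ≤ H * β) (h2 : (β : ℝ) ≤ H * α) : LipG (1 + 4 * H) (pairF f α β) := by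
  constructor
  · intro g
    unfold pairF
    rw [norm_mul, RCLike.norm_conj]
    exact mul_le_one₀ (hf.1 _) (norm_nonneg _) (hf.1 _)
  · intro g k
    unfold pairF
    set A := aElt (Real.sqrt α)
    set B := aElt (Real.sqrt β)
    have e1 := hf.2 (A * g) k
    have e2 := hf.2 (B * g * (A * B⁻¹)) ((A * B⁻¹)⁻¹ * k * (A * B⁻¹))
    have e3 : B * g * (A * B⁻¹) * ((A * B⁻¹)⁻¹ * k * (A * B⁻¹)) = B * (g * k) * (A * B⁻¹) := by
      group
    rw [e3] at e2
    rw [mul_assoc] at e1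
    refine (norm_mul_conj_sub_le (hf.1 _) (hf.1 _) e1 e2).trans ?_
    have e4 := matSup_conj_sub_one_le (A * B⁻¹) k
    have e5 := matSup_aElt_mul_inv_sq hα hβ h1 h2
    have e6 := matSup_nonneg (k.1 - 1)
    nlinarith [mul_le_mul_of_nonneg_right e5 e6]

lemma f_Wst_aElt {f : SL2R → ℂ} (hf : InvN 1 f) {α : ℕ} (hα : 0 < α) (j : ℤ) (g : SL2R) :
    f (aElt (Real.sqrt α) * (Wst * (uElt j * g))) = f (ptg (Real.sqrt α) α j * g) := by
  have h1 := sqrt_natCast_ne_zero hα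
  have hα' : (0 : ℝ) < α := by exact_mod_cast hα
  obtain ⟨δ, d00, d01, d10, d11⟩ := exists_zSL 0 (-1) 1 0 (by norm_num)
  have w00 : Wst.1 0 0 = 0 := rfl
  have w01 : Wst.1 0 1 = -1 := rfl
  have w10 : Wst.1 1 0 = 1 := rfl
  have w11 : Wst.1 1 1 = 0 := rfl
  have e : aElt (Real.sqrt α) * Wst * uElt j = zSL δ * ptg (Real.sqrt α) α j := by
    apply SL2R_ext <;>
    simp only [mul_apply2, aElt_00 h1, aElt_01 h1, aElt_10 h1, aElt_11 h1, ptg_00 h1,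
      ptg_01 h1, ptg_10 h1, ptg_11 h1, u_00, u_01, u_10, u_11, d00, d01, d10, d11, w00, w01, w10,
      w11]
    · ring
    · ring
    · push_cast; ring
    · push_cast
      field_simp
      rw [Real.sq_sqrt hα'.le]; ring
  rw [← mul_assoc, ← mul_assoc, e, mul_assoc]
  exact hf _ (by simp) _

lemma f_ptg_mod {f : SL2R → ℂ} (hf : InvN 1 f) {R : ℝ} {n : ℕ} (hn : 0 < n) (j : ℕ) (g : SL2R) :
    f (ptg R n j * g) = f (ptg R n ((j % n : ℕ) : ℤ) * g) := by
  have : NeZero n := ⟨hn.ne'⟩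
  have key : ∀ (m : ℕ) (i : ℤ), f (ptg R n (i + m * n) * g) = f (ptg R n i * g) := by
    intro m i
    induction m with
    | zero => simp
    | succ m ih =>
      rw [show i + ((m + 1 : ℕ) : ℤ) * n = (i + m * n) + n by push_cast; ring, ptg_add, mul_assoc,
        hf _ (by simp), ih]
  have := key (j / n) ((j % n : ℕ) : ℤ)
  rw [← this]
  congr 3
  exact_mod_cast (by rw [mul_comm]; exact (Nat.mod_add_div j n).symm)

lemma sum_range_mul_coprime {α β : ℕ} (hα : 0 < α) (hβ : 0 < β) (h : Nat.Coprime α β) (F G : ℕ → ℂ) :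
    ∑ j ∈ Finset.range (α * β), F (j % α) * G (j % β) =
      (∑ j ∈ Finset.range α, F j) * ∑ j ∈ Finset.range β, G j := by
  rw [Finset.sum_mul_sum, ← Finset.sum_product' _ _ (fun i j => F i * G j)]
  refine Finset.sum_nbij (fun j => (j % α, j % β)) ?_ ?_ ?_ (fun _ _ => rfl)
  · intro j _
    simp [Nat.mod_lt _ hα, Nat.mod_lt _ hβ]
  · intro i hi j hj hij
    simp only [Finset.coe_range, Set.mem_Iio] at hi hj
    have h1 : i ≡ j [MOD α] := (Prod.ext_iff.1 hij).1
    have h2 : i ≡ j [MOD β] := (Prod.ext_iff.1 hij).2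
    have := (Nat.modEq_and_modEq_iff_modEq_mul h).1 ⟨h1, h2⟩
    exact Nat.ModEq.eq_of_lt_of_lt this hi hj
  · rintro ⟨i, j⟩ hij
    simp only [Finset.coe_product, Finset.coe_range, Set.mem_prod, Set.mem_Iio] at hij
    refine ⟨Nat.chineseRemainder h i j, ?_, ?_⟩
    · simpa using Nat.chineseRemainder_lt_mul h i j hα.ne' hβ.ne'
    · have := (Nat.chineseRemainder h i j).2
      exact Prod.ext (Eq.trans this.1 (Nat.mod_eq_of_lt hij.1))
        (Eq.trans this.2 (Nat.mod_eq_of_lt hij.2))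

/-- The vanishing of the mean of every right translate. -/
def MZ (f : SL2R → ℂ) : Prop := ∀ k, ∫ x in (0 : ℝ)..3, Mn (fun g => f (g * k)) 1 x = 0

lemma Mn_const_mul (s : ℂ) (f : SL2R → ℂ) (N : ℕ) (x : ℝ) :
    Mn (fun g => s * f g) N x = s * Mn f N x := by
  unfold Mn Phi
  simp only [mul_assoc, integral_const_mul, intervalIntegral.integral_const_mul]

lemma norm_sum_translate_le {C₀ : ℝ} (h0 : FullOrbitBound C₀)
    {f : SL2R → ℂ} (hi : InvN 1 f) (hf : LipG 1 f) (hz : MZ f) (k : SL2R) {n : ℕ} (hn : 0 < n) :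
    ‖∑ j ∈ Finset.range n, f (ptg (Real.sqrt n) n j * k)‖ ≤
      4 * matSup k.1 ^ 2 * (C₀ * (n : ℝ) ^ (1 - 1 / 2000 : ℝ)) := by
  have hm := matSup_pos k
  set m := matSup k.1 ^ 2
  have hm0 : 0 < 4 * m := by linarith
  set s : ℝ := (4 * m)⁻¹ with hs
  have hs0 : 0 < s := inv_pos.2 hm0
  have hs1 : s ≤ 1 := inv_le_one_of_one_le₀ (by linarith)
  have key := h0 (fun g => (s : ℂ) * f (g * k)) n ?_ ?_ ?_ hn
  · rw [← Finset.mul_sum, norm_mul, Complex.norm_real, Real.norm_of_nonneg hs0.le, hs,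
      inv_mul_le_iff₀ hm0] at key
    exact key
  · intro γ hγ g
    simp only
    rw [mul_assoc, hi γ hγ]
  · constructor
    · intro g
      rw [norm_mul, Complex.norm_real, Real.norm_of_nonneg hs0.le]
      exact mul_le_one₀ hs1 (norm_nonneg _) (hf.1 _)
    · intro g x
      rw [← mul_sub, norm_mul, Complex.norm_real, Real.norm_of_nonneg hs0.le]
      have e := hf.2 (g * k) (k⁻¹ * x * k)
      rw [show g * k * (k⁻¹ * x * k) = g * x * k by group] at e
      have e2 := matSup_conj_sub_one_le k x
      calc s * ‖f (g * x * k) - f (g * k)‖ ≤ s * (4 * m * matSup (x.1 - 1)) := by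
            refine mul_le_mul_of_nonneg_left (e.trans ?_) hs0.le
            rw [one_mul]; exact e2
        _ = 1 * matSup (x.1 - 1) := by
            rw [← mul_assoc, hs, inv_mul_cancel₀ hm0.ne']
  · simp only [Mn_const_mul, intervalIntegral.integral_const_mul]
    rw [hz k, mul_zero]

lemma norm_sum_pairF_le {C₀ : ℝ} (h0 : FullOrbitBound C₀)
    {f : SL2R → ℂ} (hi : InvN 1 f) (hf : LipG 1 f) (hz : MZ f) {α β : ℕ} (hα : 0 < α) (hβ : 0 < β)
    (hc : Nat.Coprime α β) {H : ℝ} (h1 : (α : ℝ) ≤ H * β) (h2 : (β : ℝ) ≤ H * α) (g : SL2R) :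
    ‖∑ j ∈ Finset.range (α * β), pairF f α β (Wst * (uElt (j : ℤ) * g))‖ ≤
      α * (16 * matSup g.1 ^ 2 * H * (C₀ * (β : ℝ) ^ (1 - 1 / 2000 : ℝ))) := by
  set h := aElt (Real.sqrt α) * (aElt (Real.sqrt β))⁻¹ with hh
  have e : ∀ j : ℕ, pairF f α β (Wst * (uElt (j : ℤ) * g)) =
      f (ptg (Real.sqrt α) α ((j % α : ℕ) : ℤ) * g) *
        starRingEnd ℂ (f (ptg (Real.sqrt β) β ((j % β : ℕ) : ℤ) * (g * h))) := by
    intro j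
    unfold pairF
    rw [f_Wst_aElt hi hα, f_ptg_mod hi hα, ← hh,
      show aElt (Real.sqrt β) * (Wst * (uElt (j : ℤ) * g)) * h =
        aElt (Real.sqrt β) * (Wst * (uElt (j : ℤ) * (g * h))) by simp only [mul_assoc],
      f_Wst_aElt hi hβ, f_ptg_mod hi hβ]
  rw [Finset.sum_congr rfl fun j _ => e j,
    sum_range_mul_coprime hα hβ hc (fun j => f (ptg (Real.sqrt α) α (j : ℤ) * g))
      (fun j => starRingEnd ℂ (f (ptg (Real.sqrt β) β (j : ℤ) * (g * h)))), norm_mul]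
  refine mul_le_mul ?_ ?_ (norm_nonneg _) (by positivity)
  · refine (norm_sum_le _ _).trans ?_
    refine (Finset.sum_le_card_nsmul _ _ 1 fun j _ => hf.1 _).trans (by simp)
  · rw [← map_sum, RCLike.norm_conj]
    have k1 := norm_sum_translate_le h0 hi hf hz (g * h) hβ
    have k2 : matSup (g * h).1 ^ 2 ≤ 4 * matSup g.1 ^ 2 * H := by
      have e1 : matSup (g * h).1 ≤ 2 * matSup g.1 * matSup h.1 := matSup_mul_le g.1 h.1
      have e2 := matSup_aElt_mul_inv_sq hα hβ h1 h2
      rw [← hh] at e2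
      calc matSup (g * h).1 ^ 2 ≤ (2 * matSup g.1 * matSup h.1) ^ 2 :=
            pow_le_pow_left₀ (matSup_nonneg _) e1 2
        _ = 4 * matSup g.1 ^ 2 * matSup h.1 ^ 2 := by ring
        _ ≤ _ := by gcongr
    have k3 : 0 ≤ C₀ * (β : ℝ) ^ (1 - 1 / 2000 : ℝ) := by
      have := (norm_nonneg _).trans k1
      have hm := matSup_pos (g * h)
      by_contra hneg
      push Not at hneg
      nlinarith
    refine k1.trans ((mul_le_mul_of_nonneg_right (mul_le_mul_of_nonneg_left k2 (by norm_num)) k3).trans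
      (le_of_eq (by ring)))

lemma Mn_eq_average {Ψ : SL2R → ℂ} {T : ℝ} (hT : 1 ≤ T) (hΨ : LipG T Ψ) {N : ℕ} (hN : 0 < N) {x : ℝ}
    (hx : 1 / T ≤ x) : Mn Ψ N x = (N : ℂ)⁻¹ * ∫ Y in (0 : ℝ)..1, ∫ w,
      (∑ j ∈ Finset.range N, Ψ (Wst * (uElt (j : ℤ) * gp x w Y))) * rho (gp x w Y) := by
  have hx0 : x ≠ 0 := (lt_of_lt_of_le (by positivity) hx).ne'
  have hN' : (N : ℝ) ≠ 0 := by exact_mod_cast hN.ne'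
  have hcont := continuous_integral_Phi hT hΨ hx
  unfold Mn
  rw [intervalIntegral.integral_comp_mul_left (fun Y => ∫ w, Phi Ψ x w Y) hN']
  rw [mul_zero, mul_one]
  have hs : ∑ k ∈ Finset.range N, ∫ Y in ((k : ℕ) : ℝ)..((k + 1 : ℕ) : ℝ), (∫ w, Phi Ψ x w Y) =
      ∫ Y in ((0 : ℕ) : ℝ)..(N : ℝ), (∫ w, Phi Ψ x w Y) :=
    intervalIntegral.sum_integral_adjacent_intervals
      (fun k _ => hcont.intervalIntegrable _ _)
  rw [Nat.cast_zero] at hs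
  rw [← hs]
  have e : ∀ k : ℕ, ∫ Y in ((k : ℕ) : ℝ)..((k + 1 : ℕ) : ℝ), (∫ w, Phi Ψ x w Y) =
      ∫ Y in (0 : ℝ)..1, ∫ w, Phi Ψ x w (Y + k) := by
    intro k
    rw [intervalIntegral.integral_comp_add_right (fun Y => ∫ w, Phi Ψ x w Y)]
    push_cast
    rw [zero_add, add_comm (1 : ℝ)]
  simp only [e]
  rw [← intervalIntegral.integral_finsetSum]
  · rw [Complex.real_smul]
    push_cast
    congr 1
    refine intervalIntegral.integral_congr fun Y _ => ?_
    rw [← integral_finsetSum _ fun j _ => integrable_Phi hT hΨ hx _]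
    congr 1
    ext w
    rw [Finset.sum_mul]
    refine Finset.sum_congr rfl fun j _ => ?_
    unfold Phi
    rw [← u_mul_gp hx0]
    have := rho_u_mul (j : ℤ) (gp x w Y)
    push_cast at this ⊢
    rw [this]
  · intro k _
    exact (hcont.comp (continuous_id.add continuous_const)).intervalIntegrable _ _

lemma norm_Mn_pairF_le {C₀ : ℝ} (h0 : FullOrbitBound C₀) (hC₀ : 0 ≤ C₀)
    {f : SL2R → ℂ} (hi : InvN 1 f) (hf : LipG 1 f) (hz : MZ f) {α β : ℕ} (hα : 0 < α) (hβ : 0 < β)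
    (hc : Nat.Coprime α β) {H : ℝ} (h1 : (α : ℝ) ≤ H * β) (h2 : (β : ℝ) ≤ H * α) {T : ℝ} (hT : 1 ≤ T)
    (hΨ : LipG T (pairF f α β)) {V : ℝ} (hV : 1 ≤ V) (hVT : V ≤ T) {x : ℝ} (hx : 1 / V ≤ x) :
    ‖Mn (pairF f α β) (α * β) x‖ ≤ 1536 * V ^ 2 * H * C₀ * (β : ℝ) ^ (-(1 / 2000) : ℝ) := by
  have hx0 : 0 < x := lt_of_lt_of_le (by positivity) hx
  have hα' : (0 : ℝ) < α := by exact_mod_cast hα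
  have hβ' : (0 : ℝ) < β := by exact_mod_cast hβ
  have hH : 0 ≤ H := by
    by_contra h; push Not at h; nlinarith [mul_neg_of_neg_of_pos h hβ']
  rcases le_or_gt 3 x with h3 | h3
  · rw [Mn_eq_zero _ _ h3, norm_zero]; positivity
  rw [Mn_eq_average hT hΨ (Nat.mul_pos hα hβ) ((one_div_le_one_div_of_le (by positivity) hVT).trans hx)]
  rw [norm_mul, norm_inv, Complex.norm_natCast]
  have hb : ∀ Y ∈ Set.uIoc (0 : ℝ) 1, ‖∫ w, (∑ j ∈ Finset.range (α * β),
      pairF f α β (Wst * (uElt (j : ℤ) * gp x w Y))) * rho (gp x w Y)‖ ≤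
      6 * (α * (16 * (4 * V) ^ 2 * H * (C₀ * (β : ℝ) ^ (1 - 1 / 2000 : ℝ)))) := by
    intro Y hY
    rw [Set.uIoc_of_le (by norm_num)] at hY
    have hs : ∀ w, 3 ≤ |w| → ((rho (gp x w Y) : ℝ) : ℂ) = 0 := by
      intro w hw
      rw [rho_eq_zero, Complex.ofReal_zero]
      rw [gp_10 hx0.ne', gp_11 hx0.ne']
      exact le_max_of_le_right hw
    refine norm_integral_le_of_supp (fun w => ?_) (fun w hw => by rw [hs w hw, mul_zero])
    rcases le_or_gt 3 |w| with hw | hw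
    · rw [hs w hw, mul_zero, norm_zero]; positivity
    rw [norm_mul, Complex.norm_real, Real.norm_of_nonneg (rho_nonneg _)]
    refine (mul_le_of_le_one_right (norm_nonneg _) (rho_le_one _)).trans ?_
    refine (norm_sum_pairF_le h0 hi hf hz hα hβ hc h1 h2 _).trans ?_
    have := matSup_gp_le hV hx h3.le hw.le (abs_le.2 ⟨by linarith [hY.1], hY.2⟩)
    have h4 := matSup_nonneg (gp x w Y).1
    gcongr
  have := intervalIntegral.norm_integral_le_of_norm_le_const hb
  rw [sub_zero, abs_one, mul_one] at this
  refine (mul_le_mul_of_nonneg_left this (by positivity)).trans (le_of_eq ?_)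
  have e : (β : ℝ) ^ (1 - 1 / 2000 : ℝ) = β * (β : ℝ) ^ (-(1 / 2000) : ℝ) := by
    rw [sub_eq_add_neg, Real.rpow_add hβ', Real.rpow_one]
  rw [e]
  push_cast
  field_simp
  ring

lemma sum_gcd_multiples_le (n : ℕ) (hn : 0 < n) {q : ℕ} (hq : q.Prime) (hqn : ¬ q ∣ n) {X : ℝ}
    (hX : 0 ≤ X) :
    ∑ c ∈ (Finset.Icc 1 ⌊X⌋₊).filter (q ∣ ·), (Nat.gcd c n : ℝ) ≤ X / q * n.divisors.card := by
  have hq0 : (0 : ℝ) < q := by exact_mod_cast hq.pos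
  set S := (Finset.Icc 1 ⌊X⌋₊).filter (q ∣ ·) with hS
  have hinj : Set.InjOn (fun c => c / q) S := by
    intro a ha b hb hab
    have ha' : q ∣ a := (Finset.mem_filter.1 ha).2
    have hb' : q ∣ b := (Finset.mem_filter.1 hb).2
    rw [← Nat.div_mul_cancel ha', ← Nat.div_mul_cancel hb']
    exact congrArg (· * q) hab
  have e : ∑ c ∈ S, (Nat.gcd c n : ℝ) = ∑ c ∈ S.image (fun c => c / q), (Nat.gcd c n : ℝ) := by
    rw [Finset.sum_image hinj]
    refine Finset.sum_congr rfl fun c hc => ?_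
    obtain ⟨k, rfl⟩ := (Finset.mem_filter.1 hc).2
    rw [Nat.mul_div_cancel_left _ hq.pos]
    congr 1
    exact Nat.Coprime.gcd_mul_left_cancel _ ((Nat.Prime.coprime_iff_not_dvd hq).2 hqn)
  rw [e]
  refine sum_gcd_le_of_le n hn (by positivity) _ fun c hc => ?_
  obtain ⟨k, hk, rfl⟩ := Finset.mem_image.1 hc
  obtain ⟨hk1, ⟨m, rfl⟩⟩ := Finset.mem_filter.1 hk
  rw [Finset.mem_Icc] at hk1
  simp only [Nat.mul_div_cancel_left _ hq.pos]
  refine ⟨Nat.pos_of_ne_zero fun h => by simp [h] at hk1, ?_⟩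
  rw [le_div_iff₀ hq0]
  have := (Nat.le_floor_iff hX).1 hk1.2
  push_cast at this
  linarith

lemma sum_badC_le {n : ℕ} (hn : 0 < n) {q₁ q₂ d : ℕ} (h₁ : q₁.Prime) (h₂ : q₂.Prime)
    (h₁n : ¬ q₁ ∣ n) (h₂n : ¬ q₂ ∣ n) {Q T R : ℝ} (hQ : 1 ≤ Q) (hQ₁ : Q ≤ q₁) (hQ₂ : Q ≤ q₂)
    (hQT : Q ≤ T) (hR : 0 ≤ R) :
    ∑ c ∈ badC T R (q₁ ^ d * q₂ ^ d), (Nat.gcd c n : ℝ) ≤ 7 * R / Q * n.divisors.card := by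
  have hsub : badC T R (q₁ ^ d * q₂ ^ d) ⊆ ((Finset.Icc 1 ⌊R / T⌋₊) ∪
      (Finset.Icc 1 ⌊3 * R⌋₊).filter (q₁ ∣ ·)) ∪ (Finset.Icc 1 ⌊3 * R⌋₊).filter (q₂ ∣ ·) := by
    intro c hc
    obtain ⟨h1, h2⟩ := Finset.mem_filter.1 hc
    simp only [Finset.mem_union, Finset.mem_filter]
    by_cases hRT : R / T ≤ c
    · have h3 : ¬ Nat.Coprime (q₁ ^ d * q₂ ^ d) c := fun h => h2 ⟨hRT, h⟩
      by_cases a : q₁ ∣ c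
      · exact Or.inl (Or.inr ⟨h1, a⟩)
      · refine Or.inr ⟨h1, ?_⟩
        by_contra b
        exact h3 (Nat.Coprime.mul_left (Nat.Coprime.pow_left _ ((Nat.Prime.coprime_iff_not_dvd h₁).2 a))
          (Nat.Coprime.pow_left _ ((Nat.Prime.coprime_iff_not_dvd h₂).2 b)))
    · push Not at hRT
      refine Or.inl (Or.inl ?_)
      rw [Finset.mem_Icc] at h1 ⊢
      exact ⟨h1.1, Nat.le_floor hRT.le⟩
  have hpos : ∀ c, (0 : ℝ) ≤ (Nat.gcd c n : ℝ) := fun c => by positivity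
  have hu : ∀ (s t : Finset ℕ), ∑ c ∈ s ∪ t, (Nat.gcd c n : ℝ) ≤
      ∑ c ∈ s, (Nat.gcd c n : ℝ) + ∑ c ∈ t, (Nat.gcd c n : ℝ) := by
    intro s t
    rw [← Finset.sum_union_inter]
    exact le_add_of_nonneg_right (Finset.sum_nonneg fun c _ => hpos c)
  have hT : 0 < T := by linarith
  have b0 : ∑ c ∈ Finset.Icc 1 ⌊R / T⌋₊, (Nat.gcd c n : ℝ) ≤ R / Q * n.divisors.card := by
    refine (sum_gcd_le_of_le n hn (X := R / T) (by positivity) _ fun c hc => ?_).trans ?_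
    · rw [Finset.mem_Icc] at hc
      exact ⟨hc.1, (Nat.le_floor_iff (by positivity)).1 hc.2⟩
    · gcongr
  have b : ∀ q : ℕ, q.Prime → ¬ q ∣ n → Q ≤ q →
      ∑ c ∈ (Finset.Icc 1 ⌊3 * R⌋₊).filter (q ∣ ·), (Nat.gcd c n : ℝ) ≤
        3 * R / Q * n.divisors.card := by
    intro q hq hqn hQq
    refine (sum_gcd_multiples_le n hn hq hqn (by positivity)).trans ?_
    gcongr
  calc _ ≤ _ := Finset.sum_le_sum_of_subset_of_nonneg hsub fun c _ _ => hpos c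
    _ ≤ _ := (hu _ _).trans (add_le_add_left (hu _ _) _)
    _ ≤ R / Q * n.divisors.card + 3 * R / Q * n.divisors.card + 3 * R / Q * n.divisors.card :=
      add_le_add (add_le_add b0 (b q₁ h₁ h₁n hQ₁)) (b q₂ h₂ h₂n hQ₂)
    _ = _ := by ring

lemma norm_main_le {Ψ : SL2R → ℂ} {T : ℝ} (hT : 1 ≤ T) (hΨ : LipG T Ψ) {R : ℝ} (hR : 4 ≤ R) (n : ℕ)
    (hn : 0 < n) (hn1 : (n : ℝ) ≤ R ^ 2) (hn2 : R ^ 2 ≤ T * n) (N : ℕ) {η M : ℝ} (hη : 0 ≤ η)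
    (hM : 0 ≤ M) (hb : ∀ x, η ≤ x → 0 < x → ‖Mn Ψ N x‖ ≤ M) :
    ‖2 * ∑ c ∈ goodC T R N, (Nat.totient c : ℂ) * Ic Ψ R n 0 N c‖ ≤ 2 * n * (6 * η + 3 * M) := by
  have : NeZero n := ⟨hn.ne'⟩
  have hR0 : 0 < R := by linarith
  have hn0 : (0 : ℝ) < n := by exact_mod_cast hn
  have key : ∀ c ∈ goodC T R N, ‖(Nat.totient c : ℂ) * Ic Ψ R n 0 N c‖ ≤
      n / R * ((if (c : ℝ) ≤ η * R then 6 else 0) + M) := by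
    intro c hc
    obtain ⟨h1, h2⟩ := Finset.mem_filter.1 hc
    rw [Finset.mem_Icc] at h1
    have hc0 : 0 < c := h1.1
    have : NeZero c := ⟨hc0.ne'⟩
    have hc' : (0 : ℝ) < c := by exact_mod_cast hc0
    rw [Ic_zero_eq hT hΨ hR n hn1 hn2 N c h2.1 ((Nat.le_floor_iff (by positivity)).1 h1.2),
      norm_mul, norm_mul, Complex.norm_natCast, Complex.norm_real, Real.norm_of_nonneg (by positivity)]
    have e : ‖Mn Ψ N (c / R)‖ ≤ (if (c : ℝ) ≤ η * R then 6 else 0) + M := by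
      split_ifs with h
      · have := norm_Mn_le hΨ.1 N (x := c / R) (by positivity)
        linarith
      · push Not at h
        rw [zero_add]
        exact hb _ ((le_div_iff₀ hR0).2 h.le) (by positivity)
    have ht : (Nat.totient c : ℝ) ≤ c := by exact_mod_cast Nat.totient_le c
    calc (Nat.totient c : ℝ) * (n / (R * c) * ‖Mn Ψ N (c / R)‖)
        ≤ c * (n / (R * c) * ((if (c : ℝ) ≤ η * R then 6 else 0) + M)) := by
          refine mul_le_mul ht (mul_le_mul_of_nonneg_left e (by positivity)) (by positivity)
            (by positivity)
      _ = _ := by field_simp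
  rw [norm_mul]
  have hs : ‖∑ c ∈ goodC T R N, (Nat.totient c : ℂ) * Ic Ψ R n 0 N c‖ ≤
      n / R * (6 * (η * R) + 3 * R * M) := by
    refine (norm_sum_le _ _).trans ((Finset.sum_le_sum key).trans ?_)
    rw [← Finset.mul_sum]
    refine mul_le_mul_of_nonneg_left ?_ (by positivity)
    rw [Finset.sum_add_distrib]
    refine add_le_add ?_ ?_
    · rw [← Finset.sum_filter, Finset.sum_const, nsmul_eq_mul, mul_comm]
      refine mul_le_mul_of_nonneg_left ?_ (by norm_num)
      have hsub : (goodC T R N).filter (fun c : ℕ => (c : ℝ) ≤ η * R) ⊆ Finset.Icc 1 ⌊η * R⌋₊ := by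
        intro c hc
        obtain ⟨h1, h2⟩ := Finset.mem_filter.1 hc
        exact Finset.mem_Icc.2 ⟨(Finset.mem_Icc.1 (Finset.mem_filter.1 h1).1).1, Nat.le_floor h2⟩
      calc _ ≤ ((Finset.Icc 1 ⌊η * R⌋₊).card : ℝ) := by exact_mod_cast Finset.card_le_card hsub
        _ = ⌊η * R⌋₊ := by simp
        _ ≤ _ := Nat.floor_le (by positivity)
    · rw [Finset.sum_const, nsmul_eq_mul]
      refine mul_le_mul_of_nonneg_right ?_ hM
      calc _ ≤ ((Finset.Icc 1 ⌊3 * R⌋₊).card : ℝ) := by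
            exact_mod_cast Finset.card_le_card (Finset.filter_subset _ _)
        _ = ⌊3 * R⌋₊ := by simp
        _ ≤ _ := Nat.floor_le (by positivity)
  calc _ ≤ ‖(2 : ℂ)‖ * (n / R * (6 * (η * R) + 3 * R * M)) :=
        mul_le_mul_of_nonneg_left hs (norm_nonneg _)
    _ = _ := by rw [Complex.norm_ofNat]; field_simp

/-- Bound, with constant `C`, for the correlations of `f` along the orbits sped up by the `d`-th
powers of two primes of size about `Q`. -/
def PairBound (d : ℕ) (C : ℝ) : Prop :=
  ∀ (f : SL2R → ℂ) (B : ℤ) (n Q q₁ q₂ : ℕ), InvN 1 f → LipG 1 f → 1 ≤ Q → q₁.Prime → q₂.Prime →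
    q₁ ≠ q₂ → Q < q₁ → q₁ ≤ 8 * Q → Q < q₂ → q₂ ≤ 8 * Q → ¬ q₁ ∣ n → ¬ q₂ ∣ n → |B| < n →
    (B ≠ 0 ∨ MZ f) → 5 * (8 * Q : ℝ) ^ (2 * d) ≤ n →
    ‖∑ j ∈ Finset.range n, eR ((B : ℝ) * j / n) *
      (f (ptg (Real.sqrt n) n ((q₁ ^ d : ℕ) * (j : ℤ))) *
        starRingEnd ℂ (f (ptg (Real.sqrt n) n ((q₂ ^ d : ℕ) * (j : ℤ)))))‖ ≤
      n * (C * n.divisors.card * (Q : ℝ) ^ (-(1 / 8000) : ℝ) +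
        C * (Q : ℝ) ^ (14 * d) * (n : ℝ) ^ (-(1 / 80) : ℝ))

set_option maxHeartbeats 1000000 in
theorem exists_pair_bound (d : ℕ) (hd : 0 < d) : ∃ C : ℝ, 1 ≤ C ∧ PairBound d C := by
  obtain ⟨C₁, hC₁, h1⟩ := exists_expSum_bound
  obtain ⟨C₀, hC₀, h0⟩ := exists_fullOrbit_bound
  refine ⟨98 + 12 + 6 * (1536 * 8 ^ d * C₀) + C₁ * (5 ^ 7 * 8 ^ (14 * d)), ?_, ?_⟩
  · have : 0 ≤ C₁ * (5 ^ 7 * 8 ^ (14 * d)) := by positivity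
    have : 0 ≤ 6 * (1536 * 8 ^ d * C₀) := by positivity
    linarith
  intro f B n Q q₁ q₂ hi hf hQ p₁ p₂ hne l₁ u₁ l₂ u₂ n₁ n₂ hB hz hn
  have hQ' : (1 : ℝ) ≤ Q := by exact_mod_cast hQ
  have l₁' : (Q : ℝ) < q₁ := by exact_mod_cast l₁
  have l₂' : (Q : ℝ) < q₂ := by exact_mod_cast l₂
  have u₁' : (q₁ : ℝ) ≤ 8 * Q := by exact_mod_cast u₁
  have u₂' : (q₂ : ℝ) ≤ 8 * Q := by exact_mod_cast u₂
  have hα : 0 < q₁ ^ d := pow_pos p₁.pos _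
  have hβ : 0 < q₂ ^ d := pow_pos p₂.pos _
  set α := q₁ ^ d with hαd
  set β := q₂ ^ d with hβd
  have hα8 : (α : ℝ) ≤ (8 * Q) ^ d := by
    rw [hαd]; push_cast; gcongr
  have hβ8 : (β : ℝ) ≤ (8 * Q) ^ d := by
    rw [hβd]; push_cast; gcongr
  have hαQ : (Q : ℝ) ^ d ≤ α := by
    rw [hαd]; push_cast; gcongr
  have hβQ : (Q : ℝ) ^ d ≤ β := by
    rw [hβd]; push_cast; gcongr
  have hβQ1 : (Q : ℝ) ≤ β := (le_self_pow₀ hQ' hd.ne').trans hβQ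
  set T : ℝ := 5 * (8 * Q : ℝ) ^ (2 * d) with hT
  have h8Q : (1 : ℝ) ≤ 8 * Q := by linarith
  have hp1 : (8 * Q : ℝ) ^ d ≤ (8 * Q : ℝ) ^ (2 * d) := pow_le_pow_right₀ h8Q (by omega)
  have hp2 : (8 * Q : ℝ) ≤ (8 * Q : ℝ) ^ (2 * d) := le_self_pow₀ h8Q (by omega)
  have hT1 : 1 ≤ T := by linarith
  have hQT : (Q : ℝ) ≤ T := by linarith
  have hnp : 0 < n := Nat.pos_of_ne_zero fun h => by rw [h, Nat.cast_zero] at hn; linarith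
  have hn0 : (0 : ℝ) < n := by exact_mod_cast hnp
  have hα1 : (1 : ℝ) ≤ α := by exact_mod_cast hα
  have hβ1 : (1 : ℝ) ≤ β := by exact_mod_cast hβ
  have hH1 : (α : ℝ) ≤ 8 ^ d * β := by
    rw [mul_pow] at hα8; exact hα8.trans (mul_le_mul_of_nonneg_left hβQ (by positivity))
  have hH2 : (β : ℝ) ≤ 8 ^ d * α := by
    rw [mul_pow] at hβ8; exact hβ8.trans (mul_le_mul_of_nonneg_left hαQ (by positivity))
  have hcop : Nat.Coprime α β := Nat.Coprime.pow _ _ ((Nat.coprime_primes p₁ p₂).2 hne)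
  have hL : LipG T (pairF f α β) := by
    refine (lipG_pairF hf hα hβ hH1 hH2).mono ?_
    have h8 : (8 : ℝ) ^ d ≤ (8 * Q : ℝ) ^ d := pow_le_pow_left₀ (by norm_num) (by linarith) d
    have h81 : (1 : ℝ) ≤ 8 ^ d := one_le_pow₀ (by norm_num)
    linarith
  set R : ℝ := Real.sqrt (n * α) with hR
  have hR2 : R ^ 2 = n * α := Real.sq_sqrt (by positivity)
  have hR4 : 4 ≤ R := by
    rw [hR]; apply Real.le_sqrt_of_sq_le; nlinarith
  have hR0 : 0 < R := by linarith
  have hαT : (α : ℝ) ≤ T := by linarith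
  have hRn : R ≤ n := by
    rw [hR]; apply Real.sqrt_le_iff.2 ⟨hn0.le, ?_⟩
    rw [sq]; exact mul_le_mul_of_nonneg_left (hαT.trans hn) hn0.le
  have hNT : ((α * β : ℕ) : ℝ) ≤ T := by
    push_cast
    calc (α : ℝ) * β ≤ (8 * Q) ^ d * (8 * Q) ^ d := by gcongr
      _ = (8 * Q : ℝ) ^ (2 * d) := by rw [← pow_add]; congr 1; omega
      _ ≤ T := by rw [hT]; linarith
  have key := h1 (pairF f α β) T (α * β) R n B hT1 hL (invN_pairF hi hα hβ) hNT hR4 hnp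
    (by rw [hR2]; nlinarith) (by rw [hR2]; nlinarith) hB
  set τ : ℝ := (n.divisors.card : ℝ) with hτ
  have hτ1 : 1 ≤ τ := by
    rw [hτ]; exact_mod_cast Finset.card_pos.2 ⟨1, Nat.one_mem_divisors.2 hnp.ne'⟩
  have hbad := sum_badC_le hnp p₁ p₂ n₁ n₂ (d := d) hQ' l₁'.le l₂'.le hQT hR0.le
  rw [← hαd, ← hβd] at hbad
  set q : ℝ := (Q : ℝ) ^ (-(1 / 8000) : ℝ) with hq
  have hq0 : 0 < q := Real.rpow_pos_of_pos (by linarith) _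
  have hQq : (Q : ℝ)⁻¹ ≤ q := by
    rw [hq, ← Real.rpow_neg_one]
    exact Real.rpow_le_rpow_of_exponent_le hQ' (by norm_num)
  have hbad2 : 2 * ∑ c ∈ badC T R (α * β), (Nat.gcd c n : ℝ) * (6 * n / R + 1) ≤
      n * (98 * τ * q) := by
    rw [← Finset.sum_mul]
    calc _ ≤ 2 * (7 * R / Q * τ * (6 * n / R + 1)) := by gcongr
      _ = 14 * τ * (6 * n + R) * (Q : ℝ)⁻¹ := by field_simp; ring
      _ ≤ 14 * τ * (7 * n) * q := by
          refine mul_le_mul (mul_le_mul_of_nonneg_left (by linarith) (by positivity)) hQq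
            (by positivity) (by positivity)
      _ = _ := by ring
  have herr : C₁ * T ^ 7 * (n : ℝ) ^ (1 - 1 / 80 : ℝ) =
      n * (C₁ * (5 ^ 7 * 8 ^ (14 * d)) * (Q : ℝ) ^ (14 * d) * (n : ℝ) ^ (-(1 / 80) : ℝ)) := by
    rw [sub_eq_add_neg, Real.rpow_add hn0, Real.rpow_one, hT, mul_pow, ← pow_mul, mul_pow]
    rw [show 2 * d * 7 = 14 * d by ring]
    ring
  have hmain : ‖(if B = 0 then 2 * ∑ c ∈ goodC T R (α * β), (Nat.totient c : ℂ) *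
      Ic (pairF f α β) R n 0 (α * β) c else 0)‖ ≤ n * ((12 + 6 * (1536 * 8 ^ d * C₀)) * τ * q) := by
    split_ifs with hB0
    · have hz' : MZ f := hz.resolve_left (fun h => h hB0)
      set V : ℝ := (Q : ℝ) ^ (1 / 8000 : ℝ) with hV
      have hV1 : 1 ≤ V := Real.one_le_rpow hQ' (by norm_num)
      have hVq : 1 / V = q := by
        rw [hV, hq, one_div, ← Real.rpow_neg (by positivity)]
      have hVT : V ≤ T := by
        exact (Real.rpow_le_self_of_one_le hQ' (by norm_num)).trans hQT
      have hM : 0 ≤ 1536 * V ^ 2 * 8 ^ d * C₀ * (β : ℝ) ^ (-(1 / 2000) : ℝ) := by positivity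
      refine (norm_main_le hT1 hL hR4 n hnp (by rw [hR2]; nlinarith) (by rw [hR2]; nlinarith)
        (α * β) hq0.le hM (fun x hx hx0 => norm_Mn_pairF_le h0 (by linarith) hi hf hz' hα hβ hcop
          hH1 hH2 hT1 hL hV1 hVT (by rw [hVq]; exact hx))).trans ?_
      have e1 : V ^ 2 * (β : ℝ) ^ (-(1 / 2000) : ℝ) ≤ q := by
        calc V ^ 2 * (β : ℝ) ^ (-(1 / 2000) : ℝ)
            ≤ V ^ 2 * (Q : ℝ) ^ (-(1 / 2000) : ℝ) := by
              refine mul_le_mul_of_nonneg_left ?_ (by positivity)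
              exact Real.rpow_le_rpow_of_nonpos (by linarith) hβQ1 (by norm_num)
          _ = (Q : ℝ) ^ (1 / 4000 - 1 / 2000 : ℝ) := by
              rw [hV, ← Real.rpow_natCast, ← Real.rpow_mul (by positivity),
                ← Real.rpow_add (by linarith)]
              norm_num
          _ ≤ q := Real.rpow_le_rpow_of_exponent_le hQ' (by norm_num)
      calc _ = n * (12 * q + 6 * (1536 * 8 ^ d * C₀) * (V ^ 2 * (β : ℝ) ^ (-(1 / 2000) : ℝ))) := by
            ring
        _ ≤ n * (12 * q + 6 * (1536 * 8 ^ d * C₀) * q) := by gcongr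
        _ = n * ((12 + 6 * (1536 * 8 ^ d * C₀)) * q) := by ring
        _ ≤ n * ((12 + 6 * (1536 * 8 ^ d * C₀)) * (τ * q)) := by
            gcongr; exact le_mul_of_one_le_left hq0.le hτ1
        _ = _ := by ring
    · rw [norm_zero]; positivity
  have hsum : ∑ j ∈ Finset.range n, eR ((B : ℝ) * j / n) *
        (f (ptg (Real.sqrt n) n ((α : ℕ) * (j : ℤ))) *
          starRingEnd ℂ (f (ptg (Real.sqrt n) n ((β : ℕ) * (j : ℤ))))) =
      ∑ i ∈ Finset.range n, eR ((B : ℝ) * i / n) * pairF f α β (ptg R n i) := by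
    refine Finset.sum_congr rfl fun j _ => ?_
    rw [hR, pairF_ptg f hα hβ hnp]
  rw [hsum]
  have htri := norm_le_norm_sub_add (∑ i ∈ Finset.range n, eR ((B : ℝ) * i / n) * pairF f α β (ptg R n i))
    (if B = 0 then 2 * ∑ c ∈ goodC T R (α * β), (Nat.totient c : ℂ) *
      Ic (pairF f α β) R n 0 (α * β) c else 0)
  refine (htri.trans (add_le_add (key.trans (add_le_add hbad2 herr.le)) hmain)).trans ?_
  rw [← mul_add, ← mul_add]
  refine mul_le_mul_of_nonneg_left ?_ hn0.le
  have k1 : 0 ≤ C₁ * (5 ^ 7 * 8 ^ (14 * d)) := by positivity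
  have k2 : 0 ≤ 98 + 12 + 6 * (1536 * 8 ^ d * C₀) := by positivity
  generalize C₁ * (5 ^ 7 * 8 ^ (14 * d)) = K₁ at k1 ⊢
  have a1 : 0 ≤ K₁ * (τ * q) := mul_nonneg k1 (mul_nonneg (by linarith) hq0.le)
  have a2 : 0 ≤ (98 + 12 + 6 * (1536 * 8 ^ d * C₀)) * ((Q : ℝ) ^ (14 * d) * (n : ℝ) ^ (-(1 / 80) : ℝ)) :=
    mul_nonneg k2 (mul_nonneg (pow_nonneg (by linarith) _) (Real.rpow_nonneg hn0.le _))
  linarith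

lemma sum_range_eq_sum_zmod (n : ℕ) [NeZero n] (F : ZMod n → ℂ) :
    ∑ j ∈ Finset.range n, F (j : ZMod n) = ∑ x : ZMod n, F x := by
  refine Finset.sum_nbij' (fun j => (j : ZMod n)) (fun x => x.val) ?_ ?_ ?_ ?_ ?_
  · simp
  · intro x _; simpa using ZMod.val_lt x
  · intro j hj
    exact ZMod.val_cast_of_lt (Finset.mem_range.1 hj)
  · intro x _; simp
  · simp

lemma amplification (n d : ℕ) [NeZero n] (hd : 0 < d) (G : ZMod n → ℂ) (P : Finset ℕ)
    (hP : ∀ q ∈ P, Nat.Coprime q n) :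
    ((P.card : ℝ) * ‖∑ u : (ZMod n)ˣ, G ((u : ZMod n) ^ d)‖) ^ 2 ≤
      Nat.totient n * ((n.divisors.card : ℝ) ^ (d + 1) * ∑ q₁ ∈ P, ∑ q₂ ∈ P,
        ‖∑ x : ZMod n, G ((q₁ : ZMod n) ^ d * x) * starRingEnd ℂ (G ((q₂ : ZMod n) ^ d * x))‖) := by
  set A : ZMod n → ℂ := fun x => ∑ q ∈ P, G ((q : ZMod n) ^ d * x) with hA
  have e1 : (P.card : ℂ) * ∑ u : (ZMod n)ˣ, G ((u : ZMod n) ^ d) =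
      ∑ u : (ZMod n)ˣ, A ((u : ZMod n) ^ d) := by
    rw [hA]
    simp only
    rw [Finset.sum_comm, ← nsmul_eq_mul, ← Finset.sum_const]
    refine Finset.sum_congr rfl fun q hq => ?_
    rw [← Equiv.sum_comp (Equiv.mulLeft (ZMod.unitOfCoprime q (hP q hq)))]
    refine Finset.sum_congr rfl fun u _ => ?_
    rw [Equiv.coe_mulLeft, Units.val_mul, mul_pow, ZMod.coe_unitOfCoprime]
  have e2 : (P.card : ℝ) * ‖∑ u : (ZMod n)ˣ, G ((u : ZMod n) ^ d)‖ ≤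
      ∑ u : (ZMod n)ˣ, ‖A ((u : ZMod n) ^ d)‖ := by
    rw [← Complex.norm_natCast, ← norm_mul, e1]
    exact norm_sum_le _ _
  have e3 : (∑ u : (ZMod n)ˣ, ‖A ((u : ZMod n) ^ d)‖) ^ 2 ≤
      Nat.totient n * ∑ u : (ZMod n)ˣ, ‖A ((u : ZMod n) ^ d)‖ ^ 2 := by
    have := sq_sum_le_card_mul_sum_sq (s := (Finset.univ : Finset (ZMod n)ˣ))
      (f := fun u => ‖A ((u : ZMod n) ^ d)‖)
    rwa [Finset.card_univ, ZMod.card_units_eq_totient] at this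
  have e4 : ∑ u : (ZMod n)ˣ, ‖A ((u : ZMod n) ^ d)‖ ^ 2 ≤
      (n.divisors.card : ℝ) ^ (d + 1) * ∑ j : (ZMod n)ˣ, ‖A (j : ZMod n)‖ ^ 2 := by
    rw [← Finset.sum_fiberwise (s := (Finset.univ : Finset (ZMod n)ˣ)) (g := fun u => u ^ d),
      Finset.mul_sum]
    refine Finset.sum_le_sum fun j _ => ?_
    have : ∀ u ∈ Finset.univ.filter (fun u : (ZMod n)ˣ => u ^ d = j),
        ‖A ((u : ZMod n) ^ d)‖ ^ 2 = ‖A (j : ZMod n)‖ ^ 2 := by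
      intro u hu
      rw [← (Finset.mem_filter.1 hu).2, Units.val_pow_eq_pow_val]
    rw [Finset.sum_congr rfl this, Finset.sum_const, nsmul_eq_mul]
    refine mul_le_mul_of_nonneg_right ?_ (by positivity)
    exact_mod_cast card_pow_eq_le d n hd j
  have e5 : ∑ j : (ZMod n)ˣ, ‖A (j : ZMod n)‖ ^ 2 ≤ ∑ x : ZMod n, ‖A x‖ ^ 2 := by
    rw [← Finset.sum_image (s := Finset.univ) (g := fun j : (ZMod n)ˣ => (j : ZMod n))
      (f := fun x => ‖A x‖ ^ 2) (fun a _ b _ h => Units.ext h)]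
    exact Finset.sum_le_sum_of_subset_of_nonneg (Finset.subset_univ _) fun _ _ _ => by positivity
  have e6 : ∑ x : ZMod n, ‖A x‖ ^ 2 ≤ ∑ q₁ ∈ P, ∑ q₂ ∈ P,
        ‖∑ x : ZMod n, G ((q₁ : ZMod n) ^ d * x) * starRingEnd ℂ (G ((q₂ : ZMod n) ^ d * x))‖ := by
    have : ((∑ x : ZMod n, ‖A x‖ ^ 2 : ℝ) : ℂ) = ∑ q₁ ∈ P, ∑ q₂ ∈ P,
        ∑ x : ZMod n, G ((q₁ : ZMod n) ^ d * x) * starRingEnd ℂ (G ((q₂ : ZMod n) ^ d * x)) := by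
      push_cast
      have : ∀ x, ((‖A x‖ : ℝ) : ℂ) ^ 2 = ∑ q₁ ∈ P, ∑ q₂ ∈ P,
          G ((q₁ : ZMod n) ^ d * x) * starRingEnd ℂ (G ((q₂ : ZMod n) ^ d * x)) := by
        intro x
        rw [← Complex.mul_conj', hA, map_sum, Finset.sum_mul_sum]
      simp only [this]
      rw [Finset.sum_comm]
      exact Finset.sum_congr rfl fun q₁ _ => Finset.sum_comm
    have h2 : ‖((∑ x : ZMod n, ‖A x‖ ^ 2 : ℝ) : ℂ)‖ = ∑ x : ZMod n, ‖A x‖ ^ 2 := by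
      rw [Complex.norm_real, Real.norm_of_nonneg (Finset.sum_nonneg fun _ _ => by positivity)]
    rw [← h2, this]
    exact (norm_sum_le _ _).trans (Finset.sum_le_sum fun _ _ => norm_sum_le _ _)
  calc _ ≤ (∑ u : (ZMod n)ˣ, ‖A ((u : ZMod n) ^ d)‖) ^ 2 :=
        pow_le_pow_left₀ (by positivity) e2 2
    _ ≤ _ := e3
    _ ≤ _ := by
        refine mul_le_mul_of_nonneg_left (e4.trans ?_) (by positivity)
        exact mul_le_mul_of_nonneg_left (e5.trans e6) (by positivity)

/-- The function `x ↦ f (u_{x/n} a_{√n}⁻¹)` on residues. -/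
def resF (f : SL2R → ℂ) (n : ℕ) (x : ZMod n) : ℂ := f (ptg (Real.sqrt n) n (x.val : ℤ))

lemma resF_natCast {f : SL2R → ℂ} (hf : InvN 1 f) {n : ℕ} (hn : 0 < n) (k : ℕ) :
    resF f n (k : ZMod n) = f (ptg (Real.sqrt n) n k) := by
  have := f_ptg_mod hf hn (R := Real.sqrt n) k 1
  rw [mul_one, mul_one] at this
  rw [resF, this, ZMod.val_natCast]

lemma sum_twist_eq {f : SL2R → ℂ} (hf : InvN 1 f) {n : ℕ} [NeZero n] (c : ZMod n) (b : (ZMod n)ˣ)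
    (α β : ℕ) :
    ∑ x : ZMod n, (ZMod.stdAddChar (c * ((α : ZMod n) * x)) * resF f n (b * ((α : ZMod n) * x))) *
        starRingEnd ℂ (ZMod.stdAddChar (c * ((β : ZMod n) * x)) * resF f n (b * ((β : ZMod n) * x))) =
      ∑ j ∈ Finset.range n, eR (((c * ((b⁻¹ : (ZMod n)ˣ) : ZMod n) * (α - β)).val : ℤ) * j / n) *
        (f (ptg (Real.sqrt n) n (α * (j : ℤ))) *
          starRingEnd ℂ (f (ptg (Real.sqrt n) n (β * (j : ℤ))))) := by
  have hn : 0 < n := Nat.pos_of_ne_zero (NeZero.ne n)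
  rw [← Equiv.sum_comp (Units.mulLeft b⁻¹), ← sum_range_eq_sum_zmod]
  refine Finset.sum_congr rfl fun j _ => ?_
  simp only [Units.mulLeft_apply]
  have hb : ∀ γ : ZMod n, (b : ZMod n) * (γ * (((b⁻¹ : (ZMod n)ˣ) : ZMod n) * j)) = γ * j := by
    intro γ
    rw [mul_left_comm, Units.mul_inv_cancel_left]
  rw [hb, hb, map_mul (starRingEnd ℂ), conj_stdAddChar, ← Nat.cast_mul, ← Nat.cast_mul, resF_natCast hf hn,
    resF_natCast hf hn]
  set B := (c * ((b⁻¹ : (ZMod n)ˣ) : ZMod n) * (α - β)).val with hB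
  have e := eR_eq_stdAddChar n ((B : ℤ) * j)
  have hBc : ((B : ℕ) : ZMod n) = c * ((b⁻¹ : (ZMod n)ˣ) : ZMod n) * (α - β) := by
    rw [hB, ZMod.natCast_zmod_val]
  push_cast at e ⊢
  rw [e, hBc]
  have : c * ((b⁻¹ : (ZMod n)ˣ) : ZMod n) * ((α : ZMod n) - β) * j =
      c * (α * (((b⁻¹ : (ZMod n)ˣ) : ZMod n) * j)) + -(c * (β * (((b⁻¹ : (ZMod n)ˣ) : ZMod n) * j))) := by
    ring
  rw [this, AddChar.map_add_eq_mul]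
  ring

lemma twisted_sum_sq_le {d : ℕ} {C : ℝ} (hC : 0 ≤ C) (hd : 0 < d)
    (hpair : PairBound d C) {f : SL2R → ℂ} (hi : InvN 1 f) (hf : LipG 1 f) {n : ℕ} [NeZero n] {Q : ℕ} (hQ : 1 ≤ Q)
    (hn : 5 * (8 * Q : ℝ) ^ (2 * d) ≤ n) (m : ℤ) (hm : m ≠ 0 ∨ MZ f) (a b : (ZMod n)ˣ)
    (hmn : (|m| : ℤ) * (8 * Q) ^ d < (n : ℤ)) (P : Finset ℕ)
    (hP : ∀ q ∈ P, q.Prime ∧ Q < q ∧ q ≤ 8 * Q ∧ ¬ q ∣ n) :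
    ((P.card : ℝ) * ‖∑ u : (ZMod n)ˣ, ZMod.stdAddChar ((m * a : ZMod n) * (u : ZMod n) ^ d) *
        resF f n (b * (u : ZMod n) ^ d)‖) ^ 2 ≤
      Nat.totient n * ((n.divisors.card : ℝ) ^ (d + 1) * (n * (P.card + P.card ^ 2 *
        (C * n.divisors.card * (Q : ℝ) ^ (-(1 / 8000) : ℝ) +
          C * (Q : ℝ) ^ (14 * d) * (n : ℝ) ^ (-(1 / 80) : ℝ))))) := by
  have hn0 : 0 < n := Nat.pos_of_ne_zero (NeZero.ne n)
  set ψ : ZMod n → ℂ := fun x => ZMod.stdAddChar ((m * a : ZMod n) * x) * resF f n (b * x) with hψ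
  refine (amplification n d hd ψ P fun q hq => (Nat.Prime.coprime_iff_not_dvd (hP q hq).1).2 (hP q hq).2.2.2).trans ?_
  refine mul_le_mul_of_nonneg_left (mul_le_mul_of_nonneg_left ?_ (by positivity)) (by positivity)
  set E : ℝ := C * n.divisors.card * (Q : ℝ) ^ (-(1 / 8000) : ℝ) +
          C * (Q : ℝ) ^ (14 * d) * (n : ℝ) ^ (-(1 / 80) : ℝ) with hE
  have hE0 : 0 ≤ E := by positivity
  have hterm : ∀ q₁ ∈ P, ∀ q₂ ∈ P,
      ‖∑ x : ZMod n, ψ ((q₁ : ZMod n) ^ d * x) * starRingEnd ℂ (ψ ((q₂ : ZMod n) ^ d * x))‖ ≤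
        n * ((if q₁ = q₂ then 1 else 0) + E) := by
    intro q₁ h₁ q₂ h₂
    by_cases h : q₁ = q₂
    · rw [if_pos h]
      have hnn : ∀ x, ‖ψ x‖ ≤ 1 := fun x => by
        rw [norm_mul, norm_stdAddChar, one_mul]
        exact hf.1 _
      refine (norm_sum_le_of_le (n := fun _ => (1 : ℝ)) _ fun x _ => ?_).trans ?_
      · rw [norm_mul, RCLike.norm_conj]
        exact mul_le_one₀ (hnn _) (norm_nonneg _) (hnn _)
      rw [Finset.sum_const, Finset.card_univ, ZMod.card, nsmul_eq_mul]
      gcongr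
      linarith
    · rw [if_neg h, zero_add]
      obtain ⟨p₁, l₁, u₁, d₁⟩ := hP q₁ h₁
      obtain ⟨p₂, l₂, u₂, d₂⟩ := hP q₂ h₂
      simp only [hψ]
      rw [← Nat.cast_pow, ← Nat.cast_pow, sum_twist_eq hi]
      refine hpair f _ n Q q₁ q₂ hi hf hQ p₁ p₂ h l₁ u₁ l₂ u₂ d₁ d₂ ?_ ?_ hn
      · rw [Nat.abs_cast]
        exact_mod_cast ZMod.val_lt _
      · rcases hm with hm | hm
        · left
          intro h0
          have h1 : (m * a : ZMod n) * ((b⁻¹ : (ZMod n)ˣ) : ZMod n) *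
              (((q₁ ^ d : ℕ) : ZMod n) - ((q₂ ^ d : ℕ) : ZMod n)) = 0 := by
            rw [← ZMod.val_eq_zero]; exact_mod_cast h0
          have h2 : ((m * ((q₁ ^ d : ℕ) - (q₂ ^ d : ℕ) : ℤ) : ℤ) : ZMod n) = 0 := by
            push_cast at h1 ⊢
            have h3 := congrArg (fun z => z * (((a⁻¹ : (ZMod n)ˣ) : ZMod n) * b)) h1
            simp only [zero_mul] at h3
            rw [← h3]
            have ea : (a : ZMod n) * ((a⁻¹ : (ZMod n)ˣ) : ZMod n) = 1 := Units.mul_inv a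
            have eb : (b : ZMod n) * ((b⁻¹ : (ZMod n)ˣ) : ZMod n) = 1 := Units.mul_inv b
            calc _ = (m : ZMod n) * ((q₁ : ZMod n) ^ d - (q₂ : ZMod n) ^ d) *
                  ((a : ZMod n) * ((a⁻¹ : (ZMod n)ˣ) : ZMod n)) *
                  ((b : ZMod n) * ((b⁻¹ : (ZMod n)ˣ) : ZMod n)) := by rw [ea, eb]; ring
              _ = _ := by ring
          have h4 := (ZMod.intCast_zmod_eq_zero_iff_dvd _ n).1 h2
          have h5 : |m * ((q₁ ^ d : ℕ) - (q₂ ^ d : ℕ) : ℤ)| < n := by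
            rw [abs_mul]
            refine lt_of_le_of_lt (mul_le_mul_of_nonneg_left ?_ (abs_nonneg _)) hmn
            have k1 : ((q₁ ^ d : ℕ) : ℤ) ≤ (8 * Q) ^ d := by
              push_cast; exact pow_le_pow_left₀ (by positivity) (by exact_mod_cast u₁) d
            have k2 : ((q₂ ^ d : ℕ) : ℤ) ≤ (8 * Q) ^ d := by
              push_cast; exact pow_le_pow_left₀ (by positivity) (by exact_mod_cast u₂) d
            rw [abs_le]
            constructor <;> linarith [Int.natCast_nonneg (q₁ ^ d), Int.natCast_nonneg (q₂ ^ d)]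
          have h6 := Int.eq_zero_of_abs_lt_dvd h4 h5
          rcases mul_eq_zero.1 h6 with h7 | h7
          · exact hm h7
          · have : q₁ ^ d = q₂ ^ d := by exact_mod_cast sub_eq_zero.1 h7
            exact h (Nat.pow_left_injective hd.ne' this)
        · exact Or.inr hm
  refine (Finset.sum_le_sum fun q₁ h₁ => Finset.sum_le_sum fun q₂ h₂ => hterm q₁ h₁ q₂ h₂).trans ?_
  refine le_of_eq ?_
  simp only [← Finset.mul_sum, Finset.sum_add_distrib, Finset.sum_const, nsmul_eq_mul,
    Finset.sum_ite_eq]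
  congr 2
  · rw [Finset.sum_congr rfl fun q hq => if_pos hq]; simp
  · ring

lemma eventually_le_natCast_rpow (K : ℝ) {s : ℝ} (hs : 0 < s) :
    ∀ᶠ n : ℕ in Filter.atTop, K ≤ (n : ℝ) ^ s :=
  ((tendsto_rpow_atTop hs).comp tendsto_natCast_atTop_atTop).eventually_ge_atTop K

lemma card_primes_not_dvd_ge {Q n : ℕ} (hn : n ≠ 0)
    (h : Real.sqrt Q ≤ ((Finset.Ioc Q (8 * Q)).filter Nat.Prime).card)
    (hτ : (n.divisors.card : ℝ) ≤ Real.sqrt Q / 2) :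
    Real.sqrt Q / 2 ≤
      (((Finset.Ioc Q (8 * Q)).filter Nat.Prime).filter fun q => ¬ q ∣ n).card := by
  set P := (Finset.Ioc Q (8 * Q)).filter Nat.Prime
  have h1 : ((P.filter fun q => q ∣ n).card : ℝ) + (P.filter fun q => ¬ q ∣ n).card = P.card := by
    exact_mod_cast Finset.card_filter_add_card_filter_not (s := P) (fun q => q ∣ n)
  have h2 : ((P.filter fun q => q ∣ n).card : ℝ) ≤ n.divisors.card := by
    refine Nat.cast_le.2 (Finset.card_le_card fun q hq => ?_)
    rw [Nat.mem_divisors]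
    exact ⟨(Finset.mem_filter.1 hq).2, hn⟩
  linarith

lemma le_of_amplified {P S φ n τ C x E : ℝ} (d : ℕ) (hP : 0 < P) (hφ : 0 ≤ φ)
    (hτ : 1 ≤ τ) (hC : 1 ≤ C) (hx : 0 ≤ x) (hn : n ≤ τ * φ) (hE0 : 0 ≤ E)
    (h : (P * S) ^ 2 ≤ φ * (τ ^ (d + 1) * (n * (P + P ^ 2 * E))))
    (hPx : 1 / P ≤ 4 * x) (hE : E ≤ C * τ * (2 * x) + C * x) :
    S ^ 2 ≤ φ ^ 2 * (7 * C * τ ^ (d + 3) * x) := by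
  have h1 : S ^ 2 ≤ φ * (τ ^ (d + 1) * (n * (1 / P + E))) := by
    have : (P * S) ^ 2 ≤ P ^ 2 * (φ * (τ ^ (d + 1) * (n * (1 / P + E)))) := by
      refine h.trans (le_of_eq ?_)
      field_simp
    rw [mul_pow] at this
    exact le_of_mul_le_mul_left this (by positivity)
  have h2 : 1 / P + E ≤ 7 * C * τ * x := by
    have a1 : C * x ≤ C * τ * x := by
      have : C * 1 * x ≤ C * τ * x := by gcongr
      linarith
    have a2 : x ≤ C * τ * x := by
      have : 1 * 1 * x ≤ C * τ * x := by gcongr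
      linarith
    linarith
  have h3 : 0 ≤ 1 / P + E := by positivity
  calc S ^ 2 ≤ _ := h1
    _ ≤ φ * (τ ^ (d + 1) * ((τ * φ) * (7 * C * τ * x))) := by gcongr
    _ = _ := by ring

set_option maxHeartbeats 1000000 in
theorem exists_twisted_bound (d : ℕ) (hd : 0 < d) : ∃ C κ : ℝ, 1 ≤ C ∧ 0 < κ ∧
    ∀ (f : SL2R → ℂ) (m : ℤ) (n : ℕ) [NeZero n] (a b : (ZMod n)ˣ), InvN 1 f → LipG 1 f →
      |(m : ℝ)| ≤ (n : ℝ) ^ (1 / 2 : ℝ) → (m ≠ 0 ∨ MZ f) →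
      ‖∑ u : (ZMod n)ˣ, ZMod.stdAddChar ((m * a : ZMod n) * (u : ZMod n) ^ d) *
        resF f n (b * (u : ZMod n) ^ d)‖ ≤ C * (n : ℝ) ^ (-κ) * n.totient := by
  obtain ⟨C, hC1, hpair⟩ := exists_pair_bound d hd
  obtain ⟨Q₀, hQ₀⟩ := exists_many_primes
  have hd' : (0 : ℝ) < d := by exact_mod_cast hd
  have hd1 : (1 : ℝ) ≤ d := by exact_mod_cast hd
  set σ : ℝ := 1 / (2800 * d) with hσ
  have hσ0 : 0 < σ := by positivity
  have hdσ : d * σ = 1 / 2800 := by rw [hσ]; field_simp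
  have hσ1 : σ ≤ 1 / 2800 := by nlinarith
  set s : ℝ := σ / 8000 with hs
  have hs0 : 0 < s := by positivity
  set ε : ℝ := s / (2 * (d + 3)) with hε
  have hε0 : 0 < ε := by positivity
  have hε2 : ε * (d + 3) = s / 2 := by rw [hε]; field_simp
  have hε3 : ε ≤ σ / 4 := by nlinarith
  obtain ⟨C₀, hC₀, hdiv⟩ := exists_divisor_bound hε0
  obtain ⟨n₀, hn₀⟩ := Filter.eventually_atTop.1 <|
    (eventually_le_natCast_rpow (Q₀ + 2 : ℝ) hσ0).and <|
    (eventually_le_natCast_rpow (5 * (8 : ℝ) ^ (2 * d)) (s := 1 - 1 / 1400) (by norm_num)).and <|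
    (eventually_le_natCast_rpow (3 * C₀) (s := σ / 2 - ε) (by linarith)).and <|
    eventually_le_natCast_rpow ((8 : ℝ) ^ d + 1) (s := 1 / 2 - 1 / 2800) (by norm_num)
  set K : ℝ := 7 * C * C₀ ^ (d + 3) with hK
  have hK0 : 0 ≤ K := by positivity
  refine ⟨max 1 (max (Real.sqrt K) ((n₀ + 1 : ℝ) ^ (s / 4))), s / 4, le_max_left _ _, by positivity,
    ?_⟩
  intro f m n _ a b hi hf hm hm0
  have hn0 : 0 < n := Nat.pos_of_ne_zero (NeZero.ne n)
  have hN : (0 : ℝ) < n := by exact_mod_cast hn0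
  have hN1 : (1 : ℝ) ≤ n := by exact_mod_cast hn0
  set S := ‖∑ u : (ZMod n)ˣ, ZMod.stdAddChar ((m * a : ZMod n) * (u : ZMod n) ^ d) *
        resF f n (b * (u : ZMod n) ^ d)‖ with hSdef
  by_cases hsmall : n < n₀
  · have hS1 : S ≤ n.totient := by
      refine (norm_sum_le_of_le (n := fun _ => (1 : ℝ)) _ fun u _ => ?_).trans ?_
      · rw [norm_mul, norm_stdAddChar, one_mul]
        exact hf.1 _
      · rw [Finset.sum_const, Finset.card_univ, ZMod.card_units_eq_totient]; simp
    refine hS1.trans ?_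
    have h1 : (1 : ℝ) ≤ max 1 (max (Real.sqrt K) ((n₀ + 1 : ℝ) ^ (s / 4))) * (n : ℝ) ^ (-(s / 4)) := by
      rw [Real.rpow_neg hN.le, ← div_eq_mul_inv, le_div_iff₀ (by positivity), one_mul]
      refine le_trans ?_ ((le_max_right _ _).trans (le_max_right _ _))
      refine Real.rpow_le_rpow hN.le ?_ (by positivity)
      have : (n : ℝ) < n₀ := by exact_mod_cast hsmall
      linarith
    have h2 : (0 : ℝ) ≤ n.totient := by positivity
    nlinarith
  · obtain ⟨e1, e2, e3, e4⟩ := hn₀ n (not_lt.1 hsmall)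
    set Q : ℕ := ⌊(n : ℝ) ^ σ⌋₊ with hQdef
    have hQle : (Q : ℝ) ≤ (n : ℝ) ^ σ := Nat.floor_le (by positivity)
    have hQlt : (n : ℝ) ^ σ < Q + 1 := Nat.lt_floor_add_one _
    have hQ1 : (1 : ℝ) ≤ Q := by linarith [(Nat.cast_nonneg Q₀ : (0 : ℝ) ≤ Q₀)]
    have hQQ₀ : Q₀ ≤ Q := Nat.cast_le.1 (by linarith : (Q₀ : ℝ) ≤ Q)
    have hQ1' : 1 ≤ Q := by exact_mod_cast hQ1
    have hQhalf : (n : ℝ) ^ σ / 2 ≤ Q := by linarith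
    have hpowd : ∀ k : ℕ, (8 * (Q : ℝ)) ^ k ≤ 8 ^ k * (n : ℝ) ^ (k * σ) := by
      intro k
      rw [mul_pow, mul_comm (k : ℝ) σ, Real.rpow_mul hN.le, Real.rpow_natCast]
      gcongr
    have c1 : 5 * (8 * Q : ℝ) ^ (2 * d) ≤ n := by
      have h1 := hpowd (2 * d)
      have h2 : ((2 * d : ℕ) : ℝ) * σ = 1 / 1400 := by push_cast; linarith
      rw [h2] at h1
      have h3 : (n : ℝ) ^ (1 - 1 / 1400 : ℝ) * (n : ℝ) ^ (1 / 1400 : ℝ) = n := by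
        rw [← Real.rpow_add hN]; norm_num
      have h4 : 0 < (n : ℝ) ^ (1 / 1400 : ℝ) := by positivity
      generalize (8 * Q : ℝ) ^ (2 * d) = X at *
      generalize (8 : ℝ) ^ (2 * d) = Y at *
      nlinarith
    have c2 : (|m| : ℤ) * (8 * Q) ^ d < (n : ℤ) := by
      have h1 := hpowd d
      rw [hdσ] at h1
      have : |(m : ℝ)| * (8 * Q) ^ d < n := by
        calc |(m : ℝ)| * (8 * Q) ^ d ≤ (n : ℝ) ^ (1 / 2 : ℝ) * (8 ^ d * (n : ℝ) ^ (1 / 2800 : ℝ)) := by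
              gcongr
          _ < (n : ℝ) ^ (1 / 2 : ℝ) * ((n : ℝ) ^ (1 / 2 - 1 / 2800 : ℝ) * (n : ℝ) ^ (1 / 2800 : ℝ)) := by
              gcongr
              linarith
          _ = n := by rw [← Real.rpow_add hN, ← Real.rpow_add hN]; norm_num
      exact_mod_cast this
    set τ : ℝ := (n.divisors.card : ℝ) with hτ
    have hτ1 : 1 ≤ τ := by
      have : 0 < n.divisors.card := Finset.card_pos.2 ⟨1, by simp [hn0.ne']⟩
      rw [hτ]; exact_mod_cast this
    have hτC : τ ≤ C₀ * (n : ℝ) ^ ε := hdiv n hn0.ne'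
    have c3 : τ ≤ Real.sqrt Q / 2 := by
      have h1 : (n : ℝ) ^ (σ / 2 - ε) * (n : ℝ) ^ ε = (n : ℝ) ^ (σ / 2) := by
        rw [← Real.rpow_add hN]; ring_nf
      have h2 : 3 * τ ≤ (n : ℝ) ^ (σ / 2) := by
        have : 0 < (n : ℝ) ^ ε := by positivity
        nlinarith
      have h3 : (3 * τ) ^ 2 ≤ (n : ℝ) ^ σ := (pow_le_pow_left₀ (by positivity) h2 2).trans_eq (by
        rw [← Real.rpow_mul_natCast hN.le]; norm_num)
      linarith [Real.le_sqrt_of_sq_le (by nlinarith : (2 * τ) ^ 2 ≤ Q)]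
    set P := (((Finset.Ioc Q (8 * Q)).filter Nat.Prime).filter fun q => ¬ q ∣ n) with hPdef
    have hPc : Real.sqrt Q / 2 ≤ P.card := card_primes_not_dvd_ge hn0.ne' (hQ₀ Q hQQ₀) c3
    have hPpos : (0 : ℝ) < P.card := lt_of_lt_of_le (by positivity) hPc
    have main := twisted_sum_sq_le (by linarith : 0 ≤ C) hd hpair hi hf hQ1' c1 m hm0 a b c2 P (by
      intro q hq
      simp only [hPdef, Finset.mem_filter, Finset.mem_Ioc] at hq
      exact ⟨hq.1.2, hq.1.1.1, hq.1.1.2, hq.2⟩)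
    have hQx : (Q : ℝ) ^ (-(1 / 8000) : ℝ) ≤ 2 * (n : ℝ) ^ (-s) := by
      have h1 : (Q : ℝ) ^ (-(1 / 8000) : ℝ) ≤ ((n : ℝ) ^ σ / 2) ^ (-(1 / 8000) : ℝ) :=
        Real.rpow_le_rpow_of_nonpos (by positivity) hQhalf (by norm_num)
      refine h1.trans ?_
      rw [Real.div_rpow (by positivity) (by norm_num), ← Real.rpow_mul hN.le,
        show σ * -(1 / 8000) = -s by rw [hs]; ring, div_eq_mul_inv, ← Real.rpow_neg (by norm_num),
        mul_comm]
      refine mul_le_mul_of_nonneg_right ?_ (by positivity)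
      calc (2 : ℝ) ^ (- -(1 / 8000) : ℝ) ≤ 2 ^ (1 : ℝ) :=
            Real.rpow_le_rpow_of_exponent_le (by norm_num) (by norm_num)
        _ = 2 := by norm_num
    have hP4 : 1 / (P.card : ℝ) ≤ 4 * (n : ℝ) ^ (-s) := by
      have h1 : 1 / (P.card : ℝ) ≤ 2 * (Q : ℝ) ^ (-(1 / 2) : ℝ) := by
        rw [Real.rpow_neg (by positivity), ← Real.sqrt_eq_rpow]
        exact (one_div_le_one_div_of_le (by positivity) hPc).trans_eq (by field_simp)
      have h2 : (Q : ℝ) ^ (-(1 / 2) : ℝ) ≤ (Q : ℝ) ^ (-(1 / 8000) : ℝ) :=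
        Real.rpow_le_rpow_of_exponent_le hQ1 (by norm_num)
      linarith
    have hE2 : (Q : ℝ) ^ (14 * d) * (n : ℝ) ^ (-(1 / 80) : ℝ) ≤ (n : ℝ) ^ (-s) := by
      have h1 : (Q : ℝ) ^ (14 * d) ≤ (n : ℝ) ^ (1 / 200 : ℝ) := by
        have : (1 / 200 : ℝ) = σ * ((14 * d : ℕ) : ℝ) := by push_cast; linarith
        rw [this, Real.rpow_mul hN.le, Real.rpow_natCast]
        gcongr
      calc (Q : ℝ) ^ (14 * d) * (n : ℝ) ^ (-(1 / 80) : ℝ) ≤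
            (n : ℝ) ^ (1 / 200 : ℝ) * (n : ℝ) ^ (-(1 / 80) : ℝ) :=
            mul_le_mul_of_nonneg_right h1 (by positivity)
        _ = (n : ℝ) ^ (1 / 200 + -(1 / 80) : ℝ) := (Real.rpow_add hN _ _).symm
        _ ≤ _ := Real.rpow_le_rpow_of_exponent_le hN1 (by rw [hs]; linarith)
    have hnτ : (n : ℝ) ≤ τ * n.totient := by
      rw [hτ]; exact_mod_cast le_card_divisors_mul_totient n
    have hfin := le_of_amplified (C := C) (x := (n : ℝ) ^ (-s)) d hPpos (by positivity)
      hτ1 hC1 (by positivity) hnτ (by positivity) main hP4 (by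
        rw [mul_assoc C ((Q : ℝ) ^ (14 * d))]
        exact add_le_add (mul_le_mul_of_nonneg_left hQx (by positivity))
          (mul_le_mul_of_nonneg_left hE2 (by positivity)))
    have h1 : 7 * C * τ ^ (d + 3) * (n : ℝ) ^ (-s) ≤ K * (n : ℝ) ^ (-(s / 2)) := by
      have h2 : τ ^ (d + 3) ≤ C₀ ^ (d + 3) * (n : ℝ) ^ (s / 2) := by
        have : (n : ℝ) ^ (s / 2) = ((n : ℝ) ^ ε) ^ (d + 3) := by
          rw [← Real.rpow_mul_natCast hN.le, ← hε2]; norm_cast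
        rw [this, ← mul_pow]
        exact pow_le_pow_left₀ (by positivity) hτC _
      have h3 : (n : ℝ) ^ (s / 2) * (n : ℝ) ^ (-s) = (n : ℝ) ^ (-(s / 2)) := by
        rw [← Real.rpow_add hN]; ring_nf
      rw [hK, ← h3]
      exact (mul_le_mul_of_nonneg_right (mul_le_mul_of_nonneg_left h2 (by positivity))
        (by positivity)).trans_eq (by ring)
    have h2 : S ^ 2 ≤ (Real.sqrt K * (n : ℝ) ^ (-(s / 4)) * n.totient) ^ 2 := by
      refine hfin.trans ((mul_le_mul_of_nonneg_left h1 (by positivity)).trans (le_of_eq ?_))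
      rw [mul_pow, mul_pow, Real.sq_sqrt hK0]
      have : ((n : ℝ) ^ (-(s / 4))) ^ 2 = (n : ℝ) ^ (-(s / 2)) := by
        rw [← Real.rpow_mul_natCast hN.le]; congr 1; push_cast; ring
      rw [this]; ring
    have h3 := abs_le_of_sq_le_sq' h2 (by positivity)
    refine h3.2.trans ?_
    refine mul_le_mul_of_nonneg_right (mul_le_mul_of_nonneg_right ?_ (by positivity)) (by positivity)
    exact (le_max_left _ _).trans (le_max_right _ _)

lemma sum_eq_twisted {f : SL2R → ℂ} (hf : InvN 1 f) {n : ℕ} [NeZero n] (d : ℕ) (m : ℤ) {a b : ℕ}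
    (ha : Nat.Coprime a n) (hb : Nat.Coprime b n) :
    ∑ k ∈ (Finset.range n).filter (fun k => Nat.gcd k n = 1),
      eR (m * ((a : ℝ) * (k : ℝ) ^ d / n)) * f (uElt ((b : ℝ) * (k : ℝ) ^ d / n) *
        (aElt (Real.sqrt n))⁻¹) =
    ∑ u : (ZMod n)ˣ, ZMod.stdAddChar ((m * ZMod.unitOfCoprime a ha : ZMod n) * (u : ZMod n) ^ d) *
        resF f n (ZMod.unitOfCoprime b hb * (u : ZMod n) ^ d) := by
  rw [← sum_coprime_eq_units n (fun x => ZMod.stdAddChar ((m * ZMod.unitOfCoprime a ha : ZMod n) *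
    x ^ d) * resF f n (ZMod.unitOfCoprime b hb * x ^ d))]
  refine Finset.sum_congr rfl fun k _ => ?_
  have hn0 : 0 < n := Nat.pos_of_ne_zero (NeZero.ne n)
  have e1 := eR_eq_stdAddChar n (m * a * k ^ d)
  have e2 := resF_natCast hf hn0 (b * k ^ d)
  push_cast at e1 e2 ⊢
  simp only [ZMod.coe_unitOfCoprime]
  rw [← e1, e2, ptg]
  push_cast
  congr 2
  ring

/-! ### Measurable structure -/

lemma measurable_entry (i j : Fin 2) : Measurable fun g : SL2R => g.1 i j :=
  (measurable_pi_apply j).comp ((measurable_pi_apply i).comp measurable_subtype_coe)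

lemma measurable_SL2R {α : Type*} [MeasurableSpace α] {f : α → SL2R}
    (h : ∀ i j, Measurable fun x => (f x).1 i j) : Measurable f :=
  Measurable.subtype_mk (measurable_pi_iff.2 fun i => measurable_pi_iff.2 fun j => h i j)

instance : MeasurableMul₂ SL2R :=
  ⟨measurable_SL2R fun i j => by
    simp only [mul_apply2]
    exact (((measurable_entry i 0).comp measurable_fst).mul
      ((measurable_entry 0 j).comp measurable_snd)).add
      (((measurable_entry i 1).comp measurable_fst).mul ((measurable_entry 1 j).comp measurable_snd))⟩

instance : MeasurableInv SL2R :=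
  ⟨measurable_SL2R fun i j => by
    fin_cases i <;> fin_cases j <;> simp only [Fin.zero_eta, Fin.mk_one, inv_00, inv_01, inv_10, inv_11]
    · exact measurable_entry _ _
    · exact (measurable_entry _ _).neg
    · exact (measurable_entry _ _).neg
    · exact measurable_entry _ _⟩

instance : BorelSpace SL2R := by
  have h : BorelSpace (Fin 2 → Fin 2 → ℝ) := inferInstance
  exact @Subtype.borelSpace (Fin 2 → Fin 2 → ℝ) _ _ h {A | Matrix.det (A : Matrix (Fin 2) (Fin 2) ℝ) = 1}

/-! ### A Haar measure in coordinates -/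

/-- The point with coordinates `(w₁, w₂, Y)`. -/
def gpt (p : (ℝ × ℝ) × ℝ) : SL2R := gp p.1.1 p.1.2 p.2

lemma measurable_gpt : Measurable gpt := by
  refine measurable_SL2R fun i j => ?_
  have hs : MeasurableSet {p : (ℝ × ℝ) × ℝ | p.1.1 = 0} :=
    measurableSet_eq_fun (by fun_prop) (by fun_prop)
  have : (fun p => (gpt p).1 i j) = fun p : (ℝ × ℝ) × ℝ => if p.1.1 = 0 then (1 : SL2R).1 i j else
      (!![p.2 * p.1.1, p.2 * p.1.2 - p.1.1⁻¹; p.1.1, p.1.2] : Matrix (Fin 2) (Fin 2) ℝ) i j := by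
    funext p
    by_cases h : p.1.1 = 0
    · rw [if_pos h, gpt, gp, dif_pos h]
    · rw [if_neg h, gpt, gp, dif_neg h]; rfl
  rw [this]
  refine Measurable.ite hs measurable_const ?_
  fin_cases i <;> fin_cases j <;> simp <;> fun_prop

/-- The Haar measure on `SL₂(ℝ)` in the coordinates `gpt`. -/
def haarG : Measure SL2R := Measure.map gpt volume

lemma lintegral_haarG {ψ : SL2R → ENNReal} (h : Measurable ψ) :
    ∫⁻ g, ψ g ∂haarG = ∫⁻ p : (ℝ × ℝ) × ℝ, ψ (gpt p) :=
  lintegral_map h measurable_gpt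

lemma ae_fst_ne_zero : ∀ᵐ p : (ℝ × ℝ) × ℝ, p.1.1 ≠ 0 := by
  have h : ∀ᵐ x : ℝ, x ≠ 0 := by
    rw [ae_iff]; simp
  exact (Measure.quasiMeasurePreserving_fst (μ := (volume : Measure (ℝ × ℝ))) (ν := volume)).ae
    ((Measure.quasiMeasurePreserving_fst (μ := (volume : Measure ℝ)) (ν := volume)).ae h)

lemma measurePreserving_shear_snd (t : ℝ) :
    MeasurePreserving (fun p : ℝ × ℝ => (p.1, p.2 + t * p.1)) :=
  (MeasurePreserving.id volume).skew_product (g := fun a b => b + t * a) (by fun_prop)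
    (Filter.Eventually.of_forall fun a => map_add_right_eq_self volume (t * a))

lemma measurePreserving_shear_fst (t : ℝ) :
    MeasurePreserving (fun p : ℝ × ℝ => (p.1 + t * p.2, p.2)) := by
  have h := (Measure.measurePreserving_swap (μ := (volume : Measure ℝ)) (ν := volume)).comp
    ((measurePreserving_shear_snd t).comp
    (Measure.measurePreserving_swap (μ := (volume : Measure ℝ)) (ν := volume)))
  exact h

lemma measurePreserving_shear_Y {f : ℝ × ℝ → ℝ × ℝ} (hf : MeasurePreserving f) {φ : ℝ × ℝ → ℝ}
    (hφ : Measurable φ) :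
    MeasurePreserving (fun p : (ℝ × ℝ) × ℝ => (f p.1, p.2 + φ p.1)) :=
  hf.skew_product (g := fun a b => b + φ a) (by fun_prop)
    (Filter.Eventually.of_forall fun a => map_add_right_eq_self volume (φ a))

lemma map_haarG_of {h : SL2R} {F : (ℝ × ℝ) × ℝ → (ℝ × ℝ) × ℝ} (hF : MeasurePreserving F)
    (hg : ∀ᵐ p, gpt p * h = gpt (F p)) : haarG.map (· * h) = haarG := by
  rw [haarG, Measure.map_map (measurable_mul_const h) measurable_gpt]
  have : ((fun g => g * h) ∘ gpt) =ᵐ[volume] gpt ∘ F := hg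
  rw [Measure.map_congr this, ← Measure.map_map measurable_gpt hF.measurable, hF.map_eq]

lemma map_haarG_u (t : ℝ) : haarG.map (· * uElt t) = haarG := by
  refine map_haarG_of (measurePreserving_shear_Y (measurePreserving_shear_snd t)
    (φ := fun _ => 0) measurable_const) ?_
  filter_upwards [ae_fst_ne_zero] with p hp
  apply SL2R_ext <;> simp only [gpt, mul_apply2, gp_00 hp, gp_01 hp, gp_10 hp, gp_11 hp, u_00, u_01,
    u_10, u_11] <;> ring

lemma map_haarG_v (t : ℝ) : haarG.map (· * vElt t) = haarG := by
  have hm := measurePreserving_shear_Y (measurePreserving_shear_fst t)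
    (φ := fun w => -(t / (w.1 * (w.1 + t * w.2)))) (by fun_prop)
  refine map_haarG_of hm ?_
  filter_upwards [ae_fst_ne_zero, hm.quasiMeasurePreserving.ae ae_fst_ne_zero] with p hp hp'
  apply SL2R_ext <;> simp only [gpt, mul_apply2, gp_00 hp, gp_01 hp, gp_10 hp, gp_11 hp, gp_00 hp',
    gp_01 hp', gp_10 hp', gp_11 hp', v_00, v_01, v_10, v_11] <;>
    generalize hD : p.1.1 + t * p.1.2 = D at hp' <;> field_simp <;> (try rw [← hD]) <;> ring

lemma eq_uvu (k : SL2R) (h : k.1 1 0 ≠ 0) :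
    k = uElt ((k.1 0 0 - 1) / k.1 1 0) * vElt (k.1 1 0) * uElt ((k.1 1 1 - 1) / k.1 1 0) := by
  have hd := SL2R_det k
  apply SL2R_ext <;> simp only [mul_apply2, v_00, v_01, v_10, v_11, u_00, u_01, u_10, u_11] <;>
    field_simp <;> first | ring1 | linear_combination -hd

lemma map_haarG_mul {h k : SL2R} (hh : haarG.map (· * h) = haarG) (hk : haarG.map (· * k) = haarG) :
    haarG.map (· * (h * k)) = haarG := by
  have := Measure.map_map (μ := haarG) (measurable_mul_const k) (measurable_mul_const h)
  rw [hh, hk] at this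
  have e : (fun g => g * (h * k)) = (fun x => x * k) ∘ fun x => x * h := by
    funext g; simp [mul_assoc]
  rw [e, ← this]

instance : haarG.IsMulRightInvariant := by
  have key : ∀ k : SL2R, k.1 1 0 ≠ 0 → haarG.map (· * k) = haarG := fun k hk => by
    rw [eq_uvu k hk]
    exact map_haarG_mul (map_haarG_mul (map_haarG_u _) (map_haarG_v _)) (map_haarG_u _)
  refine ⟨fun k => ?_⟩
  by_cases hk : k.1 1 0 = 0
  · have e : k = (k * vElt 1) * vElt (-1) := by
      rw [mul_assoc]
      have : vElt 1 * vElt (-1) = 1 := by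
        apply SL2R_ext <;> rw [mul_apply2] <;> simp only [v_00, v_01, v_10, v_11] <;> simp
      rw [this, mul_one]
    rw [e]
    refine map_haarG_mul (key _ ?_) (map_haarG_v _)
    have hd := SL2R_det k
    rw [mul_apply2, v_00, v_10, hk]
    intro h0
    rw [hk] at hd
    have : k.1 1 1 = 0 := by linarith
    rw [this] at hd; simp at hd
  · exact key k hk

instance : SigmaFinite haarG := by
  refine ⟨⟨⟨fun k => {g | |g.1 1 0| ≤ k ∧ |g.1 1 1| ≤ k ∧ |g.1 0 0 / g.1 1 0| ≤ k}, fun _ => trivial,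
    fun k => ?_, ?_⟩⟩⟩
  · have hm : MeasurableSet {g : SL2R | |g.1 1 0| ≤ k ∧ |g.1 1 1| ≤ k ∧ |g.1 0 0 / g.1 1 0| ≤ k} := by
      have h1 := measurable_entry 1 0
      have h2 := measurable_entry 1 1
      have h3 := measurable_entry 0 0
      exact (measurableSet_le (continuous_abs.measurable.comp h1) measurable_const).inter
        ((measurableSet_le (continuous_abs.measurable.comp h2) measurable_const).inter
          (measurableSet_le (continuous_abs.measurable.comp (h3.div h1)) measurable_const))
    rw [haarG, Measure.map_apply measurable_gpt hm]
    have hfin : volume ((Set.Icc (-(k : ℝ)) k ×ˢ Set.Icc (-(k : ℝ)) k) ×ˢ Set.Icc (-(k : ℝ)) k) < ⊤ := by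
      exact ((isCompact_Icc.prod isCompact_Icc).prod isCompact_Icc).measure_lt_top
    refine lt_of_le_of_lt (measure_mono_ae ?_) hfin
    filter_upwards [ae_fst_ne_zero] with p hp hmem
    obtain ⟨h1, h2, h3⟩ := hmem
    rw [gpt, gp_10 hp] at h1
    rw [gpt, gp_11 hp] at h2
    rw [gpt, gp_10 hp, gp_00 hp, mul_div_cancel_right₀ _ hp] at h3
    exact ⟨⟨abs_le.1 h1, abs_le.1 h2⟩, abs_le.1 h3⟩
  · refine Set.eq_univ_of_forall fun g => ?_
    obtain ⟨k, hk⟩ := exists_nat_ge (max |g.1 1 0| (max |g.1 1 1| |g.1 0 0 / g.1 1 0|))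
    exact Set.mem_iUnion.2 ⟨k, (le_max_left _ _).trans hk,
      (le_max_left _ _).trans ((le_max_right _ _).trans hk),
      (le_max_right _ _).trans ((le_max_right _ _).trans hk)⟩

instance : Countable (Matrix.SpecialLinearGroup (Fin 2) ℤ) := by
  have : Countable (Matrix (Fin 2) (Fin 2) ℤ) := inferInstanceAs (Countable (Fin 2 → Fin 2 → ℤ))
  exact Subtype.countable

/-! ### Folding over `SL₂(ℤ)` -/

lemma out_XProj (g : SL2R) : ∃ γ, (XProj Γℤ g).out = zSL γ * g := by
  have h : (QuotientGroup.rightRel Γℤ) (XProj Γℤ g).out g := Quotient.exact (Quotient.out_eq _)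
  obtain ⟨γ, hγ⟩ := QuotientGroup.rightRel_apply.1 h
  refine ⟨γ⁻¹, ?_⟩
  rw [zSL_inv, show zSL γ = g * ((XProj Γℤ g).out)⁻¹ from hγ]
  group

lemma XProj_out (x : XQuot Γℤ) : XProj Γℤ x.out = x := Quotient.out_eq x

lemma XProj_zSL_mul (γ : Matrix.SpecialLinearGroup (Fin 2) ℤ) (g : SL2R) :
    XProj Γℤ (zSL γ * g) = XProj Γℤ g :=
  Quotient.sound (QuotientGroup.rightRel_apply.2 (by
    rw [_root_.mul_inv_rev, ← mul_assoc, mul_inv_cancel, one_mul]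
    exact Γℤ.inv_mem (zSL_mem γ)))

/-- The sum of `ψ` over an `SL₂(ℤ)`-orbit. -/
def perG (ψ : SL2R → ENNReal) (g : SL2R) : ENNReal :=
  ∑' γ : Matrix.SpecialLinearGroup (Fin 2) ℤ, ψ (zSL γ * g)

lemma perG_zSL_mul (ψ : SL2R → ENNReal) (γ : Matrix.SpecialLinearGroup (Fin 2) ℤ) (g : SL2R) :
    perG ψ (zSL γ * g) = perG ψ g := by
  rw [perG, perG, ← (Equiv.mulRight γ).tsum_eq (fun δ => ψ (zSL δ * g))]
  simp only [Equiv.coe_mulRight, zSL_mul, mul_assoc]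

lemma perG_out (ψ : SL2R → ENNReal) (g : SL2R) : perG ψ (XProj Γℤ g).out = perG ψ g := by
  obtain ⟨γ, h⟩ := out_XProj g
  rw [h, perG_zSL_mul]

lemma measurable_perG {ψ : SL2R → ENNReal} (h : Measurable ψ) : Measurable (perG ψ) :=
  Measurable.tsum fun γ => h.comp (measurable_const_mul _)

lemma measurable_XProj : Measurable (XProj Γℤ) := measurable_quotient_mk''

lemma measurable_of_comp_XProj {β : Type*} [MeasurableSpace β] {f : XQuot Γℤ → β}
    (h : Measurable fun g => f (XProj Γℤ g)) : Measurable f :=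
  measurable_from_quotient.2 h

lemma measurable_perG_out {ψ : SL2R → ENNReal} (h : Measurable ψ) :
    Measurable fun x : XQuot Γℤ => perG ψ x.out :=
  measurable_of_comp_XProj (by simpa only [perG_out] using measurable_perG h)

lemma measurable_rightT (g : SL2R) : Measurable (rightT Γℤ g) :=
  measurable_of_comp_XProj (measurable_XProj.comp (measurable_mul_const g))

/-- The counting measure on an `SL₂(ℤ)`-orbit. -/
def orbitMeasure (x : XQuot Γℤ) : Measure SL2R :=
  Measure.sum fun γ : Matrix.SpecialLinearGroup (Fin 2) ℤ => Measure.dirac (zSL γ * x.out)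

lemma lintegral_orbitMeasure {ψ : SL2R → ENNReal} (h : Measurable ψ) (x : XQuot Γℤ) :
    ∫⁻ g, ψ g ∂orbitMeasure x = perG ψ x.out := by
  rw [orbitMeasure, lintegral_sum_measure, perG]
  exact tsum_congr fun γ => lintegral_dirac' _ h

lemma measurable_orbitMeasure : Measurable orbitMeasure := by
  refine Measure.measurable_of_measurable_coe _ fun s hs => ?_
  have : (fun x => orbitMeasure x s) = fun x => perG (s.indicator 1) x.out := by
    funext x
    rw [← lintegral_orbitMeasure (measurable_one.indicator hs), lintegral_indicator_one hs]
  rw [this]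
  exact measurable_perG_out (measurable_one.indicator hs)

/-- The lift of a measure from `SL₂(ℤ)\SL₂(ℝ)` to `SL₂(ℝ)`. -/
def liftMeas (μX : Measure (XQuot Γℤ)) : Measure SL2R := μX.bind orbitMeasure

lemma lintegral_liftMeas (μX : Measure (XQuot Γℤ)) {ψ : SL2R → ENNReal} (h : Measurable ψ) :
    ∫⁻ g, ψ g ∂liftMeas μX = ∫⁻ x, perG ψ x.out ∂μX := by
  rw [liftMeas, Measure.lintegral_bind measurable_orbitMeasure.aemeasurable h.aemeasurable]
  simp only [lintegral_orbitMeasure h]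

lemma isMulRightInvariant_liftMeas {μX : Measure (XQuot Γℤ)}
    (hμ : ∀ g : SL2R, Measure.map (rightT Γℤ g) μX = μX) : (liftMeas μX).IsMulRightInvariant := by
  refine ⟨fun h => Measure.ext_of_lintegral _ fun ψ hψ => ?_⟩
  have e := lintegral_liftMeas μX (ψ := fun a => ψ (a * h)) (hψ.comp (measurable_mul_const h))
  rw [lintegral_map hψ (measurable_mul_const h), e, lintegral_liftMeas _ hψ]
  conv_rhs => rw [← hμ h, lintegral_map (measurable_perG_out hψ) (measurable_rightT h)]
  refine lintegral_congr fun x => ?_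
  have : rightT Γℤ h x = XProj Γℤ (x.out * h) := by
    conv_lhs => rw [← XProj_out x]
    rfl
  rw [this, perG_out, perG, perG]
  simp only [mul_assoc]

/-- The set of group elements of size at most `R`. -/
def ballG (R : ℝ) : Set SL2R := {g | matSup g.1 ≤ R}

lemma measurableSet_ballG (R : ℝ) : MeasurableSet (ballG R) := by
  have : ballG R = {g | |g.1 0 0| ≤ R} ∩ {g | |g.1 0 1| ≤ R} ∩ ({g | |g.1 1 0| ≤ R} ∩
      {g | |g.1 1 1| ≤ R}) := by
    ext g; simp only [ballG, Set.mem_ofPred_eq, matSup_le_iff, Set.mem_inter_iff]; tauto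
  rw [this]
  have h : ∀ i j, MeasurableSet {g : SL2R | |g.1 i j| ≤ R} := fun i j =>
    measurableSet_le (continuous_abs.measurable.comp (measurable_entry i j)) measurable_const
  exact ((h _ _).inter (h _ _)).inter ((h _ _).inter (h _ _))

lemma perG_ballG_le {R : ℝ} (hR : 0 ≤ R) (g : SL2R) :
    perG ((ballG R).indicator 1) g ≤ ENNReal.ofReal ((4 * R ^ 2 + 3) ^ 4) := by
  by_cases h : ∃ γ₀, zSL γ₀ * g ∈ ballG R
  · obtain ⟨γ₀, h₀⟩ := h
    rw [← perG_zSL_mul _ γ₀, perG]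
    set Z : ℕ := ⌈2 * R ^ 2⌉₊ with hZ
    set e : Matrix.SpecialLinearGroup (Fin 2) ℤ → (ℤ × ℤ) × (ℤ × ℤ) :=
      fun γ => ((γ.1 0 0, γ.1 0 1), (γ.1 1 0, γ.1 1 1)) with he
    have hinj : Function.Injective e := by
      intro γ δ hγ
      simp only [he, Prod.mk.injEq] at hγ
      ext i j
      fin_cases i <;> fin_cases j
      · exact hγ.1.1
      · exact hγ.1.2
      · exact hγ.2.1
      · exact hγ.2.2
    set I : Finset ℤ := Finset.Icc (-(Z : ℤ)) Z with hI
    set J : Finset ((ℤ × ℤ) × (ℤ × ℤ)) := (I ×ˢ I) ×ˢ (I ×ˢ I) with hJ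
    have h1 : ∀ γ, (ballG R).indicator (1 : SL2R → ENNReal) (zSL γ * (zSL γ₀ * g)) ≤
        (J : Set ((ℤ × ℤ) × (ℤ × ℤ))).indicator 1 (e γ) := by
      intro γ
      by_cases hγ : zSL γ * (zSL γ₀ * g) ∈ ballG R
      · have hm : matSup (zSL γ).1 ≤ Z := by
          have : zSL γ = (zSL γ * (zSL γ₀ * g)) * (zSL γ₀ * g)⁻¹ := by group
          rw [this, Matrix.SpecialLinearGroup.coe_mul]
          refine (matSup_mul_le _ _).trans (le_trans ?_ (Nat.le_ceil _))
          rw [matSup_inv]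
          have a1 : matSup (zSL γ * (zSL γ₀ * g)).1 ≤ R := hγ
          have a2 : matSup (zSL γ₀ * g).1 ≤ R := h₀
          have := matSup_nonneg (zSL γ₀ * g).1
          have := matSup_nonneg (zSL γ * (zSL γ₀ * g)).1
          nlinarith
        rw [matSup_le_iff] at hm
        simp only [zSL_apply] at hm
        have hmem : ∀ z : ℤ, |(z : ℝ)| ≤ Z → z ∈ I := by
          intro z hz
          rw [hI, Finset.mem_Icc, ← abs_le]
          exact_mod_cast hz
        have : e γ ∈ (J : Set ((ℤ × ℤ) × (ℤ × ℤ))) := by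
          simp only [hJ, Finset.coe_product, Set.mem_prod, Finset.mem_coe, he]
          exact ⟨⟨hmem _ hm.1, hmem _ hm.2.1⟩, hmem _ hm.2.2.1, hmem _ hm.2.2.2⟩
        rw [Set.indicator_of_mem hγ, Set.indicator_of_mem this]; rfl
      · rw [Set.indicator_of_notMem hγ]; exact zero_le
    refine (ENNReal.tsum_le_tsum h1).trans ((ENNReal.tsum_comp_le_tsum_of_injective hinj _).trans ?_)
    rw [tsum_eq_sum (s := J) fun b hb => Set.indicator_of_notMem (by simpa using hb) _]
    rw [Finset.sum_congr rfl fun b hb => Set.indicator_of_mem (show b ∈ (J : Set _) from hb) _]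
    simp only [Pi.one_apply, Finset.sum_const, nsmul_eq_mul, mul_one]
    have hc : (J.card : ℝ) ≤ (4 * R ^ 2 + 3) ^ 4 := by
      have : J.card = (2 * Z + 1) ^ 4 := by
        simp only [hJ, hI, Finset.card_product, Int.card_Icc]
        have : ((Z : ℤ) + 1 - -(Z : ℤ)).toNat = 2 * Z + 1 := by omega
        rw [this]; ring
      rw [this]
      push_cast
      have : (Z : ℝ) < 2 * R ^ 2 + 1 := Nat.ceil_lt_add_one (by positivity)
      refine pow_le_pow_left₀ (by positivity) (by linarith) 4
    rw [← ENNReal.ofReal_natCast]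
    exact ENNReal.ofReal_le_ofReal hc
  · push Not at h
    rw [perG, ENNReal.tsum_eq_zero.2 fun γ => Set.indicator_of_notMem (h γ) _]
    exact zero_le

lemma liftMeas_ballG_lt_top (μX : Measure (XQuot Γℤ)) [IsProbabilityMeasure μX] {R : ℝ} (hR : 0 ≤ R) :
    liftMeas μX (ballG R) < ⊤ := by
  rw [← lintegral_indicator_one (measurableSet_ballG R),
    lintegral_liftMeas _ (measurable_one.indicator (measurableSet_ballG R))]
  refine lt_of_le_of_lt (lintegral_mono fun x => perG_ballG_le hR x.out) ?_
  rw [lintegral_const, measure_univ, mul_one]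
  exact ENNReal.ofReal_lt_top

lemma sigmaFinite_liftMeas (μX : Measure (XQuot Γℤ)) [IsProbabilityMeasure μX] :
    SigmaFinite (liftMeas μX) := by
  refine ⟨⟨⟨fun k => ballG k, fun _ => trivial, fun k => liftMeas_ballG_lt_top μX k.cast_nonneg, ?_⟩⟩⟩
  refine Set.eq_univ_of_forall fun g => ?_
  obtain ⟨k, hk⟩ := exists_nat_ge (matSup g.1)
  exact Set.mem_iUnion.2 ⟨k, hk⟩

/-- A coordinate box of Haar measure one. -/
lemma exists_unit_box : ∃ s : Set SL2R, MeasurableSet s ∧ haarG s = 1 ∧ s ⊆ ballG 4 := by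
  refine ⟨{g | g.1 1 0 ∈ Set.Icc (1 : ℝ) 2 ∧ g.1 1 1 ∈ Set.Icc (0 : ℝ) 1 ∧
    g.1 0 0 / g.1 1 0 ∈ Set.Icc (0 : ℝ) 1}, ?_, ?_, ?_⟩
  · have h1 := measurable_entry 1 0
    have h2 := measurable_entry 1 1
    have h3 := measurable_entry 0 0
    exact (h1 measurableSet_Icc).inter ((h2 measurableSet_Icc).inter ((h3.div h1) measurableSet_Icc))
  · rw [haarG, Measure.map_apply measurable_gpt]
    · have : volume ((Set.Icc (1 : ℝ) 2 ×ˢ Set.Icc (0 : ℝ) 1) ×ˢ Set.Icc (0 : ℝ) 1) = 1 := by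
        rw [Measure.volume_eq_prod, Measure.prod_prod, Measure.volume_eq_prod, Measure.prod_prod]
        simp only [Real.volume_Icc]
        norm_num
      rw [← this]
      refine measure_congr ?_
      filter_upwards [ae_fst_ne_zero] with p hp
      refine propext ?_
      change ((gpt p).1 1 0 ∈ _ ∧ (gpt p).1 1 1 ∈ _ ∧ (gpt p).1 0 0 / (gpt p).1 1 0 ∈ _) ↔ _
      rw [gpt, gp_10 hp, gp_11 hp, gp_00 hp, mul_div_cancel_right₀ _ hp]
      exact ⟨fun h => ⟨⟨h.1, h.2.1⟩, h.2.2⟩, fun h => ⟨h.1.1, h.1.2, h.2⟩⟩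
    · have h1 := measurable_entry 1 0
      have h2 := measurable_entry 1 1
      have h3 := measurable_entry 0 0
      exact (h1 measurableSet_Icc).inter
        ((h2 measurableSet_Icc).inter ((h3.div h1) measurableSet_Icc))
  · rintro g ⟨h1, h2, h3⟩
    have h0 : g.1 1 0 ≠ 0 := by have := h1.1; positivity
    have e := eq_gp g h0
    set w₁ := g.1 1 0
    set w₂ := g.1 1 1
    set Y := g.1 0 0 / w₁
    have hw : 0 < w₁ := by linarith [h1.1]
    have hi : w₁⁻¹ ≤ 1 := inv_le_one_of_one_le₀ h1.1
    have hi0 : 0 < w₁⁻¹ := by positivity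
    rw [ballG, Set.mem_ofPred_eq, matSup_le_iff, e, gp_00 h0, gp_01 h0, gp_10 h0, gp_11 h0]
    obtain ⟨a1, a2⟩ := h1
    obtain ⟨b1, b2⟩ := h2
    obtain ⟨c1, c2⟩ := h3
    refine ⟨abs_le.2 ⟨by nlinarith, by nlinarith⟩, abs_le.2 ⟨by nlinarith, by nlinarith⟩,
      abs_le.2 ⟨by linarith, by linarith⟩, abs_le.2 ⟨by linarith, by linarith⟩⟩

lemma exists_liftMeas_eq_smul {μX : Measure (XQuot Γℤ)} [IsProbabilityMeasure μX]
    (hμ : ∀ g : SL2R, Measure.map (rightT Γℤ g) μX = μX) :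
    ∃ c : ENNReal, c ≠ ⊤ ∧ liftMeas μX = c • haarG := by
  obtain ⟨s, hs, h1, hb⟩ := exists_unit_box
  have i1 := isMulRightInvariant_liftMeas hμ
  have i2 := sigmaFinite_liftMeas μX
  have i3 : SigmaFinite (liftMeas μX).inv := (MeasurableEquiv.inv SL2R).sigmaFinite_map
  have i4 : SigmaFinite haarG.inv := (MeasurableEquiv.inv SL2R).sigmaFinite_map
  have hs' : haarG.inv s⁻¹ = 1 := by rw [Measure.inv_apply, inv_inv, h1]
  have key := measure_eq_div_smul (liftMeas μX).inv haarG.inv (s := s⁻¹) (by rw [hs']; simp)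
    (by rw [hs']; simp)
  rw [hs', div_one, Measure.inv_apply, inv_inv] at key
  refine ⟨liftMeas μX s, ((measure_mono hb).trans_lt (liftMeas_ballG_lt_top μX (by norm_num))).ne, ?_⟩
  have e1 : (liftMeas μX).inv.inv = liftMeas μX := (liftMeas μX).inv_inv
  have e2 : haarG.inv.inv = haarG := haarG.inv_inv
  conv_lhs => rw [← e1, key]
  conv_rhs => rw [← e2]
  exact Measure.map_smul _ _ _

/-! ### Unfolding the invariant measure -/

/-- The horocyclic coordinate of a group element. -/
def yG (g : SL2R) : ℝ := g.1 0 0 / g.1 1 0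

lemma yG_u_mul {g : SL2R} (h : g.1 1 0 ≠ 0) (t : ℝ) : yG (uElt t * g) = yG g + t := by
  simp only [yG, mul_apply2, u_00, u_01, u_10, u_11]
  rw [div_add' _ _ _ h]; ring

lemma measurable_yG : Measurable yG := (measurable_entry 0 0).div (measurable_entry 1 0)

lemma zU_mul_row (k : ℤ) (γ : Matrix.SpecialLinearGroup (Fin 2) ℤ) (j : Fin 2) :
    (zU k * γ).1 1 j = γ.1 1 j := by
  rw [Matrix.SpecialLinearGroup.coe_mul, Matrix.mul_apply, Fin.sum_univ_two]
  simp [zU]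

lemma eq_zU_mul {γ δ : Matrix.SpecialLinearGroup (Fin 2) ℤ} (h0 : γ.1 1 0 = δ.1 1 0)
    (h1 : γ.1 1 1 = δ.1 1 1) : ∃ k, γ = zU k * δ := by
  have a := γ.2; have b := δ.2
  rw [Matrix.det_fin_two] at a b
  rw [h0, h1] at a
  refine ⟨γ.1 0 1 * δ.1 0 0 - γ.1 0 0 * δ.1 0 1, ?_⟩
  have e : (zU (γ.1 0 1 * δ.1 0 0 - γ.1 0 0 * δ.1 0 1)).1 = !![1, γ.1 0 1 * δ.1 0 0 - γ.1 0 0 * δ.1 0 1; 0, 1] := rfl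
  apply Matrix.SpecialLinearGroup.ext
  intro i j
  rw [Matrix.SpecialLinearGroup.coe_mul, Matrix.mul_apply, Fin.sum_univ_two, e]
  fin_cases i <;> fin_cases j <;> simp [h0, h1]
  · linear_combination (-(γ.1 0 0)) * b + δ.1 0 0 * a
  · linear_combination (-(γ.1 0 1)) * b + δ.1 0 1 * a

/-- The weight `rho` cut off to the strip `0 ≤ yG < 1`. -/
def cutG (g : SL2R) : ENNReal := if yG g ∈ Set.Ico (0 : ℝ) 1 then ENNReal.ofReal (rho g) else 0

lemma summable_latTerm_div (g : SL2R) : Summable fun v => latTerm g v / latSum g :=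
  (summable_latTerm g).div_const _

lemma perG_cutG {g : SL2R} (hg : ∀ γ, (zSL γ * g).1 1 0 ≠ 0) : perG cutG g = 1 := by
  set S : Set (Matrix.SpecialLinearGroup (Fin 2) ℤ) := {γ | yG (zSL γ * g) ∈ Set.Ico (0 : ℝ) 1}
    with hS
  set T : Set (ℤ × ℤ) := {v | IsCoprime v.1 v.2} with hT
  set h : ℤ × ℤ → ENNReal := fun v => ENNReal.ofReal (latTerm g v / latSum g) with hh
  have hshift : ∀ k γ, yG (zSL (zU k * γ) * g) = yG (zSL γ * g) + k := by
    intro k γ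
    rw [zSL_mul, zSL_zU, mul_assoc, yG_u_mul (hg γ)]
  have hcop : ∀ γ : Matrix.SpecialLinearGroup (Fin 2) ℤ, (γ.1 1 0, γ.1 1 1) ∈ T := by
    intro γ
    have a := γ.2
    rw [Matrix.det_fin_two] at a
    exact ⟨-γ.1 0 1, γ.1 0 0, by linear_combination a⟩
  set φ : S → T := fun γ => ⟨(γ.1.1 1 0, γ.1.1 1 1), hcop γ⟩ with hφ
  have hbij : Function.Bijective φ := by
    constructor
    · rintro ⟨γ, hγ⟩ ⟨δ, hδ⟩ e
      simp only [hφ, Subtype.mk.injEq, Prod.mk.injEq] at e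
      obtain ⟨k, rfl⟩ := eq_zU_mul e.1 e.2
      rw [hS, Set.mem_ofPred_eq, hshift] at hγ
      have a1 : (k : ℝ) < 1 := by linarith [hγ.2, hδ.1]
      have a2 : (-1 : ℝ) < k := by linarith [hγ.1, hδ.2]
      have : k = 0 := by
        have b1 : k < 1 := by exact_mod_cast a1
        have b2 : -1 < k := by exact_mod_cast a2
        omega
      subst this
      simp only [Subtype.mk.injEq]
      have : zU 0 = 1 := by
        apply Matrix.SpecialLinearGroup.ext; intro i j; fin_cases i <;> fin_cases j <;> rfl
      rw [this, one_mul]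
    · rintro ⟨⟨v₁, v₂⟩, a, b, hab⟩
      simp only at hab
      set γ₀ : Matrix.SpecialLinearGroup (Fin 2) ℤ := ⟨!![b, -a; v₁, v₂], by
        rw [Matrix.det_fin_two_of]; linear_combination hab⟩ with hγ₀
      refine ⟨⟨zU (-⌊yG (zSL γ₀ * g)⌋) * γ₀, ?_⟩, ?_⟩
      · rw [hS, Set.mem_ofPred_eq, hshift]
        push_cast
        exact ⟨by linarith [Int.floor_le (yG (zSL γ₀ * g))],
          by linarith [Int.lt_floor_add_one (yG (zSL γ₀ * g))]⟩
      · simp only [hφ, zU_mul_row]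
        rfl
  have e1 : ∀ γ, cutG (zSL γ * g) =
      S.indicator (fun γ => h (γ.1 1 0, γ.1 1 1)) γ := by
    intro γ
    simp only [cutG, hS, Set.indicator, Set.mem_ofPred_eq, hh, rho_mul_eq]
  rw [perG, tsum_congr e1, ← tsum_subtype S]
  have e2 : ∑' γ : S, h (γ.1.1 1 0, γ.1.1 1 1) = ∑' v : T, h v :=
    (Equiv.ofBijective φ hbij).tsum_eq (fun v : T => h v)
  rw [e2, tsum_subtype T h]
  have e3 : T.indicator h = h := by
    refine Set.indicator_eq_self.2 fun v hv => ?_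
    by_contra hn
    refine hv ?_
    simp only [hh]
    rw [latTerm, if_neg (show ¬ IsCoprime v.1 v.2 from hn), zero_div, ENNReal.ofReal_zero]
  rw [e3, ← ENNReal.ofReal_tsum_of_nonneg (fun v => div_nonneg (latTerm_nonneg g v) ?_)
    (summable_latTerm_div g), tsum_latTerm_div, ENNReal.ofReal_one]
  exact zero_le_one.trans (one_le_latSum g)

lemma measurable_latTerm (v : ℤ × ℤ) : Measurable fun g => latTerm g v := by
  unfold latTerm
  split_ifs with h
  · have e : ∀ w : ℤ × ℤ, Measurable (row0 w) ∧ Measurable (row1 w) := fun w =>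
      ⟨((measurable_entry 0 0).const_mul _).add ((measurable_entry 1 0).const_mul _),
        ((measurable_entry 0 1).const_mul _).add ((measurable_entry 1 1).const_mul _)⟩
    unfold bump
    exact measurable_const.max (measurable_const.sub
      ((continuous_abs.measurable.comp (e v).1).max (continuous_abs.measurable.comp (e v).2)))
  · exact measurable_const

lemma measurable_rho : Measurable rho := by
  have e : ∀ g, ENNReal.ofReal (rho g) = ENNReal.ofReal (latTerm g (0, 1)) /
      ∑' v, ENNReal.ofReal (latTerm g v) := by
    intro g
    rw [← ENNReal.ofReal_tsum_of_nonneg (latTerm_nonneg g) (summable_latTerm g),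
      ← bump_eq_latTerm, rho, ENNReal.ofReal_div_of_pos]
    · rfl
    · exact zero_lt_one.trans_le (one_le_latSum g)
  have : rho = fun g => (ENNReal.ofReal (latTerm g (0, 1)) /
      ∑' v, ENNReal.ofReal (latTerm g v)).toReal := by
    funext g; rw [← e, ENNReal.toReal_ofReal (rho_nonneg g)]
  rw [this]
  exact ((measurable_latTerm _).ennreal_ofReal.div
    (Measurable.tsum fun v => (measurable_latTerm v).ennreal_ofReal)).ennreal_toReal

lemma measurable_cutG : Measurable cutG :=
  Measurable.ite (measurable_yG measurableSet_Ico) measurable_rho.ennreal_ofReal measurable_const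

/-- The strip in coordinates over which the modular surface unfolds. -/
def strip : Set ((ℝ × ℝ) × ℝ) := Set.univ ×ˢ Set.Ico (0 : ℝ) 1

/-- The unfolded density. -/
def rhoD (p : (ℝ × ℝ) × ℝ) : ENNReal := ENNReal.ofReal (rho (gpt p))

lemma measurable_rhoD : Measurable rhoD := (measurable_rho.comp measurable_gpt).ennreal_ofReal

/-- The unfolding of the modular surface. -/
def unfoldMeas : Measure (XQuot Γℤ) :=
  Measure.map (fun p => XProj Γℤ (gpt p)) ((volume.restrict strip).withDensity rhoD)

lemma measurable_XProj_gpt : Measurable fun p => XProj Γℤ (gpt p) :=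
  measurable_XProj.comp measurable_gpt

lemma yG_gpt {p : (ℝ × ℝ) × ℝ} (hp : p.1.1 ≠ 0) : yG (gpt p) = p.2 := by
  rw [yG, gpt, gp_00 hp, gp_10 hp, mul_div_cancel_right₀ _ hp]

lemma ae_out_ne_zero {μX : Measure (XQuot Γℤ)} {c : ENNReal} (hc : liftMeas μX = c • haarG) :
    ∀ᵐ x ∂μX, ∀ γ, (zSL γ * x.out).1 1 0 ≠ 0 := by
  set N : Set SL2R := {g | g.1 1 0 = 0} with hN
  have hm : MeasurableSet N := measurable_entry 1 0 (measurableSet_singleton 0)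
  have h0 : liftMeas μX N = 0 := by
    have : haarG N = 0 := by
      rw [haarG, Measure.map_apply measurable_gpt hm]
      refine measure_mono_null (fun p hp => ?_) ae_fst_ne_zero
      simp only [Set.mem_compl_iff, Set.mem_ofPred_eq, not_not]
      by_contra hne
      exact hne (by rw [← gp_10 (w₂ := p.1.2) (Y := p.2) hne]; exact hp)
    rw [hc, Measure.smul_apply, this, smul_zero]
  rw [← lintegral_indicator_one hm, lintegral_liftMeas _ (measurable_one.indicator hm),
    lintegral_eq_zero_iff (measurable_perG_out (measurable_one.indicator hm))] at h0
  filter_upwards [h0] with x hx γ hγ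
  have := ENNReal.tsum_eq_zero.1 hx γ
  rw [Set.indicator_of_mem (show zSL γ * x.out ∈ N from hγ)] at this
  exact one_ne_zero this

lemma eq_smul_unfoldMeas {μX : Measure (XQuot Γℤ)} {c : ENNReal} (hc : liftMeas μX = c • haarG) :
    μX = c • unfoldMeas := by
  refine Measure.ext fun s hs => ?_
  set E : SL2R → ENNReal := fun g => s.indicator 1 (XProj Γℤ g) with hE
  have hEm : Measurable E := (measurable_one.indicator hs).comp measurable_XProj
  have e1 : ∫⁻ x, perG (fun g => E g * cutG g) x.out ∂μX = μX s := by
    rw [← lintegral_indicator_one hs]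
    refine lintegral_congr_ae ?_
    filter_upwards [ae_out_ne_zero hc] with x hx
    have : ∀ γ, E (zSL γ * x.out) * cutG (zSL γ * x.out) =
        s.indicator 1 x * cutG (zSL γ * x.out) := by
      intro γ; simp only [hE, XProj_zSL_mul, XProj_out]
    rw [perG, tsum_congr this, ENNReal.tsum_mul_left]
    have := perG_cutG hx
    rw [perG] at this
    rw [this, mul_one]
  have e0 := lintegral_liftMeas μX (ψ := fun g => E g * cutG g) (hEm.mul measurable_cutG)
  have e2 := lintegral_haarG (ψ := fun g => E g * cutG g) (hEm.mul measurable_cutG)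
  rw [← e1, ← e0, hc, lintegral_smul_measure,
    e2, Measure.smul_apply, unfoldMeas,
    Measure.map_apply measurable_XProj_gpt hs,
    withDensity_apply _ (measurable_XProj_gpt hs)]
  congr 1
  have hst : MeasurableSet strip := MeasurableSet.univ.prod measurableSet_Ico
  rw [Measure.restrict_restrict (measurable_XProj_gpt hs),
    ← lintegral_indicator ((measurable_XProj_gpt hs).inter hst)]
  refine lintegral_congr_ae ?_
  filter_upwards [ae_fst_ne_zero] with p hp
  have hmem : yG (gpt p) ∈ Set.Ico (0 : ℝ) 1 ↔ p ∈ strip := by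
    rw [yG_gpt hp]; simp [strip]
  simp only [cutG, hE]
  have key : p ∈ (fun p => XProj Γℤ (gpt p)) ⁻¹' s ∩ strip ↔ XProj Γℤ (gpt p) ∈ s ∧ p ∈ strip :=
    Iff.rfl
  by_cases h2 : XProj Γℤ (gpt p) ∈ s
  · by_cases h1 : p ∈ strip
    · rw [Set.indicator_of_mem h2, if_pos (hmem.2 h1), Set.indicator_of_mem (key.2 ⟨h2, h1⟩),
        Pi.one_apply, one_mul]
      rfl
    · rw [if_neg (fun h => h1 (hmem.1 h)), mul_zero]
      rw [Set.indicator_of_notMem fun h => h1 (key.1 h).2]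
  · rw [Set.indicator_of_notMem h2, Set.indicator_of_notMem fun h => h2 (key.1 h).1, zero_mul]

/-! ### Mean zero on the quotient and mean zero of the main term -/

lemma integrable_of_box {α : Type*} [MeasurableSpace α] {μ : Measure α} {h : α → ℂ} {B : Set α}
    (hm : Measurable h) (hb : ∀ a, ‖h a‖ ≤ 1) (hB : MeasurableSet B) (hμ : μ B ≠ ⊤)
    (h0 : ∀ᵐ a ∂μ, a ∉ B → h a = 0) : Integrable h μ := by
  have : IntegrableOn h B μ :=
    Measure.integrableOn_of_bounded hμ hm.aestronglyMeasurable (Filter.Eventually.of_forall hb)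
  refine (integrable_indicator_iff hB |>.2 this).congr ?_
  filter_upwards [h0] with a ha
  by_cases h : a ∈ B
  · rw [Set.indicator_of_mem h]
  · rw [Set.indicator_of_notMem h, ha h]

section
variable {f : SL2R → ℂ} (hf : Measurable f) (hb : ∀ g, ‖f g‖ ≤ 1)

lemma apply_Wst_mul (hi : InvN 1 f) (g : SL2R) : f (Wst * g) = f g := by
  obtain ⟨γ, h1, h2, h3, h4⟩ := exists_zSL 0 (-1) 1 0 (by norm_num)
  have : Wst = zSL γ := by
    apply SL2R_ext
    · rw [h1]; simp [Wst, mk2]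
    · rw [h2]; simp [Wst, mk2]
    · rw [h3]; simp [Wst, mk2]
    · rw [h4]; simp [Wst, mk2]
  rw [this]
  exact hi γ (by simp) g

include hb in
lemma norm_Phi_le_one (w₁ w₂ Y : ℝ) : ‖Phi f w₁ w₂ Y‖ ≤ 1 := by
  rw [Phi, norm_mul, Complex.norm_real, Real.norm_of_nonneg (rho_nonneg _)]
  exact mul_le_one₀ (hb _) (rho_nonneg _) (rho_le_one _)

include hf in
lemma measurable_Phi : Measurable fun p : (ℝ × ℝ) × ℝ => Phi f p.1.1 p.1.2 p.2 :=
  (hf.comp (measurable_gpt.const_mul Wst)).mul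
    (Complex.measurable_ofReal.comp (measurable_rho.comp measurable_gpt))

lemma volume_restrict_strip :
    (volume : Measure ((ℝ × ℝ) × ℝ)).restrict strip =
      (volume : Measure (ℝ × ℝ)).prod (volume.restrict (Set.Ico (0 : ℝ) 1)) := by
  rw [strip, Measure.volume_eq_prod, ← Measure.prod_restrict, Measure.restrict_univ]

include hf hb in
lemma integrable_Phi_strip :
    Integrable (fun p : (ℝ × ℝ) × ℝ => Phi f p.1.1 p.1.2 p.2)
      ((volume : Measure (ℝ × ℝ)).prod (volume.restrict (Set.Ico (0 : ℝ) 1))) := by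
  refine integrable_of_box (B := (Set.Icc (-3) 3 ×ˢ Set.Icc (-3) 3) ×ˢ Set.univ) (measurable_Phi hf)
    (fun p => norm_Phi_le_one hb _ _ _)
    ((measurableSet_Icc.prod measurableSet_Icc).prod MeasurableSet.univ) ?_ ?_
  · rw [Measure.prod_prod, Measure.volume_eq_prod, Measure.prod_prod]
    simp [ENNReal.mul_eq_top]
  · rw [← volume_restrict_strip]
    filter_upwards [ae_restrict_of_ae ae_fst_ne_zero] with p hp h
    refine Phi_eq_zero _ hp ?_
    by_contra hcon
    push Not at hcon
    exact h ⟨⟨abs_le.1 hcon.1.le, abs_le.1 hcon.2.le⟩, trivial⟩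

include hf hb in
lemma integrable_Phi_slice {x : ℝ} (hx : x ≠ 0) :
    Integrable (fun p : ℝ × ℝ => Phi f x p.1 p.2)
      ((volume : Measure ℝ).prod (volume.restrict (Set.Ico (0 : ℝ) 1))) := by
  refine integrable_of_box (B := Set.Icc (-3) 3 ×ˢ Set.univ)
    ((measurable_Phi hf).comp (f := fun p : ℝ × ℝ => ((x, p.1), p.2))
      ((measurable_const.prodMk measurable_fst).prodMk measurable_snd))
    (fun p => norm_Phi_le_one hb _ _ _) (measurableSet_Icc.prod MeasurableSet.univ) ?_ ?_
  · rw [Measure.prod_prod]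
    simp [ENNReal.mul_eq_top]
  · refine Filter.Eventually.of_forall fun p h => Phi_eq_zero _ hx (Or.inr ?_)
    by_contra hcon
    push Not at hcon
    exact h ⟨abs_le.1 hcon.le, trivial⟩

include hf hb in
lemma integral_integral_Phi {x : ℝ} (hx : x ≠ 0) :
    ∫ w, ∫ u in Set.Ico (0 : ℝ) 1, Phi f x w u = Mn f 1 x := by
  rw [integral_integral_swap (integrable_Phi_slice hf hb hx), Mn,
    intervalIntegral.integral_of_le zero_le_one, integral_Ico_eq_integral_Ioc]
  simp

lemma gp_neg {x : ℝ} (hx : x ≠ 0) (w Y : ℝ) : gp (-x) (-w) Y = -gp x w Y := by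
  have hx' := neg_ne_zero.2 hx
  apply SL2R_ext
  · rw [gp_00 hx', Matrix.SpecialLinearGroup.coe_neg, Matrix.neg_apply, gp_00 hx]; ring
  · rw [gp_01 hx', Matrix.SpecialLinearGroup.coe_neg, Matrix.neg_apply, gp_01 hx, inv_neg]; ring
  · rw [gp_10 hx', Matrix.SpecialLinearGroup.coe_neg, Matrix.neg_apply, gp_10 hx]
  · rw [gp_11 hx', Matrix.SpecialLinearGroup.coe_neg, Matrix.neg_apply, gp_11 hx]

lemma apply_neg_of_invN (hi : InvN 1 f) (g : SL2R) : f (-g) = f g := by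
  obtain ⟨γ, h1, h2, h3, h4⟩ := exists_zSL (-1) 0 0 (-1) (by norm_num)
  have : -g = zSL γ * g := by
    apply SL2R_ext <;> rw [mul_apply2] <;> simp [h1, h2, h3, h4]
  rw [this, hi γ (by simp)]

lemma Mn_neg (hi : InvN 1 f) {x : ℝ} (hx : x ≠ 0) : Mn f 1 (-x) = Mn f 1 x := by
  have : ∀ Y, ∫ w, Phi f (-x) w Y = ∫ w, Phi f x w Y := by
    intro Y
    rw [← integral_neg_eq_self]
    refine integral_congr_ae (Filter.Eventually.of_forall fun w => ?_)
    simp only [Phi, gp_neg hx, rho_neg, mul_neg, apply_neg_of_invN hi]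
  simp only [Mn, this]

include hf hb in
lemma integral_strip_Phi (hi : InvN 1 f) :
    ∫ p in strip, Phi f p.1.1 p.1.2 p.2 = 2 * ∫ x in (0 : ℝ)..3, Mn f 1 x := by
  have hint := integrable_Phi_strip hf hb
  rw [volume_restrict_strip, integral_prod _ hint]
  have h2 : Integrable (fun q : ℝ × ℝ => ∫ u in Set.Ico (0 : ℝ) 1, Phi f q.1 q.2 u)
      ((volume : Measure ℝ).prod volume) := hint.integral_prod_left
  rw [Measure.volume_eq_prod, integral_prod _ h2]
  have h3 := h2.integral_prod_left
  have hae : (fun x => ∫ w, ∫ u in Set.Ico (0 : ℝ) 1, Phi f x w u) =ᵐ[volume] Mn f 1 := by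
    filter_upwards [compl_mem_ae_iff.2 (measure_singleton (0 : ℝ))] with x hx
    exact integral_integral_Phi hf hb hx
  have h4 : Integrable (Mn f 1) := h3.congr hae
  rw [integral_congr_ae hae, ← intervalIntegral.integral_Iic_add_Ioi h4.integrableOn h4.integrableOn
    (b := 0)]
  have e1 : ∫ x in Set.Iic (0 : ℝ), Mn f 1 x = ∫ x in Set.Ioi (0 : ℝ), Mn f 1 x := by
    have := integral_comp_neg_Iic (0 : ℝ) (Mn f 1)
    rw [neg_zero] at this
    rw [← this]
    refine setIntegral_congr_ae measurableSet_Iic ?_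
    filter_upwards [compl_mem_ae_iff.2 (measure_singleton (0 : ℝ))] with x hx _
    exact (Mn_neg hi hx).symm
  have e2 : ∫ x in Set.Ioi (0 : ℝ), Mn f 1 x = ∫ x in (0 : ℝ)..3, Mn f 1 x := by
    rw [intervalIntegral.integral_of_le (by norm_num)]
    refine setIntegral_eq_of_subset_of_forall_sdiff_eq_zero measurableSet_Ioi Set.Ioc_subset_Ioi_self ?_
    rintro x ⟨h1, h2⟩
    refine Mn_eq_zero f 1 ?_
    by_contra hcon
    exact h2 ⟨h1, (not_le.1 hcon).le⟩
  rw [e1, e2, two_mul]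

lemma apply_out_of_invN (hi : InvN 1 f) (g : SL2R) : f (XProj Γℤ g).out = f g := by
  obtain ⟨γ, h⟩ := out_XProj g
  rw [h, hi γ (by simp)]

include hf in
lemma measurable_apply_out (hi : InvN 1 f) : Measurable fun x : XQuot Γℤ => f x.out :=
  measurable_of_comp_XProj (by simpa only [apply_out_of_invN hi] using hf)

include hf hb in
lemma integral_out_eq (hi : InvN 1 f) {μX : Measure (XQuot Γℤ)} {c : ENNReal}
    (hc : liftMeas μX = c • haarG) :
    ∫ x, f x.out ∂μX = (c.toReal : ℂ) * (2 * ∫ x in (0 : ℝ)..3, Mn f 1 x) := by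
  rw [eq_smul_unfoldMeas hc, integral_smul_measure, unfoldMeas,
    integral_map measurable_XProj_gpt.aemeasurable
      (measurable_apply_out hf hi).aestronglyMeasurable,
    integral_withDensity_eq_integral_toReal_smul measurable_rhoD
      (Filter.Eventually.of_forall fun _ => ENNReal.ofReal_lt_top), ← integral_strip_Phi hf hb hi]
  rw [Complex.real_smul]
  congr 1
  refine integral_congr_ae (Filter.Eventually.of_forall fun p => ?_)
  simp only [apply_out_of_invN hi, Phi, apply_Wst_mul hi, rhoD, ENNReal.toReal_ofReal (rho_nonneg _),
    Complex.real_smul]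
  rw [mul_comm]; rfl

include hf hb in
/-- A function of mean zero on the modular surface has vanishing main terms. -/
lemma mz_of_integral_eq_zero (hi : InvN 1 f) {μX : Measure (XQuot Γℤ)} [IsProbabilityMeasure μX]
    (hμ : ∀ g : SL2R, Measure.map (rightT Γℤ g) μX = μX) (h0 : ∫ x, f x.out ∂μX = 0) : MZ f := by
  obtain ⟨c, hct, hc⟩ := exists_liftMeas_eq_smul hμ
  have hc0 : c ≠ 0 := by
    rintro rfl
    have := eq_smul_unfoldMeas hc
    rw [zero_smul] at this
    exact IsProbabilityMeasure.ne_zero μX this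
  intro k
  have hi' : InvN 1 fun g => f (g * k) := fun γ hγ g => by
    simp only [mul_assoc]; exact hi γ hγ _
  have e := integral_out_eq (hf.comp (measurable_mul_const k)) (fun g => hb (g * k)) hi' hc
  have e2 : ∫ x : XQuot Γℤ, f (x.out * k) ∂μX = 0 := by
    rw [← h0]
    conv_rhs => rw [← hμ k]
    rw [integral_map (measurable_rightT k).aemeasurable
      (measurable_apply_out hf hi).aestronglyMeasurable]
    refine integral_congr_ae (Filter.Eventually.of_forall fun x => ?_)
    have : rightT Γℤ k x = XProj Γℤ (x.out * k) := by
      conv_lhs => rw [← XProj_out x]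
      rfl
    simp only [this, apply_out_of_invN hi]
  simp only [Function.comp_def] at e
  rw [e2] at e
  have hne : (c.toReal : ℂ) ≠ 0 := by
    exact_mod_cast (ENNReal.toReal_ne_zero.2 ⟨hc0, hct⟩)
  have := mul_eq_zero.1 e.symm
  rcases this with h | h
  · exact absurd h hne
  · exact (mul_eq_zero.1 h).resolve_left two_ne_zero

end

/-! ### The chart `(r, s, t) ↦ g v_r h_s u_t` -/

lemma lintegral_weight_comp_le {s : Set ℝ} {f f' : ℝ → ℝ} (hs : MeasurableSet s)
    (hf' : ∀ x ∈ s, HasDerivAt f (f' x) x) (hf : Set.InjOn f s) (g : ℝ → ENNReal) :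
    ∫⁻ x in s, ENNReal.ofReal |f' x| * g (f x) ≤ ∫⁻ y, g y := by
  rw [← lintegral_image_eq_lintegral_abs_deriv_mul hs (fun x hx => (hf' x hx).hasDerivWithinAt) hf]
  exact setLIntegral_le_lintegral _ _

/-- The chart around `g`. -/
def chart (g : SL2R) (r s t : ℝ) : SL2R := g * vElt r * hElt s * uElt t

lemma chart_rows (g : SL2R) (r s t : ℝ) :
    (chart g r s t).1 0 0 = Real.exp (-s) * (g.1 0 0 + r * g.1 0 1) ∧
    (chart g r s t).1 1 0 = Real.exp (-s) * (g.1 1 0 + r * g.1 1 1) ∧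
    (chart g r s t).1 1 1 = Real.exp s * g.1 1 1 +
      t * (Real.exp (-s) * (g.1 1 0 + r * g.1 1 1)) := by
  refine ⟨?_, ?_, ?_⟩ <;>
  · simp only [chart, mul_apply2, u_00, u_01, u_10, u_11, v_00, v_01, v_10, v_11,
      h_00, h_01, h_10, h_11]
    ring

lemma chart_eq_gp (g : SL2R) {r : ℝ} (hr : g.1 1 0 + r * g.1 1 1 ≠ 0) (s t : ℝ) :
    chart g r s t = gp (Real.exp (-s) * (g.1 1 0 + r * g.1 1 1))
      (Real.exp s * g.1 1 1 + t * (Real.exp (-s) * (g.1 1 0 + r * g.1 1 1)))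
      ((g.1 0 0 + r * g.1 0 1) / (g.1 1 0 + r * g.1 1 1)) := by
  obtain ⟨e1, e2, e3⟩ := chart_rows g r s t
  have he := (Real.exp_pos (-s)).ne'
  have := eq_gp (chart g r s t) (by rw [e2]; exact mul_ne_zero he hr)
  rw [e1, e2, e3, mul_div_mul_left _ _ he] at this
  exact this

lemma volume_badR (g : SL2R) : volume {r : ℝ | g.1 1 0 + r * g.1 1 1 = 0} = 0 := by
  by_cases h : g.1 1 1 = 0
  · have hd := SL2R_det g
    have : {r : ℝ | g.1 1 0 + r * g.1 1 1 = 0} = ∅ := by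
      refine Set.eq_empty_of_forall_notMem fun r hr => ?_
      rw [Set.mem_ofPred_eq, h, mul_zero, add_zero] at hr
      rw [h, hr] at hd
      simp at hd
    rw [this, measure_empty]
  · refine measure_mono_null (t := {-(g.1 1 0) / g.1 1 1}) (fun r hr => ?_) (measure_singleton _)
    rw [Set.mem_ofPred_eq] at hr
    rw [Set.mem_singleton_iff, eq_div_iff h]
    linarith

lemma lintegral_chart_inner_le {x : ℝ} (hx : x ≠ 0) (Φ : ℝ → ENNReal) (y : ℝ) :
    ∫⁻ t in Set.Icc (0 : ℝ) 1, Φ (y + t * x) ≤ ENNReal.ofReal |x|⁻¹ * ∫⁻ w, Φ w := by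
  have h := lintegral_weight_comp_le (s := Set.Icc (0 : ℝ) 1) (f := fun t => y + t * x)
    (f' := fun _ => x) measurableSet_Icc
    (fun t _ => by simpa using ((hasDerivAt_id t).mul_const x).const_add y)
    (fun a _ b _ hab => mul_right_cancel₀ hx (add_left_cancel hab)) Φ
  rw [lintegral_const_mul' _ _ ENNReal.ofReal_ne_top] at h
  calc ∫⁻ t in Set.Icc (0 : ℝ) 1, Φ (y + t * x)
      = ENNReal.ofReal |x|⁻¹ * (ENNReal.ofReal |x| * ∫⁻ t in Set.Icc (0 : ℝ) 1, Φ (y + t * x)) := by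
        rw [← mul_assoc, ← ENNReal.ofReal_mul (by positivity), inv_mul_cancel₀ (abs_ne_zero.2 hx),
          ENNReal.ofReal_one, one_mul]
    _ ≤ _ := by gcongr

lemma lintegral_chart_middle_le {A : ℝ} (hA : A ≠ 0) (Φ : ℝ → ENNReal) :
    ∫⁻ s in Set.Icc (0 : ℝ) 1, ENNReal.ofReal |Real.exp (-s) * A|⁻¹ * Φ (Real.exp (-s) * A) ≤
      ENNReal.ofReal (Real.exp 2) * (ENNReal.ofReal |-1 / A ^ 2| * ∫⁻ x, Φ x) := by
  have h := lintegral_weight_comp_le (s := Set.Icc (0 : ℝ) 1) (f := fun s => Real.exp (-s) * A)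
    (f' := fun s => -(Real.exp (-s) * A)) measurableSet_Icc
    (fun s _ => by
      have := ((Real.hasDerivAt_exp (-s)).comp s (hasDerivAt_neg s)).mul_const A
      exact this.congr_deriv (by ring))
    (fun a _ b _ hab => by
      have := Real.exp_injective (mul_right_cancel₀ hA hab)
      linarith) Φ
  refine le_trans ?_ (mul_le_mul_right (mul_le_mul_right h _) _)
  rw [← lintegral_const_mul' _ _ ENNReal.ofReal_ne_top, ← lintegral_const_mul' _ _ ENNReal.ofReal_ne_top]
  refine setLIntegral_mono' measurableSet_Icc fun s hs => ?_
  rw [← mul_assoc, ← mul_assoc, ← ENNReal.ofReal_mul (by positivity),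
    ← ENNReal.ofReal_mul (by positivity)]
  refine mul_le_mul_left (ENNReal.ofReal_le_ofReal ?_) _
  have e1 : Real.exp 2 = Real.exp (2 - 2 * s) * Real.exp s ^ 2 := by
    rw [← Real.exp_nat_mul, ← Real.exp_add]; congr 1; push_cast; ring
  have e2 : 1 ≤ Real.exp (2 - 2 * s) := Real.one_le_exp (by linarith [hs.2])
  have e3 := Real.exp_pos s
  have e4 : 0 < |A| := abs_pos.2 hA
  rw [abs_neg, abs_mul, abs_div, abs_neg, abs_one, abs_pow, abs_of_pos (Real.exp_pos _), Real.exp_neg,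
    e1]
  have : Real.exp (2 - 2 * s) * Real.exp s ^ 2 * (1 / |A| ^ 2) * ((Real.exp s)⁻¹ * |A|) =
    Real.exp (2 - 2 * s) * ((Real.exp s)⁻¹ * |A|)⁻¹ := by
    generalize Real.exp (2 - 2 * s) = z
    field_simp
  rw [this]
  exact le_mul_of_one_le_left (by positivity) e2

lemma lintegral_chart_le (g : SL2R) {Ψ : SL2R → ENNReal} (hΨ : Measurable Ψ) :
    ∫⁻ r in Set.Icc (0 : ℝ) 1, ∫⁻ s in Set.Icc (0 : ℝ) 1, ∫⁻ t in Set.Icc (0 : ℝ) 1,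
      Ψ (chart g r s t) ≤ ENNReal.ofReal (Real.exp 2) * ∫⁻ h, Ψ h ∂haarG := by
  set A : ℝ → ℝ := fun r => g.1 1 0 + r * g.1 1 1 with hA
  set Y : ℝ → ℝ := fun r => (g.1 0 0 + r * g.1 0 1) / (g.1 1 0 + r * g.1 1 1) with hY
  set Φ : ℝ → ENNReal := fun y => ∫⁻ x, ∫⁻ w, Ψ (gp x w y) with hΦ
  set G : Set ℝ := Set.Icc 0 1 ∩ {r | A r ≠ 0} with hG
  have hGm : MeasurableSet G := measurableSet_Icc.inter
    ((measurableSet_eq_fun (by fun_prop) (by fun_prop)).compl)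
  have hd := SL2R_det g
  have e0 : ∫⁻ h, Ψ h ∂haarG = ∫⁻ y, Φ y := by
    have hm : Measurable fun p : (ℝ × ℝ) × ℝ => Ψ (gpt p) := hΨ.comp measurable_gpt
    rw [lintegral_haarG hΨ, Measure.volume_eq_prod, lintegral_prod_symm _ hm.aemeasurable]
    refine lintegral_congr fun y => ?_
    have hm2 : Measurable fun q : ℝ × ℝ => Ψ (gpt (q, y)) :=
      hm.comp (by fun_prop : Measurable fun q : ℝ × ℝ => (q, y))
    rw [Measure.volume_eq_prod]
    exact lintegral_prod _ hm2.aemeasurable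
  have e1 : ∀ r ∈ G, ∫⁻ s in Set.Icc (0 : ℝ) 1, ∫⁻ t in Set.Icc (0 : ℝ) 1, Ψ (chart g r s t) ≤
      ENNReal.ofReal (Real.exp 2) * (ENNReal.ofReal |-1 / A r ^ 2| * Φ (Y r)) := by
    intro r hr
    have hr' : g.1 1 0 + r * g.1 1 1 ≠ 0 := hr.2
    refine le_trans ?_ (lintegral_chart_middle_le hr' fun x => ∫⁻ w, Ψ (gp x w (Y r)))
    refine lintegral_mono fun s => ?_
    simp only [chart_eq_gp g hr']
    exact lintegral_chart_inner_le (mul_ne_zero (Real.exp_pos _).ne' hr')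
      (fun w => Ψ (gp (Real.exp (-s) * (g.1 1 0 + r * g.1 1 1)) w (Y r))) _
  have e2 : (Set.Icc (0 : ℝ) 1 : Set ℝ) =ᵐ[volume] G := by
    filter_upwards [compl_mem_ae_iff.2 (volume_badR g)] with r hr
    exact propext ⟨fun h => ⟨h, hr⟩, fun h => h.1⟩
  rw [setLIntegral_congr e2, e0]
  refine (setLIntegral_mono' hGm e1).trans ?_
  rw [lintegral_const_mul' _ _ ENNReal.ofReal_ne_top]
  refine mul_le_mul_right (lintegral_weight_comp_le hGm (fun r hr => ?_) ?_ Φ) _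
  · have hr' : g.1 1 0 + r * g.1 1 1 ≠ 0 := hr.2
    have d1 : HasDerivAt (fun r => g.1 0 0 + r * g.1 0 1) (g.1 0 1) r := by
      simpa using ((hasDerivAt_id r).mul_const (g.1 0 1)).const_add (g.1 0 0)
    have d2 : HasDerivAt (fun r => g.1 1 0 + r * g.1 1 1) (g.1 1 1) r := by
      simpa using ((hasDerivAt_id r).mul_const (g.1 1 1)).const_add (g.1 1 0)
    refine (d1.div d2 hr').congr_deriv ?_
    simp only [hA]
    congr 1
    linear_combination -hd
  · intro a ha b hb hab
    have ha' : g.1 1 0 + a * g.1 1 1 ≠ 0 := ha.2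
    have hb' : g.1 1 0 + b * g.1 1 1 ≠ 0 := hb.2
    simp only [hY] at hab
    rw [div_eq_div_iff ha' hb'] at hab
    linear_combination -hab + (b - a) * hd

/-! ### One-parameter paths and the energy of a smooth function -/

lemma continuous_SL2R {α : Type*} [TopologicalSpace α] {f : α → SL2R}
    (h : ∀ i j, Continuous fun x => (f x).1 i j) : Continuous f :=
  Continuous.subtype_mk (continuous_matrix h) _

lemma continuous_entry (i j : Fin 2) : Continuous fun g : SL2R => g.1 i j :=
  (continuous_apply_apply i j).comp continuous_subtype_val

lemma continuous_SL2R_mul {α : Type*} [TopologicalSpace α] {f f' : α → SL2R} (h : Continuous f)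
    (h' : Continuous f') : Continuous fun x => f x * f' x := by
  refine continuous_SL2R fun i j => ?_
  have e : (fun x => (f x * f' x).1 i j) =
      fun x => (f x).1 i 0 * (f' x).1 0 j + (f x).1 i 1 * (f' x).1 1 j := by
    funext x
    exact mul_apply2 _ _ _ _
  rw [e]
  exact (((continuous_entry i 0).comp h).mul ((continuous_entry 0 j).comp h')).add
    (((continuous_entry i 1).comp h).mul ((continuous_entry 1 j).comp h'))

lemma continuous_oneParam (i : Fin 3) : Continuous (oneParam i) := by
  refine continuous_SL2R fun j k => ?_
  have h : Continuous fun x : ℝ => Real.exp (-x) := by fun_prop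
  fin_cases i <;> fin_cases j <;> fin_cases k <;>
    first
    | exact continuous_const
    | exact continuous_id
    | exact h
    | exact Real.continuous_exp

lemma oneParam_add (i : Fin 3) (s t : ℝ) : oneParam i (s + t) = oneParam i s * oneParam i t := by
  have hh : hElt (s + t) = hElt s * hElt t := by
    apply SL2R_ext <;> simp only [mul_apply2, h_00, h_01, h_10, h_11, neg_add, Real.exp_add] <;> ring
  have hu : uElt (s + t) = uElt s * uElt t := by
    apply SL2R_ext <;> simp only [mul_apply2, u_00, u_01, u_10, u_11] <;> ring
  have hv : vElt (s + t) = vElt s * vElt t := by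
    apply SL2R_ext <;> simp only [mul_apply2, v_00, v_01, v_10, v_11] <;> ring
  fin_cases i
  exacts [hh, hu, hv]

lemma oneParam_zero (i : Fin 3) : oneParam i 0 = 1 := by
  have h := oneParam_add i 0 0
  rw [add_zero] at h
  exact left_eq_mul.1 h

/-- The path through `p` in the direction of the `i`-th basic operator. -/
def pPath (i : Fin 4) (p : ℝ × SL2R) (s : ℝ) : ℝ × SL2R :=
  Fin.cases (motive := fun _ => ℝ × SL2R) (p.1 + s, p.2) (fun j => (p.1, p.2 * oneParam j s)) i

lemma pPath_zero (i : Fin 4) (p : ℝ × SL2R) : pPath i p 0 = p := by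
  refine Fin.cases ?_ (fun j => ?_) i
  · exact Prod.ext (add_zero _) rfl
  · exact Prod.ext rfl (by simp [pPath, oneParam_zero])

lemma pPath_add (i : Fin 4) (p : ℝ × SL2R) (s t : ℝ) :
    pPath i p (s + t) = pPath i (pPath i p s) t := by
  refine Fin.cases ?_ (fun j => ?_) i
  · exact Prod.ext (add_assoc _ _ _).symm rfl
  · exact Prod.ext rfl (by simp [pPath, oneParam_add, mul_assoc])

lemma continuous_pPath (i : Fin 4) (p : ℝ × SL2R) : Continuous (pPath i p) := by
  refine Fin.cases ?_ (fun j => ?_) i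
  · exact (continuous_const.add continuous_id).prodMk continuous_const
  · exact continuous_const.prodMk (continuous_SL2R_mul continuous_const (continuous_oneParam j))

lemma pOp_eq (i : Fin 4) (G : ℝ × SL2R → ℂ) (p : ℝ × SL2R) :
    pOp i G p = deriv (fun s => G (pPath i p s)) 0 := by
  fin_cases i
  · have := deriv_comp_const_add (f := fun s => G (s, p.2)) p.1 0
    rw [add_zero] at this
    exact this.symm
  · rfl
  · rfl
  · rfl

lemma IsSmoothTX.hasDerivAt {G : ℝ × SL2R → ℂ} (hG : IsSmoothTX G) (w : List (Fin 4)) (i : Fin 4)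
    (p : ℝ × SL2R) (s : ℝ) :
    HasDerivAt (fun s => wordOp w G (pPath i p s)) (wordOp (i :: w) G (pPath i p s)) s := by
  have key : ∀ p, HasDerivAt (fun s => wordOp w G (pPath i p s)) (wordOp (i :: w) G p) 0 := by
    intro p
    have e : wordOp (i :: w) G p = deriv (fun s => wordOp w G (pPath i p s)) 0 := pOp_eq i _ p
    rw [e]
    refine DifferentiableAt.hasDerivAt ?_
    refine Fin.cases ?_ (fun j => ?_) i
    · have h := (hG w).2.1 p
      have h2 : DifferentiableAt ℝ (fun s : ℝ => p.1 + s) 0 := by fun_prop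
      rw [← add_zero p.1] at h
      exact DifferentiableAt.comp (g := fun s => wordOp w G (s, p.2)) (0 : ℝ) h h2
    · exact (hG w).2.2 j p
  have h := key (pPath i p s)
  rw [← sub_self s] at h
  have h2 := HasDerivAt.scomp (h := fun x : ℝ => x - s) s h ((hasDerivAt_id' s).sub_const s)
  rw [one_smul] at h2
  refine h2.congr_of_eventuallyEq (Filter.Eventually.of_forall fun x => ?_)
  change _ = wordOp w G (pPath i (pPath i p s) (x - s))
  rw [← pPath_add, add_sub_cancel]

lemma ofReal_norm_sq_le {u u' : ℝ → ℂ} (hu : ∀ s, HasDerivAt u (u' s) s) (hu' : Continuous u') :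
    ENNReal.ofReal (‖u 0‖ ^ 2) ≤
      2 * ∫⁻ s in Set.Icc (0 : ℝ) 1, (ENNReal.ofReal (‖u s‖ ^ 2) + ENNReal.ofReal (‖u' s‖ ^ 2)) := by
  have hc : Continuous u := continuous_iff_continuousAt.2 fun s => (hu s).continuousAt
  have hd : ∀ s ∈ Set.uIcc (0 : ℝ) 1, HasDerivAt (fun s => (1 - s) * ‖u s‖ ^ 2)
      (-1 * ‖u s‖ ^ 2 + (1 - s) * (2 * inner ℝ (u s) (u' s))) s := fun s _ =>
    ((hasDerivAt_id s).const_sub 1).mul (hu s).norm_sq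
  have h1 := intervalIntegral.integral_eq_sub_of_hasDerivAt hd
    (Continuous.intervalIntegrable (by fun_prop) _ _)
  have h2 : ‖u 0‖ ^ 2 = ∫ s in (0 : ℝ)..1,
      -(-1 * ‖u s‖ ^ 2 + (1 - s) * (2 * inner ℝ (u s) (u' s))) := by
    rw [intervalIntegral.integral_neg, h1]
    ring
  have h3 : ‖u 0‖ ^ 2 ≤ ∫ s in (0 : ℝ)..1, 2 * (‖u s‖ ^ 2 + ‖u' s‖ ^ 2) := by
    rw [h2]
    refine intervalIntegral.integral_mono_on zero_le_one
      (Continuous.intervalIntegrable (by fun_prop) _ _)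
      (Continuous.intervalIntegrable (by fun_prop) _ _) fun s hs => ?_
    have hi := abs_le.1 (abs_real_inner_le_norm (u s) (u' s))
    have h4 : -((1 - s) * (2 * inner ℝ (u s) (u' s))) ≤ 1 * (2 * (‖u s‖ * ‖u' s‖)) := by
      rw [← mul_neg]
      refine mul_le_mul_of_nonneg (by linarith [hs.1]) (by linarith [hi.1]) (by linarith [hs.2])
        (by positivity)
    nlinarith [sq_nonneg (‖u s‖ - ‖u' s‖), sq_nonneg ‖u' s‖]
  refine (ENNReal.ofReal_le_ofReal h3).trans (le_of_eq ?_)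
  rw [intervalIntegral.integral_of_le zero_le_one, ← integral_Icc_eq_integral_Ioc,
    ofReal_integral_eq_lintegral_ofReal, ← lintegral_const_mul' _ _ ENNReal.ofNat_ne_top]
  · refine lintegral_congr fun s => ?_
    rw [ENNReal.ofReal_mul (by norm_num), ENNReal.ofReal_add (by positivity) (by positivity)]
    norm_num
  · exact (Continuous.continuousOn (by fun_prop)).integrableOn_Icc
  · exact Filter.Eventually.of_forall fun s => by positivity

/-- The pointwise energy of all derivatives of order at most `k`. -/
def energy (G : ℝ × SL2R → ℂ) (k : ℕ) (p : ℝ × SL2R) : ENNReal :=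
  ∑ l ∈ Finset.range (k + 1), ∑ w : Fin l → Fin 4,
    ENNReal.ofReal (‖wordOp (List.ofFn w) G p‖ ^ 2)

lemma measurable_energy {G : ℝ × SL2R → ℂ} (hG : IsSmoothTX G) (k : ℕ) :
    Measurable (energy G k) := by
  refine Finset.measurable_sum _ fun l _ => Finset.measurable_sum _ fun w _ => ?_
  exact ((hG _).1.norm.pow 2).measurable.ennreal_ofReal

lemma energy_le_energy (G : ℝ × SL2R → ℂ) (k : ℕ) (p : ℝ × SL2R) :
    energy G k p ≤ energy G (k + 1) p := by
  rw [energy, energy, Finset.sum_range_succ _ (k + 1)]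
  exact le_self_add

lemma sum_cons_le_energy (G : ℝ × SL2R → ℂ) (k : ℕ) (i : Fin 4) (p : ℝ × SL2R) :
    ∑ l ∈ Finset.range (k + 1), ∑ w : Fin l → Fin 4,
      ENNReal.ofReal (‖wordOp (i :: List.ofFn w) G p‖ ^ 2) ≤ energy G (k + 1) p := by
  rw [energy, Finset.sum_range_succ' _ (k + 1)]
  refine le_add_right (Finset.sum_le_sum fun l _ => ?_)
  have hi : Function.Injective fun w : Fin l → Fin 4 => (Fin.cons i w : Fin (l + 1) → Fin 4) :=
    Fin.cons_right_injective (α := fun _ => Fin 4) i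
  refine (le_of_eq ?_).trans (Finset.sum_le_sum_of_subset
    (Finset.subset_univ (Finset.univ.image fun w => (Fin.cons i w : Fin (l + 1) → Fin 4))))
  rw [Finset.sum_image hi.injOn]
  exact Finset.sum_congr rfl fun w _ => by rw [List.ofFn_cons]

lemma energy_le_lintegral {G : ℝ × SL2R → ℂ} (hG : IsSmoothTX G) (k : ℕ) (i : Fin 4)
    (p : ℝ × SL2R) :
    energy G k p ≤ 4 * ∫⁻ s in Set.Icc (0 : ℝ) 1, energy G (k + 1) (pPath i p s) := by
  have hm : ∀ w, Measurable fun s => ENNReal.ofReal (‖wordOp w G (pPath i p s)‖ ^ 2) := fun w =>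
    (((hG w).1.comp (continuous_pPath i p)).norm.pow 2).measurable.ennreal_ofReal
  have hm2 : ∀ w v, Measurable fun s => ENNReal.ofReal (‖wordOp w G (pPath i p s)‖ ^ 2) +
      ENNReal.ofReal (‖wordOp v G (pPath i p s)‖ ^ 2) := fun w v => (hm w).add (hm v)
  have h1 : energy G k p ≤ ∑ l ∈ Finset.range (k + 1), ∑ w : Fin l → Fin 4,
      2 * ∫⁻ s in Set.Icc (0 : ℝ) 1, (ENNReal.ofReal (‖wordOp (List.ofFn w) G (pPath i p s)‖ ^ 2) +
        ENNReal.ofReal (‖wordOp (i :: List.ofFn w) G (pPath i p s)‖ ^ 2)) := by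
    refine Finset.sum_le_sum fun l _ => Finset.sum_le_sum fun w _ => ?_
    have := ofReal_norm_sq_le (fun s => hG.hasDerivAt (List.ofFn w) i p s)
      ((hG _).1.comp (continuous_pPath i p))
    rwa [pPath_zero] at this
  refine h1.trans ?_
  simp_rw [← Finset.mul_sum]
  have h2 : ∑ l ∈ Finset.range (k + 1), ∑ w : Fin l → Fin 4,
      ∫⁻ s in Set.Icc (0 : ℝ) 1, (ENNReal.ofReal (‖wordOp (List.ofFn w) G (pPath i p s)‖ ^ 2) +
        ENNReal.ofReal (‖wordOp (i :: List.ofFn w) G (pPath i p s)‖ ^ 2)) =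
      ∫⁻ s in Set.Icc (0 : ℝ) 1, ∑ l ∈ Finset.range (k + 1), ∑ w : Fin l → Fin 4,
        (ENNReal.ofReal (‖wordOp (List.ofFn w) G (pPath i p s)‖ ^ 2) +
        ENNReal.ofReal (‖wordOp (i :: List.ofFn w) G (pPath i p s)‖ ^ 2)) := by
    rw [lintegral_finsetSum _ fun l _ => Finset.measurable_sum _ fun w _ => hm2 _ _]
    refine Finset.sum_congr rfl fun l _ => ?_
    rw [lintegral_finsetSum _ fun w _ => hm2 _ _]
  rw [h2, show (4 : ENNReal) = 2 * 2 by norm_num, mul_assoc]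
  refine mul_le_mul_right ?_ _
  rw [← lintegral_const_mul' 2 _ ENNReal.ofNat_ne_top]
  refine lintegral_mono fun s => ?_
  simp_rw [Finset.sum_add_distrib]
  rw [two_mul]
  exact add_le_add (energy_le_energy _ _ _) (sum_cons_le_energy _ _ _ _)

lemma energy_one_le {G : ℝ × SL2R → ℂ} (hG : IsSmoothTX G) (t₀ : ℝ) (g : SL2R) :
    energy G 1 (t₀, g) ≤ 256 * ∫⁻ r in Set.Icc (0 : ℝ) 1, ∫⁻ s in Set.Icc (0 : ℝ) 1,
      ∫⁻ t in Set.Icc (0 : ℝ) 1, ∫⁻ τ in Set.Icc (0 : ℝ) 1, energy G 5 (t₀ + τ, chart g r s t) := by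
  have h4 : (4 : ENNReal) ≠ ⊤ := ENNReal.ofNat_ne_top
  have h : energy G 1 (t₀, g) ≤ 4 * ∫⁻ r in Set.Icc (0 : ℝ) 1, 4 * ∫⁻ s in Set.Icc (0 : ℝ) 1,
      4 * ∫⁻ t in Set.Icc (0 : ℝ) 1, 4 * ∫⁻ τ in Set.Icc (0 : ℝ) 1,
        energy G 5 (t₀ + τ, chart g r s t) := by
    refine (energy_le_lintegral hG 1 3 _).trans (mul_le_mul_right (lintegral_mono fun r => ?_) _)
    refine (energy_le_lintegral hG 2 1 _).trans (mul_le_mul_right (lintegral_mono fun s => ?_) _)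
    refine (energy_le_lintegral hG 3 2 _).trans (mul_le_mul_right (lintegral_mono fun t => ?_) _)
    exact energy_le_lintegral hG 4 0 _
  refine h.trans (le_of_eq ?_)
  simp_rw [lintegral_const_mul' _ _ h4, ← mul_assoc]
  norm_num

/-! ### The height function -/

/-- The conjugate `g⁻¹ w g` of an integer matrix. -/
def conjInt (w : Matrix (Fin 2) (Fin 2) ℤ) (g : SL2R) : Matrix (Fin 2) (Fin 2) ℝ :=
  (g⁻¹).1 * w.map (Int.cast : ℤ → ℝ) * g.1

/-- The index set of the height function. -/
abbrev TracelessInt := {w : Matrix (Fin 2) (Fin 2) ℤ // w ≠ 0 ∧ w.trace = 0}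

instance : Countable TracelessInt :=
  have : Countable (Matrix (Fin 2) (Fin 2) ℤ) := inferInstanceAs (Countable (Fin 2 → Fin 2 → ℤ))
  Subtype.countable

instance : Nonempty TracelessInt :=
  ⟨⟨!![0, 1; 0, 0], fun h => by simpa using congrFun (congrFun h 0) 1, by
    simp [Matrix.trace_fin_two_of]⟩⟩

/-- The height function on `SL₂(ℝ)`. -/
def htG (g : SL2R) : ℝ := ⨆ w : TracelessInt, (matSup (conjInt w.1 g))⁻¹

lemma htX_eq (x : XQuot Γℤ) : htX Γℤ x = htG x.out := by
  rw [htX, htG, iSup]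
  congr 1
  ext r
  constructor
  · rintro ⟨w, h0, h1, rfl⟩
    exact ⟨⟨w, h0, h1⟩, rfl⟩
  · rintro ⟨w, rfl⟩
    exact ⟨w.1, w.2.1, w.2.2, rfl⟩

/-- Conjugation by an element of `SL₂(ℤ)` on the index set. -/
def conjEquiv (γ : Matrix.SpecialLinearGroup (Fin 2) ℤ) : TracelessInt ≃ TracelessInt where
  toFun w := ⟨(γ⁻¹).1 * w.1 * γ.1, fun h => w.2.1 (by
    have h1 : γ.1 * (γ⁻¹).1 = 1 := congrArg Subtype.val (mul_inv_cancel γ)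
    calc w.1 = (γ.1 * (γ⁻¹).1) * w.1 * (γ.1 * (γ⁻¹).1) := by rw [h1, one_mul, mul_one]
      _ = γ.1 * ((γ⁻¹).1 * w.1 * γ.1) * (γ⁻¹).1 := by simp only [mul_assoc]
      _ = 0 := by rw [h, mul_zero, zero_mul]), by
    have h1 : γ.1 * (γ⁻¹).1 = 1 := congrArg Subtype.val (mul_inv_cancel γ)
    rw [Matrix.trace_mul_comm, ← mul_assoc, h1, one_mul, w.2.2]⟩
  invFun w := ⟨γ.1 * w.1 * (γ⁻¹).1, fun h => w.2.1 (by
    have h1 : (γ⁻¹).1 * γ.1 = 1 := congrArg Subtype.val (inv_mul_cancel γ)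
    calc w.1 = ((γ⁻¹).1 * γ.1) * w.1 * ((γ⁻¹).1 * γ.1) := by rw [h1, one_mul, mul_one]
      _ = (γ⁻¹).1 * (γ.1 * w.1 * (γ⁻¹).1) * γ.1 := by simp only [mul_assoc]
      _ = 0 := by rw [h, mul_zero, zero_mul]), by
    have h1 : (γ⁻¹).1 * γ.1 = 1 := congrArg Subtype.val (inv_mul_cancel γ)
    rw [Matrix.trace_mul_comm, ← mul_assoc, h1, one_mul, w.2.2]⟩
  left_inv w := Subtype.ext (by
    have h1 : γ.1 * (γ⁻¹).1 = 1 := congrArg Subtype.val (mul_inv_cancel γ)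
    change γ.1 * ((γ⁻¹).1 * w.1 * γ.1) * (γ⁻¹).1 = w.1
    calc _ = (γ.1 * (γ⁻¹).1) * w.1 * (γ.1 * (γ⁻¹).1) := by simp only [mul_assoc]
      _ = w.1 := by rw [h1, one_mul, mul_one])
  right_inv w := Subtype.ext (by
    have h1 : (γ⁻¹).1 * γ.1 = 1 := congrArg Subtype.val (inv_mul_cancel γ)
    change (γ⁻¹).1 * (γ.1 * w.1 * (γ⁻¹).1) * γ.1 = w.1
    calc _ = ((γ⁻¹).1 * γ.1) * w.1 * ((γ⁻¹).1 * γ.1) := by simp only [mul_assoc]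
      _ = w.1 := by rw [h1, one_mul, mul_one])

lemma conjInt_zSL_mul (γ : Matrix.SpecialLinearGroup (Fin 2) ℤ) (g : SL2R) (w : TracelessInt) :
    conjInt w.1 (zSL γ * g) = conjInt (conjEquiv γ w).1 g := by
  have h1 : ((zSL γ * g)⁻¹).1 = (g⁻¹).1 * (zSL γ⁻¹).1 := by
    rw [_root_.mul_inv_rev, zSL_inv]; rfl
  have h2 : (zSL γ * g).1 = (zSL γ).1 * g.1 := rfl
  have h3 (δ : Matrix.SpecialLinearGroup (Fin 2) ℤ) :
      (zSL δ).1 = δ.1.map (Int.castRingHom ℝ) := rfl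
  have h4 : (conjEquiv γ w).1.map (Int.cast : ℤ → ℝ) =
      (zSL γ⁻¹).1 * w.1.map (Int.cast : ℤ → ℝ) * (zSL γ).1 := by
    rw [h3, h3]
    change ((γ⁻¹).1 * w.1 * γ.1).map (Int.castRingHom ℝ) = _
    rw [Matrix.map_mul, Matrix.map_mul]
    rfl
  rw [conjInt, conjInt, h1, h2, h4]
  simp only [mul_assoc]

lemma htG_zSL_mul (γ : Matrix.SpecialLinearGroup (Fin 2) ℤ) (g : SL2R) :
    htG (zSL γ * g) = htG g := by
  have h : htG (zSL γ * g) = ⨆ w, (fun w : TracelessInt => (matSup (conjInt w.1 g))⁻¹)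
      (conjEquiv γ w) := by
    refine iSup_congr fun w => ?_
    rw [conjInt_zSL_mul]
  rw [h]
  exact Function.Surjective.iSup_comp (conjEquiv γ).surjective
    (fun w : TracelessInt => (matSup (conjInt w.1 g))⁻¹)

lemma htX_XProj (g : SL2R) : htX Γℤ (XProj Γℤ g) = htG g := by
  obtain ⟨γ, h⟩ := out_XProj g
  rw [htX_eq, h, htG_zSL_mul]

lemma one_le_mul_matSup_conjInt (w : TracelessInt) (g : SL2R) :
    1 ≤ 4 * matSup g.1 ^ 2 * matSup (conjInt w.1 g) := by
  have h1 : g.1 * (g⁻¹).1 = 1 := congrArg Subtype.val (mul_inv_cancel g)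
  have e : w.1.map (Int.cast : ℤ → ℝ) = g.1 * conjInt w.1 g * (g⁻¹).1 := by
    calc w.1.map (Int.cast : ℤ → ℝ)
        = (g.1 * (g⁻¹).1) * w.1.map (Int.cast : ℤ → ℝ) * (g.1 * (g⁻¹).1) := by
          rw [h1, one_mul, mul_one]
      _ = _ := by simp only [conjInt, mul_assoc]
  have h2 : 1 ≤ matSup (w.1.map (Int.cast : ℤ → ℝ)) := by
    have : ∃ i j, w.1 i j ≠ 0 := by
      by_contra! h
      exact w.2.1 (by ext i j; exact h i j)
    obtain ⟨i, j, hij⟩ := this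
    refine le_trans ?_ (abs_le_matSup _ i j)
    rw [Matrix.map_apply, ← Int.cast_abs]
    exact_mod_cast Int.one_le_abs hij
  have h3 := matSup_mul_le (g.1 * conjInt w.1 g) (g⁻¹).1
  have h4 := matSup_mul_le g.1 (conjInt w.1 g)
  rw [← e, matSup_inv] at h3
  have h0 := matSup_nonneg g.1
  nlinarith [mul_le_mul_of_nonneg_right h4 h0]

lemma matSup_conjInt_pos (w : TracelessInt) (g : SL2R) : 0 < matSup (conjInt w.1 g) := by
  refine lt_of_le_of_ne (matSup_nonneg _) fun h => ?_
  have := one_le_mul_matSup_conjInt w g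
  rw [← h] at this
  linarith

lemma inv_matSup_conjInt_le (w : TracelessInt) (g : SL2R) :
    (matSup (conjInt w.1 g))⁻¹ ≤ 4 * matSup g.1 ^ 2 := by
  rw [inv_le_iff_one_le_mul₀ (matSup_conjInt_pos w g)]
  exact one_le_mul_matSup_conjInt w g

lemma htG_le (g : SL2R) : htG g ≤ 4 * matSup g.1 ^ 2 := ciSup_le fun w => inv_matSup_conjInt_le w g

lemma htG_nonneg (g : SL2R) : 0 ≤ htG g :=
  Real.iSup_nonneg fun _ => inv_nonneg.2 (matSup_nonneg _)

lemma measurable_htG : Measurable htG := by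
  refine Measurable.iSup fun w => Measurable.inv ?_
  have h (A : Matrix (Fin 2) (Fin 2) ℝ) (i j : Fin 2) :
      Measurable fun g : SL2R => ((g⁻¹).1 * A * g.1) i j := by
    have e : (fun g : SL2R => ((g⁻¹).1 * A * g.1) i j) = fun g : SL2R =>
        ((g⁻¹).1 i 0 * A 0 0 + (g⁻¹).1 i 1 * A 1 0) * g.1 0 j +
        ((g⁻¹).1 i 0 * A 0 1 + (g⁻¹).1 i 1 * A 1 1) * g.1 1 j := by
      funext g
      simp only [Matrix.mul_apply, Fin.sum_univ_two]
    rw [e]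
    have hi : ∀ k, Measurable fun g : SL2R => (g⁻¹).1 i k := fun k =>
      (measurable_entry i k).comp measurable_inv
    exact ((((hi 0).mul_const _).add ((hi 1).mul_const _)).mul (measurable_entry 0 j)).add
      ((((hi 0).mul_const _).add ((hi 1).mul_const _)).mul (measurable_entry 1 j))
  exact (((h _ 0 0).norm).max ((h _ 0 1).norm)).max (((h _ 1 0).norm).max ((h _ 1 1).norm))

lemma measurable_htX : Measurable (htX Γℤ) :=
  measurable_of_comp_XProj (by simpa only [htX_XProj] using measurable_htG)

lemma inv_le_htG (g : SL2R) : (g.1 1 0 ^ 2 + g.1 1 1 ^ 2)⁻¹ ≤ htG g := by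
  let E : TracelessInt := ⟨!![0, 1; 0, 0], fun h => by simpa using congrFun (congrFun h 0) 1, by
    simp [Matrix.trace_fin_two_of]⟩
  have hE : (matSup (conjInt E.1 g))⁻¹ ≤ htG g :=
    le_ciSup (f := fun w : TracelessInt => (matSup (conjInt w.1 g))⁻¹)
      ⟨4 * matSup g.1 ^ 2, by rintro _ ⟨w, rfl⟩; exact inv_matSup_conjInt_le w g⟩ E
  have e (i j : Fin 2) : conjInt E.1 g i j = (g⁻¹).1 i 0 * g.1 1 j := by
    simp [conjInt, Matrix.mul_apply, Fin.sum_univ_two, E]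
  refine le_trans ?_ hE
  refine inv_anti₀ (matSup_conjInt_pos E g) ?_
  · rw [matSup_le_iff]
    simp only [e, inv_00, inv_10]
    refine ⟨?_, ?_, ?_, ?_⟩ <;> rw [abs_le] <;> constructor <;>
      nlinarith [sq_nonneg (g.1 1 0 + g.1 1 1), sq_nonneg (g.1 1 0 - g.1 1 1),
        sq_nonneg (g.1 1 0), sq_nonneg (g.1 1 1)]

/-! ### The Sobolev inequality -/

lemma unfoldMeas_univ_le : unfoldMeas Set.univ ≤ 36 := by
  have hB : MeasurableSet ((Set.Icc (-3 : ℝ) 3 ×ˢ Set.Icc (-3 : ℝ) 3) ×ˢ (Set.univ : Set ℝ)) :=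
    (measurableSet_Icc.prod measurableSet_Icc).prod MeasurableSet.univ
  rw [unfoldMeas, Measure.map_apply measurable_XProj_gpt MeasurableSet.univ, Set.preimage_univ,
    withDensity_apply _ MeasurableSet.univ, Measure.restrict_univ]
  have h : ∫⁻ p in strip, rhoD p ≤ ∫⁻ p in strip,
      ((Set.Icc (-3 : ℝ) 3 ×ˢ Set.Icc (-3 : ℝ) 3) ×ˢ (Set.univ : Set ℝ)).indicator 1 p := by
    refine lintegral_mono_ae ?_
    filter_upwards [ae_restrict_of_ae ae_fst_ne_zero] with p hp
    by_cases hb : p ∈ (Set.Icc (-3 : ℝ) 3 ×ˢ Set.Icc (-3 : ℝ) 3) ×ˢ (Set.univ : Set ℝ)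
    · rw [Set.indicator_of_mem hb]
      exact ENNReal.ofReal_le_one.2 (rho_le_one _)
    · rw [Set.indicator_of_notMem hb, rhoD, rho_eq_zero, ENNReal.ofReal_zero]
      by_contra hcon
      rw [gpt, gp_10 hp, gp_11 hp] at hcon
      push Not at hcon
      rw [max_lt_iff] at hcon
      exact hb ⟨⟨abs_le.1 hcon.1.le, abs_le.1 hcon.2.le⟩, trivial⟩
  refine h.trans ?_
  rw [lintegral_indicator_one hB, volume_restrict_strip, Measure.prod_prod,
    Measure.volume_eq_prod, Measure.prod_prod]
  simp only [Real.volume_Icc, Measure.restrict_apply MeasurableSet.univ, Set.univ_inter,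
    Real.volume_Ico]
  rw [← ENNReal.ofReal_mul (by norm_num), ← ENNReal.ofReal_mul (by norm_num)]
  norm_num

lemma lintegral_haarG_le {μX : Measure (XQuot Γℤ)} [IsProbabilityMeasure μX]
    (hμ : ∀ g : SL2R, Measure.map (rightT Γℤ g) μX = μX) {ψ : SL2R → ENNReal} (h : Measurable ψ) :
    ∫⁻ g, ψ g ∂haarG ≤ 36 * ∫⁻ x, perG ψ x.out ∂μX := by
  obtain ⟨c, -, hc⟩ := exists_liftMeas_eq_smul hμ
  have h1 : c * unfoldMeas Set.univ = 1 := by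
    have := congrArg (fun m : Measure (XQuot Γℤ) => m Set.univ) (eq_smul_unfoldMeas hc)
    simpa using this.symm
  rw [← lintegral_liftMeas μX h, hc, lintegral_smul_measure, smul_eq_mul]
  calc ∫⁻ g, ψ g ∂haarG = unfoldMeas Set.univ * (c * ∫⁻ g, ψ g ∂haarG) := by
        rw [← mul_assoc, mul_comm (unfoldMeas _), h1, one_mul]
    _ ≤ _ := mul_le_mul_left unfoldMeas_univ_le _

lemma torusRep_coe (t : ℝ) : torusRep (t : T1) = t + ((-⌊t⌋ : ℤ) : ℝ) := by
  have := AddCircle.coe_equivIco_mk_apply (p := (1 : ℝ)) t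
  rw [div_one, mul_one] at this
  rw [torusRep, this, Int.fract]
  push_cast
  ring

section
variable {F : T1 × XQuot Γℤ → ℂ}

lemma liftTX_smul (k : ℤ) (γ : Matrix.SpecialLinearGroup (Fin 2) ℤ) (t : ℝ) (g : SL2R) :
    liftTX Γℤ F (t + k, zSL γ * g) = liftTX Γℤ F (t, g) := by
  have : ((t + k : ℝ) : T1) = t := by
    rw [AddCircle.coe_add, ← zsmul_one (k : ℤ), AddCircle.coe_zsmul, AddCircle.coe_period, smul_zero,
      add_zero]
  simp only [liftTX, XProj_zSL_mul, this]

lemma wordOp_smul (w : List (Fin 4)) (k : ℤ) (γ : Matrix.SpecialLinearGroup (Fin 2) ℤ) (t : ℝ)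
    (g : SL2R) : wordOp w (liftTX Γℤ F) (t + k, zSL γ * g) = wordOp w (liftTX Γℤ F) (t, g) := by
  induction w generalizing t g with
  | nil => exact liftTX_smul k γ t g
  | cons i w ih =>
    change pOp i _ _ = pOp i _ _
    rw [pOp_eq, pOp_eq]
    congr 1
    funext s
    have : pPath i (t + k, zSL γ * g) s =
        ((pPath i (t, g) s).1 + k, zSL γ * (pPath i (t, g) s).2) := by
      refine Fin.cases ?_ (fun j => ?_) i
      · exact Prod.ext (add_right_comm _ _ _) rfl
      · exact Prod.ext rfl (mul_assoc _ _ _)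
    rw [this]
    exact ih _ _

lemma wordOp_rep (w : List (Fin 4)) (t : ℝ) (g : SL2R) :
    wordOp w (liftTX Γℤ F) (torusRep (t : T1), (XProj Γℤ g).out) = wordOp w (liftTX Γℤ F) (t, g) := by
  obtain ⟨γ, h⟩ := out_XProj g
  rw [h, torusRep_coe, wordOp_smul]

/-- The projection `ℝ × SL₂(ℝ) → 𝕋 × X`. -/
def projTX (p : ℝ × SL2R) : T1 × XQuot Γℤ := ((p.1 : T1), XProj Γℤ p.2)

lemma projTX_rep (q : T1 × XQuot Γℤ) : projTX (torusRep q.1, q.2.out) = q :=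
  Prod.ext (AddCircle.coe_equivIco) (XProj_out q.2)

lemma continuous_projTX : Continuous projTX :=
  ((AddCircle.continuous_mk' 1).comp continuous_fst).prodMk
    (continuous_quotient_mk'.comp continuous_snd)

lemma isOpenMap_projTX : IsOpenMap projTX := by
  have h1 : IsOpenMap fun t : ℝ => (t : T1) := QuotientAddGroup.isOpenMap_coe
  have h2 : IsOpenMap (XProj Γℤ) := by
    intro U hU
    have : XProj Γℤ ⁻¹' (XProj Γℤ '' U) = ⋃ γ, (fun g => zSL γ * g) ⁻¹' U := by
      ext g
      simp only [Set.mem_preimage, Set.mem_image, Set.mem_iUnion]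
      constructor
      · rintro ⟨h, hh, he⟩
        obtain ⟨γ, hγ⟩ := QuotientGroup.rightRel_apply.1 (Quotient.exact he)
        refine ⟨γ⁻¹, ?_⟩
        have e : zSL γ = g * h⁻¹ := hγ
        rw [zSL_inv, e]
        simpa using hh
      · rintro ⟨γ, hγ⟩
        exact ⟨_, hγ, XProj_zSL_mul _ _⟩
    refine isOpen_coinduced.2 ?_
    change IsOpen (XProj Γℤ ⁻¹' (XProj Γℤ '' U))
    rw [this]
    exact isOpen_iUnion fun γ => hU.preimage (continuous_SL2R_mul continuous_const continuous_id)
  exact h1.prodMap h2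

lemma wordOp_eq_zero (w : List (Fin 4)) {p : ℝ × SL2R} (hp : projTX p ∉ tsupport F) :
    wordOp w (liftTX Γℤ F) p = 0 := by
  induction w generalizing p with
  | nil => exact image_eq_zero_of_notMem_tsupport (f := F) hp
  | cons i w ih =>
    change pOp i _ _ = 0
    rw [pOp_eq]
    have ho : IsOpen {s : ℝ | projTX (pPath i p s) ∉ tsupport F} :=
      (isClosed_tsupport F).isOpen_compl.preimage (continuous_projTX.comp (continuous_pPath i p))
    have : (fun s => wordOp w (liftTX Γℤ F) (pPath i p s)) =ᶠ[nhds 0] fun _ => 0 := by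
      filter_upwards [ho.mem_nhds (by rwa [Set.mem_ofPred_eq, pPath_zero])] with s hs
      exact ih hs
    rw [this.deriv_eq, deriv_const]

lemma exists_bound (hF : HasCompactSupport F) (hG : IsSmoothTX (liftTX Γℤ F)) (w : List (Fin 4)) :
    ∃ B : ℝ, ∀ q : T1 × XQuot Γℤ,
      (1 + htX Γℤ q.2) ^ 10 * ‖wordOp w (liftTX Γℤ F) (torusRep q.1, q.2.out)‖ ^ 2 ≤ B := by
  let N : ℝ × SL2R → ℝ := fun p => (1 + 4 * (∑ i, ∑ j, |p.2.1 i j|) ^ 2) ^ 10 *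
    ‖wordOp w (liftTX Γℤ F) p‖ ^ 2
  have hN : Continuous N := by
    have h1 : Continuous fun p : ℝ × SL2R => ∑ i, ∑ j, |p.2.1 i j| :=
      continuous_finsetSum _ fun i _ => continuous_finsetSum _ fun j _ =>
        ((continuous_entry i j).comp continuous_snd).abs
    exact (((h1.pow 2).const_mul 4).const_add 1 |>.pow 10).mul ((hG w).1.norm.pow 2)
  obtain ⟨B, hB⟩ : ∃ B : ℕ, tsupport F ⊆ projTX '' {p | N p < B} := by
    refine hF.isCompact.elim_directed_cover (fun B : ℕ => projTX '' {p | N p < B})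
      (fun B => isOpenMap_projTX _ (isOpen_lt hN continuous_const)) ?_ ?_
    · intro q _
      obtain ⟨B, hB⟩ := exists_nat_gt (N (torusRep q.1, q.2.out))
      exact Set.mem_iUnion.2 ⟨B, _, hB, projTX_rep q⟩
    · refine Monotone.directed_le fun B B' hBB => Set.image_mono fun p hp => ?_
      exact lt_of_lt_of_le (show N p < B from hp) (by exact_mod_cast hBB)
  refine ⟨B, fun q => ?_⟩
  by_cases hq : q ∈ tsupport F
  · obtain ⟨p, hp, rfl⟩ := hB hq
    have h1 : matSup p.2.1 ≤ ∑ i, ∑ j, |p.2.1 i j| := by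
      simp only [Fin.sum_univ_two, matSup_le_iff]
      refine ⟨?_, ?_, ?_, ?_⟩ <;>
        linarith [abs_nonneg (p.2.1 0 0), abs_nonneg (p.2.1 0 1), abs_nonneg (p.2.1 1 0),
          abs_nonneg (p.2.1 1 1)]
    have h2 : htX Γℤ (projTX p).2 ≤ 4 * (∑ i, ∑ j, |p.2.1 i j|) ^ 2 := by
      refine (htX_XProj p.2).trans_le ((htG_le _).trans ?_)
      have := pow_le_pow_left₀ (matSup_nonneg p.2.1) h1 2
      linarith
    have h3 : 0 ≤ htX Γℤ (projTX p).2 := (htG_nonneg _).trans_eq (htX_XProj p.2).symm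
    refine le_trans ?_ (show N p < B from hp).le
    have h4 : wordOp w (liftTX Γℤ F) (torusRep (projTX p).1, (projTX p).2.out) =
      wordOp w (liftTX Γℤ F) p := wordOp_rep w p.1 p.2
    rw [h4]
    exact mul_le_mul_of_nonneg_right (pow_le_pow_left₀ (by linarith) (by linarith) 10) (by positivity)
  · rw [wordOp_eq_zero w (by rwa [projTX_rep]), norm_zero]
    simp

lemma wordOp_out (w : List (Fin 4)) (t : ℝ) (g : SL2R) :
    wordOp w (liftTX Γℤ F) (t, (XProj Γℤ g).out) = wordOp w (liftTX Γℤ F) (t, g) := by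
  obtain ⟨γ, h⟩ := out_XProj g
  have := wordOp_smul (F := F) w 0 γ t g
  rwa [Int.cast_zero, add_zero, ← h] at this

lemma wordOp_torusRep (w : List (Fin 4)) (t : ℝ) (g : SL2R) :
    wordOp w (liftTX Γℤ F) (torusRep (t : T1), g) = wordOp w (liftTX Γℤ F) (t, g) := by
  rw [← wordOp_out, wordOp_rep]

lemma measurable_wordOp_rep (hG : IsSmoothTX (liftTX Γℤ F)) (w : List (Fin 4)) :
    Measurable fun q : T1 × XQuot Γℤ => wordOp w (liftTX Γℤ F) (torusRep q.1, q.2.out) := by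
  refine measurable_uncurry_of_continuous_of_measurable
    (u := fun (θ : T1) (x : XQuot Γℤ) => wordOp w (liftTX Γℤ F) (torusRep θ, x.out)) (fun x => ?_)
    fun θ => ?_
  · refine (QuotientAddGroup.isQuotientMap_mk _).continuous_iff.2 ?_
    change Continuous fun t : ℝ => wordOp w (liftTX Γℤ F) (torusRep (t : T1), x.out)
    simp only [wordOp_torusRep]
    exact (hG w).1.comp (continuous_id.prodMk continuous_const)
  · refine measurable_of_comp_XProj ?_
    simp only [wordOp_out]
    exact ((hG w).1.comp (continuous_const.prodMk continuous_id)).measurable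

lemma energy_smul (k : ℕ) (m : ℤ) (γ : Matrix.SpecialLinearGroup (Fin 2) ℤ) (t : ℝ) (g : SL2R) :
    energy (liftTX Γℤ F) k (t + m, zSL γ * g) = energy (liftTX Γℤ F) k (t, g) := by
  simp only [energy, wordOp_smul]

lemma energy_torusRep (k : ℕ) (t : ℝ) (g : SL2R) :
    energy (liftTX Γℤ F) k (torusRep (t : T1), g) = energy (liftTX Γℤ F) k (t, g) := by
  simp only [energy, wordOp_torusRep]

lemma measurable_torusRep : Measurable torusRep :=
  measurable_subtype_coe.comp (AddCircle.measurableEquivIco 1 0).measurable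

/-- The energy averaged over the circle. -/
def energyT (F : T1 × XQuot Γℤ → ℂ) (g : SL2R) : ENNReal :=
  ∫⁻ θ : T1, energy (liftTX Γℤ F) 5 (torusRep θ, g)

lemma measurable_energyT (hG : IsSmoothTX (liftTX Γℤ F)) : Measurable (energyT F) :=
  Measurable.lintegral_prod_right' (f := fun p : SL2R × T1 =>
    energy (liftTX Γℤ F) 5 (torusRep p.2, p.1)) ((measurable_energy hG 5).comp
      ((measurable_torusRep.comp measurable_snd).prodMk measurable_fst))

lemma energyT_zSL_mul (γ : Matrix.SpecialLinearGroup (Fin 2) ℤ) (g : SL2R) :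
    energyT F (zSL γ * g) = energyT F g := by
  refine lintegral_congr fun θ => ?_
  have := energy_smul (F := F) 5 0 γ (torusRep θ) g
  rwa [Int.cast_zero, add_zero] at this

lemma lintegral_energy_eq (t₀ : ℝ) (g : SL2R) :
    ∫⁻ τ in Set.Icc (0 : ℝ) 1, energy (liftTX Γℤ F) 5 (t₀ + τ, g) = energyT F g := by
  have h := AddCircle.lintegral_preimage (1 : ℝ) t₀
    fun θ : T1 => energy (liftTX Γℤ F) 5 (torusRep θ, g)
  simp only [energy_torusRep] at h
  rw [energyT, ← h, restrict_Ioc_eq_restrict_Icc, ← lintegral_indicator measurableSet_Icc,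
    ← lintegral_indicator measurableSet_Icc]
  refine Eq.trans (lintegral_congr fun τ => ?_) (lintegral_add_left_eq_self _ t₀)
  by_cases hτ : τ ∈ Set.Icc (0 : ℝ) 1
  · rw [Set.indicator_of_mem hτ,
      Set.indicator_of_mem (by exact ⟨by linarith [hτ.1], by linarith [hτ.2]⟩)]
  · rw [Set.indicator_of_notMem hτ,
      Set.indicator_of_notMem fun h => hτ ⟨by linarith [h.1], by linarith [h.2]⟩]

lemma ofReal_sobTX_sq {μX : Measure (XQuot Γℤ)} [IsProbabilityMeasure μX]
    (hF : HasCompactSupport F) (hG : IsSmoothTX (liftTX Γℤ F)) :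
    ENNReal.ofReal (sobTX Γℤ μX 5 F ^ 2) =
      ∫⁻ x, ENNReal.ofReal ((1 + htX Γℤ x) ^ 10) * energyT F x.out ∂μX := by
  have hm := measurable_wordOp_rep hG
  have hw : Measurable fun q : T1 × XQuot Γℤ => (1 + htX Γℤ q.2) ^ 10 :=
    ((measurable_htX.comp measurable_snd).const_add 1).pow_const 10
  have h0 : ∀ x, 0 ≤ htX Γℤ x := fun x => (htG_nonneg _).trans_eq (htX_eq x).symm
  have hnn : ∀ (w : List (Fin 4)) (q : T1 × XQuot Γℤ), 0 ≤ (1 + htX Γℤ q.2) ^ 10 *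
      ‖wordOp w (liftTX Γℤ F) (torusRep q.1, q.2.out)‖ ^ 2 := fun w q => by
    have := h0 q.2
    positivity
  have hms : ∀ w : List (Fin 4), Measurable fun q : T1 × XQuot Γℤ => (1 + htX Γℤ q.2) ^ 10 *
      ‖wordOp w (liftTX Γℤ F) (torusRep q.1, q.2.out)‖ ^ 2 := fun w =>
    hw.mul ((hm w).norm.pow_const 2)
  have hi : ∀ w : List (Fin 4), Integrable (fun q : T1 × XQuot Γℤ => (1 + htX Γℤ q.2) ^ 10 *
      ‖wordOp w (liftTX Γℤ F) (torusRep q.1, q.2.out)‖ ^ 2) ((volume : Measure T1).prod μX) := by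
    intro w
    obtain ⟨B, hB⟩ := exists_bound hF hG w
    refine Integrable.of_bound (hms w).aestronglyMeasurable B (Filter.Eventually.of_forall fun q => ?_)
    rw [Real.norm_of_nonneg (hnn w q)]
    exact hB q
  rw [sobTX, Real.sq_sqrt (Finset.sum_nonneg fun l _ => Finset.sum_nonneg fun w _ =>
      integral_nonneg fun q => hnn _ q),
    ENNReal.ofReal_sum_of_nonneg fun l _ => Finset.sum_nonneg fun w _ => integral_nonneg fun q => hnn _ q]
  have e1 : ∀ x, ENNReal.ofReal ((1 + htX Γℤ x) ^ 10) * energyT F x.out =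
      ∫⁻ θ : T1, ENNReal.ofReal ((1 + htX Γℤ x) ^ 10) *
        energy (liftTX Γℤ F) 5 (torusRep θ, x.out) := fun x =>
    (lintegral_const_mul' _ _ ENNReal.ofReal_ne_top).symm
  have e2 : ∀ q : T1 × XQuot Γℤ, ENNReal.ofReal ((1 + htX Γℤ q.2) ^ 10) *
      energy (liftTX Γℤ F) 5 (torusRep q.1, q.2.out) =
      ∑ l ∈ Finset.range (5 + 1), ∑ w : Fin l → Fin 4, ENNReal.ofReal ((1 + htX Γℤ q.2) ^ 10 *
        ‖wordOp (List.ofFn w) (liftTX Γℤ F) (torusRep q.1, q.2.out)‖ ^ 2) := fun q => by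
    have := h0 q.2
    simp_rw [energy, Finset.mul_sum, ENNReal.ofReal_mul (pow_nonneg (add_nonneg zero_le_one this) 10)]
  have hme : Measurable fun q : T1 × XQuot Γℤ => ENNReal.ofReal ((1 + htX Γℤ q.2) ^ 10) *
      energy (liftTX Γℤ F) 5 (torusRep q.1, q.2.out) := by
    simp_rw [e2]
    exact Finset.measurable_sum _ fun l _ => Finset.measurable_sum _ fun w _ =>
      (hms _).ennreal_ofReal
  simp_rw [e1]
  rw [← lintegral_prod_symm _ hme.aemeasurable]
  simp_rw [e2]
  rw [lintegral_finsetSum _ fun l _ => Finset.measurable_sum _ fun w _ => (hms _).ennreal_ofReal]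
  refine Finset.sum_congr rfl fun l _ => ?_
  rw [lintegral_finsetSum _ fun w _ => (hms _).ennreal_ofReal,
    ENNReal.ofReal_sum_of_nonneg fun w _ => integral_nonneg fun q => hnn _ q]
  refine Finset.sum_congr rfl fun w _ => ?_
  rw [← ofReal_integral_eq_lintegral_ofReal (hi _) (Filter.Eventually.of_forall fun q => hnn _ q)]

end

/-- A compact piece of the Siegel set, where the bottom row has size `√Q`. -/
def siegelPiece (Q : ℝ) : Set SL2R :=
  ballG (8 * √(2 / Q)) ∩ {h | h.1 1 0 ^ 2 + h.1 1 1 ^ 2 ≤ 64 * Q}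

lemma measurableSet_siegelPiece (Q : ℝ) : MeasurableSet (siegelPiece Q) :=
  (measurableSet_ballG _).inter (measurableSet_le
    (((measurable_entry 1 0).pow_const 2).add ((measurable_entry 1 1).pow_const 2)) measurable_const)

lemma sq_add_sq_pos (g : SL2R) : 0 < g.1 1 0 ^ 2 + g.1 1 1 ^ 2 := by
  have h := SL2R_det g
  by_contra! hc
  have h0 : g.1 1 0 = 0 := by nlinarith [sq_nonneg (g.1 1 0), sq_nonneg (g.1 1 1)]
  have h1 : g.1 1 1 = 0 := by nlinarith [sq_nonneg (g.1 1 0), sq_nonneg (g.1 1 1)]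
  rw [h0, h1] at h
  simp at h

lemma chart_mem_siegelPiece {g : SL2R} {Q : ℝ} (hQ : g.1 1 0 ^ 2 + g.1 1 1 ^ 2 = Q) (h43 : Q ≤ 4 / 3)
    (hr : |g.1 0 0 * g.1 1 0 + g.1 0 1 * g.1 1 1| ≤ 1 / 2 * Q) {r s t : ℝ}
    (h1 : r ∈ Set.Icc (0 : ℝ) 1) (h2 : s ∈ Set.Icc (0 : ℝ) 1) (h3 : t ∈ Set.Icc (0 : ℝ) 1) :
    chart g r s t ∈ siegelPiece Q := by
  have hQ0 : 0 < Q := hQ ▸ sq_add_sq_pos g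
  have hd := SL2R_det g
  have hS : (g.1 0 0 * g.1 1 0 + g.1 0 1 * g.1 1 1) ^ 2 ≤ 1 := by
    rw [← sq_abs]
    nlinarith [abs_nonneg (g.1 0 0 * g.1 1 0 + g.1 0 1 * g.1 1 1)]
  have hPQ : (g.1 0 0 ^ 2 + g.1 0 1 ^ 2) * Q ≤ 2 := by
    rw [← hQ]
    nlinarith
  have hg : matSup g.1 ≤ √(2 / Q) := by
    have e0 : g.1 0 0 ^ 2 + g.1 0 1 ^ 2 ≤ 2 / Q := by rwa [le_div_iff₀ hQ0]
    have e1 : Q ≤ 2 / Q := by rw [le_div_iff₀ hQ0]; nlinarith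
    rw [matSup_le_iff]
    refine ⟨Real.abs_le_sqrt ?_, Real.abs_le_sqrt ?_, Real.abs_le_sqrt ?_, Real.abs_le_sqrt ?_⟩ <;>
      nlinarith [sq_nonneg (g.1 0 0), sq_nonneg (g.1 0 1), sq_nonneg (g.1 1 0), sq_nonneg (g.1 1 1)]
  set k : SL2R := vElt r * hElt s * uElt t with hk
  have hc : chart g r s t = g * k := by simp only [chart, hk, mul_assoc]
  have he1 : Real.exp (-s) ≤ 1 := Real.exp_le_one_iff.2 (by linarith [h2.1])
  have he0 := Real.exp_pos (-s)
  have he2 : Real.exp s ≤ 3 := (Real.exp_le_exp.2 h2.2).trans (by linarith [Real.exp_one_lt_d9])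
  have he3 := Real.exp_pos s
  have hks : matSup k.1 ≤ 4 := by
    have a1 : 0 ≤ r * Real.exp (-s) := mul_nonneg h1.1 he0.le
    have a2 : r * Real.exp (-s) ≤ 1 := mul_le_one₀ h1.2 he0.le he1
    have a3 : 0 ≤ Real.exp (-s) * t := mul_nonneg he0.le h3.1
    have a4 : Real.exp (-s) * t ≤ 1 := mul_le_one₀ he1 h3.1 h3.2
    have a5 : 0 ≤ r * Real.exp (-s) * t := mul_nonneg a1 h3.1
    have a6 : r * Real.exp (-s) * t ≤ 1 := mul_le_one₀ a2 h3.1 h3.2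
    rw [matSup_le_iff]
    simp only [hk, mul_apply2, u_00, u_01, u_10, u_11, v_00, v_01, v_10, v_11,
      h_00, h_01, h_10, h_11, one_mul, mul_one, mul_zero, zero_mul, add_zero, zero_add]
    refine ⟨?_, ?_, ?_, ?_⟩ <;> rw [abs_le] <;> constructor <;> linarith
  rw [hc]
  constructor
  · refine (matSup_mul_le _ _).trans ?_
    have := matSup_nonneg k.1
    have := Real.sqrt_nonneg (2 / Q)
    nlinarith [matSup_nonneg g.1]
  · have hb : ∀ i j, k.1 i j ^ 2 ≤ 16 := fun i j => by
      have := (abs_le_matSup k.1 i j).trans hks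
      rw [← sq_abs]
      nlinarith [abs_nonneg (k.1 i j)]
    change (g * k).1 1 0 ^ 2 + (g * k).1 1 1 ^ 2 ≤ 64 * Q
    have cs : ∀ a b x y : ℝ, x ^ 2 ≤ 16 → y ^ 2 ≤ 16 → (a * x + b * y) ^ 2 ≤ 32 * (a ^ 2 + b ^ 2) := by
      intro a b x y hx hy
      nlinarith [sq_nonneg (a * y - b * x), mul_nonneg (add_nonneg (sq_nonneg a) (sq_nonneg b))
        (sub_nonneg.2 (add_le_add hx hy))]
    have c0 := cs (g.1 1 0) (g.1 1 1) _ _ (hb 0 0) (hb 1 0)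
    have c1 := cs (g.1 1 0) (g.1 1 1) _ _ (hb 0 1) (hb 1 1)
    rw [mul_apply2 g k 1 0, mul_apply2 g k 1 1]
    rw [hQ] at c0 c1
    exact (add_le_add c0 c1).trans (by linarith)

lemma perG_siegelPiece_le {Q : ℝ} (hQ0 : 0 < Q) (h43 : Q ≤ 4 / 3) (g : SL2R) :
    perG ((siegelPiece Q).indicator 1) g ≤ ENNReal.ofReal (33024 ^ 4 * (1 + htG g) ^ 10) := by
  by_cases h : ∃ γ, zSL γ * g ∈ siegelPiece Q
  · obtain ⟨γ, hγ⟩ := h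
    have h1 := inv_le_htG (zSL γ * g)
    rw [htG_zSL_mul] at h1
    have h2 : (zSL γ * g).1 1 0 ^ 2 + (zSL γ * g).1 1 1 ^ 2 ≤ 64 * Q := hγ.2
    have h3 : Q⁻¹ ≤ 64 * htG g := by
      have := (inv_anti₀ (sq_add_sq_pos (zSL γ * g)) h2).trans h1
      rw [mul_inv] at this
      linarith
    have h4 : perG ((siegelPiece Q).indicator 1) g ≤
        perG ((ballG (8 * √(2 / Q))).indicator 1) g :=
      ENNReal.tsum_le_tsum fun γ => Set.indicator_le_indicator_of_subset Set.inter_subset_left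
        (fun _ => zero_le) _
    refine h4.trans ((perG_ballG_le (by positivity) g).trans (ENNReal.ofReal_le_ofReal ?_))
    have h5 : (8 * √(2 / Q)) ^ 2 = 128 * Q⁻¹ := by
      rw [mul_pow, Real.sq_sqrt (by positivity)]
      ring
    have h6 : 1 ≤ 4 / 3 * Q⁻¹ := by
      rw [← div_eq_mul_inv, le_div_iff₀ hQ0]
      linarith
    have h0 := htG_nonneg g
    rw [h5]
    calc (4 * (128 * Q⁻¹) + 3) ^ 4 ≤ (33024 * (1 + htG g)) ^ 4 :=
          pow_le_pow_left₀ (by positivity) (by linarith) 4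
      _ = 33024 ^ 4 * (1 + htG g) ^ 4 := mul_pow _ _ _
      _ ≤ _ := mul_le_mul_of_nonneg_left (pow_le_pow_right₀ (by linarith) (by norm_num)) (by positivity)
  · push Not at h
    have : perG ((siegelPiece Q).indicator 1) g = 0 :=
      ENNReal.tsum_eq_zero.2 fun γ => Set.indicator_of_notMem (h γ) _
    rw [this]
    exact zero_le

section
variable {F : T1 × XQuot Γℤ → ℂ}

lemma energy_one_le_sobTX {μX : Measure (XQuot Γℤ)} [IsProbabilityMeasure μX]
    (hμ : ∀ g : SL2R, Measure.map (rightT Γℤ g) μX = μX)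
    (hF : HasCompactSupport F) (hG : IsSmoothTX (liftTX Γℤ F)) (t₀ : ℝ) (g : SL2R) :
    energy (liftTX Γℤ F) 1 (t₀, g) ≤
      ENNReal.ofReal (10 ^ 24 * sobTX Γℤ μX 5 F ^ 2) := by
  obtain ⟨γ, h43, hr⟩ := exists_reduced g
  have e0 := energy_smul (F := F) 1 0 γ t₀ g
  rw [Int.cast_zero, add_zero] at e0
  rw [← e0]
  set g' := zSL γ * g
  set Q := g'.1 1 0 ^ 2 + g'.1 1 1 ^ 2 with hQ
  have hQ0 : 0 < Q := sq_add_sq_pos g'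
  have hm : Measurable ((siegelPiece Q).indicator (energyT F)) :=
    (measurable_energyT hG).indicator (measurableSet_siegelPiece Q)
  have h1 : energy (liftTX Γℤ F) 1 (t₀, g') ≤ 256 * ∫⁻ r in Set.Icc (0 : ℝ) 1,
      ∫⁻ s in Set.Icc (0 : ℝ) 1, ∫⁻ t in Set.Icc (0 : ℝ) 1,
        (siegelPiece Q).indicator (energyT F) (chart g' r s t) := by
    refine (energy_one_le hG t₀ g').trans (mul_le_mul_right ?_ _)
    refine setLIntegral_mono' measurableSet_Icc fun r h1 => ?_
    refine setLIntegral_mono' measurableSet_Icc fun s h2 => ?_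
    refine setLIntegral_mono' measurableSet_Icc fun t h3 => ?_
    rw [lintegral_energy_eq, Set.indicator_of_mem (chart_mem_siegelPiece hQ.symm h43 hr h1 h2 h3)]
  have h2 : ∀ x : XQuot Γℤ, perG ((siegelPiece Q).indicator (energyT F)) x.out ≤
      ENNReal.ofReal (33024 ^ 4) * (ENNReal.ofReal ((1 + htX Γℤ x) ^ 10) * energyT F x.out) := by
    intro x
    have e1 : perG ((siegelPiece Q).indicator (energyT F)) x.out =
        perG ((siegelPiece Q).indicator 1) x.out * energyT F x.out := by
      rw [perG, perG, ← ENNReal.tsum_mul_right]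
      refine tsum_congr fun γ => ?_
      by_cases h : zSL γ * x.out ∈ siegelPiece Q
      · rw [Set.indicator_of_mem h, Set.indicator_of_mem h, Pi.one_apply, one_mul, energyT_zSL_mul]
      · rw [Set.indicator_of_notMem h, Set.indicator_of_notMem h, zero_mul]
    rw [e1, ← mul_assoc, ← ENNReal.ofReal_mul (by norm_num), htX_eq]
    exact mul_le_mul_left (perG_siegelPiece_le hQ0 h43 _) _
  refine h1.trans ((mul_le_mul_right ((lintegral_chart_le g' hm).trans (mul_le_mul_right
    ((lintegral_haarG_le hμ hm).trans (mul_le_mul_right (lintegral_mono h2) _)) _)) _).trans ?_)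
  rw [lintegral_const_mul' _ _ ENNReal.ofReal_ne_top, ← ofReal_sobTX_sq hF hG,
    ← ENNReal.ofReal_mul (by norm_num), show (36 : ENNReal) = ENNReal.ofReal 36 by norm_num,
    show (256 : ENNReal) = ENNReal.ofReal 256 by norm_num, ← ENNReal.ofReal_mul (by norm_num),
    ← ENNReal.ofReal_mul (by positivity), ← ENNReal.ofReal_mul (by norm_num)]
  refine ENNReal.ofReal_le_ofReal ?_
  have he : Real.exp 2 ≤ 9 := by
    rw [show (2 : ℝ) = 1 + 1 by norm_num, Real.exp_add]
    nlinarith [Real.exp_one_lt_d9, Real.exp_pos 1]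
  have hS := sq_nonneg (sobTX Γℤ μX 5 F)
  generalize sobTX Γℤ μX 5 F ^ 2 = S at hS ⊢
  have : Real.exp 2 * S ≤ 9 * S := mul_le_mul_of_nonneg_right he hS
  linarith

lemma norm_wordOp_le_sobTX {μX : Measure (XQuot Γℤ)} [IsProbabilityMeasure μX]
    (hμ : ∀ g : SL2R, Measure.map (rightT Γℤ g) μX = μX)
    (hF : HasCompactSupport F) (hG : IsSmoothTX (liftTX Γℤ F)) {w : List (Fin 4)}
    (hw : w.length ≤ 1) (p : ℝ × SL2R) :
    ‖wordOp w (liftTX Γℤ F) p‖ ≤ 10 ^ 12 * sobTX Γℤ μX 5 F := by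
  have h1 : ENNReal.ofReal (‖wordOp w (liftTX Γℤ F) p‖ ^ 2) ≤ energy (liftTX Γℤ F) 1 p := by
    have h := Finset.single_le_sum (f := fun v : Fin w.length → Fin 4 =>
      ENNReal.ofReal (‖wordOp (List.ofFn v) (liftTX Γℤ F) p‖ ^ 2)) (fun _ _ => zero_le)
      (Finset.mem_univ w.get)
    rw [List.ofFn_get] at h
    refine h.trans (Finset.single_le_sum (f := fun l => ∑ v : Fin l → Fin 4,
      ENNReal.ofReal (‖wordOp (List.ofFn v) (liftTX Γℤ F) p‖ ^ 2)) (fun _ _ => zero_le)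
      (Finset.mem_range.2 (Nat.lt_succ_of_le hw)))
  have h0 : 0 ≤ sobTX Γℤ μX 5 F := Real.sqrt_nonneg _
  have h2 := (ENNReal.ofReal_le_ofReal_iff (by positivity)).1
    (h1.trans (energy_one_le_sobTX hμ hF hG p.1 p.2))
  refine abs_le_of_sq_le_sq' ?_ (by positivity) |>.2
  refine h2.trans_eq ?_
  ring

end

/-! ### Lipschitz bounds and Fourier coefficients in the torus variable -/

lemma norm_pPath_sub_le {G : ℝ × SL2R → ℂ} (hG : IsSmoothTX G) {M : ℝ}
    (hM : ∀ i p, ‖wordOp [i] G p‖ ≤ M) (i : Fin 4) (p : ℝ × SL2R) (s : ℝ) :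
    ‖G (pPath i p s) - G p‖ ≤ M * |s| := by
  have h := Convex.norm_image_sub_le_of_norm_hasDerivWithin_le (s := Set.univ) (x := 0) (y := s)
    (fun t _ => (hG.hasDerivAt [] i p t).hasDerivWithinAt) (fun t _ => hM i (pPath i p t))
    convex_univ trivial trivial
  rwa [pPath_zero, sub_zero, Real.norm_eq_abs] at h

lemma exists_uElt_mul_hElt_mul_vElt (k : SL2R) (hk : matSup (k.1 - 1) ≤ 1 / 4) :
    ∃ x y z : ℝ, k = uElt x * hElt y * vElt z ∧ |x| ≤ 2 * matSup (k.1 - 1) ∧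
      |y| ≤ 2 * matSup (k.1 - 1) ∧ |z| ≤ 2 * matSup (k.1 - 1) := by
  have h01 : |k.1 0 1| ≤ matSup (k.1 - 1) := by simpa using abs_le_matSup (k.1 - 1) 0 1
  have h10 : |k.1 1 0| ≤ matSup (k.1 - 1) := by simpa using abs_le_matSup (k.1 - 1) 1 0
  have h11 : |k.1 1 1 - 1| ≤ matSup (k.1 - 1) := by simpa using abs_le_matSup (k.1 - 1) 1 1
  have hd := SL2R_det k
  set δ := matSup (k.1 - 1)
  have hδ : 0 ≤ δ := (abs_nonneg _).trans h01
  obtain ⟨l, r⟩ := abs_le.1 h11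
  have hs : 1 / 2 ≤ k.1 1 1 := by linarith
  have hs0 : 0 < k.1 1 1 := by linarith
  have hdiv : ∀ q : ℝ, |q| ≤ δ → |q / k.1 1 1| ≤ 2 * δ := fun q hq => by
    rw [abs_div, abs_of_pos hs0, div_le_iff₀ hs0]
    nlinarith
  refine ⟨k.1 0 1 / k.1 1 1, Real.log (k.1 1 1), k.1 1 0 / k.1 1 1, ?_, hdiv _ h01, ?_, hdiv _ h10⟩
  · apply SL2R_ext <;> simp only [mul_apply2, u_00, u_01, u_10, u_11, h_00, h_01, h_10, h_11,
      v_00, v_01, v_10, v_11, Real.exp_neg, Real.exp_log hs0] <;> field_simp <;> linarith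
  · have hlog := Real.one_sub_inv_le_log_of_pos hs0
    have hlog2 := Real.log_le_sub_one_of_pos hs0
    have hinv : (k.1 1 1)⁻¹ ≤ 1 + 2 * δ := by
      rw [inv_le_iff_one_le_mul₀ hs0]
      nlinarith
    rw [abs_le]
    constructor <;> linarith

lemma norm_mul_sub_le {G : ℝ × SL2R → ℂ} (hG : IsSmoothTX G) {M : ℝ}
    (hM : ∀ w : List (Fin 4), w.length ≤ 1 → ∀ p, ‖wordOp w G p‖ ≤ M) (t : ℝ) (g k : SL2R) :
    ‖G (t, g * k) - G (t, g)‖ ≤ 8 * M * matSup (k.1 - 1) := by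
  have h0 : ∀ p, ‖G p‖ ≤ M := hM [] (by simp)
  have hM0 : 0 ≤ M := (norm_nonneg _).trans (h0 (0, 1))
  rcases le_total (matSup (k.1 - 1)) (1 / 4) with hk | hk
  · obtain ⟨x, y, z, e, hx, hy, hz⟩ := exists_uElt_mul_hElt_mul_vElt k hk
    have hp := norm_pPath_sub_le hG (M := M) fun i p => hM [i] (by simp) p
    have e1 : ‖G (t, g * uElt x) - G (t, g)‖ ≤ M * |x| := hp (Fin.succ 1) (t, g) x
    have e2 : ‖G (t, g * uElt x * hElt y) - G (t, g * uElt x)‖ ≤ M * |y| :=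
      hp (Fin.succ 0) (t, g * uElt x) y
    have e3 : ‖G (t, g * uElt x * hElt y * vElt z) - G (t, g * uElt x * hElt y)‖ ≤ M * |z| :=
      hp (Fin.succ 2) (t, g * uElt x * hElt y) z
    have e4 : g * k = g * uElt x * hElt y * vElt z := by rw [e]; simp only [mul_assoc]
    rw [e4]
    have h1 := norm_sub_le_norm_sub_add_norm_sub (G (t, g * uElt x * hElt y * vElt z))
      (G (t, g * uElt x * hElt y)) (G (t, g))
    have h2 := norm_sub_le_norm_sub_add_norm_sub (G (t, g * uElt x * hElt y))
      (G (t, g * uElt x)) (G (t, g))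
    have := mul_le_mul_of_nonneg_left hx hM0
    have := mul_le_mul_of_nonneg_left hy hM0
    have := mul_le_mul_of_nonneg_left hz hM0
    have := mul_nonneg hM0 (matSup_nonneg (k.1 - 1))
    linarith
  · refine (norm_sub_le _ _).trans ?_
    have := mul_le_mul_of_nonneg_left hk hM0
    linarith [h0 (t, g * k), h0 (t, g)]

/-- The `m`-th Fourier coefficient in the torus variable. -/
def torusCoeff (G : ℝ × SL2R → ℂ) (m : ℤ) (g : SL2R) : ℂ :=
  ∫ t in (0 : ℝ)..1, G (t, g) * eR (-(m * t))

lemma norm_torusCoeff_le {G : ℝ × SL2R → ℂ} {M : ℝ} (hM : ∀ p, ‖G p‖ ≤ M) (m : ℤ) (g : SL2R) :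
    ‖torusCoeff G m g‖ ≤ M :=
  norm_fourier_le (fun t => hM (t, g)) m

lemma torusCoeff_sub {G : ℝ × SL2R → ℂ} (hG : Continuous G) (m : ℤ) (g g' : SL2R) :
    torusCoeff G m g - torusCoeff G m g' =
      torusCoeff (fun p => G (p.1, g) - G (p.1, g')) m 1 := by
  have hc (g : SL2R) : IntervalIntegrable (fun t => G (t, g) * eR (-(m * t))) volume 0 1 := by
    have := continuous_eR
    have : Continuous fun t => G (t, g) := hG.comp (continuous_id.prodMk continuous_const)
    exact Continuous.intervalIntegrable (by fun_prop) _ _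
  simp only [torusCoeff, sub_mul]
  rw [intervalIntegral.integral_sub (hc g) (hc g')]

lemma continuous_torusCoeff {G : ℝ × SL2R → ℂ} (hG : Continuous G) (m : ℤ) :
    Continuous (torusCoeff G m) := by
  refine intervalIntegral.continuous_parametric_intervalIntegral_of_continuous'
    (f := fun g t => G (t, g) * eR (-(m * t))) ?_ 0 1
  have := continuous_eR
  have : Continuous fun x : SL2R × ℝ => G (x.2, x.1) := hG.comp continuous_swap
  simp only [Function.uncurry_def]
  fun_prop

lemma invN_torusCoeff {F : T1 × XQuot Γℤ → ℂ} (m : ℤ) : InvN 1 (torusCoeff (liftTX Γℤ F) m) := by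
  intro γ _ g
  have h (t : ℝ) : liftTX Γℤ F (t, zSL γ * g) = liftTX Γℤ F (t, g) := by
    simpa using liftTX_smul (F := F) 0 γ t g
  simp only [torusCoeff, h]

lemma integral_eq_integral_torusCoeff {F : T1 × XQuot Γℤ → ℂ} (hG : IsSmoothTX (liftTX Γℤ F))
    {M : ℝ} (hM : ∀ p, ‖liftTX Γℤ F p‖ ≤ M) (μX : Measure (XQuot Γℤ)) [IsProbabilityMeasure μX] :
    ∫ q, F q ∂((volume : Measure T1).prod μX) =
      ∫ x, torusCoeff (liftTX Γℤ F) 0 x.out ∂μX := by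
  have hrep : F = fun q : T1 × XQuot Γℤ => liftTX Γℤ F (torusRep q.1, q.2.out) := by
    funext q
    exact congrArg F (projTX_rep q).symm
  have hm : Measurable F := by
    rw [hrep]
    exact measurable_wordOp_rep hG []
  have hb (q) : ‖F q‖ ≤ M := by
    rw [hrep]
    exact hM _
  have hi : Integrable F ((volume : Measure T1).prod μX) :=
    Integrable.of_bound hm.aestronglyMeasurable M (Filter.Eventually.of_forall hb)
  rw [integral_prod_symm _ hi]
  refine integral_congr_ae (Filter.Eventually.of_forall fun x => ?_)
  have h := AddCircle.intervalIntegral_preimage 1 0 fun θ : T1 => F (θ, x)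
  simp only [zero_add] at h
  simp only [← h, torusCoeff, Int.cast_zero, zero_mul, neg_zero, eR_zero, mul_one, liftTX, XProj_out]

/-! ### The main estimate -/

lemma exists_scaled_bound (d : ℕ) (hd : 0 < d) : ∃ C κ : ℝ, 1 ≤ C ∧ 0 < κ ∧
    ∀ (f : SL2R → ℂ) (K : ℝ) (m : ℤ) (n a b : ℕ), 0 < n → Nat.Coprime a n → Nat.Coprime b n →
      InvN 1 f → (∀ g, ‖f g‖ ≤ K) → (∀ g k, ‖f (g * k) - f g‖ ≤ K * matSup (k.1 - 1)) →
      |(m : ℝ)| ≤ (n : ℝ) ^ (1 / 2 : ℝ) → (m ≠ 0 ∨ MZ f) →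
      ‖∑ k ∈ (Finset.range n).filter (fun k => Nat.gcd k n = 1),
        eR (m * ((a : ℝ) * (k : ℝ) ^ d / n)) * f (uElt ((b : ℝ) * (k : ℝ) ^ d / n) *
          (aElt (Real.sqrt n))⁻¹)‖ ≤ K * (C * (n : ℝ) ^ (-κ) * n.totient) := by
  obtain ⟨C, κ, hC, hκ, h⟩ := exists_twisted_bound d hd
  refine ⟨C, κ, hC, hκ, fun f K m n a b hn ha hb hi hK hL hm hz => ?_⟩
  have : NeZero n := ⟨hn.ne'⟩
  have hK0 : 0 ≤ K := (norm_nonneg _).trans (hK 1)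
  rcases hK0.eq_or_lt with rfl | hpos
  · have h0 (g) : f g = 0 := norm_le_zero_iff.1 (hK g)
    simp [h0]
  have hKc : (K : ℂ) ≠ 0 := by exact_mod_cast hpos.ne'
  have hn1 : ‖(K : ℂ)⁻¹‖ = K⁻¹ := by rw [norm_inv, Complex.norm_real, Real.norm_of_nonneg hK0]
  have hi' : InvN 1 fun g => (K : ℂ)⁻¹ * f g := fun γ hγ g => by
    simp only [hi γ hγ g]
  have key := h (fun g => (K : ℂ)⁻¹ * f g) m n (ZMod.unitOfCoprime a ha) (ZMod.unitOfCoprime b hb) hi'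
    ⟨fun g => by
      rw [norm_mul, hn1, inv_mul_le_iff₀ hpos, mul_one]
      exact hK g, fun g k => by
      rw [← mul_sub, norm_mul, hn1, inv_mul_le_iff₀ hpos, one_mul]
      exact hL g k⟩ hm (hz.imp_right fun hz k => by
        simp only [Mn_const_mul, intervalIntegral.integral_const_mul, hz k, mul_zero])
  rw [← sum_eq_twisted hi' d m ha hb] at key
  simp only [mul_left_comm _ (K : ℂ)⁻¹, ← Finset.mul_sum] at key
  rwa [norm_mul, hn1, inv_mul_le_iff₀ hpos] at key

/-- The zeroth Fourier coefficient with its mean removed, and the other Fourier coefficients. -/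
def centredCoeff (μX : Measure (XQuot Γℤ)) (F : T1 × XQuot Γℤ → ℂ) (m : ℤ) (g : SL2R) : ℂ :=
  torusCoeff (liftTX Γℤ F) m g -
    if m = 0 then ∫ q, F q ∂((volume : Measure T1).prod μX) else 0

section
variable {F : T1 × XQuot Γℤ → ℂ} {μX : Measure (XQuot Γℤ)} [IsProbabilityMeasure μX] {M : ℝ}
  (hG : IsSmoothTX (liftTX Γℤ F))
  (hM : ∀ w : List (Fin 4), w.length ≤ 1 → ∀ p, ‖wordOp w (liftTX Γℤ F) p‖ ≤ M)

omit [IsProbabilityMeasure μX] in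
lemma invN_centredCoeff (m : ℤ) : InvN 1 (centredCoeff μX F m) := fun γ hγ g => by
  simp only [centredCoeff, invN_torusCoeff m γ hγ g]

include hG hM in
lemma norm_integral_le_of_wordOp : ‖∫ q, F q ∂((volume : Measure T1).prod μX)‖ ≤ M := by
  have hM' : ∀ p, ‖liftTX Γℤ F p‖ ≤ M := hM [] (by simp)
  rw [integral_eq_integral_torusCoeff hG hM']
  simpa using norm_integral_le_of_norm_le_const (μ := μX)
    (Filter.Eventually.of_forall fun x : XQuot Γℤ => norm_torusCoeff_le hM' 0 x.out)

include hG hM in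
lemma norm_centredCoeff_le (m : ℤ) (g : SL2R) : ‖centredCoeff μX F m g‖ ≤ 8 * M := by
  have hM' : ∀ p, ‖liftTX Γℤ F p‖ ≤ M := hM [] (by simp)
  have h0 : 0 ≤ M := (norm_nonneg _).trans (hM' (0, 1))
  refine (norm_sub_le _ _).trans ?_
  have h1 := norm_torusCoeff_le hM' m g
  have h2 := norm_integral_le_of_wordOp (μX := μX) hG hM
  split_ifs
  · linarith
  · rw [norm_zero]
    linarith

omit [IsProbabilityMeasure μX] in
include hG hM in
lemma norm_centredCoeff_mul_sub_le (m : ℤ) (g k : SL2R) :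
    ‖centredCoeff μX F m (g * k) - centredCoeff μX F m g‖ ≤ 8 * M * matSup (k.1 - 1) := by
  rw [centredCoeff, centredCoeff, sub_sub_sub_cancel_right, torusCoeff_sub (G := liftTX Γℤ F) (hG []).1]
  exact norm_torusCoeff_le (fun p => norm_mul_sub_le hG hM p.1 g k) m 1

include hG hM in
lemma mz_centredCoeff (hμ : ∀ g : SL2R, Measure.map (rightT Γℤ g) μX = μX) :
    MZ (centredCoeff μX F 0) := by
  have hM' : ∀ p, ‖liftTX Γℤ F p‖ ≤ M := hM [] (by simp)
  have hm : Measurable (centredCoeff μX F 0) :=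
    (continuous_torusCoeff (hG []).1 0).measurable.sub_const _
  have hb := norm_centredCoeff_le (μX := μX) hG hM 0
  have h0 : 0 ≤ M := (norm_nonneg _).trans (hM' (0, 1))
  have hK : (0 : ℝ) < 8 * M + 1 := by linarith
  have hKc : ((8 * M + 1 : ℝ) : ℂ)⁻¹ ≠ 0 := inv_ne_zero (by exact_mod_cast hK.ne')
  have hI : Integrable (fun x : XQuot Γℤ => torusCoeff (liftTX Γℤ F) 0 x.out) μX :=
    Integrable.of_bound (measurable_apply_out (continuous_torusCoeff (hG []).1 0).measurable
      (invN_torusCoeff 0)).aestronglyMeasurable M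
      (Filter.Eventually.of_forall fun x => norm_torusCoeff_le hM' 0 _)
  have key := mz_of_integral_eq_zero (f := fun g => ((8 * M + 1 : ℝ) : ℂ)⁻¹ * centredCoeff μX F 0 g)
    (hm.const_mul _) (fun g => by
      rw [norm_mul, norm_inv, Complex.norm_real, Real.norm_of_nonneg hK.le, inv_mul_le_iff₀ hK]
      linarith [hb g]) (fun γ hγ g => by simp only [invN_centredCoeff 0 γ hγ g]) hμ (by
      rw [integral_const_mul]
      simp only [centredCoeff, if_true]
      rw [integral_sub hI (integrable_const _), ← integral_eq_integral_torusCoeff hG hM']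
      simp)
  intro k
  have := key k
  simp only [Mn_const_mul, intervalIntegral.integral_const_mul] at this
  exact (mul_eq_zero.1 this).resolve_left hKc

include hG hM in
lemma norm_sum_sub_le (H : ℕ) (hH : 0 < H) {ι : Type*} (s : Finset ι) (θ : ι → ℝ) (y : ι → SL2R)
    {B : ℝ} (hB : ∀ m : ℤ, |(m : ℝ)| ≤ H - 1 →
      ‖∑ k ∈ s, eR (m * θ k) * centredCoeff μX F m (y k)‖ ≤ B) :
    ‖∑ k ∈ s, F ((θ k : T1), XProj Γℤ (y k)) -
      s.card * ∫ q, F q ∂((volume : Measure T1).prod μX)‖ ≤ s.card * (M / Real.sqrt H) + H * B := by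
  set I := ∫ q, F q ∂((volume : Measure T1).prod μX)
  have hHc : (H : ℂ) ≠ 0 := by exact_mod_cast hH.ne'
  have hc (g : SL2R) : Continuous fun τ => liftTX Γℤ F (τ, g) :=
    (hG []).1.comp (continuous_id.prodMk continuous_const)
  set S : (ℤ → SL2R → ℂ) → ι → ℂ := fun c k =>
    (H : ℂ)⁻¹ * ∑ p ∈ box H, eR (freq p * θ k) * c (freq p) (y k) with hS
  have hfej (k : ι) : ‖F ((θ k : T1), XProj Γℤ (y k)) - S (torusCoeff (liftTX Γℤ F)) k‖ ≤
      M / Real.sqrt H := by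
    have h := norm_sub_fejer_le H hH (fun τ => liftTX Γℤ F (τ, y k)) M
      (fun τ => by simp [liftTX]) (fun s t => ?_) (hc _) (θ k)
    · rw [fejer_mean_eq H _ (hc _)] at h
      exact h
    · have := norm_pPath_sub_le hG (M := M) (fun i p => hM [i] (by simp) p) 0 (t, y k) (s - t)
      have e : pPath 0 (t, y k) (s - t) = (s, y k) := by
        change (t + (s - t), y k) = _
        rw [add_sub_cancel]
      rwa [e] at this
  have hdiag : (H : ℂ)⁻¹ * ∑ p ∈ box H, (if freq p = 0 then I else 0) = I := by
    rw [Finset.sum_product, inv_mul_eq_iff_eq_mul₀ hHc]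
    have : ∀ x ∈ Finset.range H, ∑ z ∈ Finset.range H,
        (if freq (x, z) = 0 then I else 0) = I := fun x hx => by
      have e (z : ℕ) : freq (x, z) = 0 ↔ x = z := by simp only [freq]; omega
      simp only [e, Finset.sum_ite_eq, hx, if_true]
    rw [Finset.sum_congr rfl this]
    simp
  have hsplit (k : ι) : S (torusCoeff (liftTX Γℤ F)) k - I = S (centredCoeff μX F) k := by
    conv_lhs => rw [← hdiag]
    rw [← mul_sub, ← Finset.sum_sub_distrib]
    congr 1
    refine Finset.sum_congr rfl fun p _ => ?_
    rw [centredCoeff]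
    split_ifs with h
    · rw [h, Int.cast_zero, zero_mul, eR_zero, one_mul, one_mul]
    · rw [sub_zero, sub_zero]
  have hdec : ∑ k ∈ s, F ((θ k : T1), XProj Γℤ (y k)) - s.card * I =
      ∑ k ∈ s, (F ((θ k : T1), XProj Γℤ (y k)) - S (torusCoeff (liftTX Γℤ F)) k) +
      (H : ℂ)⁻¹ * ∑ p ∈ box H,
        ∑ k ∈ s, eR (freq p * θ k) * centredCoeff μX F (freq p) (y k) := by
    rw [Finset.sum_comm, Finset.mul_sum, ← Finset.sum_add_distrib, ← nsmul_eq_mul,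
      ← Finset.sum_const, ← Finset.sum_sub_distrib]
    refine Finset.sum_congr rfl fun k _ => ?_
    linear_combination hsplit k
  rw [hdec]
  refine (norm_add_le _ _).trans (add_le_add ?_ ?_)
  · refine (norm_sum_le_of_le _ fun k _ => hfej k).trans ?_
    rw [Finset.sum_const, nsmul_eq_mul]
  · have h2 : ‖∑ p ∈ box H, ∑ k ∈ s, eR (freq p * θ k) * centredCoeff μX F (freq p) (y k)‖ ≤
        H * H * B := by
      refine (norm_sum_le_of_le _ fun p hp => hB _ ?_).trans ?_
      · obtain ⟨h1, h2⟩ := Finset.mem_product.1 hp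
        rw [Finset.mem_range] at h1 h2
        have h1' : (p.1 : ℝ) + 1 ≤ H := by exact_mod_cast h1
        have h2' : (p.2 : ℝ) + 1 ≤ H := by exact_mod_cast h2
        push_cast
        rw [abs_le]
        constructor <;> linarith [Nat.cast_nonneg (α := ℝ) p.1, Nat.cast_nonneg (α := ℝ) p.2]
      · rw [Finset.sum_const, Finset.card_product, Finset.card_range, nsmul_eq_mul, Nat.cast_mul]
    have hHr : (0 : ℝ) < H := by exact_mod_cast hH
    rw [norm_mul, norm_inv, Complex.norm_natCast, inv_mul_le_iff₀ hHr, ← mul_assoc]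
    exact h2

end

/-- Fix `d ∈ ℕ+`.  There exist `D ∈ ℕ` and constants `C, κ, η > 0` such
that for all `n, a, b ∈ ℕ+` with `gcd(n, ab) = 1` and every smooth compactly supported
`F : 𝕋 × X → ℂ`,
`|φ(n)⁻¹ ∑_{k ∈ (ℤ/nℤ)ˣ} F(a k^d/n, SL₂(ℤ) u_{b k^d/n} a_{√n}⁻¹) − ∫ F d(m ⊗ μ_X)|
  ≤ C (ab)^η n^{−κ} S_D(F)`. -/
theorem primitive_monomial_points_equidistribute_product (d : ℕ+) :
    ∃ (D : ℕ) (C κ η : ℝ), 0 < C ∧ 0 < κ ∧ 0 < η ∧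
      ∀ (μX : Measure (XQuot Γℤ)), IsProbabilityMeasure μX →
        (∀ g : SL2R, Measure.map (rightT Γℤ g) μX = μX) →
        ∀ (n a b : ℕ+), Nat.gcd (n : ℕ) ((a : ℕ) * (b : ℕ)) = 1 →
          ∀ F : T1 × XQuot Γℤ → ℂ, IsSmoothTX (liftTX Γℤ F) → HasCompactSupport F →
            ‖(Nat.totient (n : ℕ) : ℂ)⁻¹ *
                (∑ k ∈ (Finset.range (n : ℕ)).filter fun k => Nat.gcd k (n : ℕ) = 1,
                  F (((((a : ℕ) : ℝ) * (k : ℝ) ^ (d : ℕ) / ((n : ℕ) : ℝ) : ℝ) : T1),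
                    XProj Γℤ
                      (uElt (((b : ℕ) : ℝ) * (k : ℝ) ^ (d : ℕ) / ((n : ℕ) : ℝ)) *
                        (aElt (Real.sqrt ((n : ℕ) : ℝ)))⁻¹))) -
              ∫ q, F q ∂((volume : Measure T1).prod μX)‖ ≤
            C * (((a : ℕ) : ℝ) * ((b : ℕ) : ℝ)) ^ η * ((n : ℕ) : ℝ) ^ (-κ) *
              sobTX Γℤ μX D F := by
  obtain ⟨C, κ, hC, hκ, hsc⟩ := exists_scaled_bound d d.pos
  set σ : ℝ := min κ 1 / 2 with hσ
  have hσ0 : 0 < σ := by positivity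
  have hσ1 : σ ≤ 1 / 2 := by linarith [min_le_right κ 1]
  have hσκ : 2 * σ ≤ κ := by linarith [min_le_left κ 1]
  refine ⟨5, 17 * C * 10 ^ 12, σ / 2, 1, by positivity, by positivity, one_pos, ?_⟩
  intro μX hp hμ n a b hab F hG hF
  have hn0 : 0 < (n : ℕ) := n.pos
  have hn1 : (1 : ℝ) ≤ (n : ℕ) := by exact_mod_cast hn0
  have hnr : (0 : ℝ) < (n : ℕ) := by linarith
  have ha : Nat.Coprime a n := (Nat.Coprime.coprime_mul_right_right hab).symm
  have hb : Nat.Coprime b n := (Nat.Coprime.coprime_mul_left_right hab).symm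
  have hM : ∀ w : List (Fin 4), w.length ≤ 1 → ∀ p,
      ‖wordOp w (liftTX Γℤ F) p‖ ≤ 10 ^ 12 * sobTX Γℤ μX 5 F :=
    fun w hw p => norm_wordOp_le_sobTX hμ hF hG hw p
  set M : ℝ := 10 ^ 12 * sobTX Γℤ μX 5 F with hMdef
  have hM0 : 0 ≤ M := (norm_nonneg _).trans (hM [] (by simp) (0, 1))
  set x : ℝ := ((n : ℕ) : ℝ) ^ σ with hx
  have hx1 : 1 ≤ x := Real.one_le_rpow hn1 hσ0.le
  set H : ℕ := ⌈x⌉₊ with hH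
  have hHx : x ≤ H := Nat.le_ceil x
  have hHx2 : (H : ℝ) < x + 1 := Nat.ceil_lt_add_one (by linarith)
  have hH0 : 0 < H := Nat.ceil_pos.2 (by linarith)
  have hcard : ((Finset.range (n : ℕ)).filter fun k => Nat.gcd k n = 1).card = Nat.totient n := by
    rw [Nat.totient]
    congr 1
    refine Finset.filter_congr fun k _ => ?_
    rw [Nat.gcd_comm, Nat.Coprime]
  have key := norm_sum_sub_le (μX := μX) hG hM H hH0
    ((Finset.range (n : ℕ)).filter fun k => Nat.gcd k n = 1)
    (fun k => ((a : ℕ) : ℝ) * (k : ℝ) ^ (d : ℕ) / ((n : ℕ) : ℝ))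
    (fun k => uElt (((b : ℕ) : ℝ) * (k : ℝ) ^ (d : ℕ) / ((n : ℕ) : ℝ)) *
      (aElt (Real.sqrt ((n : ℕ) : ℝ)))⁻¹)
    (B := 8 * M * (C * ((n : ℕ) : ℝ) ^ (-κ) * (n : ℕ).totient)) fun m hm => by
      refine hsc (centredCoeff μX F m) (8 * M) m n a b hn0 ha hb (invN_centredCoeff m)
        (norm_centredCoeff_le hG hM m) (norm_centredCoeff_mul_sub_le hG hM m) ?_ ?_
      · have : x ≤ ((n : ℕ) : ℝ) ^ (1 / 2 : ℝ) := Real.rpow_le_rpow_of_exponent_le hn1 hσ1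
        linarith
      · rcases eq_or_ne m 0 with rfl | h
        · exact Or.inr (mz_centredCoeff hG hM hμ)
        · exact Or.inl h
  rw [hcard] at key
  have ht : (0 : ℝ) < (n : ℕ).totient := by exact_mod_cast Nat.totient_pos.2 hn0
  have htc : ((n : ℕ).totient : ℂ) ≠ 0 := by exact_mod_cast ht.ne'
  set S : ℂ := ∑ k ∈ (Finset.range (n : ℕ)).filter fun k => Nat.gcd k (n : ℕ) = 1,
    F (((((a : ℕ) : ℝ) * (k : ℝ) ^ (d : ℕ) / ((n : ℕ) : ℝ) : ℝ) : T1),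
      XProj Γℤ (uElt (((b : ℕ) : ℝ) * (k : ℝ) ^ (d : ℕ) / ((n : ℕ) : ℝ)) *
        (aElt (Real.sqrt ((n : ℕ) : ℝ)))⁻¹))
  set I := ∫ q, F q ∂((volume : Measure T1).prod μX)
  have e1 : ((n : ℕ).totient : ℂ)⁻¹ * S - I =
      ((n : ℕ).totient : ℂ)⁻¹ * (S - (n : ℕ).totient * I) := by
    rw [mul_sub, inv_mul_cancel_left₀ htc]
  rw [e1, norm_mul, norm_inv, Complex.norm_natCast, inv_mul_le_iff₀ ht]
  refine key.trans ?_
  set y : ℝ := ((n : ℕ) : ℝ) ^ (-(σ / 2)) with hy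
  have hy0 : 0 < y := Real.rpow_pos_of_pos hnr _
  have hsq : 1 / Real.sqrt H ≤ y := by
    have e : Real.sqrt x = y⁻¹ := by
      rw [hy, Real.rpow_neg hnr.le, inv_inv, hx, Real.sqrt_eq_rpow, ← Real.rpow_mul hnr.le]
      ring_nf
    have h := Real.sqrt_le_sqrt hHx
    rw [e] at h
    have := one_div_le_one_div_of_le (inv_pos.2 hy0) h
    rwa [one_div, one_div, inv_inv, ← one_div] at this
  have hxκ : H * ((n : ℕ) : ℝ) ^ (-κ) ≤ 2 * y := by
    have h1 : x * ((n : ℕ) : ℝ) ^ (-κ) ≤ y := by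
      rw [hx, ← Real.rpow_add hnr]
      exact Real.rpow_le_rpow_of_exponent_le hn1 (by linarith)
    have h2 := mul_le_mul_of_nonneg_right (show (H : ℝ) ≤ 2 * x by linarith)
      (Real.rpow_pos_of_pos hnr (-κ)).le
    linarith
  have hab1 : (1 : ℝ) ≤ ((a : ℕ) : ℝ) * ((b : ℕ) : ℝ) := by exact_mod_cast (a * b).pos
  rw [Real.rpow_one]
  have h1 : M / Real.sqrt H ≤ M * y := by
    rw [div_eq_mul_one_div]
    exact mul_le_mul_of_nonneg_left hsq hM0
  have h2 : 8 * M * C * (H * ((n : ℕ) : ℝ) ^ (-κ)) ≤ 8 * M * C * (2 * y) :=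
    mul_le_mul_of_nonneg_left hxκ (by positivity)
  have h3 : M * y ≤ C * (M * y) := le_mul_of_one_le_left (by positivity) hC
  have h4 : 17 * C * M * y * 1 ≤ 17 * C * M * y * (((a : ℕ) : ℝ) * ((b : ℕ) : ℝ)) :=
    mul_le_mul_of_nonneg_left hab1 (by positivity)
  have e2 : 17 * C * 10 ^ 12 * (((a : ℕ) : ℝ) * ((b : ℕ) : ℝ)) * y * sobTX Γℤ μX 5 F =
      17 * C * M * y * (((a : ℕ) : ℝ) * ((b : ℕ) : ℝ)) := by
    rw [hMdef]
    ring
  rw [e2]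
  have e3 : ((n : ℕ).totient : ℝ) * (M / Real.sqrt H) +
      H * (8 * M * (C * ((n : ℕ) : ℝ) ^ (-κ) * (n : ℕ).totient)) =
      (n : ℕ).totient * (M / Real.sqrt H + 8 * M * C * (H * ((n : ℕ) : ℝ) ^ (-κ))) := by ring
  rw [e3]
  refine mul_le_mul_of_nonneg_left ?_ ht.le
  linarith

end
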